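/- Let α ∈ ℝ, r > 0, and let u : B_r(0) → ℝ be Lipschitz continuous on the open disk B_r(0) ⊂ ℝ², of class C² on the punctured disk B_r(0) \ {0}, with |q|² + u(q)² > 0 for all q ∈ B_r(0), and satisfying the equation (eq-div) pointwise on B_r(0) \ {0}. Then u is real-analytic on all of B_r(0); in particular the isolated singularity at the origin is removable. -/

import Mathlib

open Real Set
open scoped RealInnerProductSpace

/-- The divergence of the normalized gradient field `Du/√(1+|Du|²)` of a function
`u : ℝ² → ℝ`, i.e. the left-hand side of equation (eq-div). -/
noncomputable def mcDiv (u : EuclideanSpace ℝ (Fin 2) → ℝ) (q : EuclideanSpace ℝ (Fin 2)) : ℝ :=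
  ∑ i : Fin 2,
    fderiv ℝ (fun p => (Real.sqrt (1 + ‖gradient u p‖ ^ 2))⁻¹ • gradient u p) q
      (EuclideanSpace.single i 1) i

noncomputable section

/-- The space of absolutely summable two-sided sequences, with the convolution product. -/
def Wien (R : Type*) [NormedCommRing R] : Type _ := lp (fun _ : ℤ => R) 1

namespace Wien

variable {R : Type*} [NormedCommRing R]

instance : NormedAddCommGroup (Wien R) := inferInstanceAs (NormedAddCommGroup (lp (fun _ : ℤ => R) 1))

instance {𝕜 : Type*} [NormedField 𝕜] [NormedAlgebra 𝕜 R] : NormedSpace 𝕜 (Wien R) :=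
  inferInstanceAs (NormedSpace 𝕜 (lp (fun _ : ℤ => R) 1))

instance [CompleteSpace R] : CompleteSpace (Wien R) :=
  inferInstanceAs (CompleteSpace (lp (fun _ : ℤ => R) 1))

/-- The coefficient sequence of an element. -/
def coeff (f : Wien R) : ℤ → R := Subtype.val (p := fun x => x ∈ lp (fun _ : ℤ => R) 1) f

instance : CoeFun (Wien R) (fun _ => ℤ → R) := ⟨coeff⟩

@[ext] theorem ext {f g : Wien R} (h : ∀ k, f k = g k) : f = g := lp.ext (funext h)

@[simp] theorem add_apply (f g : Wien R) (k : ℤ) : (f + g) k = f k + g k := rfl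
@[simp] theorem neg_apply (f : Wien R) (k : ℤ) : (-f) k = -f k := rfl
@[simp] theorem sub_apply (f g : Wien R) (k : ℤ) : (f - g) k = f k - g k := rfl
@[simp] theorem zero_apply (k : ℤ) : (0 : Wien R) k = 0 := rfl
@[simp] theorem smul_apply {𝕜 : Type*} [NormedField 𝕜] [NormedAlgebra 𝕜 R] (c : 𝕜) (f : Wien R)
    (k : ℤ) : (c • f) k = c • f k := rfl

theorem summable_norm (f : Wien R) : Summable fun k => ‖f k‖ := by
  have h : Summable fun k => ‖f k‖ ^ (1 : ENNReal).toReal :=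
    (lp.memℓp (show lp (fun _ : ℤ => R) 1 from f)).summable (by simp)
  simpa using h

theorem norm_eq (f : Wien R) : ‖f‖ = ∑' k, ‖f k‖ := by
  have h : ‖f‖ = (∑' k, ‖f k‖ ^ (1 : ENNReal).toReal) ^ (1 / (1 : ENNReal).toReal) :=
    lp.norm_eq_tsum_rpow (p := 1) (by simp) (show lp (fun _ : ℤ => R) 1 from f)
  simpa using h

/-- The element with prescribed absolutely summable coefficients. -/
def mk (f : ℤ → R) (hf : Summable fun k => ‖f k‖) : Wien R :=
  (⟨f, memℓp_gen (by simpa using hf)⟩ : lp (fun _ : ℤ => R) 1)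

@[simp] theorem mk_apply (f : ℤ → R) (hf : Summable fun k => ‖f k‖) (k : ℤ) : mk f hf k = f k := rfl

theorem norm_apply_le (f : Wien R) (k : ℤ) : ‖f k‖ ≤ ‖f‖ := by
  rw [norm_eq]; exact f.summable_norm.le_tsum k fun _ _ => norm_nonneg _

/-- Reindexing of pairs used for convolutions. -/
def convEquiv : ℤ × ℤ ≃ ℤ × ℤ where
  toFun p := (p.1, p.2 - p.1)
  invFun p := (p.1, p.2 + p.1)
  left_inv p := by simp
  right_inv p := by simp

theorem summable_pair (f g : Wien R) : Summable fun p : ℤ × ℤ => ‖f p.1‖ * ‖g (p.2 - p.1)‖ :=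
  (convEquiv.summable_iff (f := fun p : ℤ × ℤ => ‖f p.1‖ * ‖g p.2‖)).2
    (f.summable_norm.mul_of_nonneg g.summable_norm (fun _ => norm_nonneg _) fun _ => norm_nonneg _)

theorem summable_conv_norm (f g : Wien R) (k : ℤ) : Summable fun j => ‖f j * g (k - j)‖ :=
  Summable.of_nonneg_of_le (fun _ => norm_nonneg _) (fun _ => norm_mul_le _ _)
    (((Equiv.prodComm ℤ ℤ).summable_iff.2 (summable_pair f g)).prod_factor k)

theorem tsum_pair (f g : Wien R) :
    ∑' p : ℤ × ℤ, ‖f p.1‖ * ‖g (p.2 - p.1)‖ = ‖f‖ * ‖g‖ := by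
  rw [norm_eq, norm_eq, tsum_mul_tsum_of_summable_norm (R := ℝ)
    (f := fun k => ‖f k‖) (g := fun k => ‖g k‖) (by simpa using f.summable_norm)
    (by simpa using g.summable_norm)]
  exact convEquiv.tsum_eq (fun p : ℤ × ℤ => ‖f p.1‖ * ‖g p.2‖)

theorem norm_conv_le (f g : Wien R) (k : ℤ) :
    ‖∑' j, f j * g (k - j)‖ ≤ ∑' j, ‖f j‖ * ‖g (k - j)‖ := by
  refine (norm_tsum_le_tsum_norm (summable_conv_norm f g k)).trans ?_
  exact (summable_conv_norm f g k).tsum_le_tsum (fun _ => norm_mul_le _ _)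
    (((Equiv.prodComm ℤ ℤ).summable_iff.2 (summable_pair f g)).prod_factor k)

theorem summable_conv (f g : Wien R) : Summable fun k => ‖∑' j, f j * g (k - j)‖ :=
  Summable.of_nonneg_of_le (fun _ => norm_nonneg _) (norm_conv_le f g)
    ((Equiv.prodComm ℤ ℤ).summable_iff.2 (summable_pair f g)).prod

instance : Mul (Wien R) := ⟨fun f g => mk (fun k => ∑' j, f j * g (k - j)) (summable_conv f g)⟩

theorem mul_apply (f g : Wien R) (k : ℤ) : (f * g) k = ∑' j, f j * g (k - j) := rfl

theorem norm_mul_le' (f g : Wien R) : ‖f * g‖ ≤ ‖f‖ * ‖g‖ := by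
  have h := (Equiv.prodComm ℤ ℤ).summable_iff.2 (summable_pair f g)
  calc ‖f * g‖ = ∑' k, ‖∑' j, f j * g (k - j)‖ := norm_eq _
    _ ≤ ∑' k, ∑' j, ‖f j‖ * ‖g (k - j)‖ :=
      (summable_conv f g).tsum_le_tsum (norm_conv_le f g) h.prod
    _ = ‖f‖ * ‖g‖ := by
      rw [← tsum_pair, ← (Equiv.prodComm ℤ ℤ).tsum_eq]; exact h.tsum_prod.symm

theorem mul_comm' (f g : Wien R) : f * g = g * f := by
  ext k
  rw [mul_apply, mul_apply, ← (Equiv.subLeft k).tsum_eq]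
  exact tsum_congr fun j => by simp [mul_comm]

variable [CompleteSpace R]

theorem add_mul' (f g h : Wien R) : (f + g) * h = f * h + g * h := by
  ext k
  simp only [mul_apply, add_apply, add_mul]
  exact (summable_conv_norm f h k).of_norm.tsum_add (summable_conv_norm g h k).of_norm

theorem mul_assoc' (f g h : Wien R) : f * g * h = f * (g * h) := by
  ext k
  have hs : Summable fun p : ℤ × ℤ => f p.1 * g (p.2 - p.1) * h (k - p.2) := by
    refine Summable.of_norm_bounded ((summable_pair f g).mul_right ‖h‖) fun p => ?_
    refine (norm_mul_le _ _).trans (mul_le_mul (norm_mul_le _ _) (norm_apply_le _ _)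
      (norm_nonneg _) (by positivity))
  simp only [mul_apply]
  calc ∑' j, (∑' i, f i * g (j - i)) * h (k - j)
      = ∑' j, ∑' i, f i * g (j - i) * h (k - j) := by
        congr 1; ext j; exact ((summable_conv_norm f g j).of_norm.tsum_mul_right _).symm
    _ = ∑' i, ∑' j, f i * g (j - i) * h (k - j) := hs.tsum_comm
    _ = ∑' i, f i * ∑' j, g j * h (k - i - j) := by
        congr 1; ext i
        rw [← (summable_conv_norm g h (k - i)).of_norm.tsum_mul_left,
          ← (Equiv.subRight i).tsum_eq (fun j => f i * (g j * h (k - i - j)))]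
        congr 1; ext j
        simp [mul_assoc]

/-- The sequence supported at one index. -/
def single (n : ℤ) (c : R) : Wien R :=
  mk (fun k => if k = n then c else 0)
    (summable_of_ne_finset_zero (s := {n}) (by intro k hk; simp at hk; simp [hk]))

omit [CompleteSpace R] in
theorem single_apply (n : ℤ) (c : R) (k : ℤ) : single n c k = if k = n then c else 0 := rfl

omit [CompleteSpace R] in
theorem single_mul_apply (n : ℤ) (c : R) (f : Wien R) (k : ℤ) :
    (single n c * f) k = c * f (k - n) := by
  rw [mul_apply, tsum_eq_single n]
  · simp [single_apply]
  · intro j hj; simp [single_apply, hj]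

instance : One (Wien R) := ⟨single 0 1⟩

omit [CompleteSpace R] in
theorem one_mul' (f : Wien R) : 1 * f = f := by
  ext k; exact (single_mul_apply 0 1 f k).trans (by simp)

instance : NormedCommRing (Wien R) where
  __ := (inferInstance : NormedAddCommGroup (Wien R))
  mul_comm := mul_comm'
  mul_assoc := mul_assoc'
  one_mul := one_mul'
  mul_one f := (mul_comm' f 1).trans (one_mul' f)
  left_distrib f g h := by
    rw [mul_comm' f, add_mul', mul_comm' g, mul_comm' h]
  right_distrib := add_mul'
  zero_mul f := by ext k; simp [mul_apply]
  mul_zero f := by ext k; simp [mul_apply]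
  norm_mul_le := norm_mul_le'

instance {𝕜 : Type*} [NormedField 𝕜] [NormedAlgebra 𝕜 R] : NormedAlgebra 𝕜 (Wien R) where
  __ := Algebra.ofModule (R := 𝕜) (A := Wien R)
    (fun c f g => by
      ext k; simp only [mul_apply, smul_apply, smul_mul_assoc]
      exact (summable_conv_norm f g k).of_norm.tsum_const_smul c)
    (fun c f g => by
      ext k; simp only [mul_apply, smul_apply, mul_smul_comm]
      exact (summable_conv_norm f g k).of_norm.tsum_const_smul c)
  norm_smul_le := norm_smul_le

end Wien

end

noncomputable section

section evaluation

variable {X : Type*} [TopologicalSpace X] [CompactSpace X]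

namespace Wien

/-- The value at `(x, θ)` of the function with Fourier coefficients `f`. -/
def evC (x : X) (θ : ℝ) (f : Wien C(X, ℂ)) : ℂ := ∑' k : ℤ, f k x * Complex.exp (k * θ * Complex.I)

theorem norm_exp_int (k : ℤ) (θ : ℝ) : ‖Complex.exp (k * θ * Complex.I)‖ = 1 := by
  rw [← Complex.norm_exp_ofReal_mul_I (k * θ)]; push_cast; rfl

theorem norm_term_le (x : X) (θ : ℝ) (f : Wien C(X, ℂ)) (k : ℤ) :
    ‖f k x * Complex.exp (k * θ * Complex.I)‖ ≤ ‖f k‖ := by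
  rw [norm_mul, norm_exp_int, mul_one]; exact (f k).norm_coe_le_norm x

theorem summable_term (x : X) (θ : ℝ) (f : Wien C(X, ℂ)) :
    Summable fun k : ℤ => ‖f k x * Complex.exp (k * θ * Complex.I)‖ :=
  Summable.of_nonneg_of_le (fun _ => norm_nonneg _) (norm_term_le x θ f) f.summable_norm

theorem norm_evC_le (x : X) (θ : ℝ) (f : Wien C(X, ℂ)) : ‖evC x θ f‖ ≤ ‖f‖ := by
  rw [norm_eq]
  exact (norm_tsum_le_tsum_norm (summable_term x θ f)).trans
    ((summable_term x θ f).tsum_le_tsum (norm_term_le x θ f) f.summable_norm)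

theorem continuous_evC (f : Wien C(X, ℂ)) : Continuous fun p : X × ℝ => evC p.1 p.2 f := by
  refine continuous_tsum (fun k => ?_) f.summable_norm fun k p => norm_term_le p.1 p.2 f k
  have := (f k).continuous
  fun_prop

theorem evC_add (x : X) (θ : ℝ) (f g : Wien C(X, ℂ)) :
    evC x θ (f + g) = evC x θ f + evC x θ g := by
  simp only [evC, add_apply, ContinuousMap.add_apply, add_mul]
  exact (summable_term x θ f).of_norm.tsum_add (summable_term x θ g).of_norm

theorem evC_smul (x : X) (θ : ℝ) (c : ℝ) (f : Wien C(X, ℂ)) :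
    evC x θ (c • f) = c • evC x θ f := by
  simp only [evC, smul_apply, ContinuousMap.smul_apply, smul_mul_assoc]
  exact (summable_term x θ f).of_norm.tsum_const_smul c

theorem evC_single (x : X) (θ : ℝ) (n : ℤ) (c : C(X, ℂ)) :
    evC x θ (single n c) = c x * Complex.exp (n * θ * Complex.I) := by
  rw [evC, tsum_eq_single n]
  · simp [single_apply]
  · intro k hk; simp [single_apply, hk]

theorem evC_mul (x : X) (θ : ℝ) (f g : Wien C(X, ℂ)) :
    evC x θ (f * g) = evC x θ f * evC x θ g := by
  rw [evC, evC, evC, tsum_mul_tsum_of_summable_norm (summable_term x θ f) (summable_term x θ g)]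
  have hs := summable_mul_of_summable_norm (summable_term x θ f) (summable_term x θ g)
  rw [← convEquiv.tsum_eq, ← (Equiv.prodComm ℤ ℤ).tsum_eq]
  refine Eq.trans ?_ ((Equiv.prodComm ℤ ℤ).summable_iff.2
    (convEquiv.summable_iff.2 hs)).tsum_prod.symm
  refine tsum_congr fun k => ?_
  rw [mul_apply, ← ContinuousMap.tsum_apply (summable_conv_norm f g k).of_norm, ← tsum_mul_right]
  refine tsum_congr fun j => ?_
  have : Complex.exp (k * θ * Complex.I)
      = Complex.exp (j * θ * Complex.I) * Complex.exp (((k - j : ℤ) : ℂ) * θ * Complex.I) := by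
    rw [← Complex.exp_add]; push_cast; ring_nf
  change (f j * g (k - j)) x * Complex.exp (k * θ * Complex.I) = f j x *
    Complex.exp (j * θ * Complex.I) *
      (g (k - j) x * Complex.exp (((k - j : ℤ) : ℂ) * θ * Complex.I))
  rw [this, ContinuousMap.mul_apply]
  ring

end Wien

variable (X) in
/-- The real Banach algebra of functions on `X × ℝ/2πℤ` with absolutely summable
Fourier coefficients in the circle variable. -/
def wienReal : Subalgebra ℝ (Wien C(X, ℂ)) where
  carrier := {f | ∀ k, f (-k) = star (f k)}
  mul_mem' {f g} hf hg k := by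
    rw [Wien.mul_apply, Wien.mul_apply, ← (Equiv.neg ℤ).tsum_eq, tsum_star]
    refine tsum_congr fun j => ?_
    rw [star_mul', ← hf, ← hg]
    simp [sub_eq_add_neg, add_comm]
  add_mem' {f g} hf hg k := by
    rw [Wien.add_apply, Wien.add_apply, hf k, hg k, star_add]
  algebraMap_mem' c k := by
    rw [Algebra.algebraMap_eq_smul_one]
    change c • Wien.single (R := C(X, ℂ)) 0 1 (-k) = star (c • Wien.single (R := C(X, ℂ)) 0 1 k)
    by_cases h : k = 0 <;> simp [Wien.single_apply, h]

theorem mem_wienReal {f : Wien C(X, ℂ)} : f ∈ wienReal X ↔ ∀ k, f (-k) = star (f k) := Iff.rfl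

theorem Wien.continuous_apply {R : Type*} [NormedCommRing R] (k : ℤ) : Continuous fun f : Wien R => f k := by
  refine LipschitzWith.continuous (K := 1) (LipschitzWith.of_dist_le_mul fun f g => ?_)
  simpa [dist_eq_norm] using Wien.norm_apply_le (f - g) k

theorem isClosed_wienReal : IsClosed (wienReal X : Set (Wien C(X, ℂ))) := by
  have : (wienReal X : Set (Wien C(X, ℂ))) = ⋂ k, {f | f (-k) = star (f k)} := by
    ext f; simp [mem_wienReal]
  rw [this]
  exact isClosed_iInter fun k => isClosed_eq (Wien.continuous_apply _)
    (continuous_star.comp (Wien.continuous_apply _))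

instance : CompleteSpace (wienReal X) := isClosed_wienReal.completeSpace_coe

namespace wienReal

theorem evC_real (x : X) (θ : ℝ) (f : wienReal X) : star (Wien.evC x θ f) = Wien.evC x θ f := by
  conv_rhs => rw [Wien.evC, ← (Equiv.neg ℤ).tsum_eq]
  rw [Wien.evC, tsum_star]
  refine tsum_congr fun k => ?_
  rw [Equiv.neg_apply, mem_wienReal.1 f.2 k, star_mul']
  congr 1
  simp [← Complex.exp_conj]

/-- Pointwise evaluation. -/
def ev (x : X) (θ : ℝ) : wienReal X →L[ℝ] ℝ :=
  LinearMap.mkContinuous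
    { toFun f := (Wien.evC x θ f).re
      map_add' f g := by simp [Wien.evC_add]
      map_smul' c f := by simp [Wien.evC_smul] } 1 fun f => by
    rw [one_mul]; exact (Complex.abs_re_le_norm _).trans (Wien.norm_evC_le x θ f)

theorem ev_apply (x : X) (θ : ℝ) (f : wienReal X) : ev x θ f = (Wien.evC x θ f).re := rfl

theorem ofReal_ev (x : X) (θ : ℝ) (f : wienReal X) : (ev x θ f : ℂ) = Wien.evC x θ f :=
  Complex.conj_eq_iff_re.1 (evC_real x θ f)

theorem abs_ev_le (x : X) (θ : ℝ) (f : wienReal X) : |ev x θ f| ≤ ‖f‖ :=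
  (Complex.abs_re_le_norm _).trans (Wien.norm_evC_le x θ f)

theorem continuous_ev (f : wienReal X) : Continuous fun p : X × ℝ => ev p.1 p.2 f :=
  Complex.continuous_re.comp (Wien.continuous_evC (f : Wien C(X, ℂ)))

@[simp] theorem ev_mul (x : X) (θ : ℝ) (f g : wienReal X) : ev x θ (f * g) = ev x θ f * ev x θ g := by
  have h : (ev x θ (f * g) : ℂ) = ev x θ f * ev x θ g := by
    simp only [ofReal_ev]; exact Wien.evC_mul x θ f g
  exact_mod_cast h

@[simp] theorem ev_one (x : X) (θ : ℝ) : ev x θ 1 = 1 := by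
  have := Wien.evC_single x θ 0 1
  rw [ev_apply]
  change (Wien.evC x θ (Wien.single 0 1)).re = 1
  simp [this]

theorem ev_periodic (x : X) (f : wienReal X) (θ : ℝ) : ev x (θ + 2 * π) f = ev x θ f := by
  rw [ev_apply, ev_apply, Wien.evC, Wien.evC]
  congr 1
  refine tsum_congr fun k => ?_
  have : (k * ((θ + 2 * π : ℝ) : ℂ) * Complex.I) = k * θ * Complex.I + k * (2 * π * Complex.I) := by
    push_cast; ring
  rw [this, Complex.exp_add, Complex.exp_int_mul_two_pi_mul_I, mul_one]

/-- Functions of `x` alone. -/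
def const (c : C(X, ℝ)) : wienReal X :=
  ⟨Wien.single 0 ((⟨_, Complex.continuous_ofReal⟩ : C(ℝ, ℂ)).comp c), fun k => by
    by_cases h : k = 0
    · ext; simp [Wien.single_apply, h]
    · simp [Wien.single_apply, h]⟩

@[simp] theorem ev_const (c : C(X, ℝ)) (x : X) (θ : ℝ) : ev x θ (const c) = c x := by
  rw [ev_apply, const, Wien.evC_single]; simp

variable (X) in
/-- The function `cos θ`. -/
def cosE : wienReal X :=
  ⟨Wien.single 1 (ContinuousMap.const X (1 / 2)) + Wien.single (-1) (ContinuousMap.const X (1 / 2)),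
    fun k => by
      ext x
      rcases eq_or_ne k 1 with rfl | h1
      · simp [Wien.single_apply]
      rcases eq_or_ne k (-1) with rfl | h2
      · simp [Wien.single_apply]
      have h3 : -k ≠ 1 := by omega
      have h4 : -k ≠ -1 := by omega
      simp only [Wien.add_apply, Wien.single_apply, h1, h2, h3, h4, if_false]
      simp⟩

@[simp] theorem ev_cosE (x : X) (θ : ℝ) : ev x θ (cosE X) = Real.cos θ := by
  have : (ev x θ (cosE X) : ℂ) = Real.cos θ := by
    rw [ofReal_ev, cosE, Wien.evC_add, Wien.evC_single, Wien.evC_single, Complex.ofReal_cos,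
      Complex.cos]
    simp; ring
  exact_mod_cast this

variable (X) in
/-- The function `sin θ`. -/
def sinE : wienReal X :=
  ⟨Wien.single 1 (ContinuousMap.const X (-Complex.I / 2)) +
      Wien.single (-1) (ContinuousMap.const X (Complex.I / 2)),
    fun k => by
      ext x
      rcases eq_or_ne k 1 with rfl | h1
      · simp [Wien.single_apply]
      rcases eq_or_ne k (-1) with rfl | h2
      · simp [Wien.single_apply]
      have h3 : -k ≠ 1 := by omega
      have h4 : -k ≠ -1 := by omega
      simp only [Wien.add_apply, Wien.single_apply, h1, h2, h3, h4, if_false]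
      simp⟩

@[simp] theorem ev_sinE (x : X) (θ : ℝ) : ev x θ (sinE X) = Real.sin θ := by
  have : (ev x θ (sinE X) : ℂ) = Real.sin θ := by
    rw [ofReal_ev, sinE, Wien.evC_add, Wien.evC_single, Wien.evC_single, Complex.ofReal_sin,
      Complex.sin]
    simp; ring
  exact_mod_cast this

end wienReal

end evaluation
end

noncomputable section

/-- The `k`-th Fourier coefficient of a `2π`-periodic real function. -/
def pCoeff (f : ℝ → ℝ) (k : ℤ) : ℂ :=
  fourierCoeffOn (lt_add_of_pos_right 0 two_pi_pos) (fun x => (f x : ℂ)) k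

theorem fourier_coe_eq (k : ℤ) (x : ℝ) {p : ℝ} (hp : p = 2 * π) :
    fourier k (x : AddCircle p) = Complex.exp (k * x * Complex.I) := by
  subst hp
  rw [fourier_coe_apply]
  congr 1
  have : (π : ℂ) ≠ 0 := by exact_mod_cast pi_ne_zero
  push_cast
  field_simp

theorem pCoeff_eq (f : ℝ → ℝ) (k : ℤ) :
    pCoeff f k = (1 / (2 * π) : ℝ) • ∫ x in (0 : ℝ)..2 * π, Complex.exp (-(k * x * Complex.I)) * f x := by
  have h : ∀ x : ℝ, fourier (-k) (x : AddCircle (0 + 2 * π - 0)) =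
      Complex.exp (-(k * x * Complex.I)) := fun x => by
    rw [fourier_coe_eq _ _ (by simp)]; push_cast; congr 1; ring
  rw [pCoeff, fourierCoeffOn_eq_integral]
  simp only [h, zero_add, sub_zero, smul_eq_mul]

theorem pCoeff_neg (f : ℝ → ℝ) (k : ℤ) : pCoeff f (-k) = star (pCoeff f k) := by
  rw [pCoeff_eq, pCoeff_eq, star_smul]
  congr 1
  rw [intervalIntegral.integral_of_le two_pi_pos.le, intervalIntegral.integral_of_le two_pi_pos.le]
  refine Eq.trans ?_ (integral_conj (f := fun x : ℝ => Complex.exp (-(k * x * Complex.I)) * f x))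
  congr 1; ext x
  rw [map_mul, ← Complex.exp_conj]
  simp

theorem norm_pCoeff_le {f : ℝ → ℝ} {ε : ℝ} (hf : ∀ x, |f x| ≤ ε) (k : ℤ) : ‖pCoeff f k‖ ≤ ε := by
  rw [pCoeff_eq, norm_smul]
  have h := intervalIntegral.norm_integral_le_of_norm_le_const (a := 0) (b := 2 * π) (C := ε)
    (f := fun x : ℝ => Complex.exp (-(k * x * Complex.I)) * f x) (fun x _ => by
      rw [norm_mul, Complex.norm_real, Complex.norm_exp]
      simpa using hf x)
  rw [sub_zero, abs_of_pos two_pi_pos] at h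
  calc ‖(1 / (2 * π) : ℝ)‖ * _ ≤ (1 / (2 * π)) * (ε * (2 * π)) := by
        rw [Real.norm_of_nonneg (by positivity)]
        gcongr
    _ = ε := by field_simp

theorem hasSum_pCoeff {f : ℝ → ℝ} (hf : Continuous f) (hp : Function.Periodic f (2 * π))
    (hs : Summable (pCoeff f)) (θ : ℝ) :
    HasSum (fun k : ℤ => pCoeff f k * Complex.exp (k * θ * Complex.I)) (f θ) := by
  have : Fact (0 < 2 * π) := ⟨two_pi_pos⟩
  have hp' : Function.Periodic (fun x => (f x : ℂ)) (2 * π) := fun x => by simp [hp x]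
  let F : C(AddCircle (2 * π), ℂ) := ⟨hp'.lift, by
    apply continuous_coinduced_dom.mpr
    exact Complex.continuous_ofReal.comp hf⟩
  have hF : ∀ x : ℝ, F x = f x := fun x => hp'.lift_coe x
  have hc : fourierCoeff F = pCoeff f := by
    ext k
    rw [pCoeff, ← fourierCoeff_liftIco_eq]
    congr 1
    ext y
    obtain ⟨x, hx, rfl⟩ := (AddCircle.coe_image_Ico_eq (2 * π) 0).symm ▸ mem_univ y
    rw [AddCircle.liftIco_coe_apply hx]
    exact hF x
  have := has_pointwise_sum_fourier_series_of_summable (f := F) (hc ▸ hs) (θ : AddCircle (2 * π))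
  rw [hF, hc] at this
  convert this using 2 with k
  rw [fourier_coe_eq _ _ rfl, smul_eq_mul]

theorem pCoeff_deriv {f f' : ℝ → ℝ} (hf : ∀ x, HasDerivAt f (f' x) x) (hf' : Continuous f')
    (hp : Function.Periodic f (2 * π)) (k : ℤ) : pCoeff f' k = k * Complex.I * pCoeff f k := by
  have hfc : Continuous f := continuous_iff_continuousAt.2 fun x => (hf x).continuousAt
  have he : ∀ x : ℝ, HasDerivAt (fun x : ℝ => Complex.exp (-(k * x * Complex.I)))
      (Complex.exp (-(k * x * Complex.I)) * -(k * Complex.I)) x := fun x => by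
    have h1 : HasDerivAt (fun x : ℝ => -(k * (x : ℂ) * Complex.I)) (-(k * Complex.I)) x := by
      have := (((hasDerivAt_id x).ofReal_comp).const_mul (k : ℂ)).mul_const Complex.I
      simpa using this.fun_neg
    exact h1.cexp
  have hi := intervalIntegral.integral_mul_deriv_eq_deriv_mul (a := 0) (b := 2 * π)
    (u := fun x : ℝ => Complex.exp (-(k * x * Complex.I))) (v := fun x => (f x : ℂ))
    (u' := fun x : ℝ => Complex.exp (-(k * x * Complex.I)) * -(k * Complex.I))
    (v' := fun x => (f' x : ℂ)) (fun x _ => he x) (fun x _ => (hf x).ofReal_comp)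
    (Continuous.intervalIntegrable (by fun_prop) _ _)
    (Continuous.intervalIntegrable (by fun_prop) _ _)
  rw [pCoeff_eq, pCoeff_eq, hi]
  have h0 : f (2 * π) = f 0 := by simpa using hp 0
  have h1 : Complex.exp (-(k * ((2 * π : ℝ) : ℂ) * Complex.I)) = 1 := by
    have := Complex.exp_int_mul_two_pi_mul_I (-k)
    rw [← this]; push_cast; congr 1; ring
  rw [h0, h1]
  have h2 : (fun x : ℝ => Complex.exp (-(k * x * Complex.I)) * -(k * Complex.I) * (f x : ℂ)) =
    fun x : ℝ => (-(k * Complex.I)) * (Complex.exp (-(k * x * Complex.I)) * f x) := by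
    ext x; ring
  rw [h2, intervalIntegral.integral_const_mul]
  simp
  ring

theorem summable_sq_pCoeff {f : ℝ → ℝ} (hf : Continuous f) :
    Summable (fun k => ‖pCoeff f k‖ ^ 2) ∧
      ∑' k, ‖pCoeff f k‖ ^ 2 = (2 * π)⁻¹ * ∫ x in (0 : ℝ)..2 * π, f x ^ 2 := by
  have hL : MeasureTheory.MemLp (fun x => (f x : ℂ)) 2
      (MeasureTheory.volume.restrict (Ioc (0 : ℝ) (0 + 2 * π))) := by
    have hc : Continuous fun x => (f x : ℂ) := by fun_prop
    obtain ⟨C, hC⟩ := (isCompact_Icc (a := (0 : ℝ)) (b := 0 + 2 * π)).exists_bound_of_continuousOn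
      hc.continuousOn
    refine MeasureTheory.MemLp.of_bound hc.aestronglyMeasurable C ?_
    exact (MeasureTheory.ae_restrict_iff' measurableSet_Ioc).2
      (Filter.Eventually.of_forall fun x hx => hC x (Ioc_subset_Icc_self hx))
  have := hasSum_sq_fourierCoeffOn (lt_add_of_pos_right 0 two_pi_pos) hL
  refine ⟨this.summable, this.tsum_eq.trans ?_⟩
  simp

/-- A `C²` periodic function and its derivative have absolutely summable Fourier coefficients,
with a bound in terms of its supremum and the `L²` norm of its second derivative. -/
theorem exists_periodic_bound : ∃ C : ℝ, 0 < C ∧ ∀ (f f' f'' : ℝ → ℝ) (ε : ℝ), 0 < ε →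
    (∀ x, HasDerivAt f (f' x) x) → (∀ x, HasDerivAt f' (f'' x) x) → Continuous f'' →
    Function.Periodic f (2 * π) → (∀ x, |f x| ≤ ε) →
    (∫ x in (0 : ℝ)..2 * π, f'' x ^ 2) ≤ ε ^ 2 →
    Summable (fun k => ‖pCoeff f k‖) ∧ Summable (fun k => ‖pCoeff f' k‖) ∧
    ∑' k, ‖pCoeff f k‖ ≤ C * ε ∧ ∑' k, ‖pCoeff f' k‖ ≤ C * ε := by
  have hZ : Summable fun k : ℤ => 1 / (k : ℝ) ^ 2 := Real.summable_one_div_int_pow.2 one_lt_two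
  refine ⟨2 + ∑' k : ℤ, 1 / (k : ℝ) ^ 2, ?_, fun f f' f'' ε hε hf hf' hf'' hp hb hi => ?_⟩
  · have : 0 ≤ ∑' k : ℤ, 1 / (k : ℝ) ^ 2 := tsum_nonneg fun k => by positivity
    linarith
  have hc' : Continuous f' := continuous_iff_continuousAt.2 fun x => (hf' x).continuousAt
  have hp' : Function.Periodic f' (2 * π) := fun x => by
    have h1 := (hf (x + 2 * π)).comp_add_const x (2 * π)
    have h2 : (fun y => f (y + 2 * π)) = f := funext hp
    rw [h2] at h1
    exact h1.unique (hf x)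
  obtain ⟨hs, ht⟩ := summable_sq_pCoeff hf''
  have h1 := pCoeff_deriv hf hc' hp
  have h2 := pCoeff_deriv hf' hf'' hp'
  have hle : ∑' k, ‖pCoeff f'' k‖ ^ 2 ≤ ε ^ 2 := by
    rw [ht]
    have : (2 * π)⁻¹ ≤ 1 := inv_le_one_of_one_le₀ (by linarith [pi_gt_three])
    have h0 : 0 ≤ ∫ x in (0 : ℝ)..2 * π, f'' x ^ 2 :=
      intervalIntegral.integral_nonneg two_pi_pos.le fun x _ => sq_nonneg _
    calc (2 * π)⁻¹ * ∫ x in (0 : ℝ)..2 * π, f'' x ^ 2 ≤ 1 * ∫ x in (0 : ℝ)..2 * π, f'' x ^ 2 := by gcongr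
      _ ≤ ε ^ 2 := by linarith
  have hmaj : Summable fun k : ℤ => ε⁻¹ * ‖pCoeff f'' k‖ ^ 2 + ε * (1 / (k : ℝ) ^ 2) :=
    (hs.mul_left _).add (hZ.mul_left _)
  have hb' : ∀ k, ‖pCoeff f' k‖ ≤ ε⁻¹ * ‖pCoeff f'' k‖ ^ 2 + ε * (1 / (k : ℝ) ^ 2) := fun k => by
    rcases eq_or_ne k 0 with rfl | hk
    · rw [h1]; simp; positivity
    · have hk' : (0 : ℝ) < |(k : ℝ)| := by simpa using hk
      rw [h2, norm_mul, norm_mul, Complex.norm_I, mul_one, Complex.norm_intCast]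
      rw [mul_pow, ← sq_abs (k : ℝ)]
      set a := |(k : ℝ)|
      set b := ‖pCoeff f' k‖
      have : ε⁻¹ * (a ^ 2 * b ^ 2) + ε * (1 / a ^ 2) - b = 
        (ε⁻¹ * (a * b) ^ 2 - 2 * b + ε * (1 / a) ^ 2) + b := by field_simp; ring
      have h3 : ε⁻¹ * (a * b) ^ 2 - 2 * b + ε * (1 / a) ^ 2 = ε⁻¹ * (a * b - ε / a) ^ 2 := by
        field_simp; ring
      have h4 : 0 ≤ ε⁻¹ * (a * b - ε / a) ^ 2 := by positivity
      have h5 : 0 ≤ b := norm_nonneg _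
      linarith
  have hs' : Summable fun k => ‖pCoeff f' k‖ :=
    Summable.of_nonneg_of_le (fun _ => norm_nonneg _) hb' hmaj
  have hsum : ∑' k, ‖pCoeff f' k‖ ≤ (1 + ∑' k : ℤ, 1 / (k : ℝ) ^ 2) * ε := by
    refine (hs'.tsum_le_tsum hb' hmaj).trans ?_
    rw [(hs.mul_left _).tsum_add (hZ.mul_left _), tsum_mul_left, tsum_mul_left]
    have : ε⁻¹ * ∑' k, ‖pCoeff f'' k‖ ^ 2 ≤ ε⁻¹ * ε ^ 2 := by gcongr
    have h6 : ε⁻¹ * ε ^ 2 = ε := by field_simp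
    linarith
  have h0 : ∀ k, ‖pCoeff f k‖ ≤ (if k = 0 then ε else 0) + ‖pCoeff f' k‖ := fun k => by
    rcases eq_or_ne k 0 with rfl | hk
    · simpa using (norm_pCoeff_le hb 0).trans (le_add_of_nonneg_right (norm_nonneg _))
    · rw [h1, norm_mul, norm_mul, Complex.norm_I, mul_one, Complex.norm_intCast, if_neg hk, zero_add]
      have : (1 : ℝ) ≤ |(k : ℝ)| := by exact_mod_cast Int.one_le_abs hk
      nlinarith [norm_nonneg (pCoeff f k)]
  have hδ : Summable fun k : ℤ => if k = 0 then ε else 0 := (hasSum_ite_eq 0 ε).summable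
  have hs0 : Summable fun k => ‖pCoeff f k‖ :=
    Summable.of_nonneg_of_le (fun _ => norm_nonneg _) h0 (hδ.add hs')
  refine ⟨hs0, hs', ?_, by linarith⟩
  refine (hs0.tsum_le_tsum h0 (hδ.add hs')).trans ?_
  rw [hδ.tsum_add hs', tsum_ite_eq]
  linarith

namespace wienReal

variable {X : Type*} [TopologicalSpace X] [CompactSpace X]

variable (X) in
/-- The element given by a periodic function of the circle variable. -/
def ofPeriodic (f : ℝ → ℝ) (hs : Summable fun k => ‖pCoeff f k‖) : wienReal X :=
  ⟨Wien.mk (fun k => ContinuousMap.const X (pCoeff f k))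
    (Summable.of_nonneg_of_le (fun _ => norm_nonneg _) (fun k =>
      (ContinuousMap.norm_le _ (norm_nonneg _)).2 fun _ => le_rfl) hs), fun k => by
    ext x; simp [pCoeff_neg]⟩

theorem ev_ofPeriodic {f : ℝ → ℝ} (hs : Summable fun k => ‖pCoeff f k‖) (hf : Continuous f)
    (hp : Function.Periodic f (2 * π)) (x : X) (θ : ℝ) : ev x θ (ofPeriodic X f hs) = f θ := by
  have h := (hasSum_pCoeff hf hp hs.of_norm θ).tsum_eq
  rw [ev_apply, Wien.evC]
  change (∑' k : ℤ, pCoeff f k * Complex.exp (k * θ * Complex.I)).re = f θ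
  rw [h, Complex.ofReal_re]

theorem norm_ofPeriodic_le (f : ℝ → ℝ) (hs : Summable fun k => ‖pCoeff f k‖) :
    ‖ofPeriodic X f hs‖ ≤ ∑' k, ‖pCoeff f k‖ := by
  have h1 : ∀ k, ‖ContinuousMap.const X (pCoeff f k)‖ ≤ ‖pCoeff f k‖ := fun k =>
    (ContinuousMap.norm_le _ (norm_nonneg _)).2 fun _ => le_rfl
  refine (Wien.norm_eq (ofPeriodic X f hs : Wien C(X, ℂ))).trans_le ?_
  exact (Summable.of_nonneg_of_le (fun _ => norm_nonneg _) h1 hs).tsum_le_tsum h1 hs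

end wienReal

end

noncomputable section

section green

variable {T : ℝ} [hT : Fact (0 < T)]

/-- The projection of the real line to the interval `[0, T]`. -/
def clamp (t : ℝ) : Icc (0 : ℝ) T := projIcc 0 T hT.out.le t

@[fun_prop]
theorem continuous_clamp : Continuous (clamp (T := T)) := continuous_projIcc (h := hT.out.le)

theorem coe_clamp {t : ℝ} (ht : t ∈ Icc 0 T) : (clamp (T := T) t : ℝ) = t := by
  rw [clamp, projIcc_of_mem _ ht]

theorem clamp_mem (t : ℝ) : (clamp (T := T) t : ℝ) ∈ Icc 0 T := (clamp t).2

local notation "CI" => C(Icc (0 : ℝ) T, ℂ)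

theorem norm_clamp_le (f : CI) (t : ℝ) : ‖f (clamp t)‖ ≤ ‖f‖ := f.norm_coe_le_norm _

theorem continuous_comp_clamp (f : CI) : Continuous fun t : ℝ => f (clamp t) :=
  f.continuous.comp continuous_clamp

/-- The solution of `y' = -m y + f`, `y(0) = 0`. -/
def fwd (m : ℝ) (f : CI) (t : ℝ) : ℂ :=
  rexp (-(m * t)) * ∫ s in (0 : ℝ)..t, rexp (m * s) * f (clamp s)

/-- The solution of `y' = m y - f`, `y(T) = 0`. -/
def bwd (m : ℝ) (f : CI) (t : ℝ) : ℂ :=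
  rexp (m * t) * ∫ s in t..T, rexp (-(m * s)) * f (clamp s)

theorem continuous_fwd_integrand (m : ℝ) (f : CI) :
    Continuous fun s : ℝ => (rexp (m * s) : ℂ) * f (clamp s) := by
  have := continuous_comp_clamp f
  fun_prop

theorem continuous_bwd_integrand (m : ℝ) (f : CI) :
    Continuous fun s : ℝ => (rexp (-(m * s)) : ℂ) * f (clamp s) := by
  have := continuous_comp_clamp f
  fun_prop

theorem hasDerivAt_exp_mul (m t : ℝ) :
    HasDerivAt (fun t : ℝ => (rexp (m * t) : ℂ)) (m * rexp (m * t)) t := by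
  have h : HasDerivAt (fun t : ℝ => rexp (m * t)) (rexp (m * t) * (m * 1)) t :=
    ((hasDerivAt_id t).const_mul m).exp
  convert h.ofReal_comp using 1
  push_cast; ring

theorem hasDerivAt_fwd (m : ℝ) (f : CI) (t : ℝ) :
    HasDerivAt (fwd m f) (-m * fwd m f t + f (clamp t)) t := by
  have h1 := hasDerivAt_exp_mul (-m) t
  have h2 := (continuous_fwd_integrand m f).integral_hasStrictDerivAt 0 t |>.hasDerivAt
  have h3 := h1.mul h2
  have e : (rexp (-m * t) : ℂ) * (rexp (m * t) * f (clamp t)) = f (clamp t) := by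
    rw [← mul_assoc, ← Complex.ofReal_mul, ← Real.exp_add]; simp
  have e2 : fwd m f = (fun t : ℝ => (rexp (-m * t) : ℂ)) *
      fun u => ∫ x in (0 : ℝ)..u, (rexp (m * x) : ℂ) * f (clamp x) := by
    ext t; simp [fwd]
  rw [e2]
  refine h3.congr_deriv ?_
  rw [e, Pi.mul_apply]; push_cast; ring

theorem hasDerivAt_bwd (m : ℝ) (f : CI) (t : ℝ) :
    HasDerivAt (bwd m f) (m * bwd m f t - f (clamp t)) t := by
  have h1 := hasDerivAt_exp_mul m t
  have hc := continuous_bwd_integrand m f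
  have h2 := intervalIntegral.integral_hasDerivAt_left (hc.intervalIntegrable t T)
    (hc.stronglyMeasurableAtFilter _ _) hc.continuousAt
  have h3 := h1.mul h2
  have e : (rexp (m * t) : ℂ) * (rexp (-(m * t)) * f (clamp t)) = f (clamp t) := by
    rw [← mul_assoc, ← Complex.ofReal_mul, ← Real.exp_add]; simp
  refine HasDerivAt.congr_deriv (f := bwd m f) h3 ?_
  rw [mul_neg, e, bwd]; ring

theorem continuous_fwd (m : ℝ) (f : CI) : Continuous (fwd m f) :=
  continuous_iff_continuousAt.2 fun t => (hasDerivAt_fwd m f t).continuousAt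

theorem fwd_zero (m : ℝ) (f : CI) : fwd m f 0 = 0 := by simp [fwd]

theorem bwd_right (m : ℝ) (f : CI) : bwd m f T = 0 := by simp [bwd]

theorem fwd_add (m : ℝ) (f g : CI) (t : ℝ) : fwd m (f + g) t = fwd m f t + fwd m g t := by
  simp only [fwd, ContinuousMap.add_apply, mul_add]
  rw [intervalIntegral.integral_add ((continuous_fwd_integrand m f).intervalIntegrable _ _)
    ((continuous_fwd_integrand m g).intervalIntegrable _ _), mul_add]

theorem bwd_add (m : ℝ) (f g : CI) (t : ℝ) : bwd m (f + g) t = bwd m f t + bwd m g t := by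
  simp only [bwd, ContinuousMap.add_apply, mul_add]
  rw [intervalIntegral.integral_add ((continuous_bwd_integrand m f).intervalIntegrable _ _)
    ((continuous_bwd_integrand m g).intervalIntegrable _ _), mul_add]

theorem fwd_smul (m : ℝ) (c : ℂ) (f : CI) (t : ℝ) : fwd m (c • f) t = c * fwd m f t := by
  simp only [fwd, ContinuousMap.smul_apply, smul_eq_mul, mul_left_comm _ c]
  rw [intervalIntegral.integral_const_mul, mul_left_comm]

theorem bwd_smul (m : ℝ) (c : ℂ) (f : CI) (t : ℝ) : bwd m (c • f) t = c * bwd m f t := by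
  simp only [bwd, ContinuousMap.smul_apply, smul_eq_mul, mul_left_comm _ c]
  rw [intervalIntegral.integral_const_mul, mul_left_comm]

theorem fwd_star (m : ℝ) (f : CI) (t : ℝ) : fwd m (star f) t = star (fwd m f t) := by
  rw [fwd, fwd, star_mul', intervalIntegral.intervalIntegral_eq_integral_uIoc,
    intervalIntegral.intervalIntegral_eq_integral_uIoc, star_smul]
  congr 1
  · simp [-Complex.ofReal_exp]
  congr 1
  refine Eq.trans ?_ (integral_conj (f := fun s : ℝ => rexp (m * s) * f (clamp s)))
  congr 1; ext x; simp [-Complex.ofReal_exp]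

theorem bwd_star (m : ℝ) (f : CI) (t : ℝ) : bwd m (star f) t = star (bwd m f t) := by
  rw [bwd, bwd, star_mul', intervalIntegral.intervalIntegral_eq_integral_uIoc,
    intervalIntegral.intervalIntegral_eq_integral_uIoc, star_smul]
  congr 1
  · simp [-Complex.ofReal_exp]
  congr 1
  refine Eq.trans ?_ (integral_conj (f := fun s : ℝ => rexp (-(m * s)) * f (clamp s)))
  congr 1; ext x; simp [-Complex.ofReal_exp]

theorem norm_fwd_le {m : ℝ} (hm : 0 < m) (f : CI) {t : ℝ} (ht : 0 ≤ t) :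
    ‖fwd m f t‖ ≤ ‖f‖ / m := by
  have h1 : ‖∫ s in (0 : ℝ)..t, (rexp (m * s) : ℂ) * f (clamp s)‖ ≤
      ∫ s in (0 : ℝ)..t, rexp (m * s) * ‖f‖ := by
    refine intervalIntegral.norm_integral_le_of_norm_le ht
      (MeasureTheory.ae_of_all _ fun s _ => ?_)
      (Continuous.intervalIntegrable (by fun_prop) _ _)
    rw [norm_mul, Complex.norm_real, Real.norm_of_nonneg (exp_pos _).le]
    gcongr; exact norm_clamp_le f s
  have h2 : ∫ s in (0 : ℝ)..t, rexp (m * s) * ‖f‖ = (rexp (m * t) - 1) / m * ‖f‖ := by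
    rw [intervalIntegral.integral_mul_const, intervalIntegral.integral_comp_mul_left _ hm.ne']
    rw [mul_zero, integral_exp, exp_zero, smul_eq_mul]; ring
  rw [fwd, norm_mul, Complex.norm_real, Real.norm_of_nonneg (exp_pos _).le]
  calc _ ≤ rexp (-(m * t)) * ((rexp (m * t) - 1) / m * ‖f‖) := by rw [← h2]; gcongr
    _ = (1 - rexp (-(m * t))) * (‖f‖ / m) := by
      have : rexp (-(m * t)) * rexp (m * t) = 1 := by rw [← Real.exp_add]; simp
      linear_combination (‖f‖ / m) * this
    _ ≤ 1 * (‖f‖ / m) := by gcongr; linarith [exp_pos (-(m * t))]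
    _ = _ := one_mul _

theorem norm_bwd_le {m : ℝ} (hm : 0 < m) (f : CI) {t : ℝ} (ht : t ≤ T) :
    ‖bwd m f t‖ ≤ ‖f‖ / m := by
  have h1 : ‖∫ s in t..T, (rexp (-(m * s)) : ℂ) * f (clamp s)‖ ≤
      ∫ s in t..T, rexp (-m * s) * ‖f‖ := by
    refine intervalIntegral.norm_integral_le_of_norm_le ht
      (MeasureTheory.ae_of_all _ fun s _ => ?_)
      (Continuous.intervalIntegrable (by fun_prop) _ _)
    rw [norm_mul, Complex.norm_real, Real.norm_of_nonneg (exp_pos _).le, neg_mul]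
    gcongr; exact norm_clamp_le f s
  have h2 : ∫ s in t..T, rexp (-m * s) * ‖f‖ = (rexp (-m * t) - rexp (-m * T)) / m * ‖f‖ := by
    rw [intervalIntegral.integral_mul_const, intervalIntegral.integral_comp_mul_left _ (by linarith)]
    rw [integral_exp, smul_eq_mul]; field_simp; ring
  rw [bwd, norm_mul, Complex.norm_real, Real.norm_of_nonneg (exp_pos _).le]
  calc _ ≤ rexp (m * t) * ((rexp (-m * t) - rexp (-m * T)) / m * ‖f‖) := by rw [← h2]; gcongr
    _ = (1 - rexp (m * t) * rexp (-m * T)) * (‖f‖ / m) := by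
      have : rexp (m * t) * rexp (-m * t) = 1 := by rw [← Real.exp_add]; simp
      linear_combination (‖f‖ / m) * this
    _ ≤ 1 * (‖f‖ / m) := by gcongr; linarith [mul_pos (exp_pos (m * t)) (exp_pos (-m * T))]
    _ = _ := one_mul _

theorem norm_fwd_zero_le (f : CI) {t : ℝ} (ht : t ∈ Icc 0 T) : ‖fwd 0 f t‖ ≤ T * ‖f‖ := by
  have h := intervalIntegral.norm_integral_le_of_norm_le_const (a := 0) (b := t) (C := ‖f‖)
    (f := fun s : ℝ => f (clamp s)) (fun s _ => norm_clamp_le f s)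
  rw [sub_zero, abs_of_nonneg ht.1] at h
  have e : fwd 0 f t = ∫ s in (0 : ℝ)..t, f (clamp s) := by simp [fwd]
  rw [e]
  nlinarith [ht.2, norm_nonneg f]

/-! ### The two-point boundary value problem for a single Fourier mode -/

/-- The growing component of the solution of the boundary value problem. -/
def growing (m : ℝ) (f s : CI) (t : ℝ) : ℂ :=
  -bwd m (m • f + s) t + (fwd m (-(m • f) + s) T - rexp (-(m * T)) * bwd m (m • f + s) 0) /
    (1 - rexp (-(m * T)) ^ 2) * rexp (-(m * T)) * rexp (m * t)

/-- The decaying component of the solution of the boundary value problem. -/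
def decaying (m : ℝ) (f s : CI) (t : ℝ) : ℂ :=
  fwd m (-(m • f) + s) t + (rexp (-(m * T)) * fwd m (-(m • f) + s) T - bwd m (m • f + s) 0) /
    (1 - rexp (-(m * T)) ^ 2) * rexp (-m * t)

theorem hasDerivAt_growing (m : ℝ) (f s : CI) (t : ℝ) :
    HasDerivAt (growing m f s) (m * growing m f s t + m * f (clamp t) + s (clamp t)) t := by
  have h := (hasDerivAt_bwd m (m • f + s) t).fun_neg.fun_add ((hasDerivAt_exp_mul m t).const_mul
    ((fwd m (-(m • f) + s) T - rexp (-(m * T)) * bwd m (m • f + s) 0) /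
    (1 - rexp (-(m * T)) ^ 2) * rexp (-(m * T))))
  refine HasDerivAt.congr_deriv (f := growing m f s) h ?_
  simp only [growing, ContinuousMap.add_apply, ContinuousMap.smul_apply, Complex.real_smul]
  ring

theorem hasDerivAt_decaying (m : ℝ) (f s : CI) (t : ℝ) :
    HasDerivAt (decaying m f s) (-m * decaying m f s t - m * f (clamp t) + s (clamp t)) t := by
  have h := (hasDerivAt_fwd m (-(m • f) + s) t).fun_add ((hasDerivAt_exp_mul (-m) t).const_mul
    ((rexp (-(m * T)) * fwd m (-(m • f) + s) T - bwd m (m • f + s) 0) /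
    (1 - rexp (-(m * T)) ^ 2)))
  refine HasDerivAt.congr_deriv (f := decaying m f s) h ?_
  simp only [decaying, ContinuousMap.add_apply, ContinuousMap.smul_apply, Complex.real_smul,
    ContinuousMap.neg_apply]
  push_cast
  ring

theorem one_sub_exp_sq_pos {m : ℝ} (hm : 0 < m) : 0 < 1 - rexp (-(m * T)) ^ 2 := by
  have h1 : rexp (-(m * T)) < 1 := by
    rw [Real.exp_lt_one_iff]; linarith [mul_pos hm hT.out]
  nlinarith [exp_pos (-(m * T))]

theorem one_sub_exp_sq_ne {m : ℝ} (hm : 0 < m) : (1 - (rexp (-(m * T)) : ℂ) ^ 2) ≠ 0 := by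
  exact_mod_cast (one_sub_exp_sq_pos (T := T) hm).ne'

theorem growing_zero {m : ℝ} (hm : 0 < m) (f s : CI) : growing m f s 0 = decaying m f s 0 := by
  have := one_sub_exp_sq_ne (T := T) hm
  simp only [growing, decaying, fwd_zero, mul_zero, Real.exp_zero, Complex.ofReal_one]
  field_simp
  ring

theorem growing_right {m : ℝ} (hm : 0 < m) (f s : CI) : growing m f s T = decaying m f s T := by
  have := one_sub_exp_sq_ne (T := T) hm
  have e : (rexp (-(m * T)) : ℂ) * rexp (m * T) = 1 := by
    rw [← Complex.ofReal_mul, ← Real.exp_add]; simp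
  simp only [growing, decaying, bwd_right, neg_mul]
  rw [mul_assoc, e]
  field_simp
  ring

omit hT in
theorem norm_src_le {m : ℝ} (hm : 0 < m) (f s : CI) :
    ‖m • f + s‖ / m ≤ ‖f‖ + ‖s‖ / m := by
  have : ‖m • f + s‖ ≤ m * ‖f‖ + ‖s‖ := by
    refine (norm_add_le _ _).trans ?_
    rw [norm_smul, Real.norm_of_nonneg hm.le]
  rw [div_le_iff₀ hm]; field_simp; linarith

omit hT in
theorem norm_src_le' {m : ℝ} (hm : 0 < m) (f s : CI) :
    ‖-(m • f) + s‖ / m ≤ ‖f‖ + ‖s‖ / m := by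
  simpa using norm_src_le hm (-f) s

theorem boundary_coeff_le {m S : ℝ} (hm : 1 ≤ m) {x y : ℂ} (hx : ‖x‖ ≤ S) (hy : ‖y‖ ≤ S) :
    ‖(x - rexp (-(m * T)) * y) / (1 - rexp (-(m * T)) ^ 2)‖ ≤ 2 / (1 - rexp (-(1 * T)) ^ 2) * S := by
  have hT' := hT.out
  have hE : rexp (-(m * T)) ≤ rexp (-(1 * T)) := Real.exp_le_exp.2 (by nlinarith)
  have h0 := exp_pos (-(m * T))
  have h1 := one_sub_exp_sq_pos (T := T) one_pos
  have hS : 0 ≤ S := (norm_nonneg _).trans hx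
  have hle : rexp (-(m * T)) ≤ 1 := by rw [Real.exp_le_one_iff]; nlinarith
  rw [norm_div, show (1 - (rexp (-(m * T)) : ℂ) ^ 2) = ((1 - rexp (-(m * T)) ^ 2 : ℝ) : ℂ) by
    push_cast; rfl, Complex.norm_real, Real.norm_of_nonneg (one_sub_exp_sq_pos (by linarith)).le]
  have h2 : ‖x - rexp (-(m * T)) * y‖ ≤ 2 * S := by
    refine (norm_sub_le _ _).trans ?_
    rw [norm_mul, Complex.norm_real, Real.norm_of_nonneg h0.le]
    nlinarith [norm_nonneg y]
  calc _ ≤ 2 * S / (1 - rexp (-(1 * T)) ^ 2) := by gcongr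
    _ = _ := by ring

theorem norm_growing_le {m : ℝ} (hm : 1 ≤ m) (f s : CI) {t : ℝ} (ht : t ∈ Icc 0 T) :
    ‖growing m f s t‖ ≤ (1 + 2 / (1 - rexp (-(1 * T)) ^ 2)) * (‖f‖ + ‖s‖ / m) := by
  have hm' : 0 < m := by linarith
  have hU (t) (ht : t ∈ Icc 0 T) := (norm_bwd_le hm' (m • f + s) ht.2).trans (norm_src_le hm' f s)
  have hN (t) (ht : t ∈ Icc 0 T) :=
    (norm_fwd_le hm' (-(m • f) + s) ht.1).trans (norm_src_le' hm' f s)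
  have hB := boundary_coeff_le (T := T) hm (hN T ⟨hT.out.le, le_rfl⟩) (hU 0 ⟨le_rfl, hT.out.le⟩)
  have hE : ‖(rexp (-(m * T)) : ℂ) * rexp (m * t)‖ ≤ 1 := by
    rw [← Complex.ofReal_mul, ← Real.exp_add, Complex.norm_real, Real.norm_of_nonneg (exp_pos _).le,
      Real.exp_le_one_iff]
    nlinarith [ht.2]
  rw [growing, mul_assoc]
  refine (norm_add_le _ _).trans ?_
  rw [norm_neg, norm_mul]
  have := mul_le_mul hB hE (norm_nonneg _) ((norm_nonneg _).trans hB)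
  linarith [hU t ht]

theorem norm_decaying_le {m : ℝ} (hm : 1 ≤ m) (f s : CI) {t : ℝ} (ht : t ∈ Icc 0 T) :
    ‖decaying m f s t‖ ≤ (1 + 2 / (1 - rexp (-(1 * T)) ^ 2)) * (‖f‖ + ‖s‖ / m) := by
  have hm' : 0 < m := by linarith
  have hU (t) (ht : t ∈ Icc 0 T) := (norm_bwd_le hm' (m • f + s) ht.2).trans (norm_src_le hm' f s)
  have hN (t) (ht : t ∈ Icc 0 T) :=
    (norm_fwd_le hm' (-(m • f) + s) ht.1).trans (norm_src_le' hm' f s)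
  have hB := boundary_coeff_le (T := T) hm (hU 0 ⟨le_rfl, hT.out.le⟩) (hN T ⟨hT.out.le, le_rfl⟩)
  rw [← norm_neg, ← neg_div, neg_sub] at hB
  have hE : ‖(rexp (-m * t) : ℂ)‖ ≤ 1 := by
    rw [Complex.norm_real, Real.norm_of_nonneg (exp_pos _).le, Real.exp_le_one_iff]
    nlinarith [ht.1]
  rw [decaying]
  refine (norm_add_le _ _).trans ?_
  rw [norm_mul]
  have := mul_le_mul hB hE (norm_nonneg _) ((norm_nonneg _).trans hB)
  linarith [hN t ht]

/-! Linearity and reality. -/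

theorem growing_add (m : ℝ) (f s f' s' : CI) (t : ℝ) :
    growing m (f + f') (s + s') t = growing m f s t + growing m f' s' t := by
  have e1 : m • (f + f') + (s + s') = (m • f + s) + (m • f' + s') := by module
  have e2 : -(m • (f + f')) + (s + s') = (-(m • f) + s) + (-(m • f') + s') := by module
  simp only [growing, e1, e2, fwd_add, bwd_add]; ring

theorem decaying_add (m : ℝ) (f s f' s' : CI) (t : ℝ) :
    decaying m (f + f') (s + s') t = decaying m f s t + decaying m f' s' t := by
  have e1 : m • (f + f') + (s + s') = (m • f + s) + (m • f' + s') := by module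
  have e2 : -(m • (f + f')) + (s + s') = (-(m • f) + s) + (-(m • f') + s') := by module
  simp only [decaying, e1, e2, fwd_add, bwd_add]; ring

theorem fwd_rsmul (m c : ℝ) (f : CI) (t : ℝ) : fwd m (c • f) t = c * fwd m f t := fwd_smul m c f t

theorem bwd_rsmul (m c : ℝ) (f : CI) (t : ℝ) : bwd m (c • f) t = c * bwd m f t := bwd_smul m c f t

theorem growing_smul (m c : ℝ) (f s : CI) (t : ℝ) :
    growing m (c • f) (c • s) t = c * growing m f s t := by
  have e1 : m • (c • f) + c • s = c • (m • f + s) := by module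
  have e2 : -(m • (c • f)) + c • s = c • (-(m • f) + s) := by module
  simp only [growing, e1, e2, fwd_rsmul, bwd_rsmul]; ring

theorem decaying_smul (m c : ℝ) (f s : CI) (t : ℝ) :
    decaying m (c • f) (c • s) t = c * decaying m f s t := by
  have e1 : m • (c • f) + c • s = c • (m • f + s) := by module
  have e2 : -(m • (c • f)) + c • s = c • (-(m • f) + s) := by module
  simp only [decaying, e1, e2, fwd_rsmul, bwd_rsmul]; ring

theorem growing_star (m : ℝ) (f s : CI) (t : ℝ) :
    growing m (star f) (star s) t = star (growing m f s t) := by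
  have e1 : m • star f + star s = star (m • f + s) := by simp
  have e2 : -(m • star f) + star s = star (-(m • f) + s) := by simp
  simp only [growing, e1, e2, fwd_star, bwd_star]
  simp [-Complex.ofReal_exp]

theorem decaying_star (m : ℝ) (f s : CI) (t : ℝ) :
    decaying m (star f) (star s) t = star (decaying m f s t) := by
  have e1 : m • star f + star s = star (m • f + s) := by simp
  have e2 : -(m • star f) + star s = star (-(m • f) + s) := by simp
  simp only [decaying, e1, e2, fwd_star, bwd_star]
  simp [-Complex.ofReal_exp]

/-- The source term of the `k`-th mode. -/
def modeSrc (k : ℤ) (g h : CI) : CI := (k * Complex.I) • g + h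

/-- The constant of integration of the zeroth mode. -/
def zeroConst (f h : CI) : ℂ := -(fwd 0 f T + ∫ s in (0 : ℝ)..T, fwd 0 h s) / T

/-- The `k`-th Fourier mode of the solution. -/
def modeV (k : ℤ) (f g h : CI) (t : ℝ) : ℂ :=
  if k = 0 then fwd 0 f t + (∫ s in (0 : ℝ)..t, fwd 0 h s) + zeroConst f h * t
  else (growing |(k : ℝ)| f (modeSrc k g h) t - decaying |(k : ℝ)| f (modeSrc k g h) t) /
    (2 * |(k : ℝ)|)

/-- The `k`-th Fourier mode of the normal flux of the solution. -/
def modeS (k : ℤ) (f g h : CI) (t : ℝ) : ℂ :=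
  if k = 0 then fwd 0 h t + zeroConst f h
  else (growing |(k : ℝ)| f (modeSrc k g h) t + decaying |(k : ℝ)| f (modeSrc k g h) t) / 2

theorem hasDerivAt_modeV (k : ℤ) (f g h : CI) (t : ℝ) :
    HasDerivAt (modeV k f g h) (f (clamp t) + modeS k f g h t) t := by
  by_cases hk : k = 0
  · have h1 := (hasDerivAt_fwd 0 f t).fun_add ((continuous_fwd 0 h).integral_hasStrictDerivAt 0
      t).hasDerivAt |>.fun_add ((Complex.ofRealCLM.hasDerivAt (x := t)).const_mul (zeroConst f h))
    have e : modeV k f g h = fun t => fwd 0 f t + (∫ s in (0 : ℝ)..t, fwd 0 h s) +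
        zeroConst f h * t := by ext; simp [modeV, hk]
    rw [e]
    refine h1.congr_deriv ?_
    simp [modeS, hk]; ring
  · have h1 := ((hasDerivAt_growing |(k : ℝ)| f (modeSrc k g h) t).fun_sub
      (hasDerivAt_decaying |(k : ℝ)| f (modeSrc k g h) t)).div_const (2 * |(k : ℝ)| : ℂ)
    have e : modeV k f g h = fun t => (growing |(k : ℝ)| f (modeSrc k g h) t -
      decaying |(k : ℝ)| f (modeSrc k g h) t) / (2 * |(k : ℝ)|) := by ext; simp [modeV, hk]
    rw [e]
    refine h1.congr_deriv ?_
    have : ((|(k : ℝ)| : ℝ) : ℂ) ≠ 0 := by simpa using hk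
    simp only [modeS, hk, if_false]
    field_simp
    ring

theorem hasDerivAt_modeS (k : ℤ) (f g h : CI) (t : ℝ) :
    HasDerivAt (modeS k f g h)
      (k ^ 2 * modeV k f g h t + k * Complex.I * g (clamp t) + h (clamp t)) t := by
  by_cases hk : k = 0
  · have h1 := (hasDerivAt_fwd 0 h t).add_const (zeroConst f h)
    have e : modeS k f g h = fun t => fwd 0 h t + zeroConst f h := by ext; simp [modeS, hk]
    rw [e]
    refine h1.congr_deriv ?_
    simp [hk]
  · have h1 := ((hasDerivAt_growing |(k : ℝ)| f (modeSrc k g h) t).fun_add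
      (hasDerivAt_decaying |(k : ℝ)| f (modeSrc k g h) t)).div_const 2
    have e : modeS k f g h = fun t => (growing |(k : ℝ)| f (modeSrc k g h) t +
      decaying |(k : ℝ)| f (modeSrc k g h) t) / 2 := by ext; simp [modeS, hk]
    rw [e]
    refine h1.congr_deriv ?_
    have : ((|(k : ℝ)| : ℝ) : ℂ) ≠ 0 := by simpa using hk
    have e2 : (k : ℂ) ^ 2 = ((|(k : ℝ)| : ℝ) : ℂ) ^ 2 := by
      rw [← Complex.ofReal_pow, sq_abs]; push_cast; rfl
    simp only [modeV, hk, if_false, e2, modeSrc, ContinuousMap.add_apply, ContinuousMap.smul_apply,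
      smul_eq_mul]
    field_simp
    ring

theorem modeV_zero (k : ℤ) (f g h : CI) : modeV k f g h 0 = 0 := by
  by_cases hk : k = 0
  · simp [modeV, hk, fwd_zero]
  · simp only [modeV, hk, if_false]
    rw [growing_zero (by positivity), sub_self, zero_div]

theorem modeV_right (k : ℤ) (f g h : CI) : modeV k f g h T = 0 := by
  by_cases hk : k = 0
  · have : (T : ℂ) ≠ 0 := by exact_mod_cast hT.out.ne'
    simp only [modeV, hk, if_true, zeroConst]
    field_simp
    ring
  · simp only [modeV, hk, if_false]
    rw [growing_right (by positivity), sub_self, zero_div]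

omit hT in
theorem modeSrc_add (k : ℤ) (g h g' h' : CI) :
    modeSrc k (g + g') (h + h') = modeSrc k g h + modeSrc k g' h' := by
  simp only [modeSrc]; module

omit hT in
theorem modeSrc_smul (k : ℤ) (c : ℝ) (g h : CI) :
    modeSrc k (c • g) (c • h) = c • modeSrc k g h := by
  ext; simp [modeSrc]; ring

omit hT in
theorem modeSrc_star (k : ℤ) (g h : CI) :
    modeSrc (-k) (star g) (star h) = star (modeSrc k g h) := by
  ext; simp [modeSrc]

theorem zeroConst_add (f h f' h' : CI) :
    zeroConst (f + f') (h + h') = zeroConst f h + zeroConst f' h' := by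
  simp only [zeroConst, fwd_add]
  rw [intervalIntegral.integral_add ((continuous_fwd 0 h).intervalIntegrable _ _)
    ((continuous_fwd 0 h').intervalIntegrable _ _)]
  ring

theorem zeroConst_smul (c : ℝ) (f h : CI) :
    zeroConst (c • f) (c • h) = c * zeroConst f h := by
  simp only [zeroConst, fwd_rsmul, intervalIntegral.integral_const_mul]
  ring

theorem integral_star (f : ℝ → ℂ) (a b : ℝ) :
    ∫ s in a..b, star (f s) = star (∫ s in a..b, f s) := by
  rw [intervalIntegral.intervalIntegral_eq_integral_uIoc,
    intervalIntegral.intervalIntegral_eq_integral_uIoc, star_smul]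
  congr 1
  exact integral_conj (f := f)

theorem zeroConst_star (f h : CI) : zeroConst (star f) (star h) = star (zeroConst f h) := by
  simp only [zeroConst, fwd_star, integral_star]
  simp

theorem modeV_add (k : ℤ) (f g h f' g' h' : CI) (t : ℝ) :
    modeV k (f + f') (g + g') (h + h') t = modeV k f g h t + modeV k f' g' h' t := by
  by_cases hk : k = 0
  · simp only [modeV, hk, if_true, zeroConst_add, fwd_add]
    rw [intervalIntegral.integral_add ((continuous_fwd 0 h).intervalIntegrable _ _)
      ((continuous_fwd 0 h').intervalIntegrable _ _)]
    ring
  · simp only [modeV, hk, if_false, modeSrc_add, growing_add, decaying_add]; ring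

theorem modeS_add (k : ℤ) (f g h f' g' h' : CI) (t : ℝ) :
    modeS k (f + f') (g + g') (h + h') t = modeS k f g h t + modeS k f' g' h' t := by
  by_cases hk : k = 0
  · simp only [modeS, hk, if_true, zeroConst_add, fwd_add]; ring
  · simp only [modeS, hk, if_false, modeSrc_add, growing_add, decaying_add]; ring

theorem modeV_smul (k : ℤ) (c : ℝ) (f g h : CI) (t : ℝ) :
    modeV k (c • f) (c • g) (c • h) t = c * modeV k f g h t := by
  by_cases hk : k = 0
  · simp only [modeV, hk, if_true, zeroConst_smul, fwd_rsmul, intervalIntegral.integral_const_mul]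
    ring
  · simp only [modeV, hk, if_false, modeSrc_smul, growing_smul, decaying_smul]; ring

theorem modeS_smul (k : ℤ) (c : ℝ) (f g h : CI) (t : ℝ) :
    modeS k (c • f) (c • g) (c • h) t = c * modeS k f g h t := by
  by_cases hk : k = 0
  · simp only [modeS, hk, if_true, zeroConst_smul, fwd_rsmul]; ring
  · simp only [modeS, hk, if_false, modeSrc_smul, growing_smul, decaying_smul]; ring

theorem modeV_star (k : ℤ) (f g h : CI) (t : ℝ) :
    modeV (-k) (star f) (star g) (star h) t = star (modeV k f g h t) := by
  by_cases hk : k = 0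
  · simp only [modeV, hk, neg_zero, if_true, zeroConst_star, fwd_star, integral_star]; simp
  · simp only [modeV, hk, neg_eq_zero, if_false, modeSrc_star, growing_star, decaying_star,
      Int.cast_neg, abs_neg]
    simp

theorem modeS_star (k : ℤ) (f g h : CI) (t : ℝ) :
    modeS (-k) (star f) (star g) (star h) t = star (modeS k f g h t) := by
  by_cases hk : k = 0
  · simp only [modeS, hk, neg_zero, if_true, zeroConst_star, fwd_star]; simp
  · simp only [modeS, hk, neg_eq_zero, if_false, modeSrc_star, growing_star, decaying_star,
      Int.cast_neg, abs_neg]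
    simp

/-- Uniform bounds for all modes. -/
theorem exists_mode_bound : ∃ C > 0, ∀ (k : ℤ) (f g h : CI), ∀ t ∈ Icc 0 T,
    ‖modeV k f g h t‖ ≤ C * (‖f‖ + ‖g‖ + ‖h‖) ∧ ‖k * modeV k f g h t‖ ≤ C * (‖f‖ + ‖g‖ + ‖h‖) ∧
    ‖modeS k f g h t‖ ≤ C * (‖f‖ + ‖g‖ + ‖h‖) := by
  have hT' := hT.out
  have hE := one_sub_exp_sq_pos (T := T) one_pos
  set C1 := 1 + 2 / (1 - rexp (-(1 * T)) ^ 2) with hC1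
  have hC1' : 1 < C1 := by rw [hC1]; linarith [div_pos two_pos hE]
  refine ⟨C1 + (2 * T + 2 * T ^ 2 + 1), by positivity, fun k f g h t ht => ?_⟩
  set S := ‖f‖ + ‖g‖ + ‖h‖ with hS
  have hf := norm_nonneg f
  have hg := norm_nonneg g
  have hh := norm_nonneg h
  have hS0 : 0 ≤ S := by positivity
  have hT2 : 0 ≤ (2 * T + 2 * T ^ 2 + 1) * S := by positivity
  by_cases hk : k = 0
  · have hig (t) (ht : t ∈ Icc 0 T) : ‖∫ s in (0 : ℝ)..t, fwd 0 h s‖ ≤ T * (T * ‖h‖) := by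
      refine (intervalIntegral.norm_integral_le_of_norm_le_const (C := T * ‖h‖)
        (fun s hs => norm_fwd_zero_le h ?_)).trans ?_
      · rw [uIoc_of_le ht.1] at hs; exact ⟨hs.1.le, hs.2.trans ht.2⟩
      · rw [sub_zero, abs_of_nonneg ht.1, mul_comm]
        exact mul_le_mul_of_nonneg_right ht.2 (by positivity)
    have hTT : T ∈ Icc 0 T := ⟨hT'.le, le_rfl⟩
    have hz : ‖zeroConst f h‖ ≤ ‖f‖ + T * ‖h‖ := by
      rw [zeroConst, norm_div, norm_neg, Complex.norm_real, Real.norm_of_nonneg hT'.le,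
        div_le_iff₀ hT']
      refine (norm_add_le _ _).trans ?_
      linarith [hig T hTT, norm_fwd_zero_le f hTT]
    have hV : ‖modeV k f g h t‖ ≤ (2 * T + 2 * T ^ 2 + 1) * S := by
      simp only [modeV, hk, if_true]
      refine (norm_add₃_le).trans ?_
      rw [norm_mul, Complex.norm_real, Real.norm_of_nonneg ht.1]
      have : ‖zeroConst f h‖ * t ≤ (‖f‖ + T * ‖h‖) * T := by gcongr; exacts [ht.1, ht.2]
      have h1 := mul_nonneg hT'.le hg
      have h2 := mul_nonneg hT'.le hh
      have h3 := mul_nonneg hT'.le h1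
      have h4 := mul_nonneg hT'.le (mul_nonneg hT'.le hf)
      rw [hS]
      linarith [hig t ht, norm_fwd_zero_le f ht]
    have hV' : ‖modeS k f g h t‖ ≤ (2 * T + 2 * T ^ 2 + 1) * S := by
      simp only [modeS, hk, if_true]
      refine (norm_add_le _ _).trans ?_
      have h1 := mul_nonneg hT'.le hg
      have h2 := mul_nonneg hT'.le hh
      have h3 := mul_nonneg hT'.le h1
      have h4 := mul_nonneg hT'.le h2
      have h5 := mul_nonneg hT'.le hf
      have h6 := mul_nonneg hT'.le h5
      rw [hS]
      linarith [norm_fwd_zero_le h ht]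
    have hC1S : 0 ≤ C1 * S := by positivity
    refine ⟨by linarith, ?_, by linarith⟩
    rw [hk]; simp; positivity
  · have hm : 1 ≤ |(k : ℝ)| := by exact_mod_cast Int.one_le_abs hk
    have hsrc : ‖f‖ + ‖modeSrc k g h‖ / |(k : ℝ)| ≤ S := by
      have h1 : ‖modeSrc k g h‖ ≤ |(k : ℝ)| * ‖g‖ + ‖h‖ := by
        refine (norm_add_le _ _).trans ?_
        rw [norm_smul]; simp
      have : ‖modeSrc k g h‖ / |(k : ℝ)| ≤ ‖g‖ + ‖h‖ := by
        rw [div_le_iff₀ (by linarith)]; nlinarith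
      linarith
    have hp := (norm_growing_le hm f (modeSrc k g h) ht).trans
      (mul_le_mul_of_nonneg_left hsrc (by linarith))
    have hn := (norm_decaying_le hm f (modeSrc k g h) ht).trans
      (mul_le_mul_of_nonneg_left hsrc (by linarith))
    rw [← hC1] at hp hn
    have hkV : |(k : ℝ)| * ‖modeV k f g h t‖ ≤ C1 * S := by
      simp only [modeV, hk, if_false]
      rw [norm_div, norm_mul, Complex.norm_real, Real.norm_of_nonneg (abs_nonneg _),
        Complex.norm_ofNat]
      have := norm_sub_le (growing |(k : ℝ)| f (modeSrc k g h) t)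
        (decaying |(k : ℝ)| f (modeSrc k g h) t)
      have hk0 : |(k : ℝ)| ≠ 0 := by linarith
      field_simp
      linarith
    refine ⟨?_, ?_, ?_⟩
    · nlinarith [norm_nonneg (modeV k f g h t)]
    · rw [norm_mul, Complex.norm_intCast]; linarith
    · simp only [modeS, hk, if_false]
      rw [norm_div, Complex.norm_ofNat]
      have := norm_add_le (growing |(k : ℝ)| f (modeSrc k g h) t)
        (decaying |(k : ℝ)| f (modeSrc k g h) t)
      linarith

end green

end

noncomputable section

section greenOp

variable {T : ℝ} [hT : Fact (0 < T)]

local notation "CI" => C(Icc (0 : ℝ) T, ℂ)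
local notation "𝒜" => wienReal (Icc (0 : ℝ) T)

omit hT in
theorem exists_diagonal_op (φ : ℤ → CI → CI → CI → CI)
    (hadd : ∀ k f g h f' g' h', φ k (f + f') (g + g') (h + h') = φ k f g h + φ k f' g' h')
    (hsmul : ∀ k (c : ℝ) f g h, φ k (c • f) (c • g) (c • h) = c • φ k f g h)
    (hstar : ∀ k f g h, φ (-k) (star f) (star g) (star h) = star (φ k f g h))
    (C : ℝ) (hC : ∀ k f g h, ‖φ k f g h‖ ≤ C * (‖f‖ + ‖g‖ + ‖h‖)) :
    ∃ L : 𝒜 × 𝒜 × 𝒜 →L[ℝ] 𝒜, ∀ f g h : 𝒜, ∀ k,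
      (L (f, g, h) : Wien CI) k = φ k ((f : Wien CI) k) ((g : Wien CI) k) ((h : Wien CI) k) := by
  have hsum (f g h : 𝒜) : Summable fun k => C * (‖(f : Wien CI) k‖ + ‖(g : Wien CI) k‖ +
      ‖(h : Wien CI) k‖) :=
    (((f : Wien CI).summable_norm.add (g : Wien CI).summable_norm).add
      (h : Wien CI).summable_norm).mul_left C
  have hs (f g h : 𝒜) : Summable fun k =>
      ‖φ k ((f : Wien CI) k) ((g : Wien CI) k) ((h : Wien CI) k)‖ :=
    Summable.of_nonneg_of_le (fun _ => norm_nonneg _) (fun k => hC k _ _ _) (hsum f g h)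
  let L0 : 𝒜 × 𝒜 × 𝒜 →ₗ[ℝ] 𝒜 :=
    { toFun x := ⟨Wien.mk _ (hs x.1 x.2.1 x.2.2), fun k => by
        simp only [Wien.mk_apply]
        rw [← hstar, ← mem_wienReal.1 x.1.2, ← mem_wienReal.1 x.2.1.2, ← mem_wienReal.1 x.2.2.2]⟩
      map_add' x y := Subtype.ext <| Wien.ext fun k => hadd k _ _ _ _ _ _
      map_smul' c x := Subtype.ext <| Wien.ext fun k => hsmul k c _ _ _ }
  refine ⟨L0.mkContinuous (|C| * 3) fun x => ?_, fun f g h k => rfl⟩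
  have h1 : ‖L0 x‖ = ∑' k, ‖φ k ((x.1 : Wien CI) k) ((x.2.1 : Wien CI) k) ((x.2.2 : Wien CI) k)‖ :=
    Wien.norm_eq _
  have h2 : ∑' k, C * (‖(x.1 : Wien CI) k‖ + ‖(x.2.1 : Wien CI) k‖ + ‖(x.2.2 : Wien CI) k‖)
      = C * (‖x.1‖ + ‖x.2.1‖ + ‖x.2.2‖) := by
    rw [tsum_mul_left, Summable.tsum_add ((x.1 : Wien CI).summable_norm.add
      (x.2.1 : Wien CI).summable_norm) (x.2.2 : Wien CI).summable_norm, Summable.tsum_add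
      (x.1 : Wien CI).summable_norm (x.2.1 : Wien CI).summable_norm, ← Wien.norm_eq,
      ← Wien.norm_eq, ← Wien.norm_eq]
    rfl
  rw [h1]
  refine ((hs _ _ _).tsum_le_tsum (fun k => hC k _ _ _) (hsum _ _ _)).trans ?_
  rw [h2]
  have e1 : ‖x.1‖ ≤ ‖x‖ := norm_fst_le x
  have e2 : ‖x.2.1‖ ≤ ‖x‖ := (norm_fst_le x.2).trans (norm_snd_le x)
  have e3 : ‖x.2.2‖ ≤ ‖x‖ := (norm_snd_le x.2).trans (norm_snd_le x)
  calc _ ≤ |C| * (‖x.1‖ + ‖x.2.1‖ + ‖x.2.2‖) := by gcongr; exact le_abs_self C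
    _ ≤ |C| * (‖x‖ + ‖x‖ + ‖x‖) := by gcongr
    _ = _ := by ring

theorem continuous_modeV (k : ℤ) (f g h : CI) : Continuous (modeV k f g h) :=
  continuous_iff_continuousAt.2 fun t => (hasDerivAt_modeV k f g h t).continuousAt

theorem continuous_modeS (k : ℤ) (f g h : CI) : Continuous (modeS k f g h) :=
  continuous_iff_continuousAt.2 fun t => (hasDerivAt_modeS k f g h t).continuousAt

/-- The coefficientwise description of the Green operator and its derivatives. -/
structure IsGreen (L0 L1 L2 : 𝒜 × 𝒜 × 𝒜 →L[ℝ] 𝒜) : Prop where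
  zeroth : ∀ (f g h : 𝒜) (k : ℤ) (t : Icc (0 : ℝ) T), (L0 (f, g, h) : Wien CI) k t =
    modeV k ((f : Wien CI) k) ((g : Wien CI) k) ((h : Wien CI) k) t
  first : ∀ (f g h : 𝒜) (k : ℤ) (t : Icc (0 : ℝ) T), (L1 (f, g, h) : Wien CI) k t =
    (f : Wien CI) k t + modeS k ((f : Wien CI) k) ((g : Wien CI) k) ((h : Wien CI) k) t
  second : ∀ (f g h : 𝒜) (k : ℤ) (t : Icc (0 : ℝ) T), (L2 (f, g, h) : Wien CI) k t =
    k * Complex.I * modeV k ((f : Wien CI) k) ((g : Wien CI) k) ((h : Wien CI) k) t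

theorem exists_isGreen : ∃ L0 L1 L2 : 𝒜 × 𝒜 × 𝒜 →L[ℝ] 𝒜, IsGreen L0 L1 L2 := by
  obtain ⟨C, hC0, hC⟩ := exists_mode_bound (T := T)
  let V (k : ℤ) (f g h : CI) : CI := ⟨fun t => modeV k f g h t, (continuous_modeV k f g h).comp
    continuous_subtype_val⟩
  let S (k : ℤ) (f g h : CI) : CI := ⟨fun t => modeS k f g h t, (continuous_modeS k f g h).comp
    continuous_subtype_val⟩
  obtain ⟨L0, h0⟩ := exists_diagonal_op V
    (fun k f g h f' g' h' => by ext t; exact modeV_add k f g h f' g' h' t)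
    (fun k c f g h => by ext t; exact modeV_smul k c f g h t)
    (fun k f g h => by ext t; exact modeV_star k f g h t) C
    (fun k f g h => (ContinuousMap.norm_le _ (by positivity)).2 fun t => (hC k f g h t t.2).1)
  obtain ⟨L1, h1⟩ := exists_diagonal_op (fun k f g h => f + S k f g h)
    (fun k f g h f' g' h' => by
      ext t; simp only [ContinuousMap.add_apply]
      rw [show S k (f + f') (g + g') (h + h') t = S k f g h t + S k f' g' h' t from
        modeS_add k f g h f' g' h' t]; ring)
    (fun k c f g h => by
      ext t; simp only [ContinuousMap.add_apply, ContinuousMap.smul_apply, Complex.real_smul]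
      rw [show S k (c • f) (c • g) (c • h) t = c * S k f g h t from
        modeS_smul k c f g h t]; ring)
    (fun k f g h => by
      ext t; simp only [ContinuousMap.add_apply, ContinuousMap.star_apply, star_add]
      rw [show S (-k) (star f) (star g) (star h) t = star (S k f g h t) from
        modeS_star k f g h t]) (C + 1)
    (fun k f g h => (ContinuousMap.norm_le _ (by positivity)).2 fun t => by
      refine (norm_add_le _ _).trans ?_
      have := (hC k f g h t t.2).2.2
      have h2 := f.norm_coe_le_norm t
      change ‖f t‖ + ‖modeS k f g h t‖ ≤ _
      linarith [norm_nonneg g, norm_nonneg h])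
  obtain ⟨L2, h2⟩ := exists_diagonal_op (fun k f g h => (k * Complex.I) • V k f g h)
    (fun k f g h f' g' h' => by
      ext t; simp only [ContinuousMap.add_apply, ContinuousMap.smul_apply, smul_eq_mul]
      rw [show V k (f + f') (g + g') (h + h') t = V k f g h t + V k f' g' h' t from
        modeV_add k f g h f' g' h' t]; ring)
    (fun k c f g h => by
      ext t; simp only [ContinuousMap.smul_apply, Complex.real_smul, smul_eq_mul]
      rw [show V k (c • f) (c • g) (c • h) t = c * V k f g h t from
        modeV_smul k c f g h t]; ring)
    (fun k f g h => by
      ext t; simp only [ContinuousMap.smul_apply, ContinuousMap.star_apply, smul_eq_mul, star_mul']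
      rw [show V (-k) (star f) (star g) (star h) t = star (V k f g h t) from
        modeV_star k f g h t]
      simp) C
    (fun k f g h => (ContinuousMap.norm_le _ (by positivity)).2 fun t => by
      refine le_trans (le_of_eq ?_) (hC k f g h t t.2).2.1
      change ‖(k * Complex.I) * modeV k f g h t‖ = _
      rw [norm_mul, norm_mul, norm_mul, Complex.norm_I, mul_one])
  exact ⟨L0, L1, L2, fun f g h k t => by rw [h0]; rfl, fun f g h k t => by rw [h1]; rfl,
    fun f g h k t => by rw [h2]; rfl⟩

namespace IsGreen

theorem ev_zero {L0 L1 L2 : 𝒜 × 𝒜 × 𝒜 →L[ℝ] 𝒜} (hL : IsGreen L0 L1 L2) (x : 𝒜 × 𝒜 × 𝒜) (θ : ℝ) :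
    wienReal.ev (clamp 0) θ (L0 x) = 0 := by
  obtain ⟨f, g, h⟩ := x
  have : ∀ k, (L0 (f, g, h) : Wien CI) k (clamp 0) = 0 := fun k => by
    rw [hL.zeroth, coe_clamp ⟨le_rfl, hT.out.le⟩, modeV_zero]
  simp [wienReal.ev_apply, Wien.evC, this]

theorem ev_right {L0 L1 L2 : 𝒜 × 𝒜 × 𝒜 →L[ℝ] 𝒜} (hL : IsGreen L0 L1 L2) (x : 𝒜 × 𝒜 × 𝒜) (θ : ℝ) :
    wienReal.ev (clamp T) θ (L0 x) = 0 := by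
  obtain ⟨f, g, h⟩ := x
  have : ∀ k, (L0 (f, g, h) : Wien CI) k (clamp T) = 0 := fun k => by
    rw [hL.zeroth, coe_clamp ⟨hT.out.le, le_rfl⟩, modeV_right]
  simp [wienReal.ev_apply, Wien.evC, this]

theorem hasFDerivAt {L0 L1 L2 : 𝒜 × 𝒜 × 𝒜 →L[ℝ] 𝒜} (hL : IsGreen L0 L1 L2) (x : 𝒜 × 𝒜 × 𝒜) {t : ℝ} (ht : t ∈ Ioo 0 T) (θ : ℝ) :
    HasFDerivAt (fun p : ℝ × ℝ => wienReal.ev (clamp p.1) p.2 (L0 x))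
      (wienReal.ev (clamp t) θ (L1 x) • ContinuousLinearMap.fst ℝ ℝ ℝ +
        wienReal.ev (clamp t) θ (L2 x) • ContinuousLinearMap.snd ℝ ℝ ℝ) (t, θ) := by
  obtain ⟨f, g, h⟩ := x
  set x := (f, g, h)
  let e (k : ℤ) (θ : ℝ) : ℂ := Complex.exp (k * θ * Complex.I)
  let V (k : ℤ) : ℝ → ℂ := modeV k ((f : Wien CI) k) ((g : Wien CI) k) ((h : Wien CI) k)
  let G (k : ℤ) (p : ℝ × ℝ) : ℂ := V k p.1 * e k p.2
  let G' (k : ℤ) (p : ℝ × ℝ) : ℝ × ℝ →L[ℝ] ℂ :=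
    (ContinuousLinearMap.fst ℝ ℝ ℝ).smulRight ((L1 x : Wien CI) k (clamp p.1) * e k p.2) +
    (ContinuousLinearMap.snd ℝ ℝ ℝ).smulRight ((L2 x : Wien CI) k (clamp p.1) * e k p.2)
  have hs : IsOpen (Ioo 0 T ×ˢ (univ : Set ℝ)) := isOpen_Ioo.prod isOpen_univ
  have hG : ∀ k, ∀ p ∈ Ioo 0 T ×ˢ (univ : Set ℝ), HasFDerivAt (G k) (G' k p) p := by
    intro k p hp
    have hp' : p.1 ∈ Icc 0 T := Ioo_subset_Icc_self hp.1
    have hV := (hasDerivAt_modeV k ((f : Wien CI) k) ((g : Wien CI) k) ((h : Wien CI) k) p.1)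
    have hV2 := hV.hasFDerivAt.comp p (ContinuousLinearMap.fst ℝ ℝ ℝ).hasFDerivAt
    have he : HasDerivAt (e k) (k * Complex.I * e k p.2) p.2 := by
      have h1 : HasDerivAt (fun θ : ℝ => (k * θ * Complex.I : ℂ)) (k * 1 * Complex.I) p.2 :=
        ((Complex.ofRealCLM.hasDerivAt (x := p.2)).const_mul (k : ℂ)).mul_const Complex.I
      refine h1.cexp.congr_deriv ?_
      simp only [e]; ring
    have he2 := he.hasFDerivAt.comp p (ContinuousLinearMap.snd ℝ ℝ ℝ).hasFDerivAt
    refine (hV2.mul he2).congr_fderiv ?_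
    ext
    · simp [G', x, hL.first, hL.second, coe_clamp hp']; ring
    · simp [G', x, hL.first, hL.second, coe_clamp hp']; ring
  let u (k : ℤ) : ℝ := ‖(L1 x : Wien CI) k‖ + ‖(L2 x : Wien CI) k‖
  have hu : Summable u := (L1 x : Wien CI).summable_norm.add (L2 x : Wien CI).summable_norm
  have hb : ∀ k, ∀ p ∈ Ioo 0 T ×ˢ (univ : Set ℝ), ‖G' k p‖ ≤ u k := by
    intro k p _
    refine (norm_add_le _ _).trans (add_le_add ?_ ?_)
    · rw [ContinuousLinearMap.norm_smulRight_apply, norm_mul, Wien.norm_exp_int, mul_one]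
      calc _ ≤ 1 * ‖(L1 x : Wien CI) k‖ :=
            mul_le_mul (ContinuousLinearMap.norm_fst_le ..) (norm_clamp_le _ _) (norm_nonneg _)
              zero_le_one
        _ = _ := one_mul _
    · rw [ContinuousLinearMap.norm_smulRight_apply, norm_mul, Wien.norm_exp_int, mul_one]
      calc _ ≤ 1 * ‖(L2 x : Wien CI) k‖ :=
            mul_le_mul (ContinuousLinearMap.norm_snd_le ..) (norm_clamp_le _ _) (norm_nonneg _)
              zero_le_one
        _ = _ := one_mul _
  have hmem : (t, θ) ∈ Ioo 0 T ×ˢ (univ : Set ℝ) := ⟨ht, trivial⟩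
  have hGe : ∀ k, ∀ p ∈ Ioo 0 T ×ˢ (univ : Set ℝ),
      G k p = (L0 x : Wien CI) k (clamp p.1) * e k p.2 := fun k p hp => by
    simp only [x, hL.zeroth, coe_clamp (Ioo_subset_Icc_self hp.1), G, V]
  have hsum0 : Summable fun k => G k (t, θ) := by
    simp only [hGe _ _ hmem]
    exact (Wien.summable_term (clamp t) θ (L0 x : Wien CI)).of_norm
  have key := hasFDerivAt_tsum_of_isPreconnected hu hs
    ((convex_Ioo 0 T).prod convex_univ).isPreconnected hG hb hmem hsum0 hmem
  have key2 := Complex.reCLM.hasFDerivAt.comp (t, θ) key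
  have hev : (fun p : ℝ × ℝ => wienReal.ev (clamp p.1) p.2 (L0 x)) =ᶠ[nhds (t, θ)]
      (Complex.reCLM ∘ fun p => ∑' k, G k p) := by
    filter_upwards [hs.mem_nhds hmem] with p hp
    rw [wienReal.ev_apply, Wien.evC, Function.comp_apply, Complex.reCLM_apply]
    congr 1
    exact tsum_congr fun k => (hGe k p hp).symm
  refine (key2.congr_of_eventuallyEq hev).congr_fderiv ?_
  have hsG : Summable fun k => G' k (t, θ) :=
    Summable.of_norm_bounded hu fun k => hb k _ hmem
  ext
  · simp only [ContinuousLinearMap.comp_apply, ContinuousLinearMap.inl_apply,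
      add_apply, smul_apply,
      ContinuousLinearMap.coe_fst', ContinuousLinearMap.coe_snd']
    erw [(ContinuousLinearMap.apply ℝ ℂ ((1 : ℝ), (0 : ℝ))).map_tsum hsG]
    simp [G', wienReal.ev_apply, Wien.evC, e]
  · simp only [ContinuousLinearMap.comp_apply, ContinuousLinearMap.inr_apply,
      add_apply, smul_apply,
      ContinuousLinearMap.coe_fst', ContinuousLinearMap.coe_snd']
    erw [(ContinuousLinearMap.apply ℝ ℂ ((0 : ℝ), (1 : ℝ))).map_tsum hsG]
    simp [G', wienReal.ev_apply, Wien.evC, e]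

end IsGreen

end greenOp

end

noncomputable section

section greenWeak

open MeasureTheory

variable {T : ℝ} [hT : Fact (0 < T)]

local notation "CI" => C(Icc (0 : ℝ) T, ℂ)
local notation "𝒜" => wienReal (Icc (0 : ℝ) T)

theorem continuous_iterated {E : Type*} [NormedAddCommGroup E] [NormedSpace ℝ E]
    {w : ℝ × ℝ → E} (hw : Continuous w) (a b : ℝ) :
    Continuous fun t => ∫ θ in a..b, w (t, θ) :=
  intervalIntegral.continuous_parametric_intervalIntegral_of_continuous' (by fun_prop) a b

theorem integral_swap_of_continuous {E : Type*} [NormedAddCommGroup E] [NormedSpace ℝ E]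
    {w : ℝ × ℝ → E} (hw : Continuous w) (a b c d : ℝ) :
    ∫ t in c..d, ∫ θ in a..b, w (t, θ) = ∫ θ in a..b, ∫ t in c..d, w (t, θ) := by
  refine intervalIntegral_intervalIntegral_swap (F := fun t θ => w (t, θ)) ?_
  have h : IntegrableOn w (uIcc c d ×ˢ uIcc a b) (volume.prod volume) :=
    hw.continuousOn.integrableOn_compact (isCompact_uIcc.prod isCompact_uIcc)
  exact h.mono_set (prod_mono uIoc_subset_uIcc uIoc_subset_uIcc)

theorem hasSum_pairing (e : Wien CI) {w : ℝ × ℝ → ℂ} (hw : Continuous w) {a b : ℝ} (hab : a ≤ b) :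
    HasSum (fun k : ℤ => ∫ t in (0 : ℝ)..T, ∫ θ in a..b,
      e k (clamp t) * Complex.exp (k * θ * Complex.I) * w (t, θ))
      (∫ t in (0 : ℝ)..T, ∫ θ in a..b, Wien.evC (clamp t) θ e * w (t, θ)) := by
  obtain ⟨M, hM⟩ := (isCompact_Icc.prod isCompact_Icc : IsCompact (Icc 0 T ×ˢ Icc a b)).exists_bound_of_continuousOn
    hw.continuousOn
  have hcont (k : ℤ) : Continuous fun p : ℝ × ℝ =>
      e k (clamp p.1) * Complex.exp (k * p.2 * Complex.I) * w p := by
    have := continuous_comp_clamp (e k)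
    fun_prop
  have hMb (t θ : ℝ) (ht : t ∈ uIoc 0 T) (hθ : θ ∈ uIoc a b) : ‖w (t, θ)‖ ≤ M := by
    rw [uIoc_of_le hT.out.le] at ht
    rw [uIoc_of_le hab] at hθ
    exact hM _ ⟨Ioc_subset_Icc_self ht, Ioc_subset_Icc_self hθ⟩
  have hterm (k : ℤ) (t θ : ℝ) (ht : t ∈ uIoc 0 T) (hθ : θ ∈ uIoc a b) :
      ‖e k (clamp t) * Complex.exp (k * θ * Complex.I) * w (t, θ)‖ ≤ ‖e k‖ * M := by
    rw [norm_mul, norm_mul, Wien.norm_exp_int, mul_one]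
    exact mul_le_mul (norm_clamp_le _ _) (hMb t θ ht hθ) (norm_nonneg _) (norm_nonneg _)
  refine intervalIntegral.hasSum_integral_of_dominated_convergence
    (fun k _ => ‖e k‖ * M * |b - a|) (fun k => ?_) (fun k => ?_) ?_ ?_ ?_
  · exact (continuous_iterated (hcont k) a b).aestronglyMeasurable
  · exact ae_of_all _ fun t ht =>
      intervalIntegral.norm_integral_le_of_norm_le_const fun θ hθ => hterm k t θ ht hθ
  · exact ae_of_all _ fun t ht => (e.summable_norm.mul_right M).mul_right _
  · exact intervalIntegrable_const
  · refine ae_of_all _ fun t ht => intervalIntegral.hasSum_integral_of_dominated_convergence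
      (fun k _ => ‖e k‖ * M) (fun k => ?_) (fun k => ae_of_all _ fun θ hθ => hterm k t θ ht hθ)
      ?_ ?_ ?_
    · exact ((hcont k).comp (by fun_prop : Continuous fun θ : ℝ => (t, θ))).aestronglyMeasurable
    · exact ae_of_all _ fun t ht => e.summable_norm.mul_right M
    · exact intervalIntegrable_const
    · exact ae_of_all _ fun θ hθ =>
        (Wien.summable_term (clamp t) θ e).of_norm.hasSum.mul_right _

/-- A single mode satisfies the weak equation. -/
theorem mode_weak (k : ℤ) (f g h : CI) {φ φt φθ : ℝ × ℝ → ℂ} (hφ : Continuous φ)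
    (hφt : Continuous φt) (hφθ : Continuous φθ)
    (hdt : ∀ t ∈ Ioo 0 T, ∀ θ, HasDerivAt (fun t => φ (t, θ)) (φt (t, θ)) t)
    (hdθ : ∀ t ∈ Ioo 0 T, ∀ θ, HasDerivAt (fun θ => φ (t, θ)) (φθ (t, θ)) θ)
    (h0 : ∀ θ, φ (0, θ) = 0) (hT0 : ∀ θ, φ (T, θ) = 0)
    (hper : ∀ t θ, φ (t, θ + 2 * π) = φ (t, θ)) (a : ℝ) :
    (∫ t in (0 : ℝ)..T, ∫ θ in a..a + 2 * π,
      modeS k f g h t * Complex.exp (k * θ * Complex.I) * φt (t, θ)) +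
    (∫ t in (0 : ℝ)..T, ∫ θ in a..a + 2 * π,
      (k * Complex.I * modeV k f g h t - g (clamp t)) * Complex.exp (k * θ * Complex.I) *
        φθ (t, θ)) +
    (∫ t in (0 : ℝ)..T, ∫ θ in a..a + 2 * π,
      h (clamp t) * Complex.exp (k * θ * Complex.I) * φ (t, θ)) = 0 := by
  have hS := continuous_modeS k f g h
  have hV := continuous_modeV k f g h
  have hgc := continuous_comp_clamp g
  have hhc := continuous_comp_clamp h
  have h1 : ∫ t in (0 : ℝ)..T, ∫ θ in a..a + 2 * π,
      modeS k f g h t * Complex.exp (k * θ * Complex.I) * φt (t, θ) =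
      ∫ t in (0 : ℝ)..T, ∫ θ in a..a + 2 * π,
        -((k ^ 2 * modeV k f g h t + k * Complex.I * g (clamp t) + h (clamp t)) *
          Complex.exp (k * θ * Complex.I) * φ (t, θ)) := by
    rw [integral_swap_of_continuous (w := fun p : ℝ × ℝ =>
        modeS k f g h p.1 * Complex.exp (k * p.2 * Complex.I) * φt p) (by fun_prop),
      integral_swap_of_continuous (w := fun p : ℝ × ℝ => -((k ^ 2 * modeV k f g h p.1 +
        k * Complex.I * g (clamp p.1) + h (clamp p.1)) *
          Complex.exp (k * p.2 * Complex.I) * φ p)) (by fun_prop)]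
    refine intervalIntegral.integral_congr fun θ _ => ?_
    have key := intervalIntegral.integral_mul_deriv_eq_deriv_mul_of_hasDerivAt
      (a := 0) (b := T) (u := fun t => modeS k f g h t * Complex.exp (k * θ * Complex.I))
      (u' := fun t => (k ^ 2 * modeV k f g h t + k * Complex.I * g (clamp t) + h (clamp t)) *
        Complex.exp (k * θ * Complex.I))
      (v := fun t => φ (t, θ)) (v' := fun t => φt (t, θ))
      (by fun_prop) (by fun_prop) (fun t _ => (hasDerivAt_modeS k f g h t).mul_const _)
      (fun t ht => hdt t (by rwa [min_eq_left hT.out.le, max_eq_right hT.out.le] at ht) θ)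
      (Continuous.intervalIntegrable (by fun_prop) _ _)
      (Continuous.intervalIntegrable (by fun_prop) _ _)
    simp only [h0, hT0, mul_zero, sub_zero, zero_sub] at key
    simp only [key, intervalIntegral.integral_neg]
  have h2 : ∫ t in (0 : ℝ)..T, ∫ θ in a..a + 2 * π,
      (k * Complex.I * modeV k f g h t - g (clamp t)) * Complex.exp (k * θ * Complex.I) *
        φθ (t, θ) =
      ∫ t in (0 : ℝ)..T, ∫ θ in a..a + 2 * π,
        (k ^ 2 * modeV k f g h t + k * Complex.I * g (clamp t)) *
          Complex.exp (k * θ * Complex.I) * φ (t, θ) := by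
    refine intervalIntegral.integral_congr_Ioo_of_le hT.out.le fun t ht => ?_
    have he (θ : ℝ) : HasDerivAt (fun θ : ℝ => Complex.exp (k * θ * Complex.I))
        (k * Complex.I * Complex.exp (k * θ * Complex.I)) θ := by
      have h1 : HasDerivAt (fun θ : ℝ => (k * θ * Complex.I : ℂ)) (k * 1 * Complex.I) θ :=
        ((Complex.ofRealCLM.hasDerivAt (x := θ)).const_mul (k : ℂ)).mul_const Complex.I
      refine h1.cexp.congr_deriv ?_
      ring
    have key := intervalIntegral.integral_mul_deriv_eq_deriv_mul
      (a := a) (b := a + 2 * π)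
      (u := fun θ => (k * Complex.I * modeV k f g h t - g (clamp t)) *
        Complex.exp (k * θ * Complex.I))
      (u' := fun θ => (k * Complex.I * modeV k f g h t - g (clamp t)) *
        (k * Complex.I * Complex.exp (k * θ * Complex.I)))
      (v := fun θ => φ (t, θ)) (v' := fun θ => φθ (t, θ))
      (fun θ _ => (he θ).const_mul _) (fun θ _ => hdθ t ht θ)
      (Continuous.intervalIntegrable (by fun_prop) _ _)
      (Continuous.intervalIntegrable (by fun_prop) _ _)
    have hexp : Complex.exp (k * ((a + 2 * π : ℝ) : ℂ) * Complex.I) =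
        Complex.exp (k * a * Complex.I) := by
      rw [show (k * ((a + 2 * π : ℝ) : ℂ) * Complex.I) =
        k * a * Complex.I + k * (2 * π * Complex.I) by push_cast; ring, Complex.exp_add,
        Complex.exp_int_mul_two_pi_mul_I, mul_one]
    simp only [hper, hexp, sub_self, zero_sub] at key
    simp only [key, ← intervalIntegral.integral_neg]
    refine intervalIntegral.integral_congr fun θ _ => ?_
    linear_combination (-(k : ℂ) ^ 2 * modeV k f g h t * Complex.exp (k * θ * Complex.I) *
      φ (t, θ)) * Complex.I_sq
  have hig {w : ℝ × ℝ → ℂ} (hw : Continuous w) : IntervalIntegrable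
      (fun t => ∫ θ in a..a + 2 * π, w (t, θ)) volume 0 T :=
    (continuous_iterated hw a _).intervalIntegrable _ _
  rw [h1, h2, ← intervalIntegral.integral_add
      (hig (w := fun p : ℝ × ℝ => -((k ^ 2 * modeV k f g h p.1 +
        k * Complex.I * g (clamp p.1) + h (clamp p.1)) *
          Complex.exp (k * p.2 * Complex.I) * φ p)) (by fun_prop))
      (hig (w := fun p : ℝ × ℝ => (k ^ 2 * modeV k f g h p.1 + k * Complex.I * g (clamp p.1)) *
          Complex.exp (k * p.2 * Complex.I) * φ p) (by fun_prop)), ← intervalIntegral.integral_add]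
  · refine (intervalIntegral.integral_congr fun t _ => ?_).trans intervalIntegral.integral_zero
    simp only
    rw [← intervalIntegral.integral_add (Continuous.intervalIntegrable (by fun_prop) _ _)
      (Continuous.intervalIntegrable (by fun_prop) _ _), ← intervalIntegral.integral_add
      (Continuous.intervalIntegrable (by fun_prop) _ _)
      (Continuous.intervalIntegrable (by fun_prop) _ _)]
    refine (intervalIntegral.integral_congr fun θ _ => ?_).trans intervalIntegral.integral_zero
    ring
  · exact (hig (w := fun p : ℝ × ℝ => -((k ^ 2 * modeV k f g h p.1 +
        k * Complex.I * g (clamp p.1) + h (clamp p.1)) *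
          Complex.exp (k * p.2 * Complex.I) * φ p)) (by fun_prop)).add
      (hig (w := fun p : ℝ × ℝ => (k ^ 2 * modeV k f g h p.1 + k * Complex.I * g (clamp p.1)) *
          Complex.exp (k * p.2 * Complex.I) * φ p) (by fun_prop))
  · exact hig (w := fun p : ℝ × ℝ => h (clamp p.1) * Complex.exp (k * p.2 * Complex.I) * φ p)
      (by fun_prop)

theorem continuous_ev_clamp (f : 𝒜) :
    Continuous fun p : ℝ × ℝ => wienReal.ev (clamp p.1) p.2 f :=
  (wienReal.continuous_ev f).comp (by fun_prop : Continuous fun p : ℝ × ℝ => (clamp p.1, p.2))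

theorem integral2_ofReal (w : ℝ × ℝ → ℝ) (a b c d : ℝ) :
    ((∫ t in a..b, ∫ θ in c..d, w (t, θ) : ℝ) : ℂ) =
      ∫ t in a..b, ∫ θ in c..d, (w (t, θ) : ℂ) := by
  rw [← intervalIntegral.integral_ofReal]
  simp only [intervalIntegral.integral_ofReal]

theorem integral2_add {w w' : ℝ × ℝ → ℝ} (hw : Continuous w) (hw' : Continuous w') (a b c d : ℝ) :
    ∫ t in a..b, ∫ θ in c..d, (w (t, θ) + w' (t, θ)) =
      (∫ t in a..b, ∫ θ in c..d, w (t, θ)) + ∫ t in a..b, ∫ θ in c..d, w' (t, θ) := by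
  rw [← intervalIntegral.integral_add ((continuous_iterated hw c d).intervalIntegrable _ _)
    ((continuous_iterated hw' c d).intervalIntegrable _ _)]
  refine intervalIntegral.integral_congr fun t _ => intervalIntegral.integral_add ?_ ?_ <;>
    exact Continuous.intervalIntegrable (by fun_prop) _ _

/-- The weak form of the equation solved by the Green operator. -/
theorem IsGreen.weak {L0 L1 L2 : 𝒜 × 𝒜 × 𝒜 →L[ℝ] 𝒜} (hL : IsGreen L0 L1 L2) (f g h : 𝒜)
    {φ φt φθ : ℝ × ℝ → ℝ} (hφ : Continuous φ)
    (hφt : Continuous φt) (hφθ : Continuous φθ)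
    (hdt : ∀ t ∈ Ioo 0 T, ∀ θ, HasDerivAt (fun t => φ (t, θ)) (φt (t, θ)) t)
    (hdθ : ∀ t ∈ Ioo 0 T, ∀ θ, HasDerivAt (fun θ => φ (t, θ)) (φθ (t, θ)) θ)
    (h0 : ∀ θ, φ (0, θ) = 0) (hT0 : ∀ θ, φ (T, θ) = 0)
    (hper : ∀ t θ, φ (t, θ + 2 * π) = φ (t, θ)) (a : ℝ) :
    ∫ t in (0 : ℝ)..T, ∫ θ in a..a + 2 * π,
      ((wienReal.ev (clamp t) θ (L1 (f, g, h)) - wienReal.ev (clamp t) θ f) * φt (t, θ) +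
       (wienReal.ev (clamp t) θ (L2 (f, g, h)) - wienReal.ev (clamp t) θ g) * φθ (t, θ) +
       wienReal.ev (clamp t) θ h * φ (t, θ)) = 0 := by
  have hab : a ≤ a + 2 * π := by linarith [Real.pi_pos]
  have s1 := hasSum_pairing ((L1 (f, g, h) - f : 𝒜) : Wien CI)
    (Complex.continuous_ofReal.comp hφt) hab
  have s2 := hasSum_pairing ((L2 (f, g, h) - g : 𝒜) : Wien CI)
    (Complex.continuous_ofReal.comp hφθ) hab
  have s3 := hasSum_pairing (h : Wien CI) (Complex.continuous_ofReal.comp hφ) hab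
  have hsum := ((s1.add s2).add s3)
  have hz : ∀ k : ℤ, _ := fun k => mode_weak k ((f : Wien CI) k) ((g : Wien CI) k)
    ((h : Wien CI) k) (Complex.continuous_ofReal.comp hφ) (Complex.continuous_ofReal.comp hφt)
    (Complex.continuous_ofReal.comp hφθ) (fun t ht θ => (hdt t ht θ).ofReal_comp)
    (fun t ht θ => (hdθ t ht θ).ofReal_comp) (fun θ => by simp [h0]) (fun θ => by simp [hT0])
    (fun t θ => by simp [hper]) a
  have e1 (k : ℤ) (t : ℝ) (ht : t ∈ uIcc 0 T) :
      ((L1 (f, g, h) - f : 𝒜) : Wien CI) k (clamp t) =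
        modeS k ((f : Wien CI) k) ((g : Wien CI) k) ((h : Wien CI) k) t := by
    rw [uIcc_of_le hT.out.le] at ht
    rw [Subalgebra.coe_sub, Wien.sub_apply, ContinuousMap.sub_apply, hL.first, coe_clamp ht]; ring
  have e2 (k : ℤ) (t : ℝ) (ht : t ∈ uIcc 0 T) :
      ((L2 (f, g, h) - g : 𝒜) : Wien CI) k (clamp t) =
        k * Complex.I * modeV k ((f : Wien CI) k) ((g : Wien CI) k) ((h : Wien CI) k) t -
          (g : Wien CI) k (clamp t) := by
    rw [uIcc_of_le hT.out.le] at ht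
    rw [Subalgebra.coe_sub, Wien.sub_apply, ContinuousMap.sub_apply, hL.second, coe_clamp ht]
  have htot := HasSum.tsum_eq hsum
  rw [tsum_congr (g := fun _ => 0) fun k => ?_, tsum_zero] at htot
  swap
  · refine Eq.trans (congrArg₂ _ (congrArg₂ _ ?_ ?_) rfl) (hz k)
    · exact intervalIntegral.integral_congr fun t ht =>
        intervalIntegral.integral_congr fun θ _ => by simp only [e1 k t ht]
    · exact intervalIntegral.integral_congr fun t ht =>
        intervalIntegral.integral_congr fun θ _ => by simp only [e2 k t ht]
  replace htot := htot.symm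
  have conv (F : 𝒜) (ψ : ℝ × ℝ → ℝ) :
      ∫ t in (0 : ℝ)..T, ∫ θ in a..a + 2 * π, Wien.evC (clamp t) θ (F : Wien CI) *
        (Complex.ofReal ∘ ψ) (t, θ) =
      ((∫ t in (0 : ℝ)..T, ∫ θ in a..a + 2 * π, wienReal.ev (clamp t) θ F * ψ (t, θ) : ℝ) : ℂ) := by
    rw [integral2_ofReal (fun p => wienReal.ev (clamp p.1) p.2 F * ψ p)]
    simp only [Complex.ofReal_mul, wienReal.ofReal_ev, Function.comp_apply]
  rw [conv, conv, conv, ← Complex.ofReal_add, ← Complex.ofReal_add, Complex.ofReal_eq_zero] at htot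
  have c1 := (continuous_ev_clamp (L1 (f, g, h) - f)).mul hφt
  have c2 := (continuous_ev_clamp (L2 (f, g, h) - g)).mul hφθ
  have c3 := (continuous_ev_clamp h).mul hφ
  have e := (integral2_add (c1.add c2) c3 0 T a (a + 2 * π)).trans
    (congrArg (· + _) (integral2_add c1 c2 0 T a (a + 2 * π)))
  simp only [map_sub] at e htot
  exact e.trans htot

end greenWeak

end

noncomputable section

section cutoff

open MeasureTheory

theorem smoothTransition_deriv_bound :
    ∃ C > 0, ∀ x, |deriv smoothTransition x| ≤ C := by
  have hc : Continuous (deriv smoothTransition) :=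
    (smoothTransition.contDiff (n := 1)).continuous_deriv le_rfl
  obtain ⟨C, hC⟩ := (isCompact_Icc : IsCompact (Icc (0 : ℝ) 1)).exists_bound_of_continuousOn
    hc.continuousOn
  refine ⟨max C 1, by positivity, fun x => ?_⟩
  rcases lt_trichotomy x 0 with hx | hx | hx
  · have : smoothTransition =ᶠ[nhds x] fun _ => 0 := by
      filter_upwards [Iio_mem_nhds hx] with y hy
      exact smoothTransition.zero_of_nonpos (le_of_lt hy)
    rw [this.deriv_eq]; simp
  · exact (hC x (by simp [hx])).trans (le_max_left _ _)
  · by_cases h1 : x ≤ 1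
    · exact (hC x ⟨hx.le, h1⟩).trans (le_max_left _ _)
    · have : smoothTransition =ᶠ[nhds x] fun _ => 1 := by
        filter_upwards [Ioi_mem_nhds (not_le.1 h1)] with y hy
        exact smoothTransition.one_of_one_le (le_of_lt hy)
      rw [this.deriv_eq]; simp

theorem hasDerivAt_smoothTransition (x : ℝ) :
    HasDerivAt smoothTransition (deriv smoothTransition x) x :=
  (((smoothTransition.contDiff (n := 1)).differentiable (by norm_num)) x).hasDerivAt

theorem deriv_smoothTransition_eq_zero {x : ℝ} (hx : x < 0 ∨ 1 < x) :
    deriv smoothTransition x = 0 := by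
  rcases hx with hx | hx
  · have : smoothTransition =ᶠ[nhds x] fun _ => 0 := by
      filter_upwards [Iio_mem_nhds hx] with y hy
      exact smoothTransition.zero_of_nonpos (le_of_lt hy)
    rw [this.deriv_eq]; simp
  · have : smoothTransition =ᶠ[nhds x] fun _ => 1 := by
      filter_upwards [Ioi_mem_nhds hx] with y hy
      exact smoothTransition.one_of_one_le (le_of_lt hy)
    rw [this.deriv_eq]; simp

/-- A periodic squared distance to the point `(t0, θ0)`. -/
def perSq (t0 θ0 : ℝ) (y : ℝ × ℝ) : ℝ := (y.1 - t0) ^ 2 + (2 - 2 * cos (y.2 - θ0))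

@[fun_prop]
theorem continuous_perSq (t0 θ0 : ℝ) : Continuous (perSq t0 θ0) := by
  unfold perSq; fun_prop

theorem perSq_nonneg (t0 θ0 : ℝ) (y : ℝ × ℝ) : 0 ≤ perSq t0 θ0 y := by
  have := cos_le_one (y.2 - θ0); unfold perSq; nlinarith [sq_nonneg (y.1 - t0)]

theorem perSq_add_period (t0 θ0 t θ : ℝ) : perSq t0 θ0 (t, θ + 2 * π) = perSq t0 θ0 (t, θ) := by
  simp only [perSq]; rw [show θ + 2 * π - θ0 = (θ - θ0) + 2 * π by ring, cos_add_two_pi]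

theorem sq_fst_le_perSq (t0 θ0 : ℝ) (y : ℝ × ℝ) : (y.1 - t0) ^ 2 ≤ perSq t0 θ0 y := by
  have := cos_le_one (y.2 - θ0); unfold perSq; linarith

theorem sq_sin_le_perSq (t0 θ0 : ℝ) (y : ℝ × ℝ) : sin (y.2 - θ0) ^ 2 ≤ perSq t0 θ0 y := by
  have := cos_le_one (y.2 - θ0)
  have := sin_sq_add_cos_sq (y.2 - θ0)
  unfold perSq; nlinarith [sq_nonneg (y.1 - t0)]

theorem sq_snd_le_perSq (t0 θ0 : ℝ) {y : ℝ × ℝ} (hy : |y.2 - θ0| ≤ π) :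
    (y.2 - θ0) ^ 2 ≤ 4 * perSq t0 θ0 y := by
  have h1 : cos (y.2 - θ0) ≤ 1 - 2 / π ^ 2 * (y.2 - θ0) ^ 2 := cos_le_one_sub_mul_cos_sq hy
  have h2 : π ^ 2 ≤ 16 := by nlinarith [pi_le_four, pi_pos]
  have h3 : 1 / 8 ≤ 2 / π ^ 2 := by rw [div_le_div_iff₀ (by norm_num) (by positivity)]; linarith
  unfold perSq; nlinarith [sq_nonneg (y.1 - t0), sq_nonneg (y.2 - θ0)]

theorem exists_periodic_cutoff (t0 θ0 : ℝ) : ∃ C > 0, ∀ δ > 0, ∃ χ χt χθ : ℝ × ℝ → ℝ,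
    Continuous χ ∧ Continuous χt ∧ Continuous χθ ∧
    (∀ t θ, HasDerivAt (fun t => χ (t, θ)) (χt (t, θ)) t) ∧
    (∀ t θ, HasDerivAt (fun θ => χ (t, θ)) (χθ (t, θ)) θ) ∧
    (∀ t θ, χ (t, θ + 2 * π) = χ (t, θ)) ∧ (∀ y, 0 ≤ χ y ∧ χ y ≤ 1) ∧
    (∀ y, perSq t0 θ0 y < δ ^ 2 → χ y = 0 ∧ χt y = 0 ∧ χθ y = 0) ∧
    (∀ y, 2 * δ ^ 2 < perSq t0 θ0 y → χ y = 1 ∧ χt y = 0 ∧ χθ y = 0) ∧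
    (∀ y, |χt y| ≤ C / δ ∧ |χθ y| ≤ C / δ) := by
  obtain ⟨C, hC, hCb⟩ := smoothTransition_deriv_bound
  have hc : Continuous (deriv smoothTransition) :=
    (smoothTransition.contDiff (n := 1)).continuous_deriv le_rfl
  have hst : Continuous smoothTransition := smoothTransition.continuous
  refine ⟨4 * C, by positivity, fun δ hδ => ?_⟩
  have hlow {y} (h : perSq t0 θ0 y < δ ^ 2) : perSq t0 θ0 y / δ ^ 2 - 1 < 0 := by
    rw [sub_neg, div_lt_one (by positivity)]; exact h
  have hhigh {y} (h : 2 * δ ^ 2 < perSq t0 θ0 y) : 1 < perSq t0 θ0 y / δ ^ 2 - 1 := by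
    rw [lt_sub_iff_add_lt, lt_div_iff₀ (by positivity)]; linarith
  have hb (y : ℝ × ℝ) (s : ℝ) (hs : s ^ 2 ≤ perSq t0 θ0 y) :
      |deriv smoothTransition (perSq t0 θ0 y / δ ^ 2 - 1) * (2 * s / δ ^ 2)| ≤ 4 * C / δ := by
    by_cases h : 2 * δ ^ 2 < perSq t0 θ0 y
    · rw [deriv_smoothTransition_eq_zero (Or.inr (hhigh h)), zero_mul, abs_zero]; positivity
    · have h1 : |s| ≤ 2 * δ := abs_le_of_sq_le_sq (by nlinarith) (by positivity)
      rw [abs_mul, abs_div, abs_mul, abs_two, abs_of_pos (by positivity : 0 < δ ^ 2)]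
      calc _ ≤ C * (2 * (2 * δ) / δ ^ 2) := by gcongr; exact hCb _
        _ = 4 * C / δ := by field_simp; ring
  refine ⟨fun y => smoothTransition (perSq t0 θ0 y / δ ^ 2 - 1),
    fun y => deriv smoothTransition (perSq t0 θ0 y / δ ^ 2 - 1) * (2 * (y.1 - t0) / δ ^ 2),
    fun y => deriv smoothTransition (perSq t0 θ0 y / δ ^ 2 - 1) * (2 * sin (y.2 - θ0) / δ ^ 2),
    by fun_prop, by fun_prop, by fun_prop, fun t θ => ?_, fun t θ => ?_, fun t θ => ?_,
    fun y => ⟨smoothTransition.nonneg _, smoothTransition.le_one _⟩, fun y hy => ?_, fun y hy => ?_,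
    fun y => ⟨hb y _ (sq_fst_le_perSq t0 θ0 y), hb y _ (sq_sin_le_perSq t0 θ0 y)⟩⟩
  · refine (hasDerivAt_smoothTransition _).comp t
      (h := fun t => perSq t0 θ0 (t, θ) / δ ^ 2 - 1) (HasDerivAt.sub_const 1 ?_)
    refine HasDerivAt.div_const ?_ (δ ^ 2)
    have := ((((hasDerivAt_id t).sub_const t0).fun_pow 2).add_const (2 - 2 * cos (θ - θ0)))
    refine this.congr_deriv ?_
    simp
  · refine (hasDerivAt_smoothTransition _).comp θ
      (h := fun θ => perSq t0 θ0 (t, θ) / δ ^ 2 - 1) (HasDerivAt.sub_const 1 ?_)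
    refine HasDerivAt.div_const ?_ (δ ^ 2)
    have := ((((hasDerivAt_id θ).sub_const θ0).cos.const_mul 2).const_sub 2).const_add ((t - t0) ^ 2)
    refine this.congr_deriv ?_
    simp
  · simp only [perSq_add_period]
  · simp only [deriv_smoothTransition_eq_zero (Or.inl (hlow hy)),
      smoothTransition.zero_of_nonpos (hlow hy).le, zero_mul, and_self]
  · simp only [deriv_smoothTransition_eq_zero (Or.inr (hhigh hy)),
      smoothTransition.one_of_one_le (hhigh hy).le, zero_mul, and_self]

end cutoff

end

noncomputable section

section energy

open MeasureTheory Filter Topology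

/-- Test functions on the cylinder, vanishing on the boundary and near one point. -/
structure IsTest (T t0 θ0 : ℝ) (φ φt φθ : ℝ × ℝ → ℝ) : Prop where
  cont : Continuous φ
  cont_fst : Continuous φt
  cont_snd : Continuous φθ
  dfst : ∀ t ∈ Ioo 0 T, ∀ θ, HasDerivAt (fun t => φ (t, θ)) (φt (t, θ)) t
  dsnd : ∀ t ∈ Ioo 0 T, ∀ θ, HasDerivAt (fun θ => φ (t, θ)) (φθ (t, θ)) θ
  zero : ∀ θ, φ (0, θ) = 0
  right : ∀ θ, φ (T, θ) = 0
  periodic : ∀ t θ, φ (t, θ + 2 * π) = φ (t, θ)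
  off : ∃ δ > 0, ∀ y, perSq t0 θ0 y < δ → φ y = 0 ∧ φt y = 0 ∧ φθ y = 0

theorem continuous_mul_of_vanish {t0 θ0 : ℝ} {g χ : ℝ × ℝ → ℝ}
    (hg : ContinuousOn g {y | perSq t0 θ0 y ≠ 0}) (hχ : Continuous χ) {δ : ℝ} (hδ : 0 < δ)
    (hv : ∀ y, perSq t0 θ0 y < δ → χ y = 0) : Continuous fun y => g y * χ y := by
  have ho : IsOpen {y | perSq t0 θ0 y ≠ 0} := isOpen_ne_fun (by fun_prop) (by fun_prop)
  refine continuous_iff_continuousAt.2 fun y => ?_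
  by_cases hy : perSq t0 θ0 y = 0
  · have : (fun y => g y * χ y) =ᶠ[𝓝 y] fun _ => 0 := by
      have : {z | perSq t0 θ0 z < δ} ∈ 𝓝 y :=
        (isOpen_lt (by fun_prop) (by fun_prop)).mem_nhds (by simpa [hy] using hδ)
      filter_upwards [this] with z hz
      rw [hv z hz, mul_zero]
    exact continuousAt_const.congr this.symm
  · exact (hg.continuousAt (ho.mem_nhds hy)).mul hχ.continuousAt

theorem sq_integral_le {g : ℝ → ℝ} (hg : Continuous g) {t T : ℝ} (ht : 0 < t) (htT : t ≤ T) :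
    (∫ s in (0 : ℝ)..t, g s) ^ 2 ≤ T * ∫ s in (0 : ℝ)..T, g s ^ 2 := by
  set J := ∫ s in (0 : ℝ)..t, g s with hJ
  have h0 : 0 ≤ ∫ s in (0 : ℝ)..t, (g s - J / t) ^ 2 :=
    intervalIntegral.integral_nonneg ht.le fun s _ => sq_nonneg _
  have h1 : ∫ s in (0 : ℝ)..t, (g s - J / t) ^ 2 =
      (∫ s in (0 : ℝ)..t, g s ^ 2) - 2 * (J / t) * J + t * (J / t) ^ 2 := by
    have : ∀ s, (g s - J / t) ^ 2 = g s ^ 2 - 2 * (J / t) * g s + (J / t) ^ 2 := fun s => by ring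
    simp only [this]
    rw [intervalIntegral.integral_add, intervalIntegral.integral_sub,
      intervalIntegral.integral_const_mul, intervalIntegral.integral_const]
    · simp [hJ]
    all_goals exact Continuous.intervalIntegrable (by fun_prop) _ _
  have h2 : (∫ s in (0 : ℝ)..t, g s ^ 2) ≤ ∫ s in (0 : ℝ)..T, g s ^ 2 :=
    intervalIntegral.integral_mono_interval le_rfl ht.le htT (ae_of_all _ fun s => sq_nonneg _)
      (Continuous.intervalIntegrable (by fun_prop) _ _)
  have h3 : J ^ 2 ≤ t * ∫ s in (0 : ℝ)..t, g s ^ 2 := by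
    have : t * (2 * (J / t) * J - t * (J / t) ^ 2) = J ^ 2 := by field_simp; ring
    nlinarith
  have h4 : 0 ≤ ∫ s in (0 : ℝ)..T, g s ^ 2 :=
    intervalIntegral.integral_nonneg (ht.le.trans htT) fun s _ => sq_nonneg _
  nlinarith

/-- The measure on one period of the cylinder. -/
def cellMeasure (T a : ℝ) : Measure (ℝ × ℝ) :=
  (volume.restrict (Ioc 0 T)).prod (volume.restrict (Ioc a (a + 2 * π)))

instance (T a : ℝ) : IsFiniteMeasure (cellMeasure T a) := by
  unfold cellMeasure; infer_instance

theorem cellMeasure_eq (T a : ℝ) :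
    cellMeasure T a = volume.restrict (Ioc 0 T ×ˢ Ioc a (a + 2 * π)) := by
  rw [cellMeasure, Measure.prod_restrict]; rfl

theorem integral_cell {T : ℝ} (hT : 0 ≤ T) (a : ℝ) {g : ℝ × ℝ → ℝ}
    (hg : Integrable g (cellMeasure T a)) :
    ∫ t in (0 : ℝ)..T, ∫ θ in a..a + 2 * π, g (t, θ) = ∫ y, g y ∂cellMeasure T a := by
  rw [cellMeasure, integral_prod g hg, intervalIntegral.integral_of_le hT]
  simp only [intervalIntegral.integral_of_le (by linarith [pi_pos] : a ≤ a + 2 * π)]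

theorem integral_cell_swap (T a : ℝ) {g : ℝ × ℝ → ℝ}
    (hg : Integrable g (cellMeasure T a)) :
    ∫ θ in Ioc a (a + 2 * π), ∫ t in Ioc 0 T, g (t, θ) = ∫ y, g y ∂cellMeasure T a := by
  rw [cellMeasure, integral_prod_symm g hg]

theorem cellMeasure_perSq_zero (T a t0 θ0 : ℝ) : ∀ᵐ y ∂cellMeasure T a, perSq t0 θ0 y ≠ 0 := by
  rw [cellMeasure_eq]
  refine ae_restrict_of_ae (measure_mono_null (t := {t0} ×ˢ univ) (fun y hy => ?_) ?_)
  · have h1 : perSq t0 θ0 y = 0 := by simpa using hy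
    have := sq_fst_le_perSq t0 θ0 y
    have : (y.1 - t0) = 0 := by nlinarith
    simp only [mem_prod, mem_singleton_iff, mem_univ, and_true]; linarith
  · rw [Measure.volume_eq_prod, Measure.prod_prod]; simp

theorem cellMeasure_perSq_le (T t0 θ0 : ℝ) {δ : ℝ} (hδ : 0 < δ) :
    (cellMeasure T (θ0 - π)).real {y | perSq t0 θ0 y ≤ 2 * δ ^ 2} ≤ 24 * δ ^ 2 := by
  have hsub : {y | perSq t0 θ0 y ≤ 2 * δ ^ 2} ∩ (Ioc 0 T ×ˢ Ioc (θ0 - π) (θ0 - π + 2 * π)) ⊆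
      Icc (t0 - 2 * δ) (t0 + 2 * δ) ×ˢ Icc (θ0 - 3 * δ) (θ0 + 3 * δ) := by
    rintro y ⟨hy, -, h2⟩
    simp only [mem_Ioc] at h2
    replace hy : perSq t0 θ0 y ≤ 2 * δ ^ 2 := hy
    have h1 : |y.1 - t0| ≤ 2 * δ :=
      abs_le_of_sq_le_sq (by nlinarith [sq_fst_le_perSq t0 θ0 y]) (by positivity)
    have h3 : |y.2 - θ0| ≤ 3 * δ := by
      refine abs_le_of_sq_le_sq ?_ (by positivity)
      have := sq_snd_le_perSq t0 θ0 (y := y) (abs_le.2 ⟨by linarith, by linarith⟩)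
      nlinarith
    rw [abs_le] at h1 h3
    exact ⟨⟨by linarith, by linarith⟩, ⟨by linarith, by linarith⟩⟩
  have hm : MeasurableSet {y | perSq t0 θ0 y ≤ 2 * δ ^ 2} :=
    (isClosed_le (by fun_prop) (by fun_prop)).measurableSet
  rw [cellMeasure_eq, Measure.real, Measure.restrict_apply hm]
  refine ENNReal.toReal_le_of_le_ofReal (by positivity) ((measure_mono hsub).trans ?_)
  rw [Measure.volume_eq_prod, Measure.prod_prod, Real.volume_Icc, Real.volume_Icc,
    ← ENNReal.ofReal_mul (by linarith)]
  exact ENNReal.ofReal_le_ofReal (by nlinarith)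


theorem energy_uniqueness {T : ℝ} (hT : 0 < T) (t0 θ0 : ℝ) {w w1 w2 F1 F2 h : ℝ × ℝ → ℝ}
    {M ε A : ℝ} (hw : Continuous w) (hper : ∀ t θ, w (t, θ + 2 * π) = w (t, θ))
    (hw0 : ∀ θ, w (0, θ) = 0) (hwT : ∀ θ, w (T, θ) = 0)
    (cw1 : ContinuousOn w1 {y | perSq t0 θ0 y ≠ 0}) (cw2 : ContinuousOn w2 {y | perSq t0 θ0 y ≠ 0})
    (cF1 : ContinuousOn F1 {y | perSq t0 θ0 y ≠ 0}) (cF2 : ContinuousOn F2 {y | perSq t0 θ0 y ≠ 0})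
    (ch : ContinuousOn h {y | perSq t0 θ0 y ≠ 0})
    (hM : ∀ y, perSq t0 θ0 y ≠ 0 → |w y| ≤ M ∧ |w1 y| ≤ M ∧ |w2 y| ≤ M ∧ |F1 y| ≤ M ∧
      |F2 y| ≤ M ∧ |h y| ≤ M)
    (hdt : ∀ t ∈ Ioo 0 T, ∀ θ, perSq t0 θ0 (t, θ) ≠ 0 →
      HasDerivAt (fun t => w (t, θ)) (w1 (t, θ)) t)
    (hdθ : ∀ t ∈ Ioo 0 T, ∀ θ, perSq t0 θ0 (t, θ) ≠ 0 →
      HasDerivAt (fun θ => w (t, θ)) (w2 (t, θ)) θ)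
    (hweak : ∀ φ φt φθ, IsTest T t0 θ0 φ φt φθ →
      ∫ t in (0 : ℝ)..T, ∫ θ in (θ0 - π)..θ0 - π + 2 * π,
        (F1 (t, θ) * φt (t, θ) + F2 (t, θ) * φθ (t, θ) + h (t, θ) * φ (t, θ)) = 0)
    (hcoer : ∀ t ∈ Ioo 0 T, ∀ θ, perSq t0 θ0 (t, θ) ≠ 0 → ε * w1 (t, θ) ^ 2 ≤
      F1 (t, θ) * w1 (t, θ) + F2 (t, θ) * w2 (t, θ) + h (t, θ) * w (t, θ) + A * w (t, θ) ^ 2)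
    (hA : 0 ≤ A) (hsmall : A * T ^ 2 < ε) : ∀ t ∈ Icc 0 T, ∀ θ, w (t, θ) = 0 := by
  set a := θ0 - π with ha
  set ν := cellMeasure T a with hν
  have hae : ∀ᵐ y ∂ν, perSq t0 θ0 y ≠ 0 := cellMeasure_perSq_zero T a t0 θ0
  obtain ⟨C, hC, hcut⟩ := exists_periodic_cutoff t0 θ0
  let d (n : ℕ) : ℝ := 1 / ((n : ℝ) + 1)
  have hd (n) : 0 < d n := by positivity
  choose χ χt χθ cχ cχt cχθ dχt dχθ pχ bχ zχ oχ gχ using fun n : ℕ => hcut (d n) (hd n)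
  have hd0 : Tendsto d atTop (𝓝 0) := tendsto_one_div_add_atTop_nhds_zero_nat
  have hχlim (y) (hy : perSq t0 θ0 y ≠ 0) : ∀ᶠ n in atTop, χ n y = 1 := by
    have hpos : 0 < perSq t0 θ0 y := lt_of_le_of_ne (perSq_nonneg _ _ _) (Ne.symm hy)
    have : Tendsto (fun n => 2 * d n ^ 2) atTop (𝓝 0) := by simpa using (hd0.pow 2).const_mul 2
    filter_upwards [this.eventually_lt_const hpos] with n hn
    exact (oχ n y hn).1
  have hmul {g : ℝ × ℝ → ℝ} (cg : ContinuousOn g {y | perSq t0 θ0 y ≠ 0}) (n : ℕ) :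
      Continuous fun y => g y * χ n y :=
    continuous_mul_of_vanish cg (cχ n) (pow_pos (hd n) 2) fun y hy => (zχ n y hy).1
  have hmult {g : ℝ × ℝ → ℝ} (cg : ContinuousOn g {y | perSq t0 θ0 y ≠ 0}) (n : ℕ) :
      Continuous fun y => g y * χt n y :=
    continuous_mul_of_vanish cg (cχt n) (pow_pos (hd n) 2) fun y hy => (zχ n y hy).2.1
  have hmulθ {g : ℝ × ℝ → ℝ} (cg : ContinuousOn g {y | perSq t0 θ0 y ≠ 0}) (n : ℕ) :
      Continuous fun y => g y * χθ n y :=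
    continuous_mul_of_vanish cg (cχθ n) (pow_pos (hd n) 2) fun y hy => (zχ n y hy).2.2
  have hlim {g : ℝ × ℝ → ℝ} (y) (hy : perSq t0 θ0 y ≠ 0) :
      Tendsto (fun n => g y * χ n y) atTop (𝓝 (g y)) := by
    refine tendsto_const_nhds.congr' ?_
    filter_upwards [hχlim y hy] with n hn
    rw [hn, mul_one]
  have hbd {g : ℝ × ℝ → ℝ} {B : ℝ} (hB : ∀ y, perSq t0 θ0 y ≠ 0 → |g y| ≤ B) (n : ℕ) :
      ∀ᵐ y ∂ν, ‖g y * χ n y‖ ≤ B := by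
    filter_upwards [hae] with y hy
    rw [norm_mul, norm_eq_abs, norm_eq_abs, abs_of_nonneg (bχ n y).1]
    exact (mul_le_of_le_one_right (abs_nonneg _) (bχ n y).2).trans (hB y hy)
  have hig {g : ℝ × ℝ → ℝ} {B : ℝ} (cg : ContinuousOn g {y | perSq t0 θ0 y ≠ 0})
      (hB : ∀ y, perSq t0 θ0 y ≠ 0 → |g y| ≤ B) : Integrable g ν := by
    refine Integrable.of_bound (aestronglyMeasurable_of_tendsto_ae atTop
      (f := fun n y => g y * χ n y) (fun n => (hmul cg n).aestronglyMeasurable) ?_) B ?_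
    · filter_upwards [hae] with y hy using hlim y hy
    · filter_upwards [hae] with y hy using hB y hy
  have hconv {g : ℝ × ℝ → ℝ} {B : ℝ} (cg : ContinuousOn g {y | perSq t0 θ0 y ≠ 0})
      (hB : ∀ y, perSq t0 θ0 y ≠ 0 → |g y| ≤ B) :
      Tendsto (fun n => ∫ y, g y * χ n y ∂ν) atTop (𝓝 (∫ y, g y ∂ν)) :=
    tendsto_integral_of_dominated_convergence (fun _ => B)
      (fun n => (hmul cg n).aestronglyMeasurable) (integrable_const B) (hbd hB)
      (by filter_upwards [hae] with y hy using hlim y hy)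
  have hM0 : 0 ≤ M := by
    have : perSq t0 θ0 (t0 + 1, θ0) ≠ 0 := by simp [perSq]
    exact (abs_nonneg _).trans (hM _ this).1
  have hmm {x y : ℝ} (hx : |x| ≤ M) (hy : |y| ≤ M) : |x * y| ≤ M * M := by
    rw [abs_mul]; exact mul_le_mul hx hy (abs_nonneg _) hM0
  -- the tested identity in the limit
  set E : ℝ × ℝ → ℝ := fun y => F1 y * w1 y + F2 y * w2 y + h y * w y with hE
  have cE : ContinuousOn E {y | perSq t0 θ0 y ≠ 0} :=
    ((cF1.mul cw1).add (cF2.mul cw2)).add (ch.mul hw.continuousOn)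
  have bE : ∀ y, perSq t0 θ0 y ≠ 0 → |E y| ≤ 3 * (M * M) := fun y hy => by
    obtain ⟨h0, h1, h2, h3, h4, h5⟩ := hM y hy
    have := abs_add_three (F1 y * w1 y) (F2 y * w2 y) (h y * w y)
    linarith [hmm h3 h1, hmm h4 h2, hmm h5 h0]
  have hEn (n : ℕ) : |∫ y, E y * χ n y ∂ν| ≤ 2 * (M * M) * (C / d n) * (24 * d n ^ 2) := by
    have htest : IsTest T t0 θ0 (fun y => w y * χ n y) (fun y => w1 y * χ n y + w y * χt n y)
        (fun y => w2 y * χ n y + w y * χθ n y) := by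
      refine ⟨hw.mul (cχ n), (hmul cw1 n).add (hw.mul (cχt n)), (hmul cw2 n).add (hw.mul (cχθ n)),
        fun t ht θ => ?_, fun t ht θ => ?_, fun θ => by simp [hw0], fun θ => by simp [hwT],
        fun t θ => by simp only [hper, pχ], d n ^ 2, pow_pos (hd n) 2, fun y hy => ?_⟩
      · by_cases hy : perSq t0 θ0 (t, θ) = 0
        · have hn : ∀ᶠ s in 𝓝 t, perSq t0 θ0 (s, θ) < d n ^ 2 :=
            (by fun_prop : Continuous fun s : ℝ => perSq t0 θ0 (s, θ)).continuousAt.eventually_lt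
              continuousAt_const (by rw [hy]; exact pow_pos (hd n) 2)
          have h0 := zχ n (t, θ) hn.self_of_nhds
          simp only [h0.1, h0.2.1, mul_zero, add_zero]
          refine (hasDerivAt_const t (0 : ℝ)).congr_of_eventuallyEq ?_
          filter_upwards [hn] with s hs
          rw [(zχ n (s, θ) hs).1, mul_zero]
        · exact (hdt t ht θ hy).mul (dχt n t θ)
      · by_cases hy : perSq t0 θ0 (t, θ) = 0
        · have hn : ∀ᶠ s in 𝓝 θ, perSq t0 θ0 (t, s) < d n ^ 2 :=
            (by fun_prop : Continuous fun s : ℝ => perSq t0 θ0 (t, s)).continuousAt.eventually_lt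
              continuousAt_const (by rw [hy]; exact pow_pos (hd n) 2)
          have h0 := zχ n (t, θ) hn.self_of_nhds
          simp only [h0.1, h0.2.2, mul_zero, add_zero]
          refine (hasDerivAt_const θ (0 : ℝ)).congr_of_eventuallyEq ?_
          filter_upwards [hn] with s hs
          rw [(zχ n (t, s) hs).1, mul_zero]
        · exact (hdθ t ht θ hy).mul (dχθ n t θ)
      · simp only [zχ n y hy, mul_zero, add_zero, and_self]
    have hI := hweak _ _ _ htest
    set S : ℝ × ℝ → ℝ := fun y => w y * (F1 y * χt n y) + w y * (F2 y * χθ n y) with hS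
    have cS : Continuous S := (hw.mul (hmult cF1 n)).add (hw.mul (hmulθ cF2 n))
    have hbox {y} (hy : perSq t0 θ0 y ≠ 0) : |S y| ≤ {y | perSq t0 θ0 y ≤ 2 * d n ^ 2}.indicator
        (fun _ => 2 * (M * M) * (C / d n)) y := by
      by_cases hb : perSq t0 θ0 y ≤ 2 * d n ^ 2
      · rw [indicator_of_mem (by exact hb)]
        obtain ⟨h0, h1, h2, h3, h4, h5⟩ := hM y hy
        have e1 : |w y * (F1 y * χt n y)| ≤ M * M * (C / d n) := by
          rw [← mul_assoc, abs_mul]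
          exact mul_le_mul (hmm h0 h3) (gχ n y).1 (abs_nonneg _) (by positivity)
        have e2 : |w y * (F2 y * χθ n y)| ≤ M * M * (C / d n) := by
          rw [← mul_assoc, abs_mul]
          exact mul_le_mul (hmm h0 h4) (gχ n y).2 (abs_nonneg _) (by positivity)
        exact (abs_add_le _ _).trans (by linarith)
      · rw [indicator_of_notMem (by exact hb)]
        have := oχ n y (not_le.1 hb)
        simp [hS, this.2.1, this.2.2]
    have bS : ∀ y, perSq t0 θ0 y ≠ 0 → |S y| ≤ 2 * (M * M) * (C / d n) := fun y hy =>
      (hbox hy).trans (indicator_le_self' (fun _ _ => by have := hd n; positivity) _)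
    have hsum : ∀ y, F1 y * (w1 y * χ n y + w y * χt n y) + F2 y * (w2 y * χ n y + w y * χθ n y) +
        h y * (w y * χ n y) = E y * χ n y + S y := fun y => by simp only [hE, hS]; ring
    simp only [hsum] at hI
    have iE : Integrable (fun y => E y * χ n y) ν :=
      Integrable.of_bound (hmul cE n).aestronglyMeasurable _ (hbd bE n)
    have iS : Integrable S ν := hig cS.continuousOn bS
    have hI' : ∫ y, (E y * χ n y + S y) ∂ν = 0 :=
      (integral_cell hT.le a (g := fun y => E y * χ n y + S y) (iE.add iS)).symm.trans hI
    rw [integral_add iE iS] at hI'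
    rw [eq_neg_of_add_eq_zero_left hI', abs_neg]
    have hm : MeasurableSet {y | perSq t0 θ0 y ≤ 2 * d n ^ 2} :=
      (isClosed_le (by fun_prop) (by fun_prop)).measurableSet
    calc |∫ y, S y ∂ν| ≤ ∫ y, |S y| ∂ν := abs_integral_le_integral_abs
      _ ≤ ∫ y, {y | perSq t0 θ0 y ≤ 2 * d n ^ 2}.indicator
          (fun _ => 2 * (M * M) * (C / d n)) y ∂ν :=
        integral_mono_ae iS.abs ((integrable_const _).indicator hm)
          (by filter_upwards [hae] with y hy using hbox hy)
      _ = ν.real {y | perSq t0 θ0 y ≤ 2 * d n ^ 2} * (2 * (M * M) * (C / d n)) := by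
        rw [integral_indicator_const _ hm, smul_eq_mul]
      _ ≤ (24 * d n ^ 2) * (2 * (M * M) * (C / d n)) := by
        have := hd n
        gcongr
        exact cellMeasure_perSq_le T t0 θ0 this
      _ = _ := by ring
  have hE0 : ∫ y, E y ∂ν = 0 := by
    refine tendsto_nhds_unique (hconv cE bE) (squeeze_zero_norm hEn ?_)
    have : Tendsto (fun n => 48 * (M * M) * C * d n) atTop (𝓝 0) := by
      simpa using hd0.const_mul (48 * (M * M) * C)
    refine this.congr fun n => ?_
    have := hd n
    field_simp; ring
  -- Poincaré
  have bsq {x : ℝ} (hx : |x| ≤ M) : |x ^ 2| ≤ M * M := by rw [pow_two]; exact hmm hx hx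
  have iw : Integrable (fun y => w y ^ 2) ν :=
    hig (hw.pow 2).continuousOn fun y hy => bsq (hM y hy).1
  have iw1 : Integrable (fun y => w1 y ^ 2) ν := hig (cw1.pow 2) fun y hy => bsq (hM y hy).2.1
  have hpoin : ∫ y, w y ^ 2 ∂ν ≤ T ^ 2 * ∫ y, w1 y ^ 2 ∂ν := by
    rw [hν, ← integral_cell_swap T a iw, ← integral_cell_swap T a iw1, ← integral_const_mul]
    refine integral_mono_ae iw.integral_prod_right (iw1.integral_prod_right.const_mul _) ?_
    have hne : ∀ᵐ θ ∂volume.restrict (Ioc a (a + 2 * π)), θ ≠ θ0 :=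
      ae_restrict_of_ae (by simp [ae_iff])
    filter_upwards [hne, ae_restrict_mem measurableSet_Ioc] with θ hθ hθm
    have hoff (t : ℝ) : perSq t0 θ0 (t, θ) ≠ 0 := fun h0 => by
      have := sq_snd_le_perSq t0 θ0 (y := (t, θ))
        (abs_le.2 ⟨by simp only; linarith [hθm.1], by simp only; linarith [hθm.2]⟩)
      rw [h0] at this
      exact hθ (by simp only at this; nlinarith)
    have cg : Continuous fun t => w1 (t, θ) := by
      rw [← continuousOn_univ]
      exact cw1.comp (by fun_prop : Continuous fun t : ℝ => (t, θ)).continuousOn fun t _ => hoff t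
    have hFTC (t : ℝ) (ht : t ∈ Ioc 0 T) : w (t, θ) ^ 2 ≤ T * ∫ s in (0 : ℝ)..T, w1 (s, θ) ^ 2 := by
      have : ∫ s in (0 : ℝ)..t, w1 (s, θ) = w (t, θ) - w (0, θ) :=
        intervalIntegral.integral_eq_sub_of_hasDerivAt_of_le ht.1.le
          (by fun_prop : Continuous fun s => w (s, θ)).continuousOn
          (fun s hs => hdt s ⟨hs.1, hs.2.trans_le ht.2⟩ θ (hoff s)) (cg.intervalIntegrable _ _)
      rw [hw0, sub_zero] at this
      rw [← this]
      exact sq_integral_le cg ht.1 ht.2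
    calc ∫ t in Ioc 0 T, w (t, θ) ^ 2 ≤ ∫ t in Ioc 0 T, T * ∫ s in (0 : ℝ)..T, w1 (s, θ) ^ 2 := by
          refine setIntegral_mono_on ?_ (integrableOn_const (by simp)) measurableSet_Ioc hFTC
          exact (Continuous.integrableOn_Icc (by fun_prop)).mono_set Ioc_subset_Icc_self
      _ = T ^ 2 * ∫ t in Ioc 0 T, w1 (t, θ) ^ 2 := by
          rw [setIntegral_const, intervalIntegral.integral_of_le hT.le]
          simp [Measure.real, hT.le]; ring
  have hw1nn : 0 ≤ ∫ y, w1 y ^ 2 ∂ν := integral_nonneg fun y => sq_nonneg _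
  have hwnn : 0 ≤ ∫ y, w y ^ 2 ∂ν := integral_nonneg fun y => sq_nonneg _
  have hIoo : ∀ᵐ y ∂ν, y.1 ∈ Ioo 0 T := by
    rw [hν, cellMeasure_eq]
    have hnull : ∀ᵐ y : ℝ × ℝ, y.1 ≠ T := by
      rw [ae_iff]
      refine measure_mono_null (t := {T} ×ˢ univ) (fun y hy => by simpa using hy) ?_
      rw [Measure.volume_eq_prod, Measure.prod_prod]; simp
    filter_upwards [ae_restrict_of_ae hnull,
      ae_restrict_mem (measurableSet_Ioc.prod measurableSet_Ioc)] with y hy hm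
    exact ⟨hm.1.1, lt_of_le_of_ne hm.1.2 hy⟩
  have hcoer' : ε * ∫ y, w1 y ^ 2 ∂ν ≤ (∫ y, E y ∂ν) + A * ∫ y, w y ^ 2 ∂ν := by
    rw [← integral_const_mul, ← integral_const_mul, ← integral_add (hig cE bE) (iw.const_mul A)]
    refine integral_mono_ae (iw1.const_mul ε) ((hig cE bE).add (iw.const_mul A)) ?_
    filter_upwards [hae, hIoo] with y hy hm using hcoer y.1 hm y.2 hy
  rw [hE0, zero_add] at hcoer'
  have hz1 : ∫ y, w1 y ^ 2 ∂ν = 0 := by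
    have := mul_le_mul_of_nonneg_left hpoin hA
    nlinarith
  have hz : ∫ y, w y ^ 2 ∂ν = 0 := le_antisymm (by simpa [hz1] using hpoin) hwnn
  have hzae : (fun y => w y ^ 2) =ᵐ[ν] 0 := (integral_eq_zero_iff_of_nonneg
    (fun y => sq_nonneg _) iw).1 hz
  have hopen : IsOpen (Ioo 0 T ×ˢ Ioo a (a + 2 * π)) := isOpen_Ioo.prod isOpen_Ioo
  have hzero : EqOn (fun y => w y ^ 2) 0 (Ioo 0 T ×ˢ Ioo a (a + 2 * π)) := by
    refine Measure.eqOn_open_of_ae_eq (μ := volume) ?_ hopen (hw.pow 2).continuousOn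
      continuousOn_const
    rw [hν, cellMeasure_eq] at hzae
    exact ae_restrict_of_ae_restrict_of_subset
      (prod_mono Ioo_subset_Ioc_self Ioo_subset_Ioc_self) hzae
  have hclos : EqOn (fun y => w y ^ 2) 0 (Icc 0 T ×ˢ Icc a (a + 2 * π)) := by
    refine hzero.of_subset_closure (hw.pow 2).continuousOn continuousOn_const
      (prod_mono Ioo_subset_Icc_self Ioo_subset_Icc_self) ?_
    rw [closure_prod_eq, closure_Ioo hT.ne, closure_Ioo (by linarith [pi_pos])]
  intro t ht θ
  have hp : Function.Periodic (fun θ => w (t, θ)) (2 * π) := fun θ => hper t θ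
  obtain ⟨θ', hθ', he⟩ := hp.exists_mem_Ico (by positivity) θ a
  have := hclos (mk_mem_prod ht (Ico_subset_Icc_self hθ'))
  rw [he]
  simpa using this

end energy

end

noncomputable section

section flux

open MeasureTheory Filter Topology

/-- The area element `√(1 + p² + q²)`. -/
def area (p q : ℝ) : ℝ := √(1 + p ^ 2 + q ^ 2)

theorem one_le_area (p q : ℝ) : 1 ≤ area p q := by
  unfold area; rw [Real.one_le_sqrt]; nlinarith [sq_nonneg p, sq_nonneg q]

theorem area_pos (p q : ℝ) : 0 < area p q := one_pos.trans_le (one_le_area p q)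

theorem area_sq (p q : ℝ) : area p q ^ 2 = 1 + p ^ 2 + q ^ 2 :=
  sq_sqrt (by positivity)

@[fun_prop]
theorem continuous_area {X : Type*} [TopologicalSpace X] {p q : X → ℝ} (hp : Continuous p)
    (hq : Continuous q) : Continuous fun x => area (p x) (q x) := by
  unfold area; fun_prop

theorem abs_area_sub_le (p q p' q' : ℝ) : |area p q - area p' q'| ≤ |p - p'| + |q - q'| := by
  have h1 := area_sq p q
  have h2 := area_sq p' q'
  have h3 := one_le_area p q
  have h4 := one_le_area p' q'
  have hp : |p| ≤ area p q := abs_le_of_sq_le_sq (by nlinarith) (by linarith)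
  have hq : |q| ≤ area p q := abs_le_of_sq_le_sq (by nlinarith) (by linarith)
  have hp' : |p'| ≤ area p' q' := abs_le_of_sq_le_sq (by nlinarith) (by linarith)
  have hq' : |q'| ≤ area p' q' := abs_le_of_sq_le_sq (by nlinarith) (by linarith)
  have key : (area p q + area p' q') * |area p q - area p' q'| ≤
      (area p q + area p' q') * (|p - p'| + |q - q'|) := by
    rw [← abs_of_pos (by linarith : 0 < area p q + area p' q'), ← abs_mul,
      abs_of_pos (by linarith : 0 < area p q + area p' q')]
    have e : (area p q + area p' q') * (area p q - area p' q') =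
      (p + p') * (p - p') + (q + q') * (q - q') := by nlinarith
    rw [e]
    refine (abs_add_le _ _).trans ?_
    rw [abs_mul, abs_mul, mul_add]
    have a1 : |p + p'| ≤ area p q + area p' q' := (abs_add_le _ _).trans (by linarith)
    have a2 : |q + q'| ≤ area p q + area p' q' := (abs_add_le _ _).trans (by linarith)
    gcongr
  exact le_of_mul_le_mul_left key (by linarith)

/-- Strict monotonicity of the minimal surface flux. -/
theorem flux_monotone {p q p' q' B : ℝ} (h : area p q ≤ B) (h' : area p' q' ≤ B) :
    ((p - p') ^ 2 + (q - q') ^ 2) / B ^ 3 ≤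
      (p / area p q - p' / area p' q') * (p - p') + (q / area p q - q' / area p' q') * (q - q') := by
  have h1 := area_sq p q
  have h2 := area_sq p' q'
  have h3 := one_le_area p q
  have h4 := one_le_area p' q'
  set W := area p q
  set W' := area p' q'
  have hW : 0 < W := by linarith
  have hW' : 0 < W' := by linarith
  have hB : 0 < B := by linarith
  set d := (p - p') ^ 2 + (q - q') ^ 2 with hd
  have hd0 : 0 ≤ d := by positivity
  have e : (p / W - p' / W') * (p - p') + (q / W - q' / W') * (q - q') =
      (1 / W + 1 / W') * (W * W' - (1 + p * p' + q * q')) := by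
    field_simp
    linear_combination (-W' ) * h1 - W * h2
  have hc : 1 + p * p' + q * q' ≤ W * W' := by
    refine abs_le_of_sq_le_sq' ?_ (by positivity) |>.2
    rw [mul_pow, h1, h2]
    nlinarith [sq_nonneg (p * q' - q * p')]
  have hk : d ≤ 2 * (W * W') * (W * W' - (1 + p * p' + q * q')) := by
    have : d ≤ (W * W') ^ 2 - (1 + p * p' + q * q') ^ 2 := by
      rw [mul_pow, h1, h2]
      nlinarith [sq_nonneg (p * q' - q * p')]
    nlinarith
  rw [e]
  have hWW : W * W' ≤ B * B := mul_le_mul h h' hW'.le hB.le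
  have s1 : 1 / B ≤ 1 / W := one_div_le_one_div_of_le hW h
  have s2 : 1 / B ≤ 1 / W' := one_div_le_one_div_of_le hW' h'
  have s3 : d / (2 * (B * B)) ≤ W * W' - (1 + p * p' + q * q') := by
    rw [div_le_iff₀ (by positivity)]
    nlinarith
  calc d / B ^ 3 = (1 / B + 1 / B) * (d / (2 * (B * B))) := by field_simp; ring
    _ ≤ _ := by gcongr

/-- The right-hand side of the divergence-form equation. -/
def rhs (α x1 x2 v p q : ℝ) : ℝ :=
  α * (v - x1 * p - x2 * q) / ((x1 ^ 2 + x2 ^ 2 + v ^ 2) * area p q)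

theorem rhs_lipschitz {R m : ℝ} (hR : 0 ≤ R) (hm : 0 < m) (α : ℝ) : ∃ C ≥ 0, ∀ x1 x2 v v' p q p' q',
    |x1| ≤ R → |x2| ≤ R → |v| ≤ R → |v'| ≤ R → |p| ≤ R → |q| ≤ R → |p'| ≤ R → |q'| ≤ R →
    m ≤ x1 ^ 2 + x2 ^ 2 + v ^ 2 → m ≤ x1 ^ 2 + x2 ^ 2 + v' ^ 2 →
    |rhs α x1 x2 v p q - rhs α x1 x2 v' p' q'| ≤ C * (|v - v'| + (|p - p'| + |q - q'|)) := by
  refine ⟨|α| * ((1 + R) * m⁻¹ + (R + 2 * R ^ 2) * (m⁻¹ * m⁻¹ * (2 * R)) + (R + 2 * R ^ 2) * m⁻¹),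
    by positivity, ?_⟩
  intro x1 x2 v v' p q p' q' h1 h2 hv hv' hp hq hp' hq' hD hD'
  set D := x1 ^ 2 + x2 ^ 2 + v ^ 2 with hDd
  set D' := x1 ^ 2 + x2 ^ 2 + v' ^ 2 with hDd'
  have hD0 : 0 < D := hm.trans_le hD
  have hD0' : 0 < D' := hm.trans_le hD'
  have e : rhs α x1 x2 v p q - rhs α x1 x2 v' p' q' =
      α * (((v - v') - x1 * (p - p') - x2 * (q - q')) * D⁻¹ * (area p q)⁻¹ +
        (v' - x1 * p' - x2 * q') * (D⁻¹ - D'⁻¹) * (area p q)⁻¹ +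
        (v' - x1 * p' - x2 * q') * D'⁻¹ * ((area p q)⁻¹ - (area p' q')⁻¹)) := by
    simp only [rhs, div_eq_mul_inv, mul_inv]; ring
  have a1 : |(area p q)⁻¹| ≤ 1 := by
    rw [abs_of_pos (inv_pos.2 (area_pos _ _))]; exact inv_le_one_of_one_le₀ (one_le_area _ _)
  have a1' : |(area p' q')⁻¹| ≤ 1 := by
    rw [abs_of_pos (inv_pos.2 (area_pos _ _))]; exact inv_le_one_of_one_le₀ (one_le_area _ _)
  have a2 : |D⁻¹| ≤ m⁻¹ := by rw [abs_of_pos (inv_pos.2 hD0)]; exact inv_anti₀ hm hD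
  have a2' : |D'⁻¹| ≤ m⁻¹ := by rw [abs_of_pos (inv_pos.2 hD0')]; exact inv_anti₀ hm hD'
  set d := |p - p'| + |q - q'| with hd
  have a3 : |(area p q)⁻¹ - (area p' q')⁻¹| ≤ d := by
    have : (area p q)⁻¹ - (area p' q')⁻¹ =
        (area p' q' - area p q) * ((area p q)⁻¹ * (area p' q')⁻¹) := by
      have := (area_pos p q).ne'
      have := (area_pos p' q').ne'
      field_simp
    rw [this, abs_mul, abs_mul, abs_sub_comm]
    calc _ ≤ d * (1 * 1) := by gcongr; exact abs_area_sub_le _ _ _ _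
      _ = d := by ring
  have a4 : |D⁻¹ - D'⁻¹| ≤ m⁻¹ * m⁻¹ * (2 * R) * |v - v'| := by
    have : D⁻¹ - D'⁻¹ = D⁻¹ * D'⁻¹ * ((v' + v) * (v' - v)) := by
      field_simp
      rw [hDd, hDd']; ring
    rw [this, abs_mul, abs_mul, abs_mul, abs_sub_comm v', mul_assoc _ (2 * R)]
    have : |v' + v| ≤ 2 * R := (abs_add_le _ _).trans (by linarith)
    gcongr
  have a5 : |v' - x1 * p' - x2 * q'| ≤ R + 2 * R ^ 2 := by
    have b1 : |x1 * p'| ≤ R * R := by rw [abs_mul]; gcongr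
    have b2 : |x2 * q'| ≤ R * R := by rw [abs_mul]; gcongr
    have := abs_sub (v' - x1 * p') (x2 * q')
    have := abs_sub v' (x1 * p')
    nlinarith
  have a6 : |(v - v') - x1 * (p - p') - x2 * (q - q')| ≤ (1 + R) * (|v - v'| + d) := by
    have b1 : |x1 * (p - p')| ≤ R * |p - p'| := by rw [abs_mul]; gcongr
    have b2 : |x2 * (q - q')| ≤ R * |q - q'| := by rw [abs_mul]; gcongr
    have := abs_sub ((v - v') - x1 * (p - p')) (x2 * (q - q'))
    have := abs_sub (v - v') (x1 * (p - p'))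
    have : 0 ≤ d := by positivity
    have : 0 ≤ R * |v - v'| := by positivity
    nlinarith
  set g := |v - v'| + d with hg
  have hd0 : 0 ≤ d := by positivity
  have hdg : d ≤ g := by rw [hg]; linarith [abs_nonneg (v - v')]
  have hvg : |v - v'| ≤ g := by rw [hg]; linarith
  have hg0 : 0 ≤ g := hd0.trans hdg
  rw [e, abs_mul, mul_assoc |α|]
  refine mul_le_mul_of_nonneg_left ?_ (abs_nonneg α)
  refine (abs_add_three _ _ _).trans ?_
  simp only [abs_mul]
  calc _ ≤ ((1 + R) * g) * m⁻¹ * 1 + (R + 2 * R ^ 2) * (m⁻¹ * m⁻¹ * (2 * R) * g) * 1 +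
      (R + 2 * R ^ 2) * m⁻¹ * g := by
        gcongr
        · exact a4.trans (by gcongr)
        · exact a3.trans hdg
    _ = _ := by ring

theorem weak_of_strong {T : ℝ} (hT : 0 < T) {t0 θ0 a : ℝ} {F1 F2 G1 G2 : ℝ × ℝ → ℝ}
    (cF1 : ContinuousOn F1 {y | perSq t0 θ0 y ≠ 0}) (cF2 : ContinuousOn F2 {y | perSq t0 θ0 y ≠ 0})
    (cG1 : ContinuousOn G1 {y | perSq t0 θ0 y ≠ 0}) (cG2 : ContinuousOn G2 {y | perSq t0 θ0 y ≠ 0})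
    (dF1 : ∀ t ∈ Ioo 0 T, ∀ θ, perSq t0 θ0 (t, θ) ≠ 0 →
      HasDerivAt (fun t => F1 (t, θ)) (G1 (t, θ)) t)
    (dF2 : ∀ t ∈ Ioo 0 T, ∀ θ, perSq t0 θ0 (t, θ) ≠ 0 →
      HasDerivAt (fun θ => F2 (t, θ)) (G2 (t, θ)) θ)
    (pF2 : ∀ t θ, F2 (t, θ + 2 * π) = F2 (t, θ))
    {φ φt φθ : ℝ × ℝ → ℝ} (hφ : IsTest T t0 θ0 φ φt φθ) :
    ∫ t in (0 : ℝ)..T, ∫ θ in a..a + 2 * π,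
      (F1 (t, θ) * φt (t, θ) + F2 (t, θ) * φθ (t, θ) + (G1 (t, θ) + G2 (t, θ)) * φ (t, θ)) = 0 := by
  obtain ⟨δ, hδ, hv⟩ := hφ.off
  have m0 {g : ℝ × ℝ → ℝ} (cg : ContinuousOn g {y | perSq t0 θ0 y ≠ 0}) :
      Continuous fun y => g y * φ y := continuous_mul_of_vanish cg hφ.cont hδ fun y hy => (hv y hy).1
  have mt {g : ℝ × ℝ → ℝ} (cg : ContinuousOn g {y | perSq t0 θ0 y ≠ 0}) :
      Continuous fun y => g y * φt y :=
    continuous_mul_of_vanish cg hφ.cont_fst hδ fun y hy => (hv y hy).2.1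
  have mθ {g : ℝ × ℝ → ℝ} (cg : ContinuousOn g {y | perSq t0 θ0 y ≠ 0}) :
      Continuous fun y => g y * φθ y :=
    continuous_mul_of_vanish cg hφ.cont_snd hδ fun y hy => (hv y hy).2.2
  have c1 : Continuous fun y => G1 y * φ y + F1 y * φt y := (m0 cG1).add (mt cF1)
  have c2 : Continuous fun y => G2 y * φ y + F2 y * φθ y := (m0 cG2).add (mθ cF2)
  have d1 (t) (ht : t ∈ Ioo 0 T) (θ) : HasDerivAt (fun t => F1 (t, θ) * φ (t, θ))
      (G1 (t, θ) * φ (t, θ) + F1 (t, θ) * φt (t, θ)) t := by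
    by_cases hy : perSq t0 θ0 (t, θ) = 0
    · have hn : ∀ᶠ s in 𝓝 t, perSq t0 θ0 (s, θ) < δ :=
        (by fun_prop : Continuous fun s : ℝ => perSq t0 θ0 (s, θ)).continuousAt.eventually_lt
          continuousAt_const (by rwa [hy])
      have h0 := hv (t, θ) hn.self_of_nhds
      simp only [h0.1, h0.2.1, mul_zero, add_zero]
      refine (hasDerivAt_const t (0 : ℝ)).congr_of_eventuallyEq ?_
      filter_upwards [hn] with s hs
      rw [(hv (s, θ) hs).1, mul_zero]
    · exact (dF1 t ht θ hy).mul (hφ.dfst t ht θ)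
  have d2 (t) (ht : t ∈ Ioo 0 T) (θ) : HasDerivAt (fun θ => F2 (t, θ) * φ (t, θ))
      (G2 (t, θ) * φ (t, θ) + F2 (t, θ) * φθ (t, θ)) θ := by
    by_cases hy : perSq t0 θ0 (t, θ) = 0
    · have hn : ∀ᶠ s in 𝓝 θ, perSq t0 θ0 (t, s) < δ :=
        (by fun_prop : Continuous fun s : ℝ => perSq t0 θ0 (t, s)).continuousAt.eventually_lt
          continuousAt_const (by rwa [hy])
      have h0 := hv (t, θ) hn.self_of_nhds
      simp only [h0.1, h0.2.2, mul_zero, add_zero]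
      refine (hasDerivAt_const θ (0 : ℝ)).congr_of_eventuallyEq ?_
      filter_upwards [hn] with s hs
      rw [(hv (t, s) hs).1, mul_zero]
    · exact (dF2 t ht θ hy).mul (hφ.dsnd t ht θ)
  have i1 : ∫ t in (0 : ℝ)..T, ∫ θ in a..a + 2 * π, (G1 (t, θ) * φ (t, θ) + F1 (t, θ) * φt (t, θ))
      = 0 := by
    rw [integral_swap_of_continuous c1]
    refine (intervalIntegral.integral_congr fun θ _ => ?_).trans intervalIntegral.integral_zero
    have := intervalIntegral.integral_eq_sub_of_hasDerivAt_of_le hT.le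
      ((m0 cF1).comp (by fun_prop : Continuous fun t : ℝ => (t, θ))).continuousOn
      (fun t ht => d1 t ht θ)
      ((c1.comp (by fun_prop : Continuous fun t : ℝ => (t, θ))).intervalIntegrable _ _)
    simpa [hφ.zero, hφ.right] using this
  have i2 : ∫ t in (0 : ℝ)..T, ∫ θ in a..a + 2 * π, (G2 (t, θ) * φ (t, θ) + F2 (t, θ) * φθ (t, θ))
      = 0 := by
    refine (intervalIntegral.integral_congr_Ioo_of_le hT.le fun t ht => ?_).trans
      intervalIntegral.integral_zero
    have := intervalIntegral.integral_eq_sub_of_hasDerivAt (a := a) (b := a + 2 * π)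
      (fun θ _ => d2 t ht θ)
      ((c2.comp (by fun_prop : Continuous fun θ : ℝ => (t, θ))).intervalIntegrable _ _)
    simpa [hφ.periodic, pF2] using this
  have := integral2_add c1 c2 0 T a (a + 2 * π)
  rw [i1, i2, add_zero] at this
  refine Eq.trans ?_ this
  refine intervalIntegral.integral_congr fun t _ => intervalIntegral.integral_congr fun θ _ => ?_
  ring

end flux

end

noncomputable section

section chart

open MeasureTheory Filter Topology

local notation "dfst" => ContinuousLinearMap.fst ℝ ℝ ℝ
local notation "dsnd" => ContinuousLinearMap.snd ℝ ℝ ℝ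

/-- `f` solves the equation off `q0` in a ball, with first derivatives `p, q` and second
derivatives `r, s, t`, and with quantitative bounds. -/
structure PuncturedSol (α : ℝ) (q0 : ℝ × ℝ) (δ K R m : ℝ) (f p q r s t : ℝ × ℝ → ℝ) : Prop where
  cont : ContinuousOn f (Metric.ball q0 δ)
  df : ∀ x ∈ Metric.ball q0 δ, x ≠ q0 → HasFDerivAt f (p x • dfst + q x • dsnd) x
  dp : ∀ x ∈ Metric.ball q0 δ, x ≠ q0 → HasFDerivAt p (r x • dfst + s x • dsnd) x
  dq : ∀ x ∈ Metric.ball q0 δ, x ≠ q0 → HasFDerivAt q (s x • dfst + t x • dsnd) x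
  cr : ContinuousOn r (Metric.ball q0 δ \ {q0})
  cs : ContinuousOn s (Metric.ball q0 δ \ {q0})
  ct : ContinuousOn t (Metric.ball q0 δ \ {q0})
  bp : ∀ x ∈ Metric.ball q0 δ, x ≠ q0 → |p x| ≤ K
  bq : ∀ x ∈ Metric.ball q0 δ, x ≠ q0 → |q x| ≤ K
  bx : ∀ x ∈ Metric.ball q0 δ, |x.1| ≤ R ∧ |x.2| ≤ R ∧ |f x| ≤ R ∧
    m ≤ x.1 ^ 2 + x.2 ^ 2 + f x ^ 2
  eq : ∀ x ∈ Metric.ball q0 δ, x ≠ q0 → (1 + q x ^ 2) * r x - 2 * p x * q x * s x +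
    (1 + p x ^ 2) * t x = rhs α x.1 x.2 (f x) (p x) (q x) * area (p x) (q x) ^ 3

/-- A periodic chart `X` of the cylinder with first derivatives `A = ∂ₜX`, `B = ∂_θ X`
and mixed derivative `C`, in the interior of `[0, T] × ℝ`. -/
structure IsChart (T : ℝ) (X1 X2 A1 A2 B1 B2 C1 C2 : ℝ × ℝ → ℝ) : Prop where
  cX1 : Continuous X1
  cX2 : Continuous X2
  cA1 : Continuous A1
  cA2 : Continuous A2
  cB1 : Continuous B1
  cB2 : Continuous B2
  cC1 : Continuous C1
  cC2 : Continuous C2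
  dtX1 : ∀ t ∈ Ioo 0 T, ∀ θ, HasDerivAt (fun t => X1 (t, θ)) (A1 (t, θ)) t
  dtX2 : ∀ t ∈ Ioo 0 T, ∀ θ, HasDerivAt (fun t => X2 (t, θ)) (A2 (t, θ)) t
  dθX1 : ∀ t ∈ Ioo 0 T, ∀ θ, HasDerivAt (fun θ => X1 (t, θ)) (B1 (t, θ)) θ
  dθX2 : ∀ t ∈ Ioo 0 T, ∀ θ, HasDerivAt (fun θ => X2 (t, θ)) (B2 (t, θ)) θ
  dtB1 : ∀ t ∈ Ioo 0 T, ∀ θ, HasDerivAt (fun t => B1 (t, θ)) (C1 (t, θ)) t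
  dtB2 : ∀ t ∈ Ioo 0 T, ∀ θ, HasDerivAt (fun t => B2 (t, θ)) (C2 (t, θ)) t
  dθA1 : ∀ t ∈ Ioo 0 T, ∀ θ, HasDerivAt (fun θ => A1 (t, θ)) (C1 (t, θ)) θ
  dθA2 : ∀ t ∈ Ioo 0 T, ∀ θ, HasDerivAt (fun θ => A2 (t, θ)) (C2 (t, θ)) θ
  pX1 : ∀ t θ, X1 (t, θ + 2 * π) = X1 (t, θ)
  pX2 : ∀ t θ, X2 (t, θ + 2 * π) = X2 (t, θ)
  pA1 : ∀ t θ, A1 (t, θ + 2 * π) = A1 (t, θ)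
  pA2 : ∀ t θ, A2 (t, θ + 2 * π) = A2 (t, θ)

theorem area_comm (p q : ℝ) : area p q = area q p := by
  unfold area; congr 1; ring

theorem hasFDerivAt_flux {p q : ℝ × ℝ → ℝ} {r s s' t : ℝ} {x : ℝ × ℝ}
    (hp : HasFDerivAt p (r • dfst + s • dsnd) x) (hq : HasFDerivAt q (s' • dfst + t • dsnd) x) :
    HasFDerivAt (fun x => p x / area (p x) (q x))
      ((((1 + q x ^ 2) * r - p x * q x * s') / area (p x) (q x) ^ 3) • dfst +
        (((1 + q x ^ 2) * s - p x * q x * t) / area (p x) (q x) ^ 3) • dsnd) x := by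
  have hW := area_pos (p x) (q x)
  have hsq := area_sq (p x) (q x)
  have hA : HasFDerivAt (fun x => area (p x) (q x))
      ((1 / (2 * area (p x) (q x))) • ((2 * p x) • (r • dfst + s • dsnd) +
        (2 * q x) • (s' • dfst + t • dsnd))) x := by
    have h1 : HasFDerivAt (fun x => 1 + p x ^ 2 + q x ^ 2)
        ((2 * p x) • (r • dfst + s • dsnd) + (2 * q x) • (s' • dfst + t • dsnd)) x := by
      refine (((hp.pow 2).const_add 1).add (hq.pow 2)).congr_fderiv ?_
      simp
    exact h1.sqrt (by positivity)
  refine (hp.mul ((hasDerivAt_inv hW.ne').comp_hasFDerivAt x hA)).congr_fderiv ?_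
    |>.congr_of_eventuallyEq ?_
  · ext
    · simp
      field_simp
      rw [hsq]; ring
    · simp
      field_simp
      rw [hsq]; ring
  · exact Eventually.of_forall fun y => by simp [div_eq_mul_inv]

theorem HasFDerivAt.comp_curve {g : ℝ × ℝ → ℝ} {u v : ℝ} {X1 X2 : ℝ → ℝ} {A1 A2 t : ℝ}
    (hg : HasFDerivAt g (u • dfst + v • dsnd) (X1 t, X2 t)) (h1 : HasDerivAt X1 A1 t)
    (h2 : HasDerivAt X2 A2 t) : HasDerivAt (fun t => g (X1 t, X2 t)) (u * A1 + v * A2) t := by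
  refine (hg.comp_hasDerivAt t (h1.prodMk h2)).congr_deriv ?_
  simp

theorem abs_flux_le_one (p q : ℝ) : |p / area p q| ≤ 1 := by
  rw [abs_div, abs_of_pos (area_pos p q), div_le_one (area_pos p q)]
  exact abs_le_of_sq_le_sq (by nlinarith [area_sq p q]) (area_pos p q).le

theorem area_le_of_abs_le {p q K : ℝ} (hp : |p| ≤ K) (hq : |q| ≤ K) : area p q ≤ 1 + 2 * K := by
  have hK := (abs_nonneg _).trans hp
  refine abs_le_of_sq_le_sq' ?_ (by positivity) |>.2
  rw [area_sq, ← sq_abs p, ← sq_abs q]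
  nlinarith [abs_nonneg p, abs_nonneg q]

theorem HasDerivAt.comp_clamp {T : ℝ} [hT : Fact (0 < T)] {g : ℝ → ℝ} {g' t : ℝ}
    (hg : HasDerivAt g g' t) (ht : t ∈ Ioo 0 T) :
    HasDerivAt (fun s => g (clamp (T := T) s)) g' t := by
  refine hg.congr_of_eventuallyEq ?_
  filter_upwards [Ioo_mem_nhds ht.1 ht.2] with s hs
  rw [coe_clamp (Ioo_subset_Icc_self hs)]

theorem coercive_ineq {d κ D2 C g2 s w x det h w1 C1 ρ FW : ℝ} (hκ : 0 < κ) (hd : 0 < d)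
    (hC1 : 0 < C1) (hD : 0 ≤ D2) (hs : s ^ 2 ≤ 2 * g2) (hx : x = |w|)
    (hdet : d * ρ ^ 2 ≤ det) (hdet2 : det ≤ D2 * ρ ^ 2) (hg : 0 ≤ g2) (hF : det * (κ * g2) ≤ FW)
    (hh : |h| ≤ C * (x + s)) (hw1 : |w1| ≤ C1 * ρ * s) :
    κ * d / (4 * C1 ^ 2) * w1 ^ 2 ≤ FW + det * h * w +
      ρ ^ 2 * (D2 * C + (D2 * C) ^ 2 / (κ * d)) * w ^ 2 := by
  have hx0 : 0 ≤ x := hx ▸ abs_nonneg w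
  have hw2 : w ^ 2 = x ^ 2 := by rw [hx, sq_abs]
  have e1 : κ * d / (4 * C1 ^ 2) * w1 ^ 2 ≤ ρ ^ 2 * (κ * d / 4 * s ^ 2) := by
    have : w1 ^ 2 ≤ (C1 * ρ * s) ^ 2 := by
      rw [← sq_abs w1]; gcongr
    calc κ * d / (4 * C1 ^ 2) * w1 ^ 2 ≤ κ * d / (4 * C1 ^ 2) * (C1 * ρ * s) ^ 2 := by gcongr
      _ = _ := by field_simp
  have hdet0 : 0 ≤ det := le_trans (by positivity) hdet
  have e2 : -(ρ ^ 2 * (D2 * C * (x ^ 2 + x * s))) ≤ det * h * w := by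
    have : |det * h * w| ≤ D2 * ρ ^ 2 * (C * (x + s)) * x := by
      rw [abs_mul, abs_mul, abs_of_nonneg hdet0, ← hx]; gcongr
    have := neg_abs_le (det * h * w)
    nlinarith
  have e3 : D2 * C * (x * s) ≤ κ * d / 4 * s ^ 2 + (D2 * C) ^ 2 / (κ * d) * x ^ 2 := by
    have hkd : 0 < κ * d := by positivity
    have : κ * d / 4 * s ^ 2 + (D2 * C) ^ 2 / (κ * d) * x ^ 2 - D2 * C * (x * s) =
        (κ * d * s / 2 - D2 * C * x) ^ 2 / (κ * d) := by field_simp; ring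
    have : 0 ≤ (κ * d * s / 2 - D2 * C * x) ^ 2 / (κ * d) := by positivity
    linarith
  have e4 : ρ ^ 2 * (κ * d / 2 * s ^ 2) ≤ FW := by
    refine le_trans ?_ hF
    calc ρ ^ 2 * (κ * d / 2 * s ^ 2) ≤ ρ ^ 2 * (κ * d / 2 * (2 * g2)) := by gcongr
      _ = d * ρ ^ 2 * (κ * g2) := by ring
      _ ≤ det * (κ * g2) := by gcongr
  have e5 := mul_le_mul_of_nonneg_left e3 (sq_nonneg ρ)
  rw [hw2]
  nlinarith

/-- `V`, with gradient `P` in the target coordinates, is a weak solution of the equation in the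
chart `X`. -/
structure IsWeakChartSol (α T t0 θ0 K R m : ℝ) (X1 X2 A1 A2 B1 B2 V P1 P2 : ℝ × ℝ → ℝ) :
    Prop where
  cV : Continuous V
  cP1 : Continuous P1
  cP2 : Continuous P2
  pV : ∀ t θ, V (t, θ + 2 * π) = V (t, θ)
  bP1 : ∀ y, |P1 y| ≤ K
  bP2 : ∀ y, |P2 y| ≤ K
  bV : ∀ y, |V y| ≤ R ∧ m ≤ X1 y ^ 2 + X2 y ^ 2 + V y ^ 2
  dt : ∀ t ∈ Ioo 0 T, ∀ θ, HasDerivAt (fun t => V (t, θ))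
    (A1 (t, θ) * P1 (t, θ) + A2 (t, θ) * P2 (t, θ)) t
  dθ : ∀ t ∈ Ioo 0 T, ∀ θ, HasDerivAt (fun θ => V (t, θ))
    (B1 (t, θ) * P1 (t, θ) + B2 (t, θ) * P2 (t, θ)) θ
  weak : ∀ φ φt φθ, IsTest T t0 θ0 φ φt φθ →
    ∫ t in (0 : ℝ)..T, ∫ θ in (θ0 - π)..θ0 - π + 2 * π,
      ((P1 (t, θ) / area (P1 (t, θ)) (P2 (t, θ)) * B2 (t, θ) -
          P2 (t, θ) / area (P1 (t, θ)) (P2 (t, θ)) * B1 (t, θ)) * φt (t, θ) +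
        (P2 (t, θ) / area (P1 (t, θ)) (P2 (t, θ)) * A1 (t, θ) -
          P1 (t, θ) / area (P1 (t, θ)) (P2 (t, θ)) * A2 (t, θ)) * φθ (t, θ) +
        (A1 (t, θ) * B2 (t, θ) - A2 (t, θ) * B1 (t, θ)) *
          rhs α (X1 (t, θ)) (X2 (t, θ)) (V (t, θ)) (P1 (t, θ)) (P2 (t, θ)) * φ (t, θ)) = 0

theorem IsChart.weak_flux {T t0 θ0 : ℝ} (hT : 0 < T) {X1 X2 A1 A2 B1 B2 E1 E2 : ℝ × ℝ → ℝ}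
    (hX : IsChart T X1 X2 A1 A2 B1 B2 E1 E2) {a1 a2 a1x a1y a2x a2y : ℝ × ℝ → ℝ}
    (c1 : ContinuousOn a1 {y | perSq t0 θ0 y ≠ 0}) (c2 : ContinuousOn a2 {y | perSq t0 θ0 y ≠ 0})
    (c1x : ContinuousOn a1x {y | perSq t0 θ0 y ≠ 0})
    (c1y : ContinuousOn a1y {y | perSq t0 θ0 y ≠ 0})
    (c2x : ContinuousOn a2x {y | perSq t0 θ0 y ≠ 0})
    (c2y : ContinuousOn a2y {y | perSq t0 θ0 y ≠ 0})
    (d1t : ∀ t ∈ Ioo 0 T, ∀ θ, perSq t0 θ0 (t, θ) ≠ 0 → HasDerivAt (fun t => a1 (t, θ))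
      (a1x (t, θ) * A1 (t, θ) + a1y (t, θ) * A2 (t, θ)) t)
    (d2t : ∀ t ∈ Ioo 0 T, ∀ θ, perSq t0 θ0 (t, θ) ≠ 0 → HasDerivAt (fun t => a2 (t, θ))
      (a2x (t, θ) * A1 (t, θ) + a2y (t, θ) * A2 (t, θ)) t)
    (d1θ : ∀ t ∈ Ioo 0 T, ∀ θ, perSq t0 θ0 (t, θ) ≠ 0 → HasDerivAt (fun θ => a1 (t, θ))
      (a1x (t, θ) * B1 (t, θ) + a1y (t, θ) * B2 (t, θ)) θ)
    (d2θ : ∀ t ∈ Ioo 0 T, ∀ θ, perSq t0 θ0 (t, θ) ≠ 0 → HasDerivAt (fun θ => a2 (t, θ))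
      (a2x (t, θ) * B1 (t, θ) + a2y (t, θ) * B2 (t, θ)) θ)
    (p1 : ∀ t θ, a1 (t, θ + 2 * π) = a1 (t, θ)) (p2 : ∀ t θ, a2 (t, θ + 2 * π) = a2 (t, θ))
    {φ φt φθ : ℝ × ℝ → ℝ} (hφ : IsTest T t0 θ0 φ φt φθ) :
    ∫ t in (0 : ℝ)..T, ∫ θ in (θ0 - π)..θ0 - π + 2 * π,
      ((a1 (t, θ) * B2 (t, θ) - a2 (t, θ) * B1 (t, θ)) * φt (t, θ) +
        (a2 (t, θ) * A1 (t, θ) - a1 (t, θ) * A2 (t, θ)) * φθ (t, θ) +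
        (A1 (t, θ) * B2 (t, θ) - A2 (t, θ) * B1 (t, θ)) * (a1x (t, θ) + a2y (t, θ)) * φ (t, θ)) =
      0 := by
  obtain ⟨cX1, cX2, cA1, cA2, cB1, cB2, cE1, cE2, -, -, -, -, dB1, dB2, dA1, dA2, -, -, pA1, pA2⟩ :=
    hX
  have := weak_of_strong hT (a := θ0 - π) (F1 := fun y => a1 y * B2 y - a2 y * B1 y)
    (F2 := fun y => a2 y * A1 y - a1 y * A2 y)
    (G1 := fun y => ((a1x y * A1 y + a1y y * A2 y) * B2 y + a1 y * E2 y) -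
      ((a2x y * A1 y + a2y y * A2 y) * B1 y + a2 y * E1 y))
    (G2 := fun y => ((a2x y * B1 y + a2y y * B2 y) * A1 y + a2 y * E1 y) -
      ((a1x y * B1 y + a1y y * B2 y) * A2 y + a1 y * E2 y))
    (by fun_prop) (by fun_prop) (by fun_prop) (by fun_prop)
    (fun t ht θ hy => ((d1t t ht θ hy).fun_mul (dB2 t ht θ)).fun_sub
      ((d2t t ht θ hy).fun_mul (dB1 t ht θ)))
    (fun t ht θ hy => ((d2θ t ht θ hy).fun_mul (dA1 t ht θ)).fun_sub
      ((d1θ t ht θ hy).fun_mul (dA2 t ht θ)))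
    (fun t θ => by simp only [p1, p2, pA1, pA2]) hφ
  refine Eq.trans ?_ this
  refine intervalIntegral.integral_congr fun t _ => intervalIntegral.integral_congr fun θ _ => ?_
  ring

/-- The data of a punctured solution pulled back by a chart. -/
theorem PuncturedSol.pullback {α T K R m t0 θ0 δ : ℝ} {q0 : ℝ × ℝ}
    {f p q r s tt X1 X2 A1 A2 B1 B2 E1 E2 : ℝ × ℝ → ℝ} (hT : 0 < T)
    (hf : PuncturedSol α q0 δ K R m f p q r s tt) (hX : IsChart T X1 X2 A1 A2 B1 B2 E1 E2)
    (hball : ∀ y, (X1 y, X2 y) ∈ Metric.ball q0 δ)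
    (hoff : ∀ y, (X1 y, X2 y) = q0 → perSq t0 θ0 y = 0) :
    ∃ U Q1 Q2 : ℝ × ℝ → ℝ, (∀ y, U y = f (X1 y, X2 y)) ∧ Continuous U ∧
      ContinuousOn Q1 {y | perSq t0 θ0 y ≠ 0} ∧ ContinuousOn Q2 {y | perSq t0 θ0 y ≠ 0} ∧
      (∀ t θ, U (t, θ + 2 * π) = U (t, θ)) ∧
      (∀ y, perSq t0 θ0 y ≠ 0 → |Q1 y| ≤ K ∧ |Q2 y| ≤ K) ∧
      (∀ t ∈ Ioo 0 T, ∀ θ, perSq t0 θ0 (t, θ) ≠ 0 → HasDerivAt (fun t => U (t, θ))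
        (A1 (t, θ) * Q1 (t, θ) + A2 (t, θ) * Q2 (t, θ)) t) ∧
      (∀ t ∈ Ioo 0 T, ∀ θ, perSq t0 θ0 (t, θ) ≠ 0 → HasDerivAt (fun θ => U (t, θ))
        (B1 (t, θ) * Q1 (t, θ) + B2 (t, θ) * Q2 (t, θ)) θ) ∧
      ∀ φ φt φθ, IsTest T t0 θ0 φ φt φθ →
        ∫ t in (0 : ℝ)..T, ∫ θ in (θ0 - π)..θ0 - π + 2 * π,
        ((Q1 (t, θ) / area (Q1 (t, θ)) (Q2 (t, θ)) * B2 (t, θ) -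
            Q2 (t, θ) / area (Q1 (t, θ)) (Q2 (t, θ)) * B1 (t, θ)) * φt (t, θ) +
          (Q2 (t, θ) / area (Q1 (t, θ)) (Q2 (t, θ)) * A1 (t, θ) -
            Q1 (t, θ) / area (Q1 (t, θ)) (Q2 (t, θ)) * A2 (t, θ)) * φθ (t, θ) +
          (A1 (t, θ) * B2 (t, θ) - A2 (t, θ) * B1 (t, θ)) *
            rhs α (X1 (t, θ)) (X2 (t, θ)) (U (t, θ)) (Q1 (t, θ)) (Q2 (t, θ)) * φ (t, θ)) = 0 := by
  let S : Set (ℝ × ℝ) := {y | perSq t0 θ0 y ≠ 0}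
  obtain ⟨X, hXe⟩ : ∃ X : ℝ × ℝ → ℝ × ℝ, ∀ y, X y = (X1 y, X2 y) := ⟨_, fun _ => rfl⟩
  simp only [← hXe] at hball hoff ⊢
  have cX : Continuous X := by
    rw [funext hXe]; exact hX.cX1.prodMk hX.cX2
  have hne (y) (hy : perSq t0 θ0 y ≠ 0) : X y ≠ q0 := fun h => hy (hoff y h)
  have hmaps : MapsTo X S (Metric.ball q0 δ \ {q0}) := fun y hy => ⟨hball y, hne y hy⟩
  have cp : ContinuousOn (fun y => p (X y)) S := ContinuousOn.comp
    (fun x hx => (hf.dp x hx.1 hx.2).continuousAt.continuousWithinAt) cX.continuousOn hmaps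
  have cq : ContinuousOn (fun y => q (X y)) S := ContinuousOn.comp
    (fun x hx => (hf.dq x hx.1 hx.2).continuousAt.continuousWithinAt) cX.continuousOn hmaps
  have cr : ContinuousOn (fun y => r (X y)) S := hf.cr.comp cX.continuousOn hmaps
  have cs : ContinuousOn (fun y => s (X y)) S := hf.cs.comp cX.continuousOn hmaps
  have ct : ContinuousOn (fun y => tt (X y)) S := hf.ct.comp cX.continuousOn hmaps
  have cU : Continuous fun y => f (X y) :=
    continuousOn_univ.1 (hf.cont.comp cX.continuousOn fun y _ => hball y)
  have cW : ContinuousOn (fun y => area (p (X y)) (q (X y))) S := by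
    have : Continuous fun z : ℝ × ℝ => area z.1 z.2 := by fun_prop
    exact this.comp_continuousOn (cp.prodMk cq)
  have W0 (y) : area (p (X y)) (q (X y)) ≠ 0 := (area_pos _ _).ne'
  have W3 (y) : area (p (X y)) (q (X y)) ^ 3 ≠ 0 := pow_ne_zero 3 (W0 y)
  have da1 (x) (hx : x ∈ Metric.ball q0 δ) (hxq : x ≠ q0) :=
    hasFDerivAt_flux (hf.dp x hx hxq) (hf.dq x hx hxq)
  have da2 (x) (hx : x ∈ Metric.ball q0 δ) (hxq : x ≠ q0) :=
    hasFDerivAt_flux (hf.dq x hx hxq) (hf.dp x hx hxq)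
  simp only [area_comm (q _) (p _)] at da2
  have perX (t θ) : X (t, θ + 2 * π) = X (t, θ) := by
    rw [hXe, hXe, hX.pX1, hX.pX2]
  have chain_t {g : ℝ × ℝ → ℝ} {u v : ℝ × ℝ → ℝ}
      (hg : ∀ x ∈ Metric.ball q0 δ, x ≠ q0 → HasFDerivAt g (u x • dfst + v x • dsnd) x) (t)
      (ht : t ∈ Ioo 0 T) (θ) (hy : perSq t0 θ0 (t, θ) ≠ 0) : HasDerivAt (fun t => g (X (t, θ)))
        (u (X (t, θ)) * A1 (t, θ) + v (X (t, θ)) * A2 (t, θ)) t := by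
    have := hg _ (hball (t, θ)) (hne _ hy)
    simp only [hXe] at this ⊢
    exact HasFDerivAt.comp_curve (X1 := fun t => X1 (t, θ)) (X2 := fun t => X2 (t, θ)) this
      (hX.dtX1 t ht θ) (hX.dtX2 t ht θ)
  have chain_θ {g : ℝ × ℝ → ℝ} {u v : ℝ × ℝ → ℝ}
      (hg : ∀ x ∈ Metric.ball q0 δ, x ≠ q0 → HasFDerivAt g (u x • dfst + v x • dsnd) x) (t)
      (ht : t ∈ Ioo 0 T) (θ) (hy : perSq t0 θ0 (t, θ) ≠ 0) : HasDerivAt (fun θ => g (X (t, θ)))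
        (u (X (t, θ)) * B1 (t, θ) + v (X (t, θ)) * B2 (t, θ)) θ := by
    have := hg _ (hball (t, θ)) (hne _ hy)
    simp only [hXe] at this ⊢
    exact HasFDerivAt.comp_curve (X1 := fun θ => X1 (t, θ)) (X2 := fun θ => X2 (t, θ)) this
      (hX.dθX1 t ht θ) (hX.dθX2 t ht θ)
  refine ⟨fun y => f (X y), fun y => p (X y), fun y => q (X y), fun _ => rfl, cU, cp, cq,
    fun t θ => by simp only [perX], fun y hy => ⟨hf.bp _ (hball y) (hne y hy), hf.bq _ (hball y) (hne y hy)⟩,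
    fun t ht θ hy => (chain_t hf.df t ht θ hy).congr_deriv (by ring),
    fun t ht θ hy => (chain_θ hf.df t ht θ hy).congr_deriv (by ring), fun φ φt φθ hφ => ?_⟩
  have := hX.weak_flux hT (t0 := t0) (θ0 := θ0)
    (a1 := fun y => p (X y) / area (p (X y)) (q (X y)))
    (a2 := fun y => q (X y) / area (p (X y)) (q (X y)))
    (a1x := fun y => ((1 + q (X y) ^ 2) * r (X y) - p (X y) * q (X y) * s (X y)) /
      area (p (X y)) (q (X y)) ^ 3)
    (a1y := fun y => ((1 + q (X y) ^ 2) * s (X y) - p (X y) * q (X y) * tt (X y)) /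
      area (p (X y)) (q (X y)) ^ 3)
    (a2x := fun y => ((1 + p (X y) ^ 2) * s (X y) - q (X y) * p (X y) * r (X y)) /
      area (p (X y)) (q (X y)) ^ 3)
    (a2y := fun y => ((1 + p (X y) ^ 2) * tt (X y) - q (X y) * p (X y) * s (X y)) /
      area (p (X y)) (q (X y)) ^ 3) (cp.div cW fun y _ => W0 y)
    (cq.div cW fun y _ => W0 y)
    (((continuousOn_const.add (cq.pow 2)).mul cr |>.sub ((cp.mul cq).mul cs)).div (cW.pow 3) fun y _ => W3 y)
    (((continuousOn_const.add (cq.pow 2)).mul cs |>.sub ((cp.mul cq).mul ct)).div (cW.pow 3) fun y _ => W3 y)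
    (((continuousOn_const.add (cp.pow 2)).mul cs |>.sub ((cq.mul cp).mul cr)).div (cW.pow 3) fun y _ => W3 y)
    (((continuousOn_const.add (cp.pow 2)).mul ct |>.sub ((cq.mul cp).mul cs)).div (cW.pow 3) fun y _ => W3 y)
    (chain_t da1) (chain_t da2) (chain_θ da1) (chain_θ da2)
    (fun t θ => by simp only [perX]) (fun t θ => by simp only [perX]) hφ
  obtain ⟨ε, hε, hv⟩ := hφ.off
  refine Eq.trans ?_ this
  refine intervalIntegral.integral_congr fun t _ => intervalIntegral.integral_congr fun θ _ => ?_
  have key : rhs α (X1 (t, θ)) (X2 (t, θ)) (f (X (t, θ))) (p (X (t, θ))) (q (X (t, θ))) *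
      φ (t, θ) = (((1 + q (X (t, θ)) ^ 2) * r (X (t, θ)) - p (X (t, θ)) * q (X (t, θ)) *
        s (X (t, θ))) / area (p (X (t, θ))) (q (X (t, θ))) ^ 3 +
      ((1 + p (X (t, θ)) ^ 2) * tt (X (t, θ)) - q (X (t, θ)) * p (X (t, θ)) *
        s (X (t, θ))) / area (p (X (t, θ))) (q (X (t, θ))) ^ 3) * φ (t, θ) := by
    by_cases hy : perSq t0 θ0 (t, θ) = 0
    · rw [(hv (t, θ) (by rw [hy]; exact hε)).1]; simp
    · have := hf.eq _ (hball (t, θ)) (hne _ hy)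
      congr 1
      rw [← add_div, eq_div_iff (W3 _)]
      simp only [hXe] at this ⊢
      linear_combination -this
  rw [mul_assoc _ _ (φ (t, θ)), mul_assoc _ _ (φ (t, θ)), key]

theorem chart_uniqueness (α : ℝ) {T K R m d D2 C1 : ℝ} (hT : 0 < T) (hK : 0 ≤ K) (hR : 0 ≤ R)
    (hm : 0 < m) (hd : 0 < d) (hD : 0 ≤ D2) (hC1 : 0 < C1) :
    ∃ ρ0 > 0, ∀ ρ, 0 < ρ → ρ < ρ0 → ∀ (t0 θ0 δ : ℝ) (q0 : ℝ × ℝ)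
      (f p q r s t X1 X2 A1 A2 B1 B2 E1 E2 V P1 P2 : ℝ × ℝ → ℝ),
      PuncturedSol α q0 δ K R m f p q r s t → IsChart T X1 X2 A1 A2 B1 B2 E1 E2 →
      IsWeakChartSol α T t0 θ0 K R m X1 X2 A1 A2 B1 B2 V P1 P2 →
      (∀ y, (X1 y, X2 y) ∈ Metric.ball q0 δ) →
      (∀ y, (X1 y, X2 y) = q0 → perSq t0 θ0 y = 0) →
      (∀ y, d * ρ ^ 2 ≤ A1 y * B2 y - A2 y * B1 y ∧ A1 y * B2 y - A2 y * B1 y ≤ D2 * ρ ^ 2) →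
      (∀ y, |A1 y| ≤ C1 * ρ ∧ |A2 y| ≤ C1 * ρ ∧ |B1 y| ≤ C1 * ρ ∧ |B2 y| ≤ C1 * ρ) →
      (∀ θ, f (X1 (0, θ), X2 (0, θ)) = V (0, θ)) → (∀ θ, f (X1 (T, θ), X2 (T, θ)) = V (T, θ)) →
      ∀ t ∈ Icc 0 T, ∀ θ, f (X1 (t, θ), X2 (t, θ)) = V (t, θ) := by
  obtain ⟨C, hC, hrhs⟩ := rhs_lipschitz (R := max R K) (hR.trans (le_max_left _ _)) hm α
  set κ : ℝ := 1 / (1 + 2 * K) ^ 3 with hκ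
  have hκ0 : 0 < κ := by positivity
  set ε := κ * d / (4 * C1 ^ 2) with hε
  have hε0 : 0 < ε := by positivity
  set A := D2 * C + (D2 * C) ^ 2 / (κ * d) with hA
  have hA0 : 0 ≤ A := by positivity
  obtain ⟨ρ0, hρ0, hsm⟩ : ∃ ρ0 > 0, ∀ ρ, 0 < ρ → ρ < ρ0 → ρ ^ 2 * A * T ^ 2 < ε := by
    have hc : ContinuousAt (fun ρ : ℝ => ρ ^ 2 * A * T ^ 2) 0 := by fun_prop
    obtain ⟨ρ0, h0, h⟩ := Metric.eventually_nhds_iff.1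
      (hc.eventually_lt (continuousAt_const (y := ε)) (by simpa using hε0))
    exact ⟨ρ0, h0, fun ρ h1 h2 => h (by simpa [abs_of_pos h1] using h2)⟩
  refine ⟨ρ0, hρ0, ?_⟩
  intro ρ hρ hρlt t0 θ0 δ q0 f p q r s t X1 X2 A1 A2 B1 B2 E1 E2 V P1 P2 hf hX hV hball hoff hdet
    hAB h0 hTT
  obtain ⟨U, Q1, Q2, hU, cU, cQ1, cQ2, pU, bQ, dUt, dUθ, wU⟩ := hf.pullback hT hX hball hoff
  simp only [← hU] at h0 hTT ⊢
  obtain ⟨cV, cP1, cP2, pV, bP1, bP2, bV, dVt, dVθ, wV⟩ := hV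
  have cA1 := hX.cA1
  have cA2 := hX.cA2
  have cB1 := hX.cB1
  have cB2 := hX.cB2
  have cX1 := hX.cX1
  have cX2 := hX.cX2
  have arU : ContinuousOn (fun y => area (Q1 y) (Q2 y)) {y | perSq t0 θ0 y ≠ 0} := by
    have : Continuous fun z : ℝ × ℝ => area z.1 z.2 := by fun_prop
    exact this.comp_continuousOn (cQ1.prodMk cQ2)
  have arU0 (y) : area (Q1 y) (Q2 y) ≠ 0 := (area_pos _ _).ne'
  have arV0 (y) : area (P1 y) (P2 y) ≠ 0 := (area_pos _ _).ne'
  have bU (y) := hf.bx _ (hball y)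
  have cHU : ContinuousOn (fun y => rhs α (X1 y) (X2 y) (U y) (Q1 y) (Q2 y))
      {y | perSq t0 θ0 y ≠ 0} := by
    unfold rhs
    exact ContinuousOn.div (by fun_prop) (by fun_prop) fun y _ =>
      mul_ne_zero (hU y ▸ (hm.trans_le (bU y).2.2.2).ne') (arU0 y)
  have cHV : Continuous (fun y => rhs α (X1 y) (X2 y) (V y) (P1 y) (P2 y)) := by
    unfold rhs
    exact Continuous.div (by fun_prop) (by fun_prop) fun y =>
      mul_ne_zero (hm.trans_le (bV y).2).ne' (arV0 y)
  have ca1 : ContinuousOn (fun y => Q1 y / area (Q1 y) (Q2 y)) {y | perSq t0 θ0 y ≠ 0} :=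
    cQ1.div arU fun y _ => arU0 y
  have ca2 : ContinuousOn (fun y => Q2 y / area (Q1 y) (Q2 y)) {y | perSq t0 θ0 y ≠ 0} :=
    cQ2.div arU fun y _ => arU0 y
  have cb1 : Continuous (fun y => P1 y / area (P1 y) (P2 y)) :=
    Continuous.div cP1 (by fun_prop) arV0
  have cb2 : Continuous (fun y => P2 y / area (P1 y) (P2 y)) :=
    Continuous.div cP2 (by fun_prop) arV0
  have hRK (y) (hy : perSq t0 θ0 y ≠ 0) :
      |rhs α (X1 y) (X2 y) (U y) (Q1 y) (Q2 y) - rhs α (X1 y) (X2 y) (V y) (P1 y) (P2 y)| ≤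
        C * (|U y - V y| + (|Q1 y - P1 y| + |Q2 y - P2 y|)) := by
    have l := le_max_left R K
    have l' := le_max_right R K
    have h := bU y
    rw [← hU] at h
    exact hrhs _ _ _ _ _ _ _ _ (h.1.trans l) (h.2.1.trans l) (h.2.2.1.trans l) ((bV y).1.trans l)
      ((bQ y hy).1.trans l') ((bQ y hy).2.trans l') ((bP1 y).trans l') ((bP2 y).trans l')
      h.2.2.2 (bV y).2
  have hlin {a b c d : ℝ} (hab : |a| ≤ C1 * ρ) (hbc : |b| ≤ C1 * ρ) :
      |a * c + b * d| ≤ C1 * ρ * (|c| + |d|) := by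
    calc |a * c + b * d| ≤ |a| * |c| + |b| * |d| := by
          rw [← abs_mul, ← abs_mul]; exact abs_add_le _ _
      _ ≤ C1 * ρ * |c| + C1 * ρ * |d| := by gcongr
      _ = _ := by ring
  have cdet : Continuous fun y => A1 y * B2 y - A2 y * B1 y := by fun_prop
  suffices h : ∀ t ∈ Icc 0 T, ∀ θ, U (t, θ) - V (t, θ) = 0 from
    fun t ht θ => sub_eq_zero.1 (h t ht θ)
  refine energy_uniqueness hT t0 θ0 (w := fun y => U y - V y)
    (w1 := fun y => A1 y * (Q1 y - P1 y) + A2 y * (Q2 y - P2 y))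
    (w2 := fun y => B1 y * (Q1 y - P1 y) + B2 y * (Q2 y - P2 y))
    (F1 := fun y => (Q1 y / area (Q1 y) (Q2 y) - P1 y / area (P1 y) (P2 y)) * B2 y -
      (Q2 y / area (Q1 y) (Q2 y) - P2 y / area (P1 y) (P2 y)) * B1 y)
    (F2 := fun y => (Q2 y / area (Q1 y) (Q2 y) - P2 y / area (P1 y) (P2 y)) * A1 y -
      (Q1 y / area (Q1 y) (Q2 y) - P1 y / area (P1 y) (P2 y)) * A2 y)
    (h := fun y => (A1 y * B2 y - A2 y * B1 y) * (rhs α (X1 y) (X2 y) (U y) (Q1 y) (Q2 y) -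
      rhs α (X1 y) (X2 y) (V y) (P1 y) (P2 y)))
    (M := 2 * R + C1 * ρ * (4 * K) + C1 * ρ * 4 + D2 * ρ ^ 2 * (C * (2 * R + 4 * K)))
    (ε := ε) (A := ρ ^ 2 * A)
    (cU.sub cV) (fun t θ => by simp only [pU, pV]) (fun θ => by simp only [h0, sub_self])
    (fun θ => by simp only [hTT, sub_self]) (by fun_prop) (by fun_prop)
    (((ca1.sub cb1.continuousOn).mul cB2.continuousOn).sub
      ((ca2.sub cb2.continuousOn).mul cB1.continuousOn))
    (((ca2.sub cb2.continuousOn).mul cA1.continuousOn).sub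
      ((ca1.sub cb1.continuousOn).mul cA2.continuousOn))
    (cdet.continuousOn.mul (cHU.sub cHV.continuousOn)) ?_ ?_ ?_ ?_ ?_ (by positivity) (hsm ρ hρ hρlt)
  · intro y hy
    have hsub {a b M : ℝ} (ha : |a| ≤ M) (hb : |b| ≤ M) : |a - b| ≤ 2 * M := by
      have := abs_sub a b
      linarith
    have hw : |U y - V y| ≤ 2 * R := hsub (hU y ▸ (bU y).2.2.1) (bV y).1
    have hQ : |Q1 y - P1 y| + |Q2 y - P2 y| ≤ 4 * K := by
      linarith [hsub (bQ y hy).1 (bP1 y), hsub (bQ y hy).2 (bP2 y)]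
    have ha : |Q1 y / area (Q1 y) (Q2 y) - P1 y / area (P1 y) (P2 y)| +
        |Q2 y / area (Q1 y) (Q2 y) - P2 y / area (P1 y) (P2 y)| ≤ 4 := by
      have b1 (p q : ℝ) : |q / area p q| ≤ 1 := by rw [area_comm]; exact abs_flux_le_one q p
      linarith [hsub (abs_flux_le_one (Q1 y) (Q2 y)) (abs_flux_le_one (P1 y) (P2 y)),
        hsub (b1 (Q1 y) (Q2 y)) (b1 (P1 y) (P2 y))]
    have hCρ : 0 ≤ C1 * ρ := by positivity
    have hdet0 : 0 ≤ A1 y * B2 y - A2 y * B1 y := le_trans (by positivity) (hdet y).1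
    have n1 : 0 ≤ C1 * ρ * (4 * K) := by positivity
    have n2 : 0 ≤ C1 * ρ * 4 := by positivity
    have n3 : 0 ≤ D2 * ρ ^ 2 * (C * (2 * R + 4 * K)) := by positivity
    obtain ⟨k1, k2, k3, k4⟩ := hAB y
    have l1 := (hlin (c := Q1 y - P1 y) (d := Q2 y - P2 y) k1 k2).trans
      (mul_le_mul_of_nonneg_left hQ hCρ)
    have l2 := (hlin (c := Q1 y - P1 y) (d := Q2 y - P2 y) k3 k4).trans
      (mul_le_mul_of_nonneg_left hQ hCρ)
    have l3 := (hlin (c := Q1 y / area (Q1 y) (Q2 y) - P1 y / area (P1 y) (P2 y))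
      (d := -(Q2 y / area (Q1 y) (Q2 y) - P2 y / area (P1 y) (P2 y))) k4 k3).trans
      (mul_le_mul_of_nonneg_left (c := 4) (by rwa [abs_neg]) hCρ)
    have l4 := (hlin (c := -(Q1 y / area (Q1 y) (Q2 y) - P1 y / area (P1 y) (P2 y)))
      (d := Q2 y / area (Q1 y) (Q2 y) - P2 y / area (P1 y) (P2 y)) k2 k1).trans
      (mul_le_mul_of_nonneg_left (c := 4) (by rwa [abs_neg]) hCρ)
    have l5 : |(A1 y * B2 y - A2 y * B1 y) * (rhs α (X1 y) (X2 y) (U y) (Q1 y) (Q2 y) -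
        rhs α (X1 y) (X2 y) (V y) (P1 y) (P2 y))| ≤ D2 * ρ ^ 2 * (C * (2 * R + 4 * K)) := by
      rw [abs_mul, abs_of_nonneg hdet0]
      refine mul_le_mul (hdet y).2 ((hRK y hy).trans ?_) (abs_nonneg _) (by positivity)
      gcongr
    refine ⟨by linarith, by linarith, by linarith, ?_, ?_, by linarith⟩
    · rw [show (Q1 y / area (Q1 y) (Q2 y) - P1 y / area (P1 y) (P2 y)) * B2 y -
        (Q2 y / area (Q1 y) (Q2 y) - P2 y / area (P1 y) (P2 y)) * B1 y = B2 y *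
        (Q1 y / area (Q1 y) (Q2 y) - P1 y / area (P1 y) (P2 y)) + B1 y *
        -(Q2 y / area (Q1 y) (Q2 y) - P2 y / area (P1 y) (P2 y)) by ring]
      linarith
    · rw [show (Q2 y / area (Q1 y) (Q2 y) - P2 y / area (P1 y) (P2 y)) * A1 y -
        (Q1 y / area (Q1 y) (Q2 y) - P1 y / area (P1 y) (P2 y)) * A2 y = A2 y *
        -(Q1 y / area (Q1 y) (Q2 y) - P1 y / area (P1 y) (P2 y)) + A1 y *
        (Q2 y / area (Q1 y) (Q2 y) - P2 y / area (P1 y) (P2 y)) by ring]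
      linarith
  · intro t ht θ hy
    exact ((dUt t ht θ hy).fun_sub (dVt t ht θ)).congr_deriv (by ring)
  · intro t ht θ hy
    exact ((dUθ t ht θ hy).fun_sub (dVθ t ht θ)).congr_deriv (by ring)
  · intro φ φt φθ hφ
    have eU := wU φ φt φθ hφ
    have eV := wV φ φt φθ hφ
    obtain ⟨e, he, hv⟩ := hφ.off
    have m0 {g : ℝ × ℝ → ℝ} (cg : ContinuousOn g {y | perSq t0 θ0 y ≠ 0}) :
        Continuous fun y => g y * φ y :=
      continuous_mul_of_vanish cg hφ.cont he fun y hy => (hv y hy).1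
    have mt {g : ℝ × ℝ → ℝ} (cg : ContinuousOn g {y | perSq t0 θ0 y ≠ 0}) :
        Continuous fun y => g y * φt y :=
      continuous_mul_of_vanish cg hφ.cont_fst he fun y hy => (hv y hy).2.1
    have mθ {g : ℝ × ℝ → ℝ} (cg : ContinuousOn g {y | perSq t0 θ0 y ≠ 0}) :
        Continuous fun y => g y * φθ y :=
      continuous_mul_of_vanish cg hφ.cont_snd he fun y hy => (hv y hy).2.2
    have cU' := ((mt ((ca1.mul cB2.continuousOn).sub (ca2.mul cB1.continuousOn))).add
      (mθ ((ca2.mul cA1.continuousOn).sub (ca1.mul cA2.continuousOn)))).add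
      (m0 (cdet.continuousOn.mul cHU))
    have cV' := (((((cb1.mul cB2).sub (cb2.mul cB1)).mul hφ.cont_fst).add
      (((cb2.mul cA1).sub (cb1.mul cA2)).mul hφ.cont_snd)).add
      ((cdet.mul cHV).mul hφ.cont)).const_mul (-1)
    have hadd := integral2_add cU' cV' 0 T (θ0 - π) (θ0 - π + 2 * π)
    simp only [Pi.add_apply, Pi.mul_apply, Pi.sub_apply] at hadd
    rw [eU] at hadd
    simp only [intervalIntegral.integral_const_mul] at hadd
    rw [eV] at hadd
    refine Eq.trans ?_ (hadd.trans (by ring))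
    refine intervalIntegral.integral_congr fun t _ =>
      intervalIntegral.integral_congr fun θ _ => ?_
    ring
  · intro t ht θ hy
    set y := (t, θ)
    have hm0 := flux_monotone (area_le_of_abs_le (bQ y hy).1 (bQ y hy).2)
      (area_le_of_abs_le (bP1 y) (bP2 y))
    have hdet0 : 0 ≤ A1 y * B2 y - A2 y * B1 y := le_trans (by positivity) (hdet y).1
    refine (coercive_ineq (g2 := (Q1 y - P1 y) ^ 2 + (Q2 y - P2 y) ^ 2) hκ0 hd hC1 hD
      (s := |Q1 y - P1 y| + |Q2 y - P2 y|) ?_ rfl (hdet y).1 (hdet y).2 (by positivity)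
      (FW := (A1 y * B2 y - A2 y * B1 y) *
        ((Q1 y / area (Q1 y) (Q2 y) - P1 y / area (P1 y) (P2 y)) * (Q1 y - P1 y) +
        (Q2 y / area (Q1 y) (Q2 y) - P2 y / area (P1 y) (P2 y)) * (Q2 y - P2 y)))
      ?_ (hRK y hy) (hlin (hAB y).1 (hAB y).2.1)).trans (le_of_eq ?_)
    · rw [← sq_abs (Q1 y - P1 y), ← sq_abs (Q2 y - P2 y)]
      nlinarith [sq_nonneg (|Q1 y - P1 y| - |Q2 y - P2 y|)]
    · refine mul_le_mul_of_nonneg_left (le_trans (le_of_eq ?_) hm0) hdet0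
      rw [hκ]; ring
    · ring

end chart

end

noncomputable section

section resid

open Filter Topology
open scoped ContDiff

/-- The analytic implicit function theorem for an equation whose partial derivative in the
unknown is the identity, checked along lines. -/
theorem exists_implicit {P E : Type*} [NormedAddCommGroup P] [NormedSpace ℝ P] [CompleteSpace P]
    [NormedAddCommGroup E] [NormedSpace ℝ E] [CompleteSpace E] {G : P × E → E} {x0 : P} {e0 : E}
    (hG : ContDiffAt ℝ ω G (x0, e0)) (h0 : G (x0, e0) = 0)
    (hd : ∀ ζ, HasDerivAt (fun τ : ℝ => G (x0, e0 + τ • ζ)) ζ 0) :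
    ∃ Z : P → E, ContDiffAt ℝ ω Z x0 ∧ Z x0 = e0 ∧ ∀ᶠ x in 𝓝 x0, G (x, Z x) = 0 := by
  have hid : fderiv ℝ G (x0, e0) ∘L .inr ℝ P E = .id ℝ E := by
    ext ζ
    have h1 : HasFDerivAt G (fderiv ℝ G (x0, e0)) (x0, e0 + (0 : ℝ) • ζ) := by
      rw [zero_smul, add_zero]
      exact (hG.differentiableAt (by simp)).hasFDerivAt
    have h2 : HasDerivAt (fun τ : ℝ => ((x0, e0 + τ • ζ) : P × E)) (0, ζ) 0 := by
      have h3 := ((hasDerivAt_id (0 : ℝ)).smul_const ζ).const_add e0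
      rw [one_smul] at h3
      exact (hasDerivAt_const (0 : ℝ) x0).prodMk h3
    exact (h1.comp_hasDerivAt (0 : ℝ) h2).unique (hd ζ)
  have hinv : (fderiv ℝ G (x0, e0) ∘L .inr ℝ P E).IsInvertible := by
    rw [hid]; exact ⟨ContinuousLinearEquiv.refl ℝ E, rfl⟩
  refine ⟨hG.implicitFunction (by simp) hinv, hG.contDiffAt_implicitFunction (by simp) hinv,
    hG.implicitFunction_apply_self (by simp) hinv, ?_⟩
  filter_upwards [hG.eventually_apply_implicitFunction (by simp) hinv] with x hx
  rw [hx, h0]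

variable {𝒜 : Type*} [NormedCommRing 𝒜] [NormedAlgebra ℝ 𝒜]

variable (𝒜) in
/-- The reciprocal square root near a positive constant of a commutative Banach algebra. -/
theorem exists_rsqrt [CompleteSpace 𝒜] {W : ℝ} (hW : 0 < W) : ∃ S : 𝒜 → 𝒜, ContDiffAt ℝ ω S ((W ^ 2) • 1) ∧
    S ((W ^ 2) • 1) = W⁻¹ • 1 ∧ ∀ᶠ N in 𝓝 ((W ^ 2) • (1 : 𝒜)), S N * S N * N = 1 := by
  have hG0 : (2 * W)⁻¹ • ((W⁻¹ • (1 : 𝒜)) * (W⁻¹ • (1 : 𝒜)) * ((W ^ 2) • (1 : 𝒜)) - 1) = 0 := by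
    simp only [smul_mul_smul_comm, mul_one]
    rw [show W⁻¹ * W⁻¹ * W ^ 2 = 1 by field_simp, one_smul, sub_self, smul_zero]
  have hG (ζ : 𝒜) : HasDerivAt (fun τ : ℝ => (2 * W)⁻¹ • ((W⁻¹ • (1 : 𝒜) + τ • ζ) *
      (W⁻¹ • (1 : 𝒜) + τ • ζ) * ((W ^ 2) • (1 : 𝒜)) - 1)) ζ 0 := by
    have h : HasDerivAt (fun τ : ℝ => W⁻¹ • (1 : 𝒜) + τ • ζ) ζ 0 := by
      have := ((hasDerivAt_id (0 : ℝ)).smul_const ζ).const_add (W⁻¹ • (1 : 𝒜))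
      rwa [one_smul] at this
    refine ((((h.fun_mul h).mul_const _).sub_const _).const_smul ((2 * W)⁻¹)).congr_deriv ?_
    simp only [zero_smul, add_zero, mul_smul_comm, smul_mul_assoc, mul_one, one_mul]
    rw [← add_smul, smul_smul, smul_smul, show (2 * W)⁻¹ * W ^ 2 * (W⁻¹ + W⁻¹) = 1 by
      field_simp; norm_num, one_smul]
  obtain ⟨S, h1, h2, h3⟩ := exists_implicit (x0 := (W ^ 2) • (1 : 𝒜)) (e0 := W⁻¹ • (1 : 𝒜))
    (G := fun z => (2 * W)⁻¹ • (z.2 * z.2 * z.1 - 1)) (by fun_prop) hG0 hG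
  refine ⟨S, h1, h2, h3.mono fun N hN => ?_⟩
  exact sub_eq_zero.1 ((smul_eq_zero.1 hN).resolve_left (by positivity))

/-- Constants of the linearised problem in an annulus: the polar frame `e1, e2`, a shift profile
`η` with derivative `η'`, and the lower triangular root of the inverse symbol at slope `p`. -/
structure Frame (𝒜 : Type*) [NormedCommRing 𝒜] [NormedAlgebra ℝ 𝒜] where
  (e1 e2 η η' ι0 : 𝒜)
  (p1 p2 l11 l21 l22 W : ℝ)
  S : 𝒜 → 𝒜
  ι0_mul : ι0 * (e1 * e1 + e2 * e2) = 1
  W_pos : 0 < W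
  W_sq : W ^ 2 = 1 + p1 ^ 2 + p2 ^ 2
  l11_pos : 0 < l11
  l11_sq : l11 ^ 2 = 1 + p2 ^ 2
  l11_l21 : l11 * l21 = -(p1 * p2)
  l11_l22 : l11 * l22 = W
  S_contDiffAt : ContDiffAt ℝ ω S ((W ^ 2) • 1)
  S_base : S ((W ^ 2) • 1) = W⁻¹ • 1
  S_eq : ∀ᶠ N in 𝓝 ((W ^ 2) • (1 : 𝒜)), S N * S N * N = 1

/-- Scale, height, centre; shift; boundary lift with its two derivatives. -/
abbrev Prm (𝒜 : Type*) := (ℝ × ℝ × ℝ × ℝ) × (ℝ × ℝ) × (𝒜 × 𝒜 × 𝒜)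

namespace Frame

variable (F : Frame 𝒜)

theorem l22_pos : 0 < F.l22 := by
  have := F.l11_l22 ▸ F.W_pos
  exact (pos_iff_pos_of_mul_pos this).1 F.l11_pos

theorem l21_sq : F.l21 ^ 2 + F.l22 ^ 2 = 1 + F.p1 ^ 2 := by
  have h := F.l11_pos
  have h1 : F.l11 ^ 2 * (F.l21 ^ 2 + F.l22 ^ 2) = F.l11 ^ 2 * (1 + F.p1 ^ 2) := by
    rw [show F.l11 ^ 2 * (F.l21 ^ 2 + F.l22 ^ 2) = (F.l11 * F.l21) ^ 2 + (F.l11 * F.l22) ^ 2 by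
      ring, F.l11_l21, F.l11_l22, F.W_sq, F.l11_sq]
    ring
  exact mul_left_cancel₀ (by positivity) h1

section expressions

variable (y : Prm 𝒜 × (𝒜 × 𝒜 × 𝒜))

def ja : 𝒜 := F.e1 + y.1.2.1.1 • F.η'
def jc : 𝒜 := F.e2 + y.1.2.1.2 • F.η'
def det : 𝒜 := F.ja y * F.e1 + F.jc y * F.e2
def ι : 𝒜 := Ring.inverse (F.det y)
def Q1 : 𝒜 := F.ι y * (F.e1 * (y.1.2.2.2.1 + y.2.2.1) - F.jc y * (y.1.2.2.2.2 + y.2.2.2))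
def Q2 : 𝒜 := F.ι y * (F.e2 * (y.1.2.2.2.1 + y.2.2.1) + F.ja y * (y.1.2.2.2.2 + y.2.2.2))
def P1 : 𝒜 := F.p1 • 1 + (F.l11⁻¹ • F.Q1 y - (F.l21 / F.W) • F.Q2 y)
def P2 : 𝒜 := F.p2 • 1 + F.l22⁻¹ • F.Q2 y
def s : 𝒜 := F.S (1 + F.P1 y * F.P1 y + F.P2 y * F.P2 y)
def Y1 : 𝒜 := (F.W ^ 2 * F.l22) • (F.s y * F.P1 y) - (F.W * F.l22 * F.p1) • 1
def Y2 : 𝒜 := F.W ^ 2 • (F.s y * (F.l11 • F.P2 y - F.l21 • F.P1 y)) -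
  (F.W * (F.l11 * F.p2 - F.l21 * F.p1)) • 1
def X1 : 𝒜 := F.e1 * F.Y1 y + F.e2 * F.Y2 y
def X2 : 𝒜 := F.ja y * F.Y2 y - F.jc y * F.Y1 y
def ξ1 : 𝒜 := F.e1 + y.1.2.1.1 • F.η
def ξ2 : 𝒜 := F.e2 + y.1.2.1.2 • F.η
def x1 : 𝒜 := y.1.1.2.2.1 • 1 + y.1.1.1 • (F.l11 • F.ξ1 y)
def x2 : 𝒜 := y.1.1.2.2.2 • 1 + y.1.1.1 • (F.l21 • F.ξ1 y + F.l22 • F.ξ2 y)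
def V : 𝒜 := y.1.1.2.1 • 1 + y.1.1.1 • ((F.p1 * F.l11 + F.p2 * F.l21) • F.ξ1 y +
  (F.p2 * F.l22) • F.ξ2 y + (y.1.2.2.1 + y.2.1))
def N : 𝒜 := F.x1 y * F.x1 y + F.x2 y * F.x2 y + F.V y * F.V y
def β : 𝒜 := Ring.inverse (F.N y)
def H (α : ℝ) : 𝒜 := (y.1.1.1 * F.W ^ 3 * α) •
  ((F.V y - F.x1 y * F.P1 y - F.x2 y * F.P2 y) * F.β y * F.s y * F.det y)

/-- The columns of the Jacobian of the chart. -/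
def A1 : 𝒜 := y.1.1.1 • (F.l11 • F.ja y)
def A2 : 𝒜 := y.1.1.1 • (F.l21 • F.ja y + F.l22 • F.jc y)
def B1 : 𝒜 := y.1.1.1 • (F.l11 • -F.e2)
def B2 : 𝒜 := y.1.1.1 • (F.l21 • -F.e2 + F.l22 • F.e1)

/-- The fixed point residual of the Dirichlet problem. -/
def G (α : ℝ) (L0 L1 L2 : 𝒜 × 𝒜 × 𝒜 →L[ℝ] 𝒜) : 𝒜 × 𝒜 × 𝒜 :=
  y.2 - (L0.prod (L1.prod L2)) (y.2.2.1 - F.X1 y, y.2.2.2 - F.X2 y, F.H y α)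

end expressions

section base

variable (𝒜) in
/-- The parameters of the rescaled limit. -/
def base (h c1 c2 : ℝ) : Prm 𝒜 := ((0, h, c1, c2), (0, 0), (0, 0, 0))

variable (h c1 c2 : ℝ) (z : 𝒜 × 𝒜 × 𝒜)

@[simp] theorem ja_base : F.ja (base 𝒜 h c1 c2, z) = F.e1 := by simp [ja, base]
@[simp] theorem jc_base : F.jc (base 𝒜 h c1 c2, z) = F.e2 := by simp [jc, base]
@[simp] theorem det_base : F.det (base 𝒜 h c1 c2, z) = F.e1 * F.e1 + F.e2 * F.e2 := by simp [det]
@[simp] theorem ι_base : F.ι (base 𝒜 h c1 c2, z) = F.ι0 := by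
  have h1 : (F.e1 * F.e1 + F.e2 * F.e2) * F.ι0 = 1 := by rw [mul_comm, F.ι0_mul]
  rw [ι, det_base]
  exact Ring.inverse_unit ⟨_, _, h1, F.ι0_mul⟩
theorem Q1_base : F.Q1 (base 𝒜 h c1 c2, z) = F.ι0 * (F.e1 * z.2.1 - F.e2 * z.2.2) := by
  rw [Q1, ι_base, jc_base]; simp [base]
theorem Q2_base : F.Q2 (base 𝒜 h c1 c2, z) = F.ι0 * (F.e2 * z.2.1 + F.e1 * z.2.2) := by
  rw [Q2, ι_base, ja_base]; simp [base]
@[simp] theorem P1_base : F.P1 (base 𝒜 h c1 c2, 0) = F.p1 • 1 := by simp [P1, Q1_base, Q2_base]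
@[simp] theorem P2_base : F.P2 (base 𝒜 h c1 c2, 0) = F.p2 • 1 := by simp [P2, Q2_base]
theorem one_add_base : 1 + F.P1 (base 𝒜 h c1 c2, 0) * F.P1 (base 𝒜 h c1 c2, 0) +
    F.P2 (base 𝒜 h c1 c2, 0) * F.P2 (base 𝒜 h c1 c2, 0) = F.W ^ 2 • 1 := by
  rw [P1_base, P2_base, F.W_sq, smul_mul_smul_comm, smul_mul_smul_comm, mul_one, add_smul, add_smul,
    one_smul, sq, sq]
@[simp] theorem s_base : F.s (base 𝒜 h c1 c2, 0) = F.W⁻¹ • 1 := by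
  rw [s, one_add_base, F.S_base]
theorem N_base : F.N (base 𝒜 h c1 c2, 0) = (c1 ^ 2 + c2 ^ 2 + h ^ 2) • 1 := by
  simp only [N, x1, x2, V, base, zero_smul, add_zero, smul_mul_smul_comm, mul_one]
  module
@[simp] theorem H_base (α : ℝ) : F.H (base 𝒜 h c1 c2, z) α = 0 := by simp [H, base]

end base

section deriv

variable (h c1 c2 : ℝ)

/-- The derivative of the reciprocal square root of the area element. -/
theorem hasDerivAt_s (a b : 𝒜) {g : ℝ → 𝒜} (hg : HasDerivAt g
    ((2 * F.p1) • a + (2 * F.p2) • b) 0) (h0 : g 0 = F.W ^ 2 • 1) :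
    HasDerivAt (fun τ => F.S (g τ)) (-(F.W ^ 3)⁻¹ • (F.p1 • a + F.p2 • b)) 0 := by
  have hW := F.W_pos
  have hS : HasFDerivAt F.S (fderiv ℝ F.S (g 0)) (g 0) := by
    rw [h0]; exact (F.S_contDiffAt.differentiableAt (by simp)).hasFDerivAt
  have h1 := hS.comp_hasDerivAt (0 : ℝ) hg
  refine h1.congr_deriv ?_
  set D := fderiv ℝ F.S (g 0) ((2 * F.p1) • a + (2 * F.p2) • b) with hD
  have h2 := (h1.fun_mul h1).fun_mul hg
  have h3 : HasDerivAt (fun τ => (F.S ∘ g) τ * (F.S ∘ g) τ * g τ) 0 0 := by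
    refine (hasDerivAt_const (0 : ℝ) (1 : 𝒜)).congr_of_eventuallyEq ?_
    have h4 := F.S_eq
    rw [← h0] at h4
    exact hg.continuousAt.eventually h4
  have h5 := h2.unique h3
  simp only [Function.comp_apply, h0, F.S_base, smul_mul_assoc, mul_smul_comm, one_mul, mul_one]
    at h5
  have h6 : (2 * F.W) • D + (F.W⁻¹ * F.W⁻¹) • ((2 * F.p1) • a + (2 * F.p2) • b) = 0 := by
    rw [← h5, smul_smul, ← add_smul, smul_smul]
    congr 2
    field_simp; norm_num
  have h7 : D = (2 * F.W)⁻¹ • ((2 * F.W) • D) := by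
    rw [smul_smul, inv_mul_cancel₀ (by positivity), one_smul]
  rw [h7, eq_neg_of_add_eq_zero_left h6]
  match_scalars <;> field_simp

theorem hasDerivAt_flux_line (ζ : 𝒜 × 𝒜 × 𝒜) :
    HasDerivAt (fun τ : ℝ => F.Y1 (base 𝒜 h c1 c2, τ • ζ))
      (F.ι0 * (F.e1 * ζ.2.1 - F.e2 * ζ.2.2)) 0 ∧
    HasDerivAt (fun τ : ℝ => F.Y2 (base 𝒜 h c1 c2, τ • ζ))
      (F.ι0 * (F.e2 * ζ.2.1 + F.e1 * ζ.2.2)) 0 := by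
  have hW := F.W_pos
  have hl11 := F.l11_pos
  have hl22 := F.l22_pos
  set q1 := F.ι0 * (F.e1 * ζ.2.1 - F.e2 * ζ.2.2) with hq1
  set q2 := F.ι0 * (F.e2 * ζ.2.1 + F.e1 * ζ.2.2) with hq2
  obtain ⟨a, ha⟩ : ∃ a, a = F.l11⁻¹ • q1 - (F.l21 / F.W) • q2 := ⟨_, rfl⟩
  obtain ⟨b, hb⟩ : ∃ b, b = F.l22⁻¹ • q2 := ⟨_, rfl⟩
  have e1 (τ : ℝ) : F.P1 (base 𝒜 h c1 c2, τ • ζ) = F.p1 • 1 + τ • a := by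
    rw [P1, Q1_base, Q2_base, ha, hq1, hq2]
    simp only [Prod.smul_snd, Prod.smul_fst, mul_smul_comm, ← smul_sub, ← smul_add]
    module
  have e2 (τ : ℝ) : F.P2 (base 𝒜 h c1 c2, τ • ζ) = F.p2 • 1 + τ • b := by
    rw [P2, Q2_base, hb, hq2]
    simp only [Prod.smul_snd, Prod.smul_fst, mul_smul_comm, ← smul_add]
    module
  have d1 : HasDerivAt (fun τ : ℝ => F.P1 (base 𝒜 h c1 c2, τ • ζ)) a 0 := by
    simp only [e1]
    have := ((hasDerivAt_id (0 : ℝ)).smul_const a).const_add (F.p1 • (1 : 𝒜))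
    rwa [one_smul] at this
  have d2 : HasDerivAt (fun τ : ℝ => F.P2 (base 𝒜 h c1 c2, τ • ζ)) b 0 := by
    simp only [e2]
    have := ((hasDerivAt_id (0 : ℝ)).smul_const b).const_add (F.p2 • (1 : 𝒜))
    rwa [one_smul] at this
  have z1 : F.P1 (base 𝒜 h c1 c2, (0 : ℝ) • ζ) = F.p1 • 1 := by rw [e1, zero_smul, add_zero]
  have z2 : F.P2 (base 𝒜 h c1 c2, (0 : ℝ) • ζ) = F.p2 • 1 := by rw [e2, zero_smul, add_zero]
  have ds : HasDerivAt (fun τ : ℝ => F.s (base 𝒜 h c1 c2, τ • ζ))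
      (-(F.W ^ 3)⁻¹ • (F.p1 • a + F.p2 • b)) 0 := by
    refine F.hasDerivAt_s a b
      ((((d1.fun_mul d1).const_add 1).fun_add (d2.fun_mul d2)).congr_deriv ?_) ?_
    · rw [z1, z2]
      simp only [smul_mul_assoc, mul_smul_comm, one_mul, mul_one]
      module
    · rw [zero_smul]; exact F.one_add_base h c1 c2
  have zs : F.s (base 𝒜 h c1 c2, (0 : ℝ) • ζ) = F.W⁻¹ • 1 := by
    rw [zero_smul]; exact F.s_base h c1 c2
  have k1 : F.l11 • a + F.l21 • b = q1 := by
    rw [ha, hb]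
    rw [← F.l11_l22]
    match_scalars <;> field_simp
    ring
  have k2 : F.l22 • b = q2 := by
    rw [hb, smul_smul, mul_inv_cancel₀ hl22.ne', one_smul]
  constructor
  · refine (((ds.fun_mul d1).const_smul (F.W ^ 2 * F.l22)).sub_const _).congr_deriv ?_
    rw [z1, zs, ← k1]
    simp only [smul_mul_assoc, mul_smul_comm, one_mul, mul_one]
    match_scalars
    · have := F.W_sq; have := F.l11_sq; have := F.l11_l22
      field_simp
      grind
    · have := F.l11_l22; have := F.l11_l21
      field_simp
      grind
  · refine (((ds.fun_mul ((d2.const_smul F.l11).fun_sub (d1.const_smul F.l21))).const_smul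
      (F.W ^ 2)).sub_const _).congr_deriv ?_
    simp only [Pi.smul_apply]
    rw [z1, z2, zs, ← k2]
    simp only [smul_mul_assoc, mul_smul_comm, one_mul, mul_one, mul_sub]
    match_scalars
    · have := F.W_sq; have := F.l11_sq; have := F.l11_l21
      field_simp
      grind
    · have := F.W_sq; have := F.l11_sq; have := F.l11_l22; have := F.l11_l21; have := F.l21_sq
      field_simp
      grind

theorem hasDerivAt_G (α : ℝ) (L0 L1 L2 : 𝒜 × 𝒜 × 𝒜 →L[ℝ] 𝒜) (ζ : 𝒜 × 𝒜 × 𝒜) :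
    HasDerivAt (fun τ : ℝ => F.G (base 𝒜 h c1 c2, 0 + τ • ζ) α L0 L1 L2) ζ 0 := by
  obtain ⟨d1, d2⟩ := F.hasDerivAt_flux_line h c1 c2 ζ
  have dζ {M : Type _} [NormedAddCommGroup M] [NormedSpace ℝ M] {x : M} : HasDerivAt (fun τ : ℝ => τ • x) x 0 := by
    have := (hasDerivAt_id (0 : ℝ)).smul_const x
    rwa [one_smul] at this
  have k1 : ζ.2.1 - (F.e1 * (F.ι0 * (F.e1 * ζ.2.1 - F.e2 * ζ.2.2)) +
      F.e2 * (F.ι0 * (F.e2 * ζ.2.1 + F.e1 * ζ.2.2))) = 0 := by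
    linear_combination (-ζ.2.1) * F.ι0_mul
  have k2 : ζ.2.2 - (F.e1 * (F.ι0 * (F.e2 * ζ.2.1 + F.e1 * ζ.2.2)) -
      F.e2 * (F.ι0 * (F.e1 * ζ.2.1 - F.e2 * ζ.2.2))) = 0 := by
    linear_combination (-ζ.2.2) * F.ι0_mul
  have e1 : HasDerivAt (fun τ : ℝ => τ • ζ.2.1 - F.X1 (base 𝒜 h c1 c2, τ • ζ)) 0 0 := by
    rw [← k1]
    exact dζ.fun_sub ((d1.const_mul F.e1).fun_add (d2.const_mul F.e2))
  have e2 : HasDerivAt (fun τ : ℝ => τ • ζ.2.2 - F.X2 (base 𝒜 h c1 c2, τ • ζ)) 0 0 := by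
    rw [← k2]
    simp only [X2, ja_base, jc_base]
    exact dζ.fun_sub ((d2.const_mul F.e1).fun_sub (d1.const_mul F.e2))
  have e3 : HasDerivAt (fun τ : ℝ => F.H (base 𝒜 h c1 c2, τ • ζ) α) 0 0 := by
    simp only [H_base]; exact hasDerivAt_const _ _
  have e4 := (L0.prod (L1.prod L2)).hasFDerivAt.comp_hasDerivAt (0 : ℝ)
    (e1.prodMk (e2.prodMk e3))
  have e5 := HasDerivAt.fun_sub ((dζ : HasDerivAt (fun τ : ℝ => τ • ζ) ζ 0)) e4
  refine (e5.congr_deriv ?_).congr_of_eventuallyEq (Eventually.of_forall fun τ => ?_)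
  · change ζ - (L0.prod (L1.prod L2)) 0 = ζ
    rw [map_zero, sub_zero]
  · simp only [G, zero_add]; rfl

end deriv


section smooth

variable (h c1 c2 : ℝ)

theorem contDiffAt_ja : ContDiffAt ℝ ω F.ja (base 𝒜 h c1 c2, 0) := by
  unfold ja; fun_prop
theorem contDiffAt_jc : ContDiffAt ℝ ω F.jc (base 𝒜 h c1 c2, 0) := by
  unfold jc; fun_prop
theorem contDiffAt_det : ContDiffAt ℝ ω F.det (base 𝒜 h c1 c2, 0) := by
  have := F.contDiffAt_ja h c1 c2; have := F.contDiffAt_jc h c1 c2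
  unfold det; fun_prop
theorem contDiffAt_ι [CompleteSpace 𝒜] : ContDiffAt ℝ ω F.ι (base 𝒜 h c1 c2, 0) := by
  have h1 : (F.e1 * F.e1 + F.e2 * F.e2) * F.ι0 = 1 := by rw [mul_comm, F.ι0_mul]
  have h2 := contDiffAt_ringInverse (n := ω) ℝ
    (⟨_, _, h1, F.ι0_mul⟩ : 𝒜ˣ)
  exact ContDiffAt.comp (g := Ring.inverse) _ (by rw [det_base]; exact h2)
    (F.contDiffAt_det h c1 c2)
theorem contDiffAt_P1 [CompleteSpace 𝒜] : ContDiffAt ℝ ω F.P1 (base 𝒜 h c1 c2, 0) := by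
  have := F.contDiffAt_ja h c1 c2; have := F.contDiffAt_jc h c1 c2
  have := F.contDiffAt_ι h c1 c2
  unfold P1 Q1 Q2; fun_prop
theorem contDiffAt_P2 [CompleteSpace 𝒜] : ContDiffAt ℝ ω F.P2 (base 𝒜 h c1 c2, 0) := by
  have := F.contDiffAt_ja h c1 c2; have := F.contDiffAt_jc h c1 c2
  have := F.contDiffAt_ι h c1 c2
  unfold P2 Q2; fun_prop
theorem contDiffAt_s [CompleteSpace 𝒜] : ContDiffAt ℝ ω F.s (base 𝒜 h c1 c2, 0) := by
  have := F.contDiffAt_P1 h c1 c2; have := F.contDiffAt_P2 h c1 c2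
  exact ContDiffAt.comp (g := F.S) _ (by rw [one_add_base]; exact F.S_contDiffAt)
    (by fun_prop)
theorem contDiffAt_N : ContDiffAt ℝ ω F.N (base 𝒜 h c1 c2, 0) := by
  unfold N x1 x2 V ξ1 ξ2; fun_prop

theorem isUnit_N_base (hN : 0 < c1 ^ 2 + c2 ^ 2 + h ^ 2) :
    IsUnit (F.N (base 𝒜 h c1 c2, 0)) := by
  rw [N_base]
  rw [← Algebra.algebraMap_eq_smul_one]
  exact (IsUnit.mk0 _ hN.ne').map (algebraMap ℝ 𝒜)
theorem contDiffAt_β [CompleteSpace 𝒜] (hN : 0 < c1 ^ 2 + c2 ^ 2 + h ^ 2) :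
    ContDiffAt ℝ ω F.β (base 𝒜 h c1 c2, 0) := by
  obtain ⟨v, hv⟩ := F.isUnit_N_base h c1 c2 hN
  exact ContDiffAt.comp (g := Ring.inverse) _ (by rw [← hv]; exact contDiffAt_ringInverse ℝ v)
    (F.contDiffAt_N h c1 c2)

theorem contDiff_V : ContDiff ℝ ω F.V := by
  unfold V ξ1 ξ2; fun_prop

theorem G_base (α : ℝ) (L0 L1 L2 : 𝒜 × 𝒜 × 𝒜 →L[ℝ] 𝒜) :
    F.G (base 𝒜 h c1 c2, 0) α L0 L1 L2 = 0 := by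
  have hW := F.W_pos
  have e1 : F.Y1 (base 𝒜 h c1 c2, 0) = 0 := by
    rw [Y1, s_base, P1_base, smul_mul_smul_comm, one_mul, smul_smul, ← sub_smul]
    rw [show F.W ^ 2 * F.l22 * (F.W⁻¹ * F.p1) - F.W * F.l22 * F.p1 = 0 by field_simp; ring,
      zero_smul]
  have e2 : F.Y2 (base 𝒜 h c1 c2, 0) = 0 := by
    rw [Y2, s_base, P1_base, P2_base, smul_smul, smul_smul, ← sub_smul, smul_mul_smul_comm,
      one_mul, smul_smul, ← sub_smul]
    rw [show F.W ^ 2 * (F.W⁻¹ * (F.l11 * F.p2 - F.l21 * F.p1)) -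
      F.W * (F.l11 * F.p2 - F.l21 * F.p1) = 0 by field_simp; ring, zero_smul]
  rw [G, X1, X2, e1, e2, H_base]
  simp only [Prod.snd_zero, Prod.fst_zero, mul_zero, add_zero, sub_zero, zero_sub, neg_eq_zero]
  exact map_zero (L0.prod (L1.prod L2))

theorem contDiffAt_G [CompleteSpace 𝒜] (α : ℝ) (L0 L1 L2 : 𝒜 × 𝒜 × 𝒜 →L[ℝ] 𝒜)
    (hN : 0 < c1 ^ 2 + c2 ^ 2 + h ^ 2) :
    ContDiffAt ℝ ω (fun y => F.G y α L0 L1 L2) (base 𝒜 h c1 c2, 0) := by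
  have := F.contDiffAt_ja h c1 c2; have := F.contDiffAt_jc h c1 c2
  have := F.contDiffAt_P1 h c1 c2; have := F.contDiffAt_P2 h c1 c2
  have := F.contDiffAt_s h c1 c2; have := F.contDiffAt_det h c1 c2
  have := F.contDiffAt_β h c1 c2 hN; have := F.contDiff_V
  have e1 : ContDiffAt ℝ ω F.X1 (base 𝒜 h c1 c2, 0) := by
    unfold X1 Y1 Y2; fun_prop
  have e2 : ContDiffAt ℝ ω F.X2 (base 𝒜 h c1 c2, 0) := by
    unfold X2 Y1 Y2; fun_prop
  have e3 : ContDiffAt ℝ ω (fun y => F.H y α) (base 𝒜 h c1 c2, 0) := by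
    unfold H x1 x2 ξ1 ξ2; fun_prop
  unfold G
  exact contDiffAt_snd.sub ((L0.prod (L1.prod L2)).contDiff.contDiffAt.comp _
    (by fun_prop))

/-- The relations between the intermediate quantities at a solution near the base point. -/
structure IsNear (h c1 c2 ε : ℝ) (y : Prm 𝒜 × (𝒜 × 𝒜 × 𝒜)) : Prop where
  ι_mul : F.ι y * F.det y = 1
  β_mul : F.β y * F.N y = 1
  s_mul : F.s y * F.s y * (1 + F.P1 y * F.P1 y + F.P2 y * F.P2 y) = 1
  s_near : ‖F.s y - F.W⁻¹ • 1‖ < ε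
  P1_near : ‖F.P1 y - F.p1 • 1‖ < ε
  P2_near : ‖F.P2 y - F.p2 • 1‖ < ε
  N_near : ‖F.N y - (c1 ^ 2 + c2 ^ 2 + h ^ 2) • 1‖ < ε

theorem eventually_isNear [CompleteSpace 𝒜] (hN : 0 < c1 ^ 2 + c2 ^ 2 + h ^ 2) {ε : ℝ}
    (hε : 0 < ε) : ∀ᶠ y in 𝓝 (base 𝒜 h c1 c2, 0), F.IsNear h c1 c2 ε y := by
  have near {g : Prm 𝒜 × (𝒜 × 𝒜 × 𝒜) → 𝒜} {v : 𝒜} (hg : ContDiffAt ℝ ω g (base 𝒜 h c1 c2, 0))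
      (hv : g (base 𝒜 h c1 c2, 0) = v) :
      ∀ᶠ y in 𝓝 (base 𝒜 h c1 c2, (0 : 𝒜 × 𝒜 × 𝒜)), ‖g y - v‖ < ε := by
    have := hg.continuousAt.eventually (Metric.ball_mem_nhds _ hε)
    filter_upwards [this] with y hy
    rwa [hv, dist_eq_norm] at hy
  have hdet : IsUnit (F.det (base 𝒜 h c1 c2, 0)) := by
    rw [det_base]
    exact IsUnit.of_mul_eq_one_right _ F.ι0_mul
  have unit {g : Prm 𝒜 × (𝒜 × 𝒜 × 𝒜) → 𝒜} (hg : ContDiffAt ℝ ω g (base 𝒜 h c1 c2, 0))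
      (hv : IsUnit (g (base 𝒜 h c1 c2, 0))) :
      ∀ᶠ y in 𝓝 (base 𝒜 h c1 c2, (0 : 𝒜 × 𝒜 × 𝒜)), Ring.inverse (g y) * g y = 1 := by
    obtain ⟨v, hv⟩ := hv
    have := hg.continuousAt.eventually (by rw [← hv]; exact v.nhds)
    filter_upwards [this] with y hy
    exact Ring.inverse_mul_cancel _ hy
  have hP1 := F.contDiffAt_P1 h c1 c2
  have hP2 := F.contDiffAt_P2 h c1 c2
  have hs : ∀ᶠ y in 𝓝 (base 𝒜 h c1 c2, (0 : 𝒜 × 𝒜 × 𝒜)),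
      F.s y * F.s y * (1 + F.P1 y * F.P1 y + F.P2 y * F.P2 y) = 1 := by
    have hc : ContinuousAt (fun y => 1 + F.P1 y * F.P1 y + F.P2 y * F.P2 y)
        (base 𝒜 h c1 c2, 0) :=
      ContDiffAt.continuousAt (𝕜 := ℝ) (n := ω) (by fun_prop)
    have hS := F.S_eq
    rw [← F.one_add_base h c1 c2] at hS
    exact hc.eventually hS
  filter_upwards [hs, unit (F.contDiffAt_det h c1 c2) hdet,
    unit (F.contDiffAt_N h c1 c2) (F.isUnit_N_base h c1 c2 hN),
    near (F.contDiffAt_s h c1 c2) (F.s_base h c1 c2), near hP1 (F.P1_base h c1 c2),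
    near hP2 (F.P2_base h c1 c2), near (F.contDiffAt_N h c1 c2) (F.N_base h c1 c2)]
    with y h1 h2 h3 h4 h5 h6 h7
  exact ⟨h2, h3, h1, h4, h5, h6, h7⟩

/-- Solvability of the Dirichlet problem near the base point, with analytic dependence. -/
theorem exists_solution [CompleteSpace 𝒜] (α : ℝ) (L0 L1 L2 : 𝒜 × 𝒜 × 𝒜 →L[ℝ] 𝒜)
    (hN : 0 < c1 ^ 2 + c2 ^ 2 + h ^ 2) {ε : ℝ} (hε : 0 < ε) : ∃ Z : Prm 𝒜 → 𝒜 × 𝒜 × 𝒜,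
      ∀ᶠ x in 𝓝 (base 𝒜 h c1 c2), ContDiffAt ℝ ω Z x ∧ F.G (x, Z x) α L0 L1 L2 = 0 ∧
        F.IsNear h c1 c2 ε (x, Z x) := by
  obtain ⟨Z, h1, h2, h3⟩ := exists_implicit (F.contDiffAt_G h c1 c2 α L0 L1 L2 hN)
    (F.G_base h c1 c2 α L0 L1 L2) (F.hasDerivAt_G h c1 c2 α L0 L1 L2)
  refine ⟨Z, ?_⟩
  have h4 : ContinuousAt (fun x => (x, Z x)) (base 𝒜 h c1 c2) :=
    continuousAt_id.prodMk h1.continuousAt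
  have h5 := F.eventually_isNear h c1 c2 hN hε
  rw [← h2] at h5
  filter_upwards [h1.eventually (by simp), h3, h4.eventually h5] with x k1 k2 k3
  exact ⟨k1, k2, k3⟩

end smooth

end Frame

end resid

end

noncomputable section

section interp

open Filter Topology MeasureTheory
open scoped ContDiff

variable {T : ℝ} [hT : Fact (0 < T)]

local notation "𝒜" => wienReal (Icc (0 : ℝ) T)

/-- Evaluation of an algebra element as a function on the plane, constant beyond the strip. -/
def cf (a : 𝒜) (y : ℝ × ℝ) : ℝ := wienReal.ev (clamp y.1) y.2 a

theorem continuous_cf (a : 𝒜) : Continuous (cf a) :=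
  (wienReal.continuous_ev a).comp (by fun_prop :
    Continuous fun y : ℝ × ℝ => ((clamp y.1 : Icc (0 : ℝ) T), y.2))

theorem cf_periodic (a : 𝒜) (t θ : ℝ) : cf a (t, θ + 2 * π) = cf a (t, θ) :=
  wienReal.ev_periodic _ _ _

theorem abs_cf_le (a : 𝒜) (y : ℝ × ℝ) : |cf a y| ≤ ‖a‖ := wienReal.abs_ev_le _ _ _

@[simp] theorem cf_add (a b : 𝒜) (y : ℝ × ℝ) : cf (a + b) y = cf a y + cf b y := map_add _ _ _
@[simp] theorem cf_sub (a b : 𝒜) (y : ℝ × ℝ) : cf (a - b) y = cf a y - cf b y := map_sub _ _ _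
@[simp] theorem cf_neg (a : 𝒜) (y : ℝ × ℝ) : cf (-a) y = -cf a y := map_neg _ _
@[simp] theorem cf_smul (c : ℝ) (a : 𝒜) (y : ℝ × ℝ) : cf (c • a) y = c * cf a y :=
  (map_smul _ _ _).trans (smul_eq_mul _ _)
@[simp] theorem cf_mul (a b : 𝒜) (y : ℝ × ℝ) : cf (a * b) y = cf a y * cf b y :=
  wienReal.ev_mul _ _ _ _
@[simp] theorem cf_one (y : ℝ × ℝ) : cf (1 : 𝒜) y = 1 := wienReal.ev_one _ _

theorem Wien.single_mul_single {R : Type*} [NormedCommRing R] (n m : ℤ) (c d : R) :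
    Wien.single n c * Wien.single m d = Wien.single (n + m) (c * d) := by
  ext k
  rw [Wien.single_mul_apply, Wien.single_apply, Wien.single_apply, mul_ite, mul_zero]
  congr 1
  exact propext (by omega)

theorem wienReal.const_mul_const {X : Type*} [TopologicalSpace X] [CompactSpace X]
    (c d : C(X, ℝ)) : wienReal.const c * wienReal.const d = wienReal.const (c * d) := by
  apply Subtype.ext
  change Wien.single _ _ * Wien.single _ _ = Wien.single _ _
  rw [Wien.single_mul_single, add_zero]
  congr 1
  ext x
  simp

theorem wienReal.const_one {X : Type*} [TopologicalSpace X] [CompactSpace X] :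
    wienReal.const (1 : C(X, ℝ)) = 1 := by
  apply Subtype.ext
  change Wien.single _ _ = Wien.single 0 1
  congr 1

theorem wienReal.cos_sq_add_sin_sq (X : Type*) [TopologicalSpace X] [CompactSpace X] :
    wienReal.cosE X * wienReal.cosE X + wienReal.sinE X * wienReal.sinE X = 1 := by
  apply Subtype.ext
  change (Wien.single _ _ + Wien.single _ _) * (Wien.single _ _ + Wien.single _ _) +
    (Wien.single _ _ + Wien.single _ _) * (Wien.single _ _ + Wien.single _ _) = Wien.single 0 1
  simp only [add_mul, mul_add, Wien.single_mul_single]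
  ext k x
  simp only [Wien.add_apply, Wien.single_apply]
  norm_num
  split_ifs <;> simp <;> try omega
  all_goals ring_nf
  all_goals simp
  all_goals ring_nf

variable (T) in
def expE : C(Icc (0 : ℝ) T, ℝ) := ⟨fun t => rexp t, by fun_prop⟩
variable (T) in
def expNegE : C(Icc (0 : ℝ) T, ℝ) := ⟨fun t => rexp (-(2 * t)), by fun_prop⟩
variable (T) in
def bump : C(Icc (0 : ℝ) T, ℝ) := ⟨fun t => t * (T - t), by fun_prop⟩
variable (T) in
def bump' : C(Icc (0 : ℝ) T, ℝ) := ⟨fun t => T - 2 * t, by fun_prop⟩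

omit hT in
theorem rsqrt_exists (W : {W : ℝ // 0 < W}) : ∃ S : 𝒜 → 𝒜,
    ContDiffAt ℝ ω S ((W.1 ^ 2) • 1) ∧ S ((W.1 ^ 2) • 1) = W.1⁻¹ • 1 ∧
      ∀ᶠ N in 𝓝 ((W.1 ^ 2) • (1 : 𝒜)), S N * S N * N = 1 := exists_rsqrt 𝒜 W.2

variable (T) in
/-- The frame of the annulus in logarithmic polar coordinates at slope `(p, q)`. -/
def stdFrame (p q : ℝ) : Frame 𝒜 where
  e1 := wienReal.const (expE T) * wienReal.cosE _
  e2 := wienReal.const (expE T) * wienReal.sinE _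
  η := wienReal.const (bump T)
  η' := wienReal.const (bump' T)
  ι0 := wienReal.const (expNegE T)
  p1 := p
  p2 := q
  l11 := √(1 + q ^ 2)
  l21 := -(p * q) / √(1 + q ^ 2)
  l22 := area p q / √(1 + q ^ 2)
  W := area p q
  S := (rsqrt_exists ⟨area p q, area_pos p q⟩).choose
  ι0_mul := by
    rw [show ∀ a b c d : 𝒜, d * (a * b * (a * b) + a * c * (a * c)) =
      d * (a * a) * (b * b + c * c) by intros; ring, wienReal.cos_sq_add_sin_sq, mul_one,
      wienReal.const_mul_const, wienReal.const_mul_const, ← wienReal.const_one]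
    congr 1
    ext x
    simp only [ContinuousMap.mul_apply, ContinuousMap.one_apply, expNegE, expE, ContinuousMap.coe_mk,
      ← Real.exp_add]
    rw [Real.exp_eq_one_iff]; ring
  W_pos := area_pos p q
  W_sq := area_sq p q
  l11_pos := by positivity
  l11_sq := sq_sqrt (by positivity)
  l11_l21 := by field_simp
  l11_l22 := by field_simp
  S_contDiffAt := (rsqrt_exists ⟨area p q, area_pos p q⟩).choose_spec.1
  S_base := (rsqrt_exists ⟨area p q, area_pos p q⟩).choose_spec.2.1
  S_eq := (rsqrt_exists ⟨area p q, area_pos p q⟩).choose_spec.2.2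

section chart

variable (p q : ℝ)

theorem cf_e1 (z : ℝ × ℝ) :
    cf (stdFrame T p q).e1 z = rexp (clamp (T := T) z.1) * Real.cos z.2 := by
  simp [stdFrame, cf, expE]

theorem cf_e2 (z : ℝ × ℝ) :
    cf (stdFrame T p q).e2 z = rexp (clamp (T := T) z.1) * Real.sin z.2 := by
  simp [stdFrame, cf, expE]

theorem cf_η (z : ℝ × ℝ) :
    cf (stdFrame T p q).η z = clamp (T := T) z.1 * (T - clamp (T := T) z.1) := by
  simp [stdFrame, cf, bump]

theorem cf_η' (z : ℝ × ℝ) : cf (stdFrame T p q).η' z = T - 2 * clamp (T := T) z.1 := by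
  simp [stdFrame, cf, bump']

theorem hasDerivAt_cf_e1_fst {t : ℝ} (ht : t ∈ Ioo 0 T) (θ : ℝ) :
    HasDerivAt (fun t => cf (stdFrame T p q).e1 (t, θ)) (cf (stdFrame T p q).e1 (t, θ)) t := by
  simp only [cf_e1, coe_clamp (Ioo_subset_Icc_self ht)]
  exact ((Real.hasDerivAt_exp t).comp_clamp ht).mul_const _

theorem hasDerivAt_cf_e2_fst {t : ℝ} (ht : t ∈ Ioo 0 T) (θ : ℝ) :
    HasDerivAt (fun t => cf (stdFrame T p q).e2 (t, θ)) (cf (stdFrame T p q).e2 (t, θ)) t := by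
  simp only [cf_e2, coe_clamp (Ioo_subset_Icc_self ht)]
  exact ((Real.hasDerivAt_exp t).comp_clamp ht).mul_const _

theorem hasDerivAt_cf_η_fst {t : ℝ} (ht : t ∈ Ioo 0 T) (θ : ℝ) :
    HasDerivAt (fun t => cf (stdFrame T p q).η (t, θ)) (cf (stdFrame T p q).η' (t, θ)) t := by
  simp only [cf_η, cf_η', coe_clamp (Ioo_subset_Icc_self ht)]
  refine HasDerivAt.comp_clamp (g := fun t => t * (T - t)) ?_ ht
  refine ((hasDerivAt_id t).fun_mul ((hasDerivAt_id t).const_sub T)).congr_deriv ?_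
  simp only [id]; ring

theorem hasDerivAt_cf_e1_snd (t θ : ℝ) :
    HasDerivAt (fun θ => cf (stdFrame T p q).e1 (t, θ)) (-cf (stdFrame T p q).e2 (t, θ)) θ := by
  simp only [cf_e1, cf_e2, ← mul_neg]
  exact (Real.hasDerivAt_cos θ).const_mul _

theorem hasDerivAt_cf_e2_snd (t θ : ℝ) :
    HasDerivAt (fun θ => cf (stdFrame T p q).e2 (t, θ)) (cf (stdFrame T p q).e1 (t, θ)) θ := by
  simp only [cf_e1, cf_e2]
  exact (Real.hasDerivAt_sin θ).const_mul _

theorem hasDerivAt_cf_η_snd (t θ : ℝ) :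
    HasDerivAt (fun θ => cf (stdFrame T p q).η (t, θ)) 0 θ := by
  simp only [cf_η]
  exact hasDerivAt_const _ _

theorem hasDerivAt_cf_η'_snd (t θ : ℝ) :
    HasDerivAt (fun θ => cf (stdFrame T p q).η' (t, θ)) 0 θ := by
  simp only [cf_η']
  exact hasDerivAt_const _ _

theorem stdFrame_isChart (y : Prm 𝒜 × (𝒜 × 𝒜 × 𝒜)) :
    IsChart T (cf ((stdFrame T p q).x1 y)) (cf ((stdFrame T p q).x2 y))
    (cf ((stdFrame T p q).A1 y)) (cf ((stdFrame T p q).A2 y)) (cf ((stdFrame T p q).B1 y))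
    (cf ((stdFrame T p q).B2 y)) (cf ((stdFrame T p q).B1 y)) (cf ((stdFrame T p q).B2 y)) := by
  refine ⟨continuous_cf _, continuous_cf _, continuous_cf _, continuous_cf _, continuous_cf _,
    continuous_cf _, continuous_cf _, continuous_cf _, fun t ht θ => ?_, fun t ht θ => ?_,
    fun t _ θ => ?_, fun t _ θ => ?_, fun t ht θ => ?_, fun t ht θ => ?_, fun t _ θ => ?_,
    fun t _ θ => ?_, cf_periodic _, cf_periodic _, cf_periodic _, cf_periodic _⟩
  all_goals
    simp only [Frame.x1, Frame.x2, Frame.A1, Frame.A2, Frame.B1, Frame.B2, Frame.ja, Frame.jc,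
      Frame.ξ1, Frame.ξ2, cf_add, cf_smul, cf_neg, cf_one]
  · exact ((((hasDerivAt_cf_e1_fst p q ht θ).fun_add ((hasDerivAt_cf_η_fst p q ht θ).const_mul
      _)).const_mul _).const_mul _).const_add _
  · exact (((((hasDerivAt_cf_e1_fst p q ht θ).fun_add ((hasDerivAt_cf_η_fst p q ht θ).const_mul
      _)).const_mul _).fun_add (((hasDerivAt_cf_e2_fst p q ht θ).fun_add
      ((hasDerivAt_cf_η_fst p q ht θ).const_mul _)).const_mul _)).const_mul _).const_add _
  · refine (((((hasDerivAt_cf_e1_snd p q t θ).fun_add ((hasDerivAt_cf_η_snd p q t θ).const_mul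
      _)).const_mul _).const_mul _).const_add _).congr_deriv ?_
    ring
  · refine ((((((hasDerivAt_cf_e1_snd p q t θ).fun_add ((hasDerivAt_cf_η_snd p q t θ).const_mul
      _)).const_mul _).fun_add (((hasDerivAt_cf_e2_snd p q t θ).fun_add
      ((hasDerivAt_cf_η_snd p q t θ).const_mul _)).const_mul _)).const_mul _).const_add
      _).congr_deriv ?_
    ring
  · exact (((hasDerivAt_cf_e2_fst p q ht θ).fun_neg).const_mul _).const_mul _
  · exact ((((hasDerivAt_cf_e2_fst p q ht θ).fun_neg).const_mul _).fun_add
      ((hasDerivAt_cf_e1_fst p q ht θ).const_mul _)).const_mul _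
  · refine ((((hasDerivAt_cf_e1_snd p q t θ).fun_add ((hasDerivAt_cf_η'_snd p q t θ).const_mul
      _)).const_mul _).const_mul _).congr_deriv ?_
    ring
  · refine (((((hasDerivAt_cf_e1_snd p q t θ).fun_add ((hasDerivAt_cf_η'_snd p q t θ).const_mul
      _)).const_mul _).fun_add (((hasDerivAt_cf_e2_snd p q t θ).fun_add
      ((hasDerivAt_cf_η'_snd p q t θ).const_mul _)).const_mul _)).const_mul _).congr_deriv ?_
    ring

end chart

end interp

end

noncomputable section

section weakSol

open Filter Topology MeasureTheory
open scoped ContDiff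

variable {T : ℝ} [hT : Fact (0 < T)]

local notation "𝒜" => wienReal (Icc (0 : ℝ) T)
local notation "dfst" => ContinuousLinearMap.fst ℝ ℝ ℝ
local notation "dsnd" => ContinuousLinearMap.snd ℝ ℝ ℝ

theorem HasFDerivAt.hasDerivAt_fst {w : ℝ × ℝ → ℝ} {a b t θ : ℝ}
    (h : HasFDerivAt w (a • dfst + b • dsnd) (t, θ)) : HasDerivAt (fun t => w (t, θ)) a t := by
  refine (h.comp_hasDerivAt t ((hasDerivAt_id t).prodMk (hasDerivAt_const t θ))).congr_deriv ?_
  simp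

theorem HasFDerivAt.hasDerivAt_snd {w : ℝ × ℝ → ℝ} {a b t θ : ℝ}
    (h : HasFDerivAt w (a • dfst + b • dsnd) (t, θ)) : HasDerivAt (fun θ => w (t, θ)) b θ := by
  refine (h.comp_hasDerivAt θ ((hasDerivAt_const θ t).prodMk (hasDerivAt_id θ))).congr_deriv ?_
  simp

section pointwise

theorem cf_ι_mul {F : Frame 𝒜} {y : Prm 𝒜 × (𝒜 × 𝒜 × 𝒜)} (h : F.ι y * F.det y = 1) (z : ℝ × ℝ) :
    cf (F.ι y) z * (cf (F.ja y) z * cf F.e1 z + cf (F.jc y) z * cf F.e2 z) = 1 := by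
  have := congrArg (fun a => cf a z) h
  simpa only [cf_mul, cf_one, Frame.det, cf_add] using this

/-- The slopes invert the chart Jacobian on the derivatives of the unknown. -/
theorem cf_chain {F : Frame 𝒜} {y : Prm 𝒜 × (𝒜 × 𝒜 × 𝒜)} (h : F.ι y * F.det y = 1) (z : ℝ × ℝ) :
    cf (F.A1 y) z * cf (F.P1 y) z + cf (F.A2 y) z * cf (F.P2 y) z =
      y.1.1.1 * ((F.p1 * F.l11 + F.p2 * F.l21) * cf (F.ja y) z + (F.p2 * F.l22) * cf (F.jc y) z +
        (cf y.1.2.2.2.1 z + cf y.2.2.1 z)) ∧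
    cf (F.B1 y) z * cf (F.P1 y) z + cf (F.B2 y) z * cf (F.P2 y) z =
      y.1.1.1 * ((F.p1 * F.l11 + F.p2 * F.l21) * -cf F.e2 z + (F.p2 * F.l22) * cf F.e1 z +
        (cf y.1.2.2.2.2 z + cf y.2.2.2 z)) := by
  have h1 := cf_ι_mul h z
  have hl11 := F.l11_pos
  have hl22 := F.l22_pos
  have e1 : F.l11 * cf (F.P1 y) z + F.l21 * cf (F.P2 y) z =
      F.p1 * F.l11 + F.p2 * F.l21 + cf (F.Q1 y) z := by
    simp only [Frame.P1, Frame.P2, cf_add, cf_sub, cf_smul, cf_one, ← F.l11_l22]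
    field_simp
    ring
  have e2 : F.l22 * cf (F.P2 y) z = F.p2 * F.l22 + cf (F.Q2 y) z := by
    simp only [Frame.P2, cf_add, cf_smul, cf_one]
    field_simp
  have q1 : cf (F.ja y) z * cf (F.Q1 y) z + cf (F.jc y) z * cf (F.Q2 y) z =
      cf y.1.2.2.2.1 z + cf y.2.2.1 z := by
    simp only [Frame.Q1, Frame.Q2, cf_add, cf_sub, cf_mul]
    linear_combination (cf y.1.2.2.2.1 z + cf y.2.2.1 z) * h1
  have q2 : -cf F.e2 z * cf (F.Q1 y) z + cf F.e1 z * cf (F.Q2 y) z =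
      cf y.1.2.2.2.2 z + cf y.2.2.2 z := by
    simp only [Frame.Q1, Frame.Q2, cf_add, cf_sub, cf_mul]
    linear_combination (cf y.1.2.2.2.2 z + cf y.2.2.2 z) * h1
  simp only [Frame.A1, Frame.A2, Frame.B1, Frame.B2, cf_add, cf_smul, cf_neg]
  constructor
  · linear_combination y.1.1.1 * cf (F.ja y) z * e1 + y.1.1.1 * cf (F.jc y) z * e2 + y.1.1.1 * q1
  · linear_combination -y.1.1.1 * cf F.e2 z * e1 + y.1.1.1 * cf F.e1 z * e2 + y.1.1.1 * q2

theorem cf_jac (F : Frame 𝒜) (y : Prm 𝒜 × (𝒜 × 𝒜 × 𝒜)) (z : ℝ × ℝ) :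
    cf (F.A1 y) z * cf (F.B2 y) z - cf (F.A2 y) z * cf (F.B1 y) z =
      y.1.1.1 ^ 2 * F.W * cf (F.det y) z := by
  simp only [Frame.A1, Frame.A2, Frame.B1, Frame.B2, Frame.det, cf_add, cf_smul, cf_neg, cf_mul,
    ← F.l11_l22]
  ring

theorem cf_s {F : Frame 𝒜} {y : Prm 𝒜 × (𝒜 × 𝒜 × 𝒜)} {h c1 c2 ε : ℝ}
    (hy : F.IsNear h c1 c2 ε y) (hε : ε ≤ F.W⁻¹) (z : ℝ × ℝ) :
    cf (F.s y) z = (area (cf (F.P1 y) z) (cf (F.P2 y) z))⁻¹ := by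
  have h1 := congrArg (fun a => cf a z) hy.s_mul
  simp only [cf_mul, cf_one, cf_add] at h1
  have h2 := (abs_cf_le (F.s y - F.W⁻¹ • 1) z).trans_lt hy.s_near
  simp only [cf_sub, cf_smul, cf_one, mul_one] at h2
  have h3 : 0 < cf (F.s y) z := by
    have := (abs_lt.1 h2).1; linarith
  have hA := area_pos (cf (F.P1 y) z) (cf (F.P2 y) z)
  have h4 : (cf (F.s y) z * area (cf (F.P1 y) z) (cf (F.P2 y) z)) ^ 2 = 1 := by
    rw [mul_pow, area_sq]; linear_combination h1
  exact eq_inv_of_mul_eq_one_left ((pow_eq_one_iff_of_nonneg (by positivity) two_ne_zero).1 h4)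

theorem cf_N (F : Frame 𝒜) (y : Prm 𝒜 × (𝒜 × 𝒜 × 𝒜)) (z : ℝ × ℝ) :
    cf (F.N y) z = cf (F.x1 y) z ^ 2 + cf (F.x2 y) z ^ 2 + cf (F.V y) z ^ 2 := by
  simp only [Frame.N, cf_add, cf_mul]; ring

theorem cf_H {F : Frame 𝒜} {y : Prm 𝒜 × (𝒜 × 𝒜 × 𝒜)} {h c1 c2 ε : ℝ}
    (hy : F.IsNear h c1 c2 ε y) (hε : ε ≤ F.W⁻¹) (α : ℝ) (z : ℝ × ℝ) :
    (cf (F.A1 y) z * cf (F.B2 y) z - cf (F.A2 y) z * cf (F.B1 y) z) *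
      rhs α (cf (F.x1 y) z) (cf (F.x2 y) z) (cf (F.V y) z) (cf (F.P1 y) z) (cf (F.P2 y) z) =
      y.1.1.1 / F.W ^ 2 * cf (F.H y α) z := by
  have hW := F.W_pos
  have h1 := congrArg (fun a => cf a z) hy.β_mul
  simp only [cf_mul, cf_one, cf_N] at h1
  have hb := eq_inv_of_mul_eq_one_left h1
  rw [cf_jac, Frame.H, cf_smul, rhs]
  simp only [cf_mul, cf_sub, cf_s hy hε, hb]
  field_simp

theorem cf_flux {F : Frame 𝒜} {y : Prm 𝒜 × (𝒜 × 𝒜 × 𝒜)} {h c1 c2 ε : ℝ}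
    (hy : F.IsNear h c1 c2 ε y) (hε : ε ≤ F.W⁻¹) (z : ℝ × ℝ) :
    cf (F.P1 y) z / area (cf (F.P1 y) z) (cf (F.P2 y) z) * cf (F.B2 y) z -
        cf (F.P2 y) z / area (cf (F.P1 y) z) (cf (F.P2 y) z) * cf (F.B1 y) z =
      y.1.1.1 / F.W ^ 2 * cf (F.X1 y) z +
        (F.p1 / F.W * cf (F.B2 y) z - F.p2 / F.W * cf (F.B1 y) z) ∧
    cf (F.P2 y) z / area (cf (F.P1 y) z) (cf (F.P2 y) z) * cf (F.A1 y) z -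
        cf (F.P1 y) z / area (cf (F.P1 y) z) (cf (F.P2 y) z) * cf (F.A2 y) z =
      y.1.1.1 / F.W ^ 2 * cf (F.X2 y) z +
        (F.p2 / F.W * cf (F.A1 y) z - F.p1 / F.W * cf (F.A2 y) z) := by
  have hW := F.W_pos
  simp only [div_eq_mul_inv _ (area _ _), ← cf_s hy hε]
  simp only [Frame.X1, Frame.X2, Frame.Y1, Frame.Y2, Frame.A1, Frame.A2, Frame.B1, Frame.B2,
    cf_add, cf_sub, cf_smul, cf_neg, cf_mul, cf_one]
  constructor
  · field_simp; ring
  · field_simp; ring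

end pointwise

omit hT in
theorem integral2_combine {I J E : ℝ × ℝ → ℝ} (hI : Continuous I) (hJ : Continuous J) (c : ℝ)
    (hE : ∀ t θ, E (t, θ) = c * I (t, θ) + J (t, θ)) {a b a' b' : ℝ}
    (h1 : ∫ t in a..b, ∫ θ in a'..b', I (t, θ) = 0)
    (h2 : ∫ t in a..b, ∫ θ in a'..b', J (t, θ) = 0) :
    ∫ t in a..b, ∫ θ in a'..b', E (t, θ) = 0 := by
  have h3 := integral2_add (hI.const_mul c) hJ a b a' b'
  simp only [intervalIntegral.integral_const_mul, h1, h2, mul_zero, add_zero] at h3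
  simpa only [hE] using h3

theorem cf_weak {L0 L1 L2 : 𝒜 × 𝒜 × 𝒜 →L[ℝ] 𝒜} (hL : IsGreen L0 L1 L2) {F : Frame 𝒜}
    {y : Prm 𝒜 × (𝒜 × 𝒜 × 𝒜)} {C1 C2 : ℝ × ℝ → ℝ} {x1 x2 : ℝ × ℝ → ℝ}
    (hX : IsChart T x1 x2 (cf (F.A1 y)) (cf (F.A2 y)) (cf (F.B1 y)) (cf (F.B2 y)) C1 C2)
    {f g k : 𝒜} {Y1 Y2 : 𝒜} (hY1 : L1 (f, g, k) - f = Y1) (hY2 : L2 (f, g, k) - g = Y2)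
    {E1 E2 E3 : ℝ × ℝ → ℝ} {c a b : ℝ}
    (h1 : ∀ z, E1 z = c * cf Y1 z + (a * cf (F.B2 y) z - b * cf (F.B1 y) z))
    (h2 : ∀ z, E2 z = c * cf Y2 z + (b * cf (F.A1 y) z - a * cf (F.A2 y) z))
    (h3 : ∀ z, E3 z = c * cf k z) {t0 θ0 : ℝ} {φ φt φθ : ℝ × ℝ → ℝ}
    (hφ : IsTest T t0 θ0 φ φt φθ) :
    ∫ t in (0 : ℝ)..T, ∫ θ in (θ0 - π)..θ0 - π + 2 * π,
      (E1 (t, θ) * φt (t, θ) + E2 (t, θ) * φθ (t, θ) + E3 (t, θ) * φ (t, θ)) = 0 := by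
  have hc := hX.weak_flux hT.out (a1 := fun _ => a) (a2 := fun _ => b)
    (a1x := 0) (a1y := 0) (a2x := 0) (a2y := 0) continuousOn_const continuousOn_const
    continuousOn_const continuousOn_const continuousOn_const continuousOn_const
    (fun t _ θ _ => by simpa using hasDerivAt_const t _)
    (fun t _ θ _ => by simpa using hasDerivAt_const t _)
    (fun t _ θ _ => by simpa using hasDerivAt_const θ _)
    (fun t _ θ _ => by simpa using hasDerivAt_const θ _) (fun _ _ => rfl) (fun _ _ => rfl) hφ
  have hw := hL.weak f g k hφ.cont hφ.cont_fst hφ.cont_snd hφ.dfst hφ.dsnd hφ.zero hφ.right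
    hφ.periodic (θ0 - π)
  simp only [← map_sub, hY1, hY2] at hw
  have c1 := hφ.cont
  have c2 := hφ.cont_fst
  have c3 := hφ.cont_snd
  have k1 := continuous_cf Y1
  have k2 := continuous_cf Y2
  have k3 := continuous_cf k
  have j1 := hX.cA1
  have j2 := hX.cA2
  have j3 := hX.cB1
  have j4 := hX.cB2
  refine integral2_combine (E := fun z => E1 z * φt z + E2 z * φθ z + E3 z * φ z)
    (I := fun z => cf Y1 z * φt z + cf Y2 z * φθ z + cf k z * φ z)
    (J := fun z => (a * cf (F.B2 y) z - b * cf (F.B1 y) z) * φt z +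
      (b * cf (F.A1 y) z - a * cf (F.A2 y) z) * φθ z) (by fun_prop) (by fun_prop) c
    (fun t θ => ?_) hw ?_
  · simp only [h1, h2, h3]; ring
  · simpa only [Pi.zero_apply, add_zero, mul_zero, zero_mul] using hc

theorem stdFrame_isWeakChartSol {L0 L1 L2 : 𝒜 × 𝒜 × 𝒜 →L[ℝ] 𝒜} (hL : IsGreen L0 L1 L2)
    {α p q h c1 c2 ε K R m : ℝ} {y : Prm 𝒜 × (𝒜 × 𝒜 × 𝒜)}
    (hG : (stdFrame T p q).G y α L0 L1 L2 = 0) (hy : (stdFrame T p q).IsNear h c1 c2 ε y)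
    (hε : ε ≤ (area p q)⁻¹) (hε1 : ε ≤ 1) (hεN : ε ≤ (c1 ^ 2 + c2 ^ 2 + h ^ 2) / 2)
    (hKp : |p| + 1 ≤ K) (hKq : |q| + 1 ≤ K) (hR : c1 ^ 2 + c2 ^ 2 + h ^ 2 + 1 ≤ R)
    (hm : m ≤ (c1 ^ 2 + c2 ^ 2 + h ^ 2) / 2)
    (hΨ : ∀ t ∈ Ioo 0 T, ∀ θ, HasFDerivAt (cf y.1.2.2.1)
      (cf y.1.2.2.2.1 (t, θ) • dfst + cf y.1.2.2.2.2 (t, θ) • dsnd) (t, θ)) (t0 θ0 : ℝ) :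
    IsWeakChartSol α T t0 θ0 K R m (cf ((stdFrame T p q).x1 y)) (cf ((stdFrame T p q).x2 y))
      (cf ((stdFrame T p q).A1 y)) (cf ((stdFrame T p q).A2 y)) (cf ((stdFrame T p q).B1 y))
      (cf ((stdFrame T p q).B2 y)) (cf ((stdFrame T p q).V y)) (cf ((stdFrame T p q).P1 y))
      (cf ((stdFrame T p q).P2 y)) := by
  have hX := stdFrame_isChart p q y
  have e1t := fun (t : ℝ) (ht : t ∈ Ioo 0 T) θ => hasDerivAt_cf_e1_fst p q ht θ
  have e2t := fun (t : ℝ) (ht : t ∈ Ioo 0 T) θ => hasDerivAt_cf_e2_fst p q ht θ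
  have ηt := fun (t : ℝ) (ht : t ∈ Ioo 0 T) θ => hasDerivAt_cf_η_fst p q ht θ
  have e1θ := hasDerivAt_cf_e1_snd (T := T) p q
  have e2θ := hasDerivAt_cf_e2_snd (T := T) p q
  have ηθ := hasDerivAt_cf_η_snd (T := T) p q
  have hpF : (stdFrame T p q).p1 = p := rfl
  have hqF : (stdFrame T p q).p2 = q := rfl
  have hWF : (stdFrame T p q).W = area p q := rfl
  generalize stdFrame T p q = F at *
  rw [← hWF] at hε
  have hz : y.2 = (L0.prod (L1.prod L2)) (y.2.2.1 - F.X1 y, y.2.2.2 - F.X2 y, F.H y α) :=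
    sub_eq_zero.1 hG
  have hz0 : L0 (y.2.2.1 - F.X1 y, y.2.2.2 - F.X2 y, F.H y α) = y.2.1 := by
    conv_rhs => rw [hz]
    rfl
  have hz1 : L1 (y.2.2.1 - F.X1 y, y.2.2.2 - F.X2 y, F.H y α) = y.2.2.1 := by
    conv_rhs => rw [hz]
    rfl
  have hz2 : L2 (y.2.2.1 - F.X1 y, y.2.2.2 - F.X2 y, F.H y α) = y.2.2.2 := by
    conv_rhs => rw [hz]
    rfl
  have dz : ∀ t ∈ Ioo 0 T, ∀ θ, HasFDerivAt (cf y.2.1)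
      (cf y.2.2.1 (t, θ) • dfst + cf y.2.2.2 (t, θ) • dsnd) (t, θ) := by
    intro t ht θ
    have := hL.hasFDerivAt (y.2.2.1 - F.X1 y, y.2.2.2 - F.X2 y, F.H y α) ht θ
    rwa [hz0, hz1, hz2] at this
  have near {a : 𝒜} {v : ℝ} (ha : ‖a - v • 1‖ < ε) (z : ℝ × ℝ) : |cf a z - v| < ε := by
    have := (abs_cf_le (a - v • 1) z).trans_lt ha
    simpa only [cf_sub, cf_smul, cf_one, mul_one] using this
  refine ⟨continuous_cf _, continuous_cf _, continuous_cf _, cf_periodic _, fun z => ?_,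
    fun z => ?_, fun z => ?_, fun t ht θ => ?_, fun t ht θ => ?_, fun φ φt φθ hφ => ?_⟩
  · have h1 := near hy.P1_near z
    have := abs_sub_abs_le_abs_sub (cf (F.P1 y) z) F.p1
    rw [hpF] at *; linarith
  · have h1 := near hy.P2_near z
    have := abs_sub_abs_le_abs_sub (cf (F.P2 y) z) F.p2
    rw [hqF] at *; linarith
  · have h1 := abs_lt.1 (near hy.N_near z)
    rw [cf_N] at h1
    constructor
    · have h2 : cf (F.V y) z ^ 2 ≤ R := by
        linarith [sq_nonneg (cf (F.x1 y) z), sq_nonneg (cf (F.x2 y) z), h1.2]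
      have h3 : 1 ≤ R := by linarith [sq_nonneg c1, sq_nonneg c2, sq_nonneg h]
      exact abs_le_of_sq_le_sq (by nlinarith) (by linarith)
    · linarith
  · rw [(cf_chain hy.ι_mul (t, θ)).1]
    simp only [Frame.V, Frame.ξ1, Frame.ξ2, Frame.ja, Frame.jc, cf_add, cf_smul, cf_one]
    exact (((((((e1t t ht θ).fun_add ((ηt t ht θ).const_mul _)).const_mul _).fun_add
      (((e2t t ht θ).fun_add ((ηt t ht θ).const_mul _)).const_mul _))).fun_add
      ((hΨ t ht θ).hasDerivAt_fst.fun_add (dz t ht θ).hasDerivAt_fst)).const_mul _).const_add _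
  · rw [(cf_chain hy.ι_mul (t, θ)).2]
    simp only [Frame.V, Frame.ξ1, Frame.ξ2, cf_add, cf_smul, cf_one]
    refine ((((((((e1θ t θ).fun_add ((ηθ t θ).const_mul _)).const_mul _).fun_add
      (((e2θ t θ).fun_add ((ηθ t θ).const_mul _)).const_mul _))).fun_add
      ((hΨ t ht θ).hasDerivAt_snd.fun_add (dz t ht θ).hasDerivAt_snd)).const_mul
      _).const_add _).congr_deriv ?_
    ring
  · exact cf_weak hL hX (by rw [hz1, sub_sub_cancel]) (by rw [hz2, sub_sub_cancel])
      (fun z => (cf_flux hy hε z).1) (fun z => (cf_flux hy hε z).2) (fun z => cf_H hy hε α z) hφ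

end weakSol

end

noncomputable section

section localAnalytic

open Filter Topology MeasureTheory
open scoped ContDiff

variable {T : ℝ} [hT : Fact (0 < T)]

local notation "𝒜" => wienReal (Icc (0 : ℝ) T)
local notation "dfst" => ContinuousLinearMap.fst ℝ ℝ ℝ
local notation "dsnd" => ContinuousLinearMap.snd ℝ ℝ ℝ

omit hT in
theorem exp_polar_injOn {t t' θ θ' : ℝ} (h1 : rexp t * Real.cos θ = rexp t' * Real.cos θ')
    (h2 : rexp t * Real.sin θ = rexp t' * Real.sin θ') : perSq t' θ' (t, θ) = 0 := by
  have h3 : rexp t ^ 2 = rexp t' ^ 2 := by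
    linear_combination (rexp t * Real.cos θ + rexp t' * Real.cos θ') * h1 +
      (rexp t * Real.sin θ + rexp t' * Real.sin θ') * h2 -
      rexp t ^ 2 * Real.sin_sq_add_cos_sq θ + rexp t' ^ 2 * Real.sin_sq_add_cos_sq θ'
  have h4 : rexp t = rexp t' := (pow_left_inj₀ (by positivity) (by positivity) two_ne_zero).1 h3
  have h5 := Real.exp_injective h4
  subst h5
  have hp := (Real.exp_pos t).ne'
  have h6 := mul_left_cancel₀ hp h1
  have h7 := mul_left_cancel₀ hp h2
  simp only [perSq, Real.cos_sub, h6, h7, sub_self]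
  linear_combination -2 * Real.sin_sq_add_cos_sq θ'

omit hT in
theorem sq_exp_sub_le (t t' θ θ' : ℝ) : (rexp t - rexp t') ^ 2 ≤
    (rexp t * Real.cos θ - rexp t' * Real.cos θ') ^ 2 +
      (rexp t * Real.sin θ - rexp t' * Real.sin θ') ^ 2 := by
  have h1 := Real.cos_le_one (θ - θ')
  rw [Real.cos_sub] at h1
  have h2 : 0 < rexp t * rexp t' := by positivity
  have h3 := mul_le_mul_of_nonneg_left h1 h2.le
  have h4 : (rexp t * Real.cos θ - rexp t' * Real.cos θ') ^ 2 +
      (rexp t * Real.sin θ - rexp t' * Real.sin θ') ^ 2 = rexp t ^ 2 + rexp t' ^ 2 -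
      2 * (rexp t * rexp t' * (Real.cos θ * Real.cos θ' + Real.sin θ * Real.sin θ')) := by
    linear_combination rexp t ^ 2 * Real.sin_sq_add_cos_sq θ +
      rexp t' ^ 2 * Real.sin_sq_add_cos_sq θ'
  rw [h4]
  linarith

omit hT in
/-- The shifted polar chart is injective up to the period. -/
theorem shifted_polar_injOn {t t' θ θ' μ1 μ2 : ℝ} (ht : t ∈ Icc 0 T) (ht' : t' ∈ Icc 0 T)
    (hμ : (μ1 ^ 2 + μ2 ^ 2) * T ^ 2 < 1)
    (h1 : rexp t * Real.cos θ + μ1 * (t * (T - t)) = rexp t' * Real.cos θ' + μ1 * (t' * (T - t')))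
    (h2 : rexp t * Real.sin θ + μ2 * (t * (T - t)) = rexp t' * Real.sin θ' + μ2 * (t' * (T - t'))) :
    perSq t' θ' (t, θ) = 0 := by
  have hη : (t' * (T - t') - t * (T - t)) ^ 2 ≤ T ^ 2 * (t - t') ^ 2 := by
    rw [show t' * (T - t') - t * (T - t) = (t + t' - T) * (t - t') by ring, mul_pow]
    refine mul_le_mul_of_nonneg_right ?_ (sq_nonneg _)
    exact sq_le_sq' (by linarith [ht.1, ht'.1]) (by linarith [ht.2, ht'.2])
  have he : (t - t') ^ 2 ≤ (rexp t - rexp t') ^ 2 := by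
    rw [← sq_abs (t - t'), ← sq_abs (rexp t - rexp t')]
    refine pow_le_pow_left₀ (abs_nonneg _) ?_ 2
    wlog hle : t' ≤ t generalizing t t' θ θ'
    · rw [abs_sub_comm, abs_sub_comm (rexp t)]
      refine this ht' ht h1.symm h2.symm ?_ (le_of_not_ge hle)
      linarith
    rw [abs_of_nonneg (by linarith), abs_of_nonneg (by linarith [Real.exp_le_exp.2 hle])]
    have h3 := Real.add_one_le_exp (t - t')
    have h4 : rexp t = rexp t' * rexp (t - t') := by rw [← Real.exp_add]; congr 1; ring
    have h5 : 1 ≤ rexp t' := Real.one_le_exp ht'.1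
    nlinarith
  have hs := sq_exp_sub_le t t' θ θ'
  have e1 : rexp t * Real.cos θ - rexp t' * Real.cos θ' = μ1 * (t' * (T - t') - t * (T - t)) := by
    linear_combination h1
  have e2 : rexp t * Real.sin θ - rexp t' * Real.sin θ' = μ2 * (t' * (T - t') - t * (T - t)) := by
    linear_combination h2
  have hkey : (t - t') ^ 2 ≤ (μ1 ^ 2 + μ2 ^ 2) * T ^ 2 * (t - t') ^ 2 := by
    calc (t - t') ^ 2 ≤ (μ1 ^ 2 + μ2 ^ 2) * (t' * (T - t') - t * (T - t)) ^ 2 := by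
          rw [e1, e2] at hs; linarith
      _ ≤ (μ1 ^ 2 + μ2 ^ 2) * (T ^ 2 * (t - t') ^ 2) := by gcongr
      _ = _ := by ring
  have h0 : (t - t') ^ 2 = 0 := by
    by_contra hne
    have : 0 < (t - t') ^ 2 := lt_of_le_of_ne (sq_nonneg _) (Ne.symm hne)
    nlinarith
  have h3 : t = t' := sub_eq_zero.1 (pow_eq_zero_iff two_ne_zero |>.1 h0)
  subst h3
  exact exp_polar_injOn (by linarith) (by linarith)

omit hT in
theorem perSq_eq_zero {t t' θ θ' : ℝ} (h : perSq t' θ' (t, θ) = 0) : t = t' := by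
  have h1 := Real.cos_le_one (θ - θ')
  simp only [perSq] at h
  nlinarith [sq_nonneg (t - t')]

theorem exists_shifted_polar_zero {t1 θ1 μ1 μ2 : ℝ} (ht1 : t1 ∈ Ioo 0 T)
    (hμ : (μ1 ^ 2 + μ2 ^ 2) * T ^ 2 < 1) : ∃ t0 θ0, ∀ y : ℝ × ℝ,
      rexp (clamp (T := T) y.1) * Real.cos y.2 +
        μ1 * ((clamp (T := T) y.1 : ℝ) * (T - clamp (T := T) y.1)) = rexp t1 * Real.cos θ1 →
      rexp (clamp (T := T) y.1) * Real.sin y.2 +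
        μ2 * ((clamp (T := T) y.1 : ℝ) * (T - clamp (T := T) y.1)) = rexp t1 * Real.sin θ1 →
      perSq t0 θ0 y = 0 := by
  have interior (y : ℝ × ℝ) (h1 : rexp (clamp (T := T) y.1) * Real.cos y.2 +
        μ1 * ((clamp (T := T) y.1 : ℝ) * (T - clamp (T := T) y.1)) = rexp t1 * Real.cos θ1)
      (h2 : rexp (clamp (T := T) y.1) * Real.sin y.2 +
        μ2 * ((clamp (T := T) y.1 : ℝ) * (T - clamp (T := T) y.1)) = rexp t1 * Real.sin θ1) :
      (clamp (T := T) y.1 : ℝ) = y.1 := by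
    refine coe_clamp ⟨?_, ?_⟩
    · by_contra! hlt
      have : (clamp (T := T) y.1 : ℝ) = 0 := by
        rw [clamp, projIcc_of_le_left _ hlt.le]
      rw [this, zero_mul, mul_zero, add_zero] at h1 h2
      have := perSq_eq_zero (exp_polar_injOn h1 h2)
      linarith [ht1.1]
    · by_contra! hlt
      have : (clamp (T := T) y.1 : ℝ) = T := by
        rw [clamp, projIcc_of_right_le _ hlt.le]
      rw [this, sub_self, mul_zero, mul_zero, add_zero] at h1 h2
      have := perSq_eq_zero (exp_polar_injOn h1 h2)
      linarith [ht1.2]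
  by_cases hex : ∃ y : ℝ × ℝ, rexp (clamp (T := T) y.1) * Real.cos y.2 +
        μ1 * ((clamp (T := T) y.1 : ℝ) * (T - clamp (T := T) y.1)) = rexp t1 * Real.cos θ1 ∧
      rexp (clamp (T := T) y.1) * Real.sin y.2 +
        μ2 * ((clamp (T := T) y.1 : ℝ) * (T - clamp (T := T) y.1)) = rexp t1 * Real.sin θ1
  · obtain ⟨y, h1, h2⟩ := hex
    refine ⟨clamp (T := T) y.1, y.2, fun y' h1' h2' => ?_⟩
    have := shifted_polar_injOn (clamp_mem y'.1) (clamp_mem y.1) hμ (h1'.trans h1.symm)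
      (h2'.trans h2.symm)
    rwa [interior y' h1' h2'] at this
  · exact ⟨0, 0, fun y h1 h2 => (hex ⟨y, h1, h2⟩).elim⟩

set_option maxHeartbeats 600000 in
theorem Frame.eventually_geometry (F : Frame 𝒜) (hF : ∀ z, 1 ≤ cf (F.e1 * F.e1 + F.e2 * F.e2) z)
    (h c1 c2 : ℝ) {δ : ℝ} (hδ : 0 < δ) : ∃ C1 > 0, ∀ᶠ x in 𝓝 (base 𝒜 h c1 c2), 0 < x.1.1 →
      ∀ w y, (cf (F.x1 (x, w)) y, cf (F.x2 (x, w)) y) ∈ Metric.ball (c1, c2) δ ∧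
      (F.W / 2 * x.1.1 ^ 2 ≤
        cf (F.A1 (x, w)) y * cf (F.B2 (x, w)) y - cf (F.A2 (x, w)) y * cf (F.B1 (x, w)) y ∧
      cf (F.A1 (x, w)) y * cf (F.B2 (x, w)) y - cf (F.A2 (x, w)) y * cf (F.B1 (x, w)) y ≤
        F.W * (‖F.e1 * F.e1 + F.e2 * F.e2‖ + 1) * x.1.1 ^ 2) ∧
      |cf (F.A1 (x, w)) y| ≤ C1 * x.1.1 ∧ |cf (F.A2 (x, w)) y| ≤ C1 * x.1.1 ∧
      |cf (F.B1 (x, w)) y| ≤ C1 * x.1.1 ∧ |cf (F.B2 (x, w)) y| ≤ C1 * x.1.1 := by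
  have hl := F.l11_pos
  refine ⟨(|F.l11| + |F.l21| + |F.l22|) * (‖F.e1‖ + ‖F.e2‖ + 1), by positivity, ?_⟩
  have near {g : Prm 𝒜 → 𝒜} {v : 𝒜} {ε : ℝ} (hε : 0 < ε) (hg : Continuous g)
      (hv : g (base 𝒜 h c1 c2) = v) : ∀ᶠ x in 𝓝 (base 𝒜 h c1 c2), ‖g x - v‖ < ε := by
    filter_upwards [hg.continuousAt.eventually (Metric.ball_mem_nhds _ hε)] with x hx
    rwa [hv, dist_eq_norm] at hx
  have n1 := near hδ (g := fun x => F.x1 (x, 0)) (v := c1 • 1)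
    (by unfold x1 ξ1; fun_prop) (by simp [x1, base])
  have n2 := near hδ (g := fun x => F.x2 (x, 0)) (v := c2 • 1)
    (by unfold x2 ξ1 ξ2; fun_prop) (by simp [x2, base])
  have n3 := near one_half_pos (g := fun x => F.det (x, 0)) (by unfold det ja jc; fun_prop)
    (F.det_base h c1 c2 0)
  have n4 := near one_pos (g := fun x => F.ja (x, 0)) (by unfold ja; fun_prop) (F.ja_base h c1 c2 0)
  have n5 := near one_pos (g := fun x => F.jc (x, 0)) (by unfold jc; fun_prop) (F.jc_base h c1 c2 0)
  filter_upwards [n1, n2, n3, n4, n5] with x h1 h2 h3 h4 h5 hρ w y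
  have cfle {a b : 𝒜} {ε : ℝ} (hab : ‖a - b‖ < ε) : |cf a y - cf b y| < ε := by
    rw [← cf_sub]; exact (abs_cf_le _ _).trans_lt hab
  refine ⟨?_, ?_, ?_⟩
  · have k1 := cfle h1
    have k2 := cfle h2
    rw [cf_smul, cf_one, mul_one] at k1 k2
    exact max_lt k1 k2
  · rw [cf_jac]
    have k := abs_lt.1 (cfle h3)
    have k1 := hF y
    have k2 := (abs_le.1 (abs_cf_le (F.e1 * F.e1 + F.e2 * F.e2) y)).2
    have hW := F.W_pos
    have e : cf (F.det (x, w)) y = cf (F.det (x, 0)) y := rfl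
    rw [e]
    constructor
    · calc F.W / 2 * x.1.1 ^ 2 = x.1.1 ^ 2 * F.W * (1 / 2) := by ring
        _ ≤ _ := mul_le_mul_of_nonneg_left (by linarith [k.1]) (by positivity)
    · calc _ ≤ x.1.1 ^ 2 * F.W * (‖F.e1 * F.e1 + F.e2 * F.e2‖ + 1) :=
          mul_le_mul_of_nonneg_left (by linarith [k.2]) (by positivity)
        _ = _ := by ring
  · have ka : |cf (F.ja (x, w)) y| ≤ ‖F.e1‖ + ‖F.e2‖ + 1 := by
      have := abs_cf_le (F.ja (x, w)) y
      have e : F.ja (x, w) = F.ja (x, 0) := rfl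
      have h6 := norm_le_norm_add_norm_sub' (F.ja (x, 0)) F.e1
      rw [e] at this ⊢
      linarith [norm_nonneg F.e2]
    have kc : |cf (F.jc (x, w)) y| ≤ ‖F.e1‖ + ‖F.e2‖ + 1 := by
      have := abs_cf_le (F.jc (x, w)) y
      have e : F.jc (x, w) = F.jc (x, 0) := rfl
      have h6 := norm_le_norm_add_norm_sub' (F.jc (x, 0)) F.e2
      rw [e] at this ⊢
      linarith [norm_nonneg F.e1]
    have k1 : |cf F.e1 y| ≤ ‖F.e1‖ + ‖F.e2‖ + 1 := by
      linarith [abs_cf_le F.e1 y, norm_nonneg F.e2]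
    have k2 : |cf F.e2 y| ≤ ‖F.e1‖ + ‖F.e2‖ + 1 := by
      linarith [abs_cf_le F.e2 y, norm_nonneg F.e1]
    set M := ‖F.e1‖ + ‖F.e2‖ + 1
    have hM : 0 ≤ M := by positivity
    have one (a : ℝ) (ha : |a| ≤ M) : |x.1.1 * (F.l11 * a)| ≤
        (|F.l11| + |F.l21| + |F.l22|) * M * x.1.1 := by
      rw [abs_mul, abs_mul, abs_of_pos hρ, mul_comm]
      refine mul_le_mul_of_nonneg_right ?_ hρ.le
      exact mul_le_mul (by linarith [abs_nonneg F.l21, abs_nonneg F.l22]) ha (abs_nonneg _)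
        (by positivity)
    have two (a b : ℝ) (ha : |a| ≤ M) (hb : |b| ≤ M) : |x.1.1 * (F.l21 * a + F.l22 * b)| ≤
        (|F.l11| + |F.l21| + |F.l22|) * M * x.1.1 := by
      rw [abs_mul, abs_of_pos hρ, mul_comm]
      refine mul_le_mul_of_nonneg_right ?_ hρ.le
      calc |F.l21 * a + F.l22 * b| ≤ |F.l21| * |a| + |F.l22| * |b| := by
            rw [← abs_mul, ← abs_mul]; exact abs_add_le _ _
        _ ≤ |F.l21| * M + |F.l22| * M := by gcongr
        _ ≤ _ := by nlinarith [abs_nonneg F.l11]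
    simp only [A1, A2, B1, B2, cf_smul, cf_add, cf_neg]
    exact ⟨one _ ka, two _ _ ka kc, one _ (by rwa [abs_neg]), two _ _ (by rwa [abs_neg]) k1⟩

end localAnalytic

end

noncomputable section

section localAnalytic

open Filter Topology MeasureTheory
open scoped ContDiff

variable {T : ℝ} [hT : Fact (0 < T)]

local notation "𝒜" => wienReal (Icc (0 : ℝ) T)
local notation "dfst" => ContinuousLinearMap.fst ℝ ℝ ℝ
local notation "dsnd" => ContinuousLinearMap.snd ℝ ℝ ℝ

theorem Frame.sub_center (F : Frame 𝒜) {x : Prm 𝒜} {w w' : 𝒜 × 𝒜 × 𝒜} {y z : ℝ × ℝ} (hx : x.2.1 = 0)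
    (hρ : 0 < x.1.1) (μ : ℝ × ℝ)
    (h1 : cf (F.x1 ((x.1, μ, x.2.2), w)) y = cf (F.x1 (x, w')) z)
    (h2 : cf (F.x2 ((x.1, μ, x.2.2), w)) y = cf (F.x2 (x, w')) z) :
    cf F.e1 y + μ.1 * cf F.η y = cf F.e1 z ∧ cf F.e2 y + μ.2 * cf F.η y = cf F.e2 z := by
  have hl := F.l11_pos
  have hl2 := F.l22_pos
  simp only [x1, x2, ξ1, ξ2, cf_add, cf_smul, hx, Prod.fst_zero, Prod.snd_zero, zero_mul, add_zero,
    cf_one] at h1 h2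
  have k1 : cf F.e1 y + μ.1 * cf F.η y = cf F.e1 z := by
    refine mul_left_cancel₀ (mul_pos hρ hl).ne' ?_
    linear_combination h1
  refine ⟨k1, mul_left_cancel₀ (mul_pos hρ hl2).ne' ?_⟩
  linear_combination h2 - x.1.1 * F.l21 * k1

theorem Frame.boundary_eq (F : Frame 𝒜) {x : Prm 𝒜} {w : 𝒜 × 𝒜 × 𝒜} {z : ℝ × ℝ} (hx : x.2.1 = 0)
    (μ : ℝ × ℝ) (hη : cf F.η z = 0) (hw : cf w.1 z = 0) :
    cf (F.x1 ((x.1, μ, x.2.2), w)) z = cf (F.x1 (x, 0)) z ∧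
    cf (F.x2 ((x.1, μ, x.2.2), w)) z = cf (F.x2 (x, 0)) z ∧
    cf (F.V ((x.1, μ, x.2.2), w)) z = cf (F.V (x, 0)) z := by
  simp only [x1, x2, V, ξ1, ξ2, cf_add, cf_smul, hx, hη, hw, Prod.fst_zero, Prod.snd_zero, mul_zero,
    add_zero, true_and]

omit hT in
theorem Frame.zeroth_of_G_eq_zero (F : Frame 𝒜) {L0 L1 L2 : 𝒜 × 𝒜 × 𝒜 →L[ℝ] 𝒜} {α : ℝ}
    {y : Prm 𝒜 × (𝒜 × 𝒜 × 𝒜)} (hG : F.G y α L0 L1 L2 = 0) : ∃ v, y.2.1 = L0 v := by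
  have := congrArg Prod.fst hG
  simp only [G, Prod.fst_sub, ContinuousLinearMap.prod_apply, Prod.fst_zero] at this
  exact ⟨_, sub_eq_zero.1 this⟩

/-- A Dirichlet solution over a chart agrees with the punctured solution. -/
theorem Frame.eventually_eq (F : Frame 𝒜) {α h c1 c2 δ K R m : ℝ}
    {f fp fq r s t : ℝ × ℝ → ℝ} {L0 L1 L2 : 𝒜 × 𝒜 × 𝒜 →L[ℝ] 𝒜} (hL : IsGreen L0 L1 L2)
    (hch : ∀ y, IsChart T (cf (F.x1 y)) (cf (F.x2 y)) (cf (F.A1 y)) (cf (F.A2 y)) (cf (F.B1 y))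
      (cf (F.B2 y)) (cf (F.B1 y)) (cf (F.B2 y)))
    (hE1 : ∀ z, cf F.e1 z = rexp (clamp (T := T) z.1) * Real.cos z.2)
    (hE2 : ∀ z, cf F.e2 z = rexp (clamp (T := T) z.1) * Real.sin z.2)
    (hη : ∀ z, cf F.η z = clamp (T := T) z.1 * (T - clamp (T := T) z.1))
    (Good : Prm 𝒜 × (𝒜 × 𝒜 × 𝒜) → Prop)
    (hWS : ∀ y, Good y → F.G y α L0 L1 L2 = 0 →
      (∀ t ∈ Ioo 0 T, ∀ θ, HasFDerivAt (cf y.1.2.2.1)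
        (cf y.1.2.2.2.1 (t, θ) • dfst + cf y.1.2.2.2.2 (t, θ) • dsnd) (t, θ)) →
      ∀ t0 θ0, IsWeakChartSol α T t0 θ0 K R m (cf (F.x1 y)) (cf (F.x2 y)) (cf (F.A1 y))
        (cf (F.A2 y)) (cf (F.B1 y)) (cf (F.B2 y)) (cf (F.V y)) (cf (F.P1 y)) (cf (F.P2 y)))
    (hf : PuncturedSol α (c1, c2) δ K R m f fp fq r s t) (hδ : 0 < δ) (hK : 0 ≤ K) (hR : 0 ≤ R)
    (hm0 : 0 < m) : ∀ᶠ x' in 𝓝 (base 𝒜 h c1 c2), ∀ x : Prm 𝒜, x.2.1 = 0 →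
      ∀ μ : ℝ × ℝ, (x.1, μ, x.2.2) = x' → 0 < x.1.1 →
      (∀ t ∈ Ioo 0 T, ∀ θ, HasFDerivAt (cf x.2.2.1)
        (cf x.2.2.2.1 (t, θ) • dfst + cf x.2.2.2.2 (t, θ) • dsnd) (t, θ)) →
      (∀ θ, f (cf (F.x1 (x, 0)) (0, θ), cf (F.x2 (x, 0)) (0, θ)) = cf (F.V (x, 0)) (0, θ)) →
      (∀ θ, f (cf (F.x1 (x, 0)) (T, θ), cf (F.x2 (x, 0)) (T, θ)) = cf (F.V (x, 0)) (T, θ)) →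
      ∀ t1 ∈ Ioo 0 T, ∀ θ1, cf (F.x1 (x, 0)) (t1, θ1) = c1 → cf (F.x2 (x, 0)) (t1, θ1) = c2 →
      ∀ w, Good (x', w) → F.G (x', w) α L0 L1 L2 = 0 → 
      f (cf (F.x1 (x', w)) (t1, θ1), cf (F.x2 (x', w)) (t1, θ1)) = cf (F.V (x', w)) (t1, θ1) := by
  have hT0 := hT.out
  have hF (z) : 1 ≤ cf (F.e1 * F.e1 + F.e2 * F.e2) z := by
    rw [cf_add, cf_mul, cf_mul, hE1, hE2]
    have h1 : 1 ≤ rexp (clamp (T := T) z.1) := Real.one_le_exp (clamp_mem z.1).1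
    calc (1 : ℝ) ≤ rexp (clamp (T := T) z.1) ^ 2 := one_le_pow₀ h1
      _ = _ := by linear_combination -rexp (clamp (T := T) z.1) ^ 2 * Real.sin_sq_add_cos_sq z.2
  obtain ⟨C1, hC1, hgeo⟩ := F.eventually_geometry hF h c1 c2 hδ
  have hW := F.W_pos
  obtain ⟨ρ0, hρ0, huniq⟩ := chart_uniqueness α hT0 hK hR hm0 (half_pos hW)
    (D2 := F.W * (‖F.e1 * F.e1 + F.e2 * F.e2‖ + 1)) (by positivity) hC1
  have hsmall : ∀ᶠ x in 𝓝 (base 𝒜 h c1 c2), x.1.1 < ρ0 := by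
    have : ContinuousAt (fun x : Prm 𝒜 => x.1.1) (base 𝒜 h c1 c2) := by fun_prop
    exact this.eventually_lt continuousAt_const (by simpa [base] using hρ0)
  have hμ : ∀ᶠ x in 𝓝 (base 𝒜 h c1 c2), (x.2.1.1 ^ 2 + x.2.1.2 ^ 2) * T ^ 2 < 1 := by
    have : ContinuousAt (fun x : Prm 𝒜 => (x.2.1.1 ^ 2 + x.2.1.2 ^ 2) * T ^ 2)
      (base 𝒜 h c1 c2) := by fun_prop
    exact this.eventually_lt continuousAt_const (by simp [base])
  filter_upwards [hgeo, hsmall, hμ] with x' hgeo hsmall hμ x hx μ hxx hρ hΨ hb0 hbT t1 ht1 θ1 hz1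
    hz2 w hgood hG
  subst hxx
  obtain ⟨t0, θ0, hzero⟩ := exists_shifted_polar_zero (θ1 := θ1) ht1 hμ
  have ct1 : (clamp (T := T) t1 : ℝ) = t1 := coe_clamp ⟨ht1.1.le, ht1.2.le⟩
  refine huniq x.1.1 hρ hsmall t0 θ0 δ (c1, c2) f fp fq r s t _ _ _ _ _ _ _ _ _ _ _ hf (hch _)
    (hWS _ hgood hG hΨ t0 θ0) (fun y => (hgeo hρ w y).1) (fun y hy => ?_)
    (fun y => (hgeo hρ w y).2.1) (fun y => (hgeo hρ w y).2.2) ?_ ?_ t1 ⟨ht1.1.le, ht1.2.le⟩ θ1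
  · rw [Prod.mk.injEq] at hy
    obtain ⟨k1, k2⟩ := F.sub_center hx hρ μ (hy.1.trans hz1.symm) (hy.2.trans hz2.symm)
    rw [hE1, hE1, hη, ct1] at k1
    rw [hE2, hE2, hη, ct1] at k2
    exact hzero y k1 k2
  · intro θ
    obtain ⟨v, hv⟩ := F.zeroth_of_G_eq_zero hG
    obtain ⟨e1, e2, e3⟩ := F.boundary_eq (w := w) (z := (0, θ)) hx μ
      (by rw [hη, coe_clamp ⟨le_rfl, hT0.le⟩, zero_mul])
      (by rw [show w.1 = _ from hv]; exact hL.ev_zero v θ)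
    rw [e1, e2, e3, hb0]
  · intro θ
    obtain ⟨v, hv⟩ := F.zeroth_of_G_eq_zero hG
    obtain ⟨e1, e2, e3⟩ := F.boundary_eq (w := w) (z := (T, θ)) hx μ
      (by rw [hη, coe_clamp ⟨hT0.le, le_rfl⟩, sub_self, mul_zero])
      (by rw [show w.1 = _ from hv]; exact hL.ev_right v θ)
    rw [e1, e2, e3, hbT]

/-- Inverting the affine family of base points. -/
theorem analyticAt_of_affine_family {f : ℝ × ℝ → ℝ} {g : ℝ × ℝ → ℝ} {c1 c2 κ a b d : ℝ}
    (hκ : κ ≠ 0) (ha : a ≠ 0) (hd : d ≠ 0) (hg : AnalyticAt ℝ g 0)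
    (hfg : ∀ᶠ μ in 𝓝 (0 : ℝ × ℝ),
      f (c1 + κ * (a * μ.1), c2 + κ * (b * μ.1 + d * μ.2)) = g μ) : AnalyticAt ℝ f (c1, c2) := by
  obtain ⟨ν, hν⟩ : ∃ ν : ℝ × ℝ → ℝ × ℝ, ∀ y, ν y = ((κ * a)⁻¹ * (y.1 - c1),
    d⁻¹ * (κ⁻¹ * (y.2 - c2) - b * ((κ * a)⁻¹ * (y.1 - c1)))) := ⟨_, fun _ => rfl⟩
  have hν' : ν = fun y => ((κ * a)⁻¹ * (y.1 - c1),
    d⁻¹ * (κ⁻¹ * (y.2 - c2) - b * ((κ * a)⁻¹ * (y.1 - c1)))) := funext hν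
  have h0 : ν (c1, c2) = 0 := by simp [hν]
  have han : AnalyticAt ℝ ν (c1, c2) := by
    rw [hν']
    refine ContDiffAt.analyticAt (ContDiff.contDiffAt ?_)
    fun_prop
  have hcomp : AnalyticAt ℝ (fun y => g (ν y)) (c1, c2) := by
    refine AnalyticAt.fun_comp ?_ han
    rwa [h0]
  refine hcomp.congr ?_
  have ht : Tendsto ν (𝓝 (c1, c2)) (𝓝 0) := by rw [← h0]; exact han.continuousAt
  filter_upwards [ht.eventually hfg] with y hy
  rw [← hy, hν]
  congr 1
  ext
  · field_simp; ring
  · field_simp; ring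

/-- A punctured solution agreeing with a small perturbation of an affine function on both
components of the boundary of a small annulus is analytic at the puncture. -/
theorem Frame.eventually_analyticAt (F : Frame 𝒜) {α h c1 c2 δ K R m ε : ℝ}
    {f fp fq r s t : ℝ × ℝ → ℝ} {L0 L1 L2 : 𝒜 × 𝒜 × 𝒜 →L[ℝ] 𝒜} (hL : IsGreen L0 L1 L2)
    (hch : ∀ y, IsChart T (cf (F.x1 y)) (cf (F.x2 y)) (cf (F.A1 y)) (cf (F.A2 y)) (cf (F.B1 y))
      (cf (F.B2 y)) (cf (F.B1 y)) (cf (F.B2 y)))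
    (hE1 : ∀ z, cf F.e1 z = rexp (clamp (T := T) z.1) * Real.cos z.2)
    (hE2 : ∀ z, cf F.e2 z = rexp (clamp (T := T) z.1) * Real.sin z.2)
    (hη : ∀ z, cf F.η z = clamp (T := T) z.1 * (T - clamp (T := T) z.1))
    (hWS : ∀ y, F.IsNear h c1 c2 ε y → F.G y α L0 L1 L2 = 0 →
      (∀ t ∈ Ioo 0 T, ∀ θ, HasFDerivAt (cf y.1.2.2.1)
        (cf y.1.2.2.2.1 (t, θ) • dfst + cf y.1.2.2.2.2 (t, θ) • dsnd) (t, θ)) →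
      ∀ t0 θ0, IsWeakChartSol α T t0 θ0 K R m (cf (F.x1 y)) (cf (F.x2 y)) (cf (F.A1 y))
        (cf (F.A2 y)) (cf (F.B1 y)) (cf (F.B2 y)) (cf (F.V y)) (cf (F.P1 y)) (cf (F.P2 y)))
    (hf : PuncturedSol α (c1, c2) δ K R m f fp fq r s t) (hδ : 0 < δ) (hK : 0 ≤ K) (hR : 0 ≤ R)
    (hm0 : 0 < m) (hN : 0 < c1 ^ 2 + c2 ^ 2 + h ^ 2) (hε : 0 < ε) :
    ∀ᶠ x in 𝓝 (base 𝒜 h c1 c2), 0 < x.1.1 → x.2.1 = 0 →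
      (∀ t ∈ Ioo 0 T, ∀ θ, HasFDerivAt (cf x.2.2.1)
        (cf x.2.2.2.1 (t, θ) • dfst + cf x.2.2.2.2 (t, θ) • dsnd) (t, θ)) →
      (∀ θ, f (cf (F.x1 (x, 0)) (0, θ), cf (F.x2 (x, 0)) (0, θ)) = cf (F.V (x, 0)) (0, θ)) →
      (∀ θ, f (cf (F.x1 (x, 0)) (T, θ), cf (F.x2 (x, 0)) (T, θ)) = cf (F.V (x, 0)) (T, θ)) →
      (∃ t1 ∈ Ioo 0 T, ∃ θ1, cf (F.x1 (x, 0)) (t1, θ1) = c1 ∧ cf (F.x2 (x, 0)) (t1, θ1) = c2) →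
      AnalyticAt ℝ f (c1, c2) := by
  obtain ⟨Z, hZ⟩ := F.exists_solution h c1 c2 α L0 L1 L2 hN hε
  have hEq := F.eventually_eq (h := h) hL hch hE1 hE2 hη _ hWS hf hδ hK hR hm0
  filter_upwards [(hZ.and hEq).eventually_nhds] with x hx hρ hx0 hΨ hb0 hbT ⟨t1, ht1, θ1, hz1, hz2⟩
  have hZx := hx.self_of_nhds.1.1
  obtain ⟨γ, hγ⟩ : ∃ γ : ℝ × ℝ → Prm 𝒜, γ = fun μ => (x.1, μ, x.2.2) := ⟨_, rfl⟩
  have hγ0 : γ 0 = x := by rw [hγ, ← hx0]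
  have hγc : ContDiff ℝ ω γ := by rw [hγ]; fun_prop
  have hγt : Tendsto γ (𝓝 0) (𝓝 x) := by
    have := hγc.continuous.continuousAt (x := (0 : ℝ × ℝ))
    rwa [ContinuousAt, hγ0] at this
  have hZγ : ContDiffAt ℝ ω (fun μ => Z (γ μ)) 0 := by
    refine ContDiffAt.comp (g := Z) 0 ?_ hγc.contDiffAt
    rwa [hγ0]
  have hVγ : ContDiffAt ℝ ω (fun μ => F.V (γ μ, Z (γ μ))) 0 :=
    F.contDiff_V.contDiffAt.comp (g := F.V) 0 (hγc.contDiffAt.prodMk hZγ)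
  have hg : ContDiffAt ℝ ω (fun μ => cf (F.V (γ μ, Z (γ μ))) (t1, θ1)) 0 :=
    (wienReal.ev (clamp (T := T) t1) θ1).contDiff.contDiffAt.comp (0 : ℝ × ℝ) hVγ
  have ct1 : (clamp (T := T) t1 : ℝ) = t1 := coe_clamp ⟨ht1.1.le, ht1.2.le⟩
  have hηz : 0 < cf F.η (t1, θ1) := by
    rw [hη, ct1]; exact mul_pos ht1.1 (sub_pos.2 ht1.2)
  refine analyticAt_of_affine_family (κ := x.1.1 * cf F.η (t1, θ1)) (a := F.l11) (b := F.l21)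
    (d := F.l22) (mul_pos hρ hηz).ne' F.l11_pos.ne' F.l22_pos.ne' hg.analyticAt ?_
  filter_upwards [hγt.eventually hx] with μ hμ
  have := hμ.2 x hx0 μ (by rw [hγ]) hρ hΨ hb0 hbT t1 ht1 θ1 hz1 hz2 (Z (γ μ)) hμ.1.2.2 hμ.1.2.1
  rw [← this]
  congr 1
  rw [Prod.mk.injEq]
  have e1 : cf (F.x1 (x, 0)) (t1, θ1) = x.1.2.2.1 + x.1.1 * (F.l11 * cf F.e1 (t1, θ1)) := by
    simp only [x1, ξ1, hx0, cf_add, cf_smul, cf_one, Prod.fst_zero, zero_mul, add_zero, mul_one]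
  have e2 : cf (F.x2 (x, 0)) (t1, θ1) = x.1.2.2.2 +
      x.1.1 * (F.l21 * cf F.e1 (t1, θ1) + F.l22 * cf F.e2 (t1, θ1)) := by
    simp only [x2, ξ1, ξ2, hx0, cf_add, cf_smul, cf_one, Prod.fst_zero, Prod.snd_zero, zero_mul,
      add_zero, mul_one]
  rw [e1] at hz1
  rw [e2] at hz2
  simp only [hγ, x1, x2, ξ1, ξ2, cf_add, cf_smul, cf_one]
  constructor
  · linear_combination -hz1
  · linear_combination -hz2

/-- The case of the standard frame at slope `(p, q)`. -/
theorem eventually_analyticAt {α p q h c1 c2 δ K R m : ℝ} {f fp fq r s t : ℝ × ℝ → ℝ}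
    (hf : PuncturedSol α (c1, c2) δ K R m f fp fq r s t) (hδ : 0 < δ)
    (hN : 0 < c1 ^ 2 + c2 ^ 2 + h ^ 2) (hKp : |p| + 1 ≤ K) (hKq : |q| + 1 ≤ K)
    (hR : c1 ^ 2 + c2 ^ 2 + h ^ 2 + 1 ≤ R) (hm0 : 0 < m)
    (hm : m ≤ (c1 ^ 2 + c2 ^ 2 + h ^ 2) / 2) :
    ∀ᶠ x in 𝓝 (Frame.base 𝒜 h c1 c2), 0 < x.1.1 → x.2.1 = 0 →
      (∀ t ∈ Ioo 0 T, ∀ θ, HasFDerivAt (cf x.2.2.1)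
        (cf x.2.2.2.1 (t, θ) • dfst + cf x.2.2.2.2 (t, θ) • dsnd) (t, θ)) →
      (∀ θ, f (cf ((stdFrame T p q).x1 (x, 0)) (0, θ), cf ((stdFrame T p q).x2 (x, 0)) (0, θ)) =
        cf ((stdFrame T p q).V (x, 0)) (0, θ)) →
      (∀ θ, f (cf ((stdFrame T p q).x1 (x, 0)) (T, θ), cf ((stdFrame T p q).x2 (x, 0)) (T, θ)) =
        cf ((stdFrame T p q).V (x, 0)) (T, θ)) →
      (∃ t1 ∈ Ioo 0 T, ∃ θ1, cf ((stdFrame T p q).x1 (x, 0)) (t1, θ1) = c1 ∧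
        cf ((stdFrame T p q).x2 (x, 0)) (t1, θ1) = c2) → AnalyticAt ℝ f (c1, c2) := by
  obtain ⟨L0, L1, L2, hL⟩ := exists_isGreen (T := T)
  have ha := area_pos p q
  obtain ⟨ε, hε, hε1, hε2, hε3⟩ : ∃ ε > 0, ε ≤ (area p q)⁻¹ ∧ ε ≤ 1 ∧
      ε ≤ (c1 ^ 2 + c2 ^ 2 + h ^ 2) / 2 :=
    ⟨min (area p q)⁻¹ (min 1 ((c1 ^ 2 + c2 ^ 2 + h ^ 2) / 2)), by positivity, min_le_left _ _,
      (min_le_right _ _).trans (min_le_left _ _), (min_le_right _ _).trans (min_le_right _ _)⟩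
  exact (stdFrame T p q).eventually_analyticAt hL (stdFrame_isChart p q) (cf_e1 p q) (cf_e2 p q)
    (cf_η p q) (fun y hy hG hΨ t0 θ0 => stdFrame_isWeakChartSol hL hG hy hε1 hε2 hε3 hKp hKq hR hm
      hΨ t0 θ0) hf hδ (by linarith [abs_nonneg p]) (by linarith) hm0 hN hε

end localAnalytic

end

noncomputable section

section stokes

open Filter Topology MeasureTheory

local notation "dfst" => ContinuousLinearMap.fst ℝ ℝ ℝ
local notation "dsnd" => ContinuousLinearMap.snd ℝ ℝ ℝ

variable {g gx gy Q Qx Qy : ℝ × ℝ → ℝ}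

theorem fderiv_fst_apply (hg : ∀ x, HasFDerivAt g (gx x • dfst + gy x • dsnd) x) (x : ℝ × ℝ) :
    fderiv ℝ g x (1, 0) = gx x := by
  rw [(hg x).fderiv]; simp

theorem fderiv_snd_apply (hg : ∀ x, HasFDerivAt g (gx x • dfst + gy x • dsnd) x) (x : ℝ × ℝ) :
    fderiv ℝ g x (0, 1) = gy x := by
  rw [(hg x).fderiv]; simp

theorem hasCompactSupport_fst (hg : ∀ x, HasFDerivAt g (gx x • dfst + gy x • dsnd) x)
    (sg : HasCompactSupport g) : HasCompactSupport gx := by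
  rw [show gx = fun x => fderiv ℝ g x (1, 0) from (funext (fderiv_fst_apply hg)).symm]
  exact sg.fderiv_apply (𝕜 := ℝ) (1, 0)

theorem hasCompactSupport_snd (hg : ∀ x, HasFDerivAt g (gx x • dfst + gy x • dsnd) x)
    (sg : HasCompactSupport g) : HasCompactSupport gy := by
  rw [show gy = fun x => fderiv ℝ g x (0, 1) from (funext (fderiv_snd_apply hg)).symm]
  exact sg.fderiv_apply (𝕜 := ℝ) (0, 1)

/-- Differentiating a correlation in a translation parameter. -/
theorem hasDerivAt_integral_translate (hg : ∀ x, HasFDerivAt g (gx x • dfst + gy x • dsnd) x)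
    (cgx : Continuous gx) (sg : HasCompactSupport g) {w : ℝ × ℝ → ℝ} (cw : Continuous w)
    (sw : HasCompactSupport w) :
    HasDerivAt (fun h : ℝ => ∫ x, g (x + (h, 0)) * w x) (∫ x, gx x * w x) 0 := by
  have cg : Continuous g := continuous_iff_continuousAt.2 fun x => (hg x).continuousAt
  obtain ⟨C, hC⟩ := cgx.bounded_above_of_compact_support (hasCompactSupport_fst hg sg)
  have key := (hasDerivAt_integral_of_dominated_loc_of_deriv_le (μ := (volume : Measure (ℝ × ℝ)))
    (F := fun h x => g (x + (h, 0)) * w x) (F' := fun h x => gx (x + (h, 0)) * w x) (x₀ := (0 : ℝ))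
    (s := univ) (bound := fun x => C * ‖w x‖) univ_mem
    (Eventually.of_forall fun h => Continuous.aestronglyMeasurable (by fun_prop))
    (Continuous.integrable_of_hasCompactSupport (by fun_prop) sw.mul_left)
    (Continuous.aestronglyMeasurable (by fun_prop))
    (Eventually.of_forall fun x h _ => by
      rw [norm_mul]
      exact mul_le_mul_of_nonneg_right (hC _) (norm_nonneg _))
    ((cw.norm.integrable_of_hasCompactSupport sw.norm).const_mul C)
    (Eventually.of_forall fun x h _ => by
      have h1 : HasDerivAt (fun h : ℝ => x + (h, (0 : ℝ))) (1, 0) h :=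
        ((hasDerivAt_id h).prodMk (hasDerivAt_const h (0 : ℝ))).const_add x
      have h2 := (hg (x + (h, 0))).comp_hasDerivAt h h1
      refine (h2.mul_const (w x)).congr_deriv ?_
      simp)).2
  simpa only [← Prod.zero_eq_mk, add_zero] using key

/-- The Jacobian of a compactly supported `C¹` map of the plane has vanishing integral. -/
theorem integral_jacobian_eq_zero (hg : ∀ x, HasFDerivAt g (gx x • dfst + gy x • dsnd) x)
    (cgx : Continuous gx) (cgy : Continuous gy) (sg : HasCompactSupport g)
    (hQ : ∀ x, HasFDerivAt Q (Qx x • dfst + Qy x • dsnd) x) (cQx : Continuous Qx)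
    (cQy : Continuous Qy) (sQ : HasCompactSupport Q) : ∫ x, (gx x * Qy x - gy x * Qx x) = 0 := by
  have cg : Continuous g := continuous_iff_continuousAt.2 fun x => (hg x).continuousAt
  have cQ : Continuous Q := continuous_iff_continuousAt.2 fun x => (hQ x).continuousAt
  have sQx := hasCompactSupport_fst hQ sQ
  have sQy := hasCompactSupport_snd hQ sQ
  have sgy := hasCompactSupport_snd hg sg
  have h1 := hasDerivAt_integral_translate hg cgx sg cQy sQy
  have h2 := hasDerivAt_integral_translate hQ cQx sQ cgy sgy
  have h3 : HasDerivAt (fun h : ℝ => ∫ x, Q (x + (-h, 0)) * gy x) (-∫ x, Qx x * gy x) 0 := by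
    have h2' : HasDerivAt (fun h : ℝ => ∫ x, Q (x + (h, 0)) * gy x) (∫ x, Qx x * gy x)
        (-(0 : ℝ)) := by rwa [neg_zero]
    exact (h2'.scomp (0 : ℝ) (hasDerivAt_neg (0 : ℝ))).congr_deriv (by simp)
  have h4 (h : ℝ) : ∫ x, g (x + (h, 0)) * Qy x = -∫ x, Q (x + (-h, 0)) * gy x := by
    have hgt (x : ℝ × ℝ) : HasFDerivAt (fun x => g (x + (h, 0)))
        (gx (x + (h, 0)) • dfst + gy (x + (h, 0)) • dsnd) x :=
      (hasFDerivAt_comp_add_right _).2 (hg (x + (h, 0)))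
    have k := integral_mul_fderiv_eq_neg_fderiv_mul_of_integrable
      (μ := (volume : Measure (ℝ × ℝ))) (f := fun x => g (x + (h, 0))) (g := Q) (v := (0, 1))
      (by
        simp only [fderiv_snd_apply hgt]
        exact Continuous.integrable_of_hasCompactSupport (by fun_prop) sQ.mul_left)
      (by
        simp only [fderiv_snd_apply hQ]
        exact Continuous.integrable_of_hasCompactSupport (by fun_prop) sQy.mul_left)
      (Continuous.integrable_of_hasCompactSupport (by fun_prop) sQ.mul_left)
      (fun x _ => (hgt x).differentiableAt) (fun x _ => (hQ x).differentiableAt)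
    simp only [fderiv_snd_apply hgt, fderiv_snd_apply hQ] at k
    rw [k, ← integral_add_right_eq_self (fun x => Q (x + (-h, 0)) * gy x) (h, 0)]
    congr 2
    ext x
    have : x + (h, (0 : ℝ)) + (-h, 0) = x := by ext <;> simp
    rw [this, mul_comm]
  simp only [h4] at h1
  have h5 := h1.unique h3.neg
  have i1 : Integrable (fun x => gx x * Qy x) :=
    Continuous.integrable_of_hasCompactSupport (by fun_prop) sQy.mul_left
  have i2 : Integrable (fun x => gy x * Qx x) :=
    Continuous.integrable_of_hasCompactSupport (by fun_prop) sQx.mul_left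
  rw [integral_sub i1 i2, sub_eq_zero, h5, neg_neg]
  simp only [mul_comm]

end stokes

end

noncomputable section

section annulus

open Filter Topology MeasureTheory

local notation "dfst" => ContinuousLinearMap.fst ℝ ℝ ℝ
local notation "dsnd" => ContinuousLinearMap.snd ℝ ℝ ℝ

theorem volume_real_closedBall_prod (c : ℝ × ℝ) {a : ℝ} (ha : 0 ≤ a) :
    volume.real (Metric.closedBall c a) = 4 * a ^ 2 := by
  rw [← Prod.mk.eta (p := c), ← closedBall_prod_same, Measure.volume_eq_prod, measureReal_prod_prod,
    Real.volume_real_closedBall ha, Real.volume_real_closedBall ha]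
  ring

theorem mem_closedBall_of_sq_add_sq_le {c x : ℝ × ℝ} {a : ℝ} (ha : 0 ≤ a)
    (h : (x.1 - c.1) ^ 2 + (x.2 - c.2) ^ 2 ≤ a ^ 2) : x ∈ Metric.closedBall c a := by
  rw [Metric.mem_closedBall, Prod.dist_eq, Real.dist_eq, Real.dist_eq, max_le_iff]
  exact ⟨_root_.abs_le_of_sq_le_sq (by nlinarith [sq_nonneg (x.2 - c.2)]) ha,
    _root_.abs_le_of_sq_le_sq (by nlinarith [sq_nonneg (x.1 - c.1)]) ha⟩

/-- Radial cutoffs of a thick annulus have bounded Dirichlet energy, whatever the ratio of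
the radii. -/
theorem exists_annular_cutoff : ∃ C : ℝ, ∀ (q0 : ℝ × ℝ) (δ ε : ℝ), 0 < δ → 0 < ε →
    ∃ χ χx χy : ℝ × ℝ → ℝ, (∀ x, HasFDerivAt χ (χx x • dfst + χy x • dsnd) x) ∧
    Continuous χx ∧ Continuous χy ∧ (∀ x, 0 ≤ χ x ∧ χ x ≤ 1) ∧
    (∃ S, IsCompact S ∧ S ⊆ Metric.ball q0 δ \ {q0} ∧
      ∀ x, x ∉ S → χ x = 0 ∧ χx x = 0 ∧ χy x = 0) ∧
    (∀ x ∈ Metric.ball q0 (δ / 4), x ∉ Metric.ball q0 (2 * ε) → χ x = 1) ∧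
    ∫ x, (χx x ^ 2 + χy x ^ 2) ≤ C := by
  obtain ⟨C0, hC0, hb⟩ := smoothTransition_deriv_bound
  refine ⟨512 * C0 ^ 2, fun q0 δ ε hδ hε => ?_⟩
  obtain ⟨κ, hκ, hκδ⟩ : ∃ κ : ℝ, 0 < κ ∧ κ ^ 2 = δ ^ 2 / 8 :=
    ⟨√(δ ^ 2 / 8), by positivity, Real.sq_sqrt (by positivity)⟩
  have hcS : Continuous (deriv smoothTransition) :=
    (smoothTransition.contDiff (n := 1)).continuous_deriv le_rfl
  obtain ⟨N, hN⟩ : ∃ N : ℝ × ℝ → ℝ, ∀ x, N x = (x.1 - q0.1) ^ 2 + (x.2 - q0.2) ^ 2 :=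
    ⟨_, fun _ => rfl⟩
  have hN0 (x) : 0 ≤ N x := by rw [hN]; positivity
  have cN : Continuous N := by rw [show N = _ from funext hN]; fun_prop
  obtain ⟨φ, hφ⟩ : ∃ φ : ℝ → ℝ, ∀ n, φ n = smoothTransition ((ε ^ 2)⁻¹ * n - 1) *
    smoothTransition (2 - (κ ^ 2)⁻¹ * n) := ⟨_, fun _ => rfl⟩
  obtain ⟨A, hA⟩ : ∃ A : ℝ → ℝ, ∀ n, A n = deriv smoothTransition ((ε ^ 2)⁻¹ * n - 1) *
    (ε ^ 2)⁻¹ * smoothTransition (2 - (κ ^ 2)⁻¹ * n) := ⟨_, fun _ => rfl⟩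
  obtain ⟨B, hB⟩ : ∃ B : ℝ → ℝ, ∀ n, B n = smoothTransition ((ε ^ 2)⁻¹ * n - 1) *
    (deriv smoothTransition (2 - (κ ^ 2)⁻¹ * n) * -(κ ^ 2)⁻¹) := ⟨_, fun _ => rfl⟩
  have cA : Continuous A := by
    rw [show A = _ from funext hA]
    have := smoothTransition.continuous
    fun_prop
  have cB : Continuous B := by
    rw [show B = _ from funext hB]
    have := smoothTransition.continuous
    fun_prop
  have dφ (n : ℝ) : HasDerivAt φ (A n + B n) n := by
    rw [show φ = _ from funext hφ, hA, hB]
    have h1 : HasDerivAt (fun n : ℝ => (ε ^ 2)⁻¹ * n - 1) (ε ^ 2)⁻¹ n := by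
      simpa using ((hasDerivAt_id n).const_mul (ε ^ 2)⁻¹).sub_const 1
    have h2 : HasDerivAt (fun n : ℝ => 2 - (κ ^ 2)⁻¹ * n) (-(κ ^ 2)⁻¹) n := by
      simpa using ((hasDerivAt_id n).const_mul (κ ^ 2)⁻¹).const_sub 2
    exact ((hasDerivAt_smoothTransition _).comp n h1).fun_mul
      ((hasDerivAt_smoothTransition _).comp n h2)
  have e0 : 0 < ε ^ 2 := by positivity
  have k0 : 0 < κ ^ 2 := by positivity
  have S0 := smoothTransition.nonneg
  have S1 := smoothTransition.le_one
  have Abig {n : ℝ} (h : n < ε ^ 2) : φ n = 0 ∧ A n = 0 ∧ B n = 0 := by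
    have h1 : (ε ^ 2)⁻¹ * n - 1 < 0 := by
      rw [sub_neg, inv_mul_lt_iff₀ e0]; linarith
    rw [hφ, hA, hB, smoothTransition.zero_of_nonpos h1.le, deriv_smoothTransition_eq_zero (.inl h1)]
    simp
  have Bbig {n : ℝ} (h : 2 * κ ^ 2 < n) : φ n = 0 ∧ A n = 0 ∧ B n = 0 := by
    have h1 : 2 - (κ ^ 2)⁻¹ * n < 0 := by
      rw [sub_neg, lt_inv_mul_iff₀ k0]; linarith
    rw [hφ, hA, hB, smoothTransition.zero_of_nonpos h1.le, deriv_smoothTransition_eq_zero (.inl h1)]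
    simp
  have bound {c n v w : ℝ} (hc : 0 < c) (hn : 0 ≤ n) (hn2 : n ≤ 2 * c) (hv : |v| ≤ C0) (hw0 : 0 ≤ w)
      (hw : w ≤ 1) : (v * c⁻¹ * w) ^ 2 * n ≤ 2 * C0 ^ 2 * c⁻¹ := by
    have h1 : v ^ 2 ≤ C0 ^ 2 := sq_le_sq.2 (by rwa [abs_of_pos hC0])
    have h2 : w ^ 2 ≤ 1 := pow_le_one₀ hw0 hw
    calc (v * c⁻¹ * w) ^ 2 * n = v ^ 2 * w ^ 2 * (c⁻¹ * (c⁻¹ * n)) := by ring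
      _ ≤ C0 ^ 2 * 1 * (c⁻¹ * 2) := by
          gcongr
          rw [inv_mul_le_iff₀ hc]; linarith
      _ = _ := by ring
  have bA (x) : A (N x) ^ 2 * N x ≤
      (Metric.closedBall q0 (2 * ε)).indicator (fun _ => 2 * C0 ^ 2 * (ε ^ 2)⁻¹) x := by
    rcases le_or_gt (N x) (2 * ε ^ 2) with h | h
    · rw [indicator_of_mem (mem_closedBall_of_sq_add_sq_le (by positivity)
        (by rw [← hN]; nlinarith)), hA]
      exact bound e0 (hN0 x) h (hb _) (S0 _) (S1 _)
    · have : 1 < (ε ^ 2)⁻¹ * N x - 1 := by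
        rw [lt_sub_iff_add_lt, lt_inv_mul_iff₀ e0]; linarith
      rw [hA, deriv_smoothTransition_eq_zero (.inr this)]
      simp only [zero_mul, ne_eq, OfNat.ofNat_ne_zero, not_false_eq_true, zero_pow]
      exact indicator_nonneg (fun _ _ => by positivity) _
  have bB (x) : B (N x) ^ 2 * N x ≤
      (Metric.closedBall q0 (2 * κ)).indicator (fun _ => 2 * C0 ^ 2 * (κ ^ 2)⁻¹) x := by
    rcases le_or_gt (N x) (2 * κ ^ 2) with h | h
    · rw [indicator_of_mem (mem_closedBall_of_sq_add_sq_le (by positivity)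
        (by rw [← hN]; nlinarith)), hB]
      refine le_of_eq_of_le ?_ (bound k0 (hN0 x) h (hb (2 - (κ ^ 2)⁻¹ * N x))
        (S0 ((ε ^ 2)⁻¹ * N x - 1)) (S1 _))
      ring
    · rw [(Bbig h).2.2]
      simp only [zero_mul, ne_eq, OfNat.ofNat_ne_zero, not_false_eq_true, zero_pow]
      exact indicator_nonneg (fun _ _ => by positivity) _
  have hSc : IsClosed {x | ε ^ 2 ≤ N x ∧ N x ≤ 2 * κ ^ 2} :=
    (isClosed_le continuous_const cN).inter (isClosed_le cN continuous_const)
  have hball {x} (h : N x ≤ 2 * κ ^ 2) : x ∈ Metric.closedBall q0 (δ / 2) :=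
    mem_closedBall_of_sq_add_sq_le (by positivity) (by rw [← hN]; nlinarith)
  have hscomp : IsCompact {x | ε ^ 2 ≤ N x ∧ N x ≤ 2 * κ ^ 2} :=
    (isCompact_closedBall q0 (δ / 2)).of_isClosed_subset hSc fun x hx => hball hx.2
  have off (x) (hx : x ∉ {x | ε ^ 2 ≤ N x ∧ N x ≤ 2 * κ ^ 2}) :
      φ (N x) = 0 ∧ A (N x) = 0 ∧ B (N x) = 0 := by
    by_cases h : N x < ε ^ 2
    · exact Abig h
    · exact Bbig (not_le.1 fun h' => hx ⟨not_lt.1 h, h'⟩)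
  refine ⟨fun x => φ (N x), fun x => (A (N x) + B (N x)) * (2 * (x.1 - q0.1)),
    fun x => (A (N x) + B (N x)) * (2 * (x.2 - q0.2)), fun x => ?_, by fun_prop, by fun_prop,
    fun x => ?_, ⟨_, hscomp, fun x hx => ⟨?_, ?_⟩, fun x hx => ?_⟩, fun x hx hx' => ?_, ?_⟩
  · have h1 : HasFDerivAt N ((2 * (x.1 - q0.1)) • dfst + (2 * (x.2 - q0.2)) • dsnd) x := by
      rw [show N = _ from funext hN]
      have d1 : HasFDerivAt (fun x : ℝ × ℝ => x.1 - q0.1) dfst x := hasFDerivAt_fst.sub_const _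
      have d2 : HasFDerivAt (fun x : ℝ × ℝ => x.2 - q0.2) dsnd x := hasFDerivAt_snd.sub_const _
      refine ((d1.pow 2).fun_add (d2.pow 2)).congr_fderiv ?_
      ext <;> simp
    refine ((dφ (N x)).comp_hasFDerivAt x h1).congr_fderiv ?_
    ext <;> simp
  · simp only [hφ]
    exact ⟨mul_nonneg (S0 _) (S0 _), mul_le_one₀ (S1 _) (S0 _) (S1 _)⟩
  · exact Metric.closedBall_subset_ball (by linarith) (hball hx.2)
  · rintro rfl
    have := hx.1
    rw [hN] at this
    simp at this
    exact absurd this hε.ne'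
  · obtain ⟨h1, h2, h3⟩ := off x hx
    simp [h1, h2, h3]
  · have h1 : N x ≤ κ ^ 2 := by
      rw [Metric.mem_ball, Prod.dist_eq, Real.dist_eq, Real.dist_eq, max_lt_iff] at hx
      have := sq_lt_sq' (abs_lt.1 hx.1).1 (abs_lt.1 hx.1).2
      have := sq_lt_sq' (abs_lt.1 hx.2).1 (abs_lt.1 hx.2).2
      rw [hN, hκδ]; nlinarith
    have h2 : 2 * ε ^ 2 ≤ N x := by
      by_contra! h
      refine hx' ?_
      have : x ∈ Metric.closedBall q0 (3 / 2 * ε) :=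
        mem_closedBall_of_sq_add_sq_le (by positivity) (by rw [← hN]; nlinarith)
      exact Metric.closedBall_subset_ball (by linarith) this
    have h3 : 1 ≤ (ε ^ 2)⁻¹ * N x - 1 := by
      rw [le_sub_iff_add_le, le_inv_mul_iff₀ e0]; linarith
    have h4 : 1 ≤ 2 - (κ ^ 2)⁻¹ * N x := by
      rw [le_sub_comm, inv_mul_le_iff₀ k0]; linarith
    simp only [hφ]
    rw [smoothTransition.one_of_one_le h3, smoothTransition.one_of_one_le h4, one_mul]
  · have hig (a c : ℝ) : Integrable ((Metric.closedBall q0 a).indicator (fun _ : ℝ × ℝ => c)) :=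
      (integrable_indicator_iff measurableSet_closedBall).2
        (integrableOn_const (isCompact_closedBall _ _).measure_lt_top.ne)
    have hval {a : ℝ} (ha : 0 < a) : ∫ x, (Metric.closedBall q0 (2 * a)).indicator
        (fun _ : ℝ × ℝ => 2 * C0 ^ 2 * (a ^ 2)⁻¹) x = 32 * C0 ^ 2 := by
      rw [integral_indicator_const _ measurableSet_closedBall,
        volume_real_closedBall_prod _ (by positivity), smul_eq_mul]
      field_simp
      ring
    calc _ ≤ ∫ x, (8 * (Metric.closedBall q0 (2 * ε)).indicator
              (fun _ => 2 * C0 ^ 2 * (ε ^ 2)⁻¹) x + 8 * (Metric.closedBall q0 (2 * κ)).indicator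
              (fun _ => 2 * C0 ^ 2 * (κ ^ 2)⁻¹) x) := by
            refine integral_mono_of_nonneg (Eventually.of_forall fun x => by positivity)
              (((hig _ _).const_mul 8).add ((hig _ _).const_mul 8))
              (Eventually.of_forall fun x => ?_)
            have h1 := bA x
            have h2 := bB x
            have h3 : ((A (N x) + B (N x)) * (2 * (x.1 - q0.1))) ^ 2 +
              ((A (N x) + B (N x)) * (2 * (x.2 - q0.2))) ^ 2 =
              4 * ((A (N x) + B (N x)) ^ 2 * N x) := by rw [hN]; ring
            have h4 := mul_nonneg (sq_nonneg (A (N x) - B (N x))) (hN0 x)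
            simp only [h3]
            nlinarith
      _ = 512 * C0 ^ 2 := by
            rw [integral_add ((hig _ _).const_mul 8) ((hig _ _).const_mul 8),
              integral_const_mul, integral_const_mul, hval hε, hval hκ]
            ring

end annulus

end

noncomputable section

section hess

open Filter Topology MeasureTheory

local notation "dfst" => ContinuousLinearMap.fst ℝ ℝ ℝ
local notation "dsnd" => ContinuousLinearMap.snd ℝ ℝ ℝ

theorem continuous_cutoff_mul {X : Type*} [TopologicalSpace X] {χ g : X → ℝ} {S U : Set X}
    (hχ : Continuous χ) (hS : IsClosed S) (hU : IsOpen U) (hSU : S ⊆ U) (off : ∀ x ∉ S, χ x = 0)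
    (hg : ContinuousOn g U) : Continuous fun x => χ x * g x := by
  refine continuous_iff_continuousAt.2 fun x => ?_
  by_cases hx : x ∈ U
  · exact hχ.continuousAt.mul (hg.continuousAt (hU.mem_nhds hx))
  · have : (fun x => χ x * g x) =ᶠ[𝓝 x] fun _ => 0 := by
      filter_upwards [hS.isOpen_compl.mem_nhds fun h => hx (hSU h)] with y hy
      rw [off y hy, zero_mul]
    exact (continuousAt_const (y := (0 : ℝ))).congr this.symm

theorem hasFDerivAt_cutoff_mul {χ χx χy g gx gy : ℝ × ℝ → ℝ} {S U : Set (ℝ × ℝ)}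
    (hχ : ∀ x, HasFDerivAt χ (χx x • dfst + χy x • dsnd) x) (hS : IsClosed S) (hSU : S ⊆ U)
    (off : ∀ x ∉ S, χ x = 0 ∧ χx x = 0 ∧ χy x = 0)
    (hg : ∀ x ∈ U, HasFDerivAt g (gx x • dfst + gy x • dsnd) x) (x : ℝ × ℝ) :
    HasFDerivAt (fun x => χ x * g x)
      ((χx x * g x + χ x * gx x) • dfst + (χy x * g x + χ x * gy x) • dsnd) x := by
  by_cases hx : x ∈ U
  · refine ((hχ x).fun_mul (hg x hx)).congr_fderiv ?_
    ext <;> simp <;> ring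
  · have hxS : x ∉ S := fun h => hx (hSU h)
    have : (fun x => χ x * g x) =ᶠ[𝓝 x] fun _ => 0 := by
      filter_upwards [hS.isOpen_compl.mem_nhds hxS] with y hy
      rw [(off y hy).1, zero_mul]
    obtain ⟨h1, h2, h3⟩ := off x hxS
    rw [h1, h2, h3]
    simpa using (hasFDerivAt_const (0 : ℝ) x).congr_of_eventuallyEq this

/-- The Hessian is controlled by its determinant and by the elliptic expression. -/
theorem hessian_le_det {p q r s t K : ℝ} (hp : |p| ≤ K) (hq : |q| ≤ K) :
    r ^ 2 + s ^ 2 + t ^ 2 ≤ 2 * (2 + 2 * K ^ 2) *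
      ((s ^ 2 - r * t) + ((1 + q ^ 2) * r - 2 * p * q * s + (1 + p ^ 2) * t) ^ 2) := by
  obtain ⟨β, hβ⟩ : ∃ β, β = (1 + q ^ 2) * r - 2 * p * q * s + (1 + p ^ 2) * t := ⟨_, rfl⟩
  obtain ⟨A, hA⟩ : ∃ A, A = 2 + p ^ 2 + q ^ 2 := ⟨_, rfl⟩
  obtain ⟨σ, hσ⟩ : ∃ σ, σ = s ^ 2 - r * t := ⟨_, rfl⟩
  have hp2 : p ^ 2 ≤ K ^ 2 := sq_le_sq.2 (hp.trans (le_abs_self K))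
  have hq2 : q ^ 2 ≤ K ^ 2 := sq_le_sq.2 (hq.trans (le_abs_self K))
  have id : r ^ 2 + 2 * s ^ 2 + t ^ 2 + (q * r - p * s) ^ 2 + (q * s - p * t) ^ 2 =
      A * σ + β * (r + t) := by rw [hβ, hA, hσ]; ring
  have h1 : (r ^ 2 + s ^ 2 + t ^ 2) / 2 ≤ β ^ 2 + A * σ := by
    nlinarith [sq_nonneg (q * r - p * s), sq_nonneg (q * s - p * t), sq_nonneg (β - (r + t) / 2),
      sq_nonneg (r - t)]
  have hA2 : 2 ≤ A := by nlinarith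
  have hAM : A ≤ 2 + 2 * K ^ 2 := by linarith
  rw [← hβ, ← hσ]
  obtain ⟨M, hM⟩ : ∃ M, M = 2 + 2 * K ^ 2 := ⟨_, rfl⟩
  rw [← hM] at hAM ⊢
  rcases le_or_gt 0 σ with h | h
  · nlinarith [mul_le_mul_of_nonneg_right hAM h, sq_nonneg β]
  · have h2 : 0 ≤ β ^ 2 + A * σ := le_trans (by positivity) h1
    nlinarith [mul_nonneg (by linarith : 0 ≤ M - 2) (sq_nonneg β)]

/-- Caccioppoli's inequality before integration. -/
theorem hessian_le_jacobian {p q r s t K B χ χx χy : ℝ} (hp : |p| ≤ K) (hq : |q| ≤ K)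
    (hB : |(1 + q ^ 2) * r - 2 * p * q * s + (1 + p ^ 2) * t| ≤ B) :
    χ ^ 2 * (r ^ 2 + s ^ 2 + t ^ 2) ≤
      -(4 * (2 + 2 * K ^ 2)) * ((χx * p + χ * r) * (χy * q + χ * t) -
        (χy * p + χ * s) * (χx * q + χ * s)) +
      16 * (K ^ 2 + 1) * (2 + 2 * K ^ 2) ^ 2 * (χx ^ 2 + χy ^ 2) +
      4 * (2 + 2 * K ^ 2) * B ^ 2 * χ ^ 2 := by
  have h := mul_le_mul_of_nonneg_left (hessian_le_det (r := r) (s := s) (t := t) hp hq) (sq_nonneg χ)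
  have hB2 := mul_le_mul_of_nonneg_right (sq_le_sq.2 (hB.trans (le_abs_self B))) (sq_nonneg χ)
  obtain ⟨β, hβ⟩ : ∃ β, β = (1 + q ^ 2) * r - 2 * p * q * s + (1 + p ^ 2) * t := ⟨_, rfl⟩
  rw [← hβ] at h hB2
  have hp2 : p ^ 2 ≤ K ^ 2 := sq_le_sq.2 (hp.trans (le_abs_self K))
  have hq2 : q ^ 2 ≤ K ^ 2 := sq_le_sq.2 (hq.trans (le_abs_self K))
  obtain ⟨M, hM⟩ : ∃ M, M = 2 + 2 * K ^ 2 := ⟨_, rfl⟩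
  have hM0 : 2 ≤ M := by nlinarith [sq_nonneg K]
  rw [← hM] at h ⊢
  have hyz : (p * t - q * s) ^ 2 + (q * r - p * s) ^ 2 ≤ 4 * K ^ 2 * (r ^ 2 + s ^ 2 + t ^ 2) := by
    nlinarith [sq_nonneg (p * t + q * s), sq_nonneg (q * r + p * s),
      mul_le_mul_of_nonneg_right hp2 (sq_nonneg t), mul_le_mul_of_nonneg_right hq2 (sq_nonneg s),
      mul_le_mul_of_nonneg_right hq2 (sq_nonneg r), mul_le_mul_of_nonneg_right hp2 (sq_nonneg s),
      mul_nonneg (sq_nonneg K) (sq_nonneg r), mul_nonneg (sq_nonneg K) (sq_nonneg t),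
      mul_nonneg (sq_nonneg K) (sq_nonneg s)]
  have young (a y : ℝ) : 2 * M * χ * (a * y) ≤
      χ ^ 2 * (y ^ 2 / (8 * (K ^ 2 + 1))) + 8 * (K ^ 2 + 1) * M ^ 2 * a ^ 2 := by
    have h0 : 0 < 8 * (K ^ 2 + 1) := by positivity
    have h1 : χ ^ 2 * (y ^ 2 / (8 * (K ^ 2 + 1))) + 8 * (K ^ 2 + 1) * M ^ 2 * a ^ 2 -
        2 * M * χ * (a * y) = (χ * y - 8 * (K ^ 2 + 1) * M * a) ^ 2 / (8 * (K ^ 2 + 1)) := by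
      field_simp
      ring
    have h2 : 0 ≤ (χ * y - 8 * (K ^ 2 + 1) * M * a) ^ 2 / (8 * (K ^ 2 + 1)) := by positivity
    linarith
  have hy := young χx (p * t - q * s)
  have hz := young χy (q * r - p * s)
  have hsum : (p * t - q * s) ^ 2 / (8 * (K ^ 2 + 1)) + (q * r - p * s) ^ 2 / (8 * (K ^ 2 + 1)) ≤
      (r ^ 2 + s ^ 2 + t ^ 2) / 2 := by
    rw [← add_div, div_le_div_iff₀ (by positivity) two_pos]
    nlinarith [sq_nonneg r, sq_nonneg s, sq_nonneg t]
  have hsum' := mul_le_mul_of_nonneg_left hsum (sq_nonneg χ)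
  have hB3 := mul_le_mul_of_nonneg_left hB2 (by linarith : 0 ≤ 2 * M)
  have hJ : (χx * p + χ * r) * (χy * q + χ * t) - (χy * p + χ * s) * (χx * q + χ * s) =
      χ ^ 2 * (r * t - s ^ 2) + χ * (χx * (p * t - q * s)) + χ * (χy * (q * r - p * s)) := by ring
  rw [hJ]
  nlinarith

theorem abs_rhs_le {α x1 x2 v p q K R m : ℝ} (hm : 0 < m) (hp : |p| ≤ K) (hq : |q| ≤ K)
    (h1 : |x1| ≤ R) (h2 : |x2| ≤ R) (hv : |v| ≤ R) (hN : m ≤ x1 ^ 2 + x2 ^ 2 + v ^ 2) :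
    |rhs α x1 x2 v p q| ≤ |α| * (R + 2 * R * K) / m := by
  have hR : 0 ≤ R := (abs_nonneg _).trans h1
  have hK : 0 ≤ K := (abs_nonneg _).trans hp
  have hden : m ≤ (x1 ^ 2 + x2 ^ 2 + v ^ 2) * area p q := by
    nlinarith [one_le_area p q]
  rw [rhs, abs_div, abs_mul, abs_of_pos (hm.trans_le hden)]
  gcongr
  calc |v - x1 * p - x2 * q| ≤ |v| + |x1| * |p| + |x2| * |q| := by
        rw [← abs_mul, ← abs_mul]
        exact (abs_sub _ _).trans (by gcongr; exact abs_sub _ _)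
    _ ≤ R + R * K + R * K := by gcongr
    _ = _ := by ring

end hess

end

noncomputable section

section hess

open Filter Topology MeasureTheory

local notation "dfst" => ContinuousLinearMap.fst ℝ ℝ ℝ
local notation "dsnd" => ContinuousLinearMap.snd ℝ ℝ ℝ

theorem PuncturedSol.abs_elliptic_le {α δ K R m : ℝ} {q0 : ℝ × ℝ} {f p q r s t : ℝ × ℝ → ℝ}
    (hf : PuncturedSol α q0 δ K R m f p q r s t) (hm : 0 < m) {x : ℝ × ℝ}
    (hx : x ∈ Metric.ball q0 δ) (hx0 : x ≠ q0) :
    |(1 + q x ^ 2) * r x - 2 * p x * q x * s x + (1 + p x ^ 2) * t x| ≤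
      |α| * (R + 2 * R * K) / m * (1 + 2 * K) ^ 3 := by
  have hp := hf.bp x hx hx0
  have hq := hf.bq x hx hx0
  obtain ⟨h1, h2, h3, h4⟩ := hf.bx x hx
  have hR : 0 ≤ R := (abs_nonneg _).trans h1
  have hK : 0 ≤ K := (abs_nonneg _).trans hp
  rw [hf.eq x hx hx0, abs_mul, abs_of_nonneg (pow_nonneg (area_pos _ _).le 3)]
  gcongr
  · exact pow_nonneg (area_pos _ _).le 3
  · exact abs_rhs_le hm hp hq h1 h2 h3 h4
  · exact (area_pos _ _).le
  · exact area_le_of_abs_le hp hq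

/-- The Hessian of a solution is square integrable near an isolated singularity. -/
theorem PuncturedSol.lintegral_hessian_lt_top {α δ K R m : ℝ} {q0 : ℝ × ℝ}
    {f p q r s t : ℝ × ℝ → ℝ} (hf : PuncturedSol α q0 δ K R m f p q r s t) (hδ : 0 < δ)
    (hm : 0 < m) : ∫⁻ x in Metric.ball q0 (δ / 4) \ {q0},
      ENNReal.ofReal (r x ^ 2 + s x ^ 2 + t x ^ 2) < ⊤ := by
  obtain ⟨C, hC⟩ := exists_annular_cutoff
  obtain ⟨B, hB⟩ : ∃ B, B = |α| * (R + 2 * R * K) / m * (1 + 2 * K) ^ 3 := ⟨_, rfl⟩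
  obtain ⟨E, hE⟩ : ∃ E, E = 16 * (K ^ 2 + 1) * (2 + 2 * K ^ 2) ^ 2 * C +
    4 * (2 + 2 * K ^ 2) * B ^ 2 * (4 * δ ^ 2) := ⟨_, rfl⟩
  have hU : IsOpen (Metric.ball q0 δ \ {q0}) := Metric.isOpen_ball.sdiff isClosed_singleton
  have annulus {ε : ℝ} (hε : 0 < ε) : ∫⁻ x in Metric.ball q0 (δ / 4) \ Metric.ball q0 (2 * ε),
      ENNReal.ofReal (r x ^ 2 + s x ^ 2 + t x ^ 2) ≤ ENNReal.ofReal E := by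
    obtain ⟨χ, χx, χy, dχ, cχx, cχy, hχ01, ⟨S, hS, hSU, off⟩, hχ1, hχC⟩ := hC q0 δ ε hδ hε
    have cχ : Continuous χ := continuous_iff_continuousAt.2 fun x => (dχ x).continuousAt
    have mulc {ψ g : ℝ × ℝ → ℝ} (cψ : Continuous ψ) (hψ : ∀ x ∉ S, ψ x = 0)
        (hg : ContinuousOn g (Metric.ball q0 δ \ {q0})) : Continuous fun x => ψ x * g x :=
      continuous_cutoff_mul cψ hS.isClosed hU hSU hψ hg
    have sup {g : ℝ × ℝ → ℝ} (h : ∀ x ∉ S, g x = 0) : HasCompactSupport g :=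
      HasCompactSupport.intro hS h
    have o1 (x) (hx : x ∉ S) := (off x hx).1
    have o2 (x) (hx : x ∉ S) := (off x hx).2.1
    have o3 (x) (hx : x ∉ S) := (off x hx).2.2
    have cp : ContinuousOn p (Metric.ball q0 δ \ {q0}) := fun x hx =>
      (hf.dp x hx.1 hx.2).continuousAt.continuousWithinAt
    have cq : ContinuousOn q (Metric.ball q0 δ \ {q0}) := fun x hx =>
      (hf.dq x hx.1 hx.2).continuousAt.continuousWithinAt
    have c1 := mulc cχx o2 cp
    have c2 := mulc cχy o3 cp
    have c3 := mulc cχx o2 cq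
    have c4 := mulc cχy o3 cq
    have c5 := mulc cχ o1 hf.cr
    have c6 := mulc cχ o1 hf.cs
    have c7 := mulc cχ o1 hf.ct
    have J := integral_jacobian_eq_zero
      (hasFDerivAt_cutoff_mul dχ hS.isClosed hSU off fun x hx => hf.dp x hx.1 hx.2)
      (c1.add c5) (c2.add c6) (sup fun x hx => by rw [o1 x hx, zero_mul])
      (hasFDerivAt_cutoff_mul dχ hS.isClosed hSU off fun x hx => hf.dq x hx.1 hx.2)
      (c3.add c6) (c4.add c7) (sup fun x hx => by rw [o1 x hx, zero_mul])
    have iJ : Integrable fun x => (χx x * p x + χ x * r x) * (χy x * q x + χ x * t x) -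
        (χy x * p x + χ x * s x) * (χx x * q x + χ x * s x) :=
      Continuous.integrable_of_hasCompactSupport (((c1.add c5).mul (c4.add c7)).sub
        ((c2.add c6).mul (c3.add c6))) (sup fun x hx => by simp [o1 x hx, o2 x hx, o3 x hx])
    have iG : Integrable fun x => χx x ^ 2 + χy x ^ 2 :=
      Continuous.integrable_of_hasCompactSupport (by fun_prop)
        (sup fun x hx => by simp [o2 x hx, o3 x hx])
    have iχ : Integrable fun x => χ x ^ 2 :=
      Continuous.integrable_of_hasCompactSupport (by fun_prop) (sup fun x hx => by simp [o1 x hx])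
    have iD : Integrable fun x => χ x ^ 2 * (r x ^ 2 + s x ^ 2 + t x ^ 2) := by
      refine Continuous.integrable_of_hasCompactSupport ?_ (sup fun x hx => by simp [o1 x hx])
      have : Continuous fun x => (χ x * r x) ^ 2 + (χ x * s x) ^ 2 + (χ x * t x) ^ 2 :=
        ((c5.pow 2).add (c6.pow 2)).add (c7.pow 2)
      refine this.congr fun x => by ring
    have vχ : ∫ x, χ x ^ 2 ≤ 4 * δ ^ 2 := by
      rw [← volume_real_closedBall_prod q0 hδ.le, ← integral_indicator_one measurableSet_closedBall]
      refine integral_mono_of_nonneg (Eventually.of_forall fun x => sq_nonneg _)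
        ((integrable_indicator_iff measurableSet_closedBall).2
          (integrableOn_const (isCompact_closedBall _ _).measure_lt_top.ne))
        (Eventually.of_forall fun x => ?_)
      by_cases hx : x ∈ S
      · rw [indicator_of_mem (Metric.ball_subset_closedBall (hSU hx).1)]
        exact pow_le_one₀ (hχ01 x).1 (hχ01 x).2
      · simp only [o1 x hx, ne_eq, OfNat.ofNat_ne_zero, not_false_eq_true, zero_pow]
        exact indicator_nonneg (fun _ _ => zero_le_one) _
    have main : ∫ x, χ x ^ 2 * (r x ^ 2 + s x ^ 2 + t x ^ 2) ≤ E := by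
      calc _ ≤ ∫ x, (-(4 * (2 + 2 * K ^ 2)) * ((χx x * p x + χ x * r x) * (χy x * q x + χ x * t x) -
              (χy x * p x + χ x * s x) * (χx x * q x + χ x * s x)) +
              16 * (K ^ 2 + 1) * (2 + 2 * K ^ 2) ^ 2 * (χx x ^ 2 + χy x ^ 2) +
              4 * (2 + 2 * K ^ 2) * B ^ 2 * χ x ^ 2) := by
            refine integral_mono iD (((iJ.const_mul _).add (iG.const_mul _)).add (iχ.const_mul _))
              fun x => ?_
            by_cases hx : x ∈ S
            · obtain ⟨h1, h2⟩ := hSU hx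
              exact hessian_le_jacobian (hf.bp x h1 h2) (hf.bq x h1 h2)
                (hB ▸ hf.abs_elliptic_le hm h1 h2)
            · simp [o1 x hx, o2 x hx, o3 x hx]
        _ = -(4 * (2 + 2 * K ^ 2)) * 0 +
              16 * (K ^ 2 + 1) * (2 + 2 * K ^ 2) ^ 2 * (∫ x, (χx x ^ 2 + χy x ^ 2)) +
              4 * (2 + 2 * K ^ 2) * B ^ 2 * ∫ x, χ x ^ 2 := by
            have i3 : Integrable fun x => -(4 * (2 + 2 * K ^ 2)) *
                ((χx x * p x + χ x * r x) * (χy x * q x + χ x * t x) -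
                (χy x * p x + χ x * s x) * (χx x * q x + χ x * s x)) +
                16 * (K ^ 2 + 1) * (2 + 2 * K ^ 2) ^ 2 * (χx x ^ 2 + χy x ^ 2) :=
              (iJ.const_mul _).add (iG.const_mul _)
            rw [integral_add i3 (iχ.const_mul _),
              integral_add (iJ.const_mul _) (iG.const_mul _), integral_const_mul,
              integral_const_mul, integral_const_mul, J]
        _ ≤ E := by
            rw [hE, mul_zero, zero_add]
            gcongr
    calc _ = ∫⁻ x in Metric.ball q0 (δ / 4) \ Metric.ball q0 (2 * ε),
            ENNReal.ofReal (χ x ^ 2 * (r x ^ 2 + s x ^ 2 + t x ^ 2)) := by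
          refine setLIntegral_congr_fun (measurableSet_ball.diff measurableSet_ball) fun x hx => ?_
          simp only [hχ1 x hx.1 hx.2, one_pow, one_mul]
      _ ≤ ∫⁻ x, ENNReal.ofReal (χ x ^ 2 * (r x ^ 2 + s x ^ 2 + t x ^ 2)) := setLIntegral_le_lintegral _ _
      _ = ENNReal.ofReal (∫ x, χ x ^ 2 * (r x ^ 2 + s x ^ 2 + t x ^ 2)) :=
          (ofReal_integral_eq_lintegral_ofReal iD (Eventually.of_forall fun x => by positivity)).symm
      _ ≤ _ := ENNReal.ofReal_le_ofReal main
  have hU : Metric.ball q0 (δ / 4) \ {q0} =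
      ⋃ n : ℕ, Metric.ball q0 (δ / 4) \ Metric.ball q0 (2 * (1 / ((n : ℝ) + 1))) := by
    ext x
    simp only [Set.mem_sdiff, mem_singleton_iff, mem_iUnion, exists_and_left, Metric.mem_ball, not_lt]
    refine and_congr_right fun _ => ⟨fun h => ?_, ?_⟩
    · obtain ⟨n, hn⟩ := exists_nat_one_div_lt (half_pos (dist_pos.2 h))
      exact ⟨n, by linarith⟩
    · rintro ⟨n, hn⟩ rfl
      rw [dist_self] at hn
      exact absurd hn (not_le.2 (by positivity))
  have hdir : Directed (· ⊆ ·) fun n : ℕ =>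
      Metric.ball q0 (δ / 4) \ Metric.ball q0 (2 * (1 / ((n : ℝ) + 1))) := by
    refine Monotone.directed_le fun a b hab => ?_
    refine sdiff_subset_sdiff_right (Metric.ball_subset_ball ?_)
    gcongr
  rw [hU, setLIntegral_iUnion_of_directed _ hdir]
  exact (iSup_le fun n => annulus (by positivity)).trans_lt ENNReal.ofReal_lt_top

end hess

end

noncomputable section

section lift

open Filter Topology MeasureTheory

variable {T : ℝ} [hT : Fact (0 < T)]

local notation "𝒜" => wienReal (Icc (0 : ℝ) T)
local notation "dfst" => ContinuousLinearMap.fst ℝ ℝ ℝ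
local notation "dsnd" => ContinuousLinearMap.snd ℝ ℝ ℝ

/-- A periodic function which is small in `C⁰` with small second derivative in `L²`. -/
structure SmallLoop (ε : ℝ) (ψ ψ' ψ'' : ℝ → ℝ) : Prop where
  d1 : ∀ x, HasDerivAt ψ (ψ' x) x
  d2 : ∀ x, HasDerivAt ψ' (ψ'' x) x
  c2 : Continuous ψ''
  per : Function.Periodic ψ (2 * π)
  le : ∀ x, |ψ x| ≤ ε
  int_le : (∫ x in (0 : ℝ)..2 * π, ψ'' x ^ 2) ≤ ε ^ 2

theorem SmallLoop.periodic_deriv {ε : ℝ} {ψ ψ' ψ'' : ℝ → ℝ} (h : SmallLoop ε ψ ψ' ψ'') :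
    Function.Periodic ψ' (2 * π) := fun x => by
  have h1 := (h.d1 (x + 2 * π)).comp_add_const x (2 * π)
  simp only [h.per _] at h1
  exact h1.unique (h.d1 x)

theorem cf_const (c : C(Icc (0 : ℝ) T, ℝ)) (y : ℝ × ℝ) : cf (wienReal.const c) y = c (clamp y.1) :=
  wienReal.ev_const _ _ _

variable (T) in
/-- Two small loops are interpolated by a small element of the algebra with small
derivatives. -/
theorem exists_lift : ∃ C > 0, ∀ ε > 0, ∀ ψ ψ' ψ'' φ φ' φ'' : ℝ → ℝ,
    SmallLoop ε ψ ψ' ψ'' → SmallLoop ε φ φ' φ'' → ∃ Ψ Ψt Ψθ : 𝒜,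
    ‖Ψ‖ ≤ C * ε ∧ ‖Ψt‖ ≤ C * ε ∧ ‖Ψθ‖ ≤ C * ε ∧
    (∀ θ, cf Ψ (0, θ) = ψ θ) ∧ (∀ θ, cf Ψ (T, θ) = φ θ) ∧
    ∀ t ∈ Ioo 0 T, ∀ θ, HasFDerivAt (cf Ψ) (cf Ψt (t, θ) • dfst + cf Ψθ (t, θ) • dsnd) (t, θ) := by
  obtain ⟨C, hC, hb⟩ := exists_periodic_bound
  have hT0 := hT.out
  obtain ⟨a, ha⟩ : ∃ a : C(Icc (0 : ℝ) T, ℝ), ∀ t, a t = 1 - (t : ℝ) / T :=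
    ⟨⟨fun t => 1 - (t : ℝ) / T, by fun_prop⟩, fun _ => rfl⟩
  obtain ⟨b, hb'⟩ : ∃ b : C(Icc (0 : ℝ) T, ℝ), ∀ t, b t = (t : ℝ) / T :=
    ⟨⟨fun t => (t : ℝ) / T, by fun_prop⟩, fun _ => rfl⟩
  obtain ⟨M, hM⟩ : ∃ M, M = ‖(wienReal.const a : 𝒜)‖ + ‖(wienReal.const b : 𝒜)‖ := ⟨_, rfl⟩
  have hM0 : 0 ≤ M := by rw [hM]; positivity
  have hMC : 0 ≤ M * C := by positivity
  have hTC : 0 < 2 * T⁻¹ * C := by positivity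
  refine ⟨M * C + 2 * T⁻¹ * C, by positivity, fun ε hε ψ ψ' ψ'' φ φ' φ'' hψ hφ => ?_⟩
  obtain ⟨s1, s2, n1, n2⟩ := hb ψ ψ' ψ'' ε hε hψ.d1 hψ.d2 hψ.c2 hψ.per hψ.le hψ.int_le
  obtain ⟨s3, s4, n3, n4⟩ := hb φ φ' φ'' ε hε hφ.d1 hφ.d2 hφ.c2 hφ.per hφ.le hφ.int_le
  have cont {g g' : ℝ → ℝ} (h : ∀ x, HasDerivAt g (g' x) x) : Continuous g :=
    continuous_iff_continuousAt.2 fun x => (h x).continuousAt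
  obtain ⟨A, nA, hA⟩ : ∃ A : 𝒜, ‖A‖ ≤ C * ε ∧ ∀ y, cf A y = ψ y.2 :=
    ⟨_, (wienReal.norm_ofPeriodic_le ψ s1).trans n1, fun y =>
      wienReal.ev_ofPeriodic s1 (cont hψ.d1) hψ.per _ _⟩
  obtain ⟨A', nA', hA'⟩ : ∃ A : 𝒜, ‖A‖ ≤ C * ε ∧ ∀ y, cf A y = ψ' y.2 :=
    ⟨_, (wienReal.norm_ofPeriodic_le ψ' s2).trans n2, fun y =>
      wienReal.ev_ofPeriodic s2 (cont hψ.d2) hψ.periodic_deriv _ _⟩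
  obtain ⟨B, nB, hB⟩ : ∃ A : 𝒜, ‖A‖ ≤ C * ε ∧ ∀ y, cf A y = φ y.2 :=
    ⟨_, (wienReal.norm_ofPeriodic_le φ s3).trans n3, fun y =>
      wienReal.ev_ofPeriodic s3 (cont hφ.d1) hφ.per _ _⟩
  obtain ⟨B', nB', hB'⟩ : ∃ A : 𝒜, ‖A‖ ≤ C * ε ∧ ∀ y, cf A y = φ' y.2 :=
    ⟨_, (wienReal.norm_ofPeriodic_le φ' s4).trans n4, fun y =>
      wienReal.ev_ofPeriodic s4 (cont hφ.d2) hφ.periodic_deriv _ _⟩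
  have comb {G H : 𝒜} (hG : ‖G‖ ≤ C * ε) (hH : ‖H‖ ≤ C * ε) :
      ‖wienReal.const a * G + wienReal.const b * H‖ ≤ (M * C + 2 * T⁻¹ * C) * ε := by
    calc _ ≤ ‖(wienReal.const a : 𝒜)‖ * (C * ε) + ‖(wienReal.const b : 𝒜)‖ * (C * ε) := by
          refine (norm_add_le _ _).trans (add_le_add ?_ ?_)
          · exact (norm_mul_le _ _).trans (by gcongr)
          · exact (norm_mul_le _ _).trans (by gcongr)
      _ = M * C * ε := by rw [hM]; ring
      _ ≤ _ := by gcongr; linarith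
  refine ⟨wienReal.const a * A + wienReal.const b * B, T⁻¹ • (B - A),
    wienReal.const a * A' + wienReal.const b * B', comb nA nB, ?_, comb nA' nB', fun θ => ?_,
    fun θ => ?_, fun t ht θ => ?_⟩
  · calc _ ≤ T⁻¹ * (C * ε + C * ε) := by
          rw [norm_smul, Real.norm_of_nonneg (by positivity)]
          gcongr
          exact (norm_sub_le _ _).trans (add_le_add nB nA)
      _ = 2 * T⁻¹ * C * ε := by ring
      _ ≤ _ := by gcongr; linarith
  · simp [cf_const, hA, hB, ha, hb', coe_clamp (left_mem_Icc.2 hT0.le)]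
  · simp [cf_const, hA, hB, ha, hb', coe_clamp (right_mem_Icc.2 hT0.le), hT0.ne']
  · have h1 : HasFDerivAt (fun y : ℝ × ℝ => (1 - y.1 / T) * ψ y.2 + y.1 / T * φ y.2)
        (cf (T⁻¹ • (B - A)) (t, θ) • dfst +
          cf (wienReal.const a * A' + wienReal.const b * B') (t, θ) • dsnd) (t, θ) := by
      have d0 : HasFDerivAt (fun y : ℝ × ℝ => y.1) dfst (t, θ) := hasFDerivAt_fst
      have d1 : HasFDerivAt (fun y : ℝ × ℝ => y.1 / T) (T⁻¹ • dfst) (t, θ) := by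
        simpa only [div_eq_inv_mul] using d0.const_mul T⁻¹
      have d2 : HasFDerivAt (fun y : ℝ × ℝ => y.2) dsnd (t, θ) := hasFDerivAt_snd
      have d3 : HasFDerivAt (fun y : ℝ × ℝ => ψ y.2) (ψ' θ • dsnd) (t, θ) :=
        (hψ.d1 θ).comp_hasFDerivAt (t, θ) d2
      have d4 : HasFDerivAt (fun y : ℝ × ℝ => φ y.2) (φ' θ • dsnd) (t, θ) :=
        (hφ.d1 θ).comp_hasFDerivAt (t, θ) d2
      refine (((d1.const_sub 1).fun_mul d3).fun_add (d1.fun_mul d4)).congr_fderiv ?_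
      ext
      · simp [hA, hB]
        ring
      · simp [cf_const, hA', hB', ha, hb', coe_clamp (Ioo_subset_Icc_self ht)]
    refine h1.congr_of_eventuallyEq ?_
    filter_upwards [(continuous_fst.tendsto (t, θ)).eventually (Icc_mem_nhds ht.1 ht.2)] with y hy
    simp [cf_const, hA, hB, ha, hb', coe_clamp hy]

end lift

end

noncomputable section

section ellipse

open Filter Topology MeasureTheory

variable {T : ℝ} [hT : Fact (0 < T)]

local notation "𝒜" => wienReal (Icc (0 : ℝ) T)
local notation "dfst" => ContinuousLinearMap.fst ℝ ℝ ℝ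
local notation "dsnd" => ContinuousLinearMap.snd ℝ ℝ ℝ

/-- The point with polar coordinates `(ρ, θ)` in the lower triangular frame `(a, b, d)` at `c`. -/
def ellipse (a b d : ℝ) (c : ℝ × ℝ) (ρ θ : ℝ) : ℝ × ℝ :=
  (c.1 + ρ * (a * cos θ), c.2 + ρ * (b * cos θ + d * sin θ))

theorem cf_x1 (p q ρ h c1 c2 t θ : ℝ) (ht : t ∈ Icc 0 T) (ψ : 𝒜 × 𝒜 × 𝒜) :
    cf ((stdFrame T p q).x1 ((((ρ, h, c1, c2), (0, 0), ψ) : Prm 𝒜), 0)) (t, θ) =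
      c1 + ρ * exp t * (√(1 + q ^ 2) * cos θ) := by
  simp only [Frame.x1, Frame.ξ1, zero_smul, add_zero, cf_add, cf_smul, cf_one, cf_e1, coe_clamp ht]
  rw [show (stdFrame T p q).l11 = √(1 + q ^ 2) from rfl]
  ring

theorem cf_x2 (p q ρ h c1 c2 t θ : ℝ) (ht : t ∈ Icc 0 T) (ψ : 𝒜 × 𝒜 × 𝒜) :
    cf ((stdFrame T p q).x2 ((((ρ, h, c1, c2), (0, 0), ψ) : Prm 𝒜), 0)) (t, θ) =
      c2 + ρ * exp t * (-(p * q) / √(1 + q ^ 2) * cos θ + area p q / √(1 + q ^ 2) * sin θ) := by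
  simp only [Frame.x2, Frame.ξ1, Frame.ξ2, zero_smul, add_zero, cf_add, cf_smul, cf_one, cf_e1,
    cf_e2, coe_clamp ht]
  rw [show (stdFrame T p q).l21 = -(p * q) / √(1 + q ^ 2) from rfl,
    show (stdFrame T p q).l22 = area p q / √(1 + q ^ 2) from rfl]
  ring

theorem cf_V (p q ρ h c1 c2 t θ : ℝ) (ht : t ∈ Icc 0 T) (ψ : 𝒜 × 𝒜 × 𝒜) :
    cf ((stdFrame T p q).V ((((ρ, h, c1, c2), (0, 0), ψ) : Prm 𝒜), 0)) (t, θ) =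
      h + ρ * (exp t * (p * (√(1 + q ^ 2) * cos θ) +
        q * (-(p * q) / √(1 + q ^ 2) * cos θ + area p q / √(1 + q ^ 2) * sin θ)) +
        cf ψ.1 (t, θ)) := by
  have z : ((((ρ, h, c1, c2), (0, 0), ψ) : Prm 𝒜), (0 : 𝒜 × 𝒜 × 𝒜)).2.1 = 0 := rfl
  simp only [Frame.V, Frame.ξ1, Frame.ξ2, zero_smul, add_zero, cf_add, cf_smul, cf_one, cf_e1,
    cf_e2, coe_clamp ht, Prod.fst_zero]
  rw [show (stdFrame T p q).l21 = -(p * q) / √(1 + q ^ 2) from rfl,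
    show (stdFrame T p q).l22 = area p q / √(1 + q ^ 2) from rfl,
    show (stdFrame T p q).l11 = √(1 + q ^ 2) from rfl,
    show (stdFrame T p q).p1 = p from rfl, show (stdFrame T p q).p2 = q from rfl]
  ring

variable (T) in
/-- A solution is analytic at its singularity once the singularity is enclosed, at small scales,
between two ellipses on which the solution is close to a fixed affine function. -/
theorem analyticAt_of_ellipses {α p q δ K R m a b d : ℝ} {q0 : ℝ × ℝ} {f fp fq r s t : ℝ × ℝ → ℝ}
    (hf : PuncturedSol α q0 δ K R m f fp fq r s t) (hδ : 0 < δ)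
    (hN : 0 < q0.1 ^ 2 + q0.2 ^ 2 + f q0 ^ 2) (hKp : |p| + 1 ≤ K) (hKq : |q| + 1 ≤ K)
    (hR : q0.1 ^ 2 + q0.2 ^ 2 + f q0 ^ 2 + 1 ≤ R) (hm0 : 0 < m)
    (hm : m ≤ (q0.1 ^ 2 + q0.2 ^ 2 + f q0 ^ 2) / 2) (ha : a = √(1 + q ^ 2))
    (hb : b = -(p * q) / √(1 + q ^ 2)) (hd : d = area p q / √(1 + q ^ 2))
    (H : ∀ ε > 0, ∃ (ρ h : ℝ) (c : ℝ × ℝ) (ψ ψ' ψ'' φ φ' φ'' : ℝ → ℝ), 0 < ρ ∧ ρ ≤ ε ∧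
      |h - f q0| ≤ ε ∧ dist c q0 ≤ ε ∧ SmallLoop ε ψ ψ' ψ'' ∧ SmallLoop ε φ φ' φ'' ∧
      (∀ θ, f (ellipse a b d c ρ θ) =
        h + ρ * (p * (a * cos θ) + q * (b * cos θ + d * sin θ) + ψ θ)) ∧
      (∀ θ, f (ellipse a b d c (ρ * exp T) θ) =
        h + ρ * (exp T * (p * (a * cos θ) + q * (b * cos θ + d * sin θ)) + φ θ)) ∧
      ∃ t ∈ Ioo 0 T, ∃ θ, ellipse a b d c (ρ * exp t) θ = q0) : AnalyticAt ℝ f q0 := by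
  obtain ⟨C, hC, hL⟩ := exists_lift T
  have key := eventually_analyticAt (T := T) (p := p) (q := q) (h := f q0) (c1 := q0.1)
    (c2 := q0.2) hf hδ hN hKp hKq hR hm0 hm
  obtain ⟨η, hη, hη'⟩ := Metric.eventually_nhds_iff.1 key
  obtain ⟨ε, hε, hεη, hCεη⟩ : ∃ ε > 0, ε < η ∧ C * ε < η := by
    refine ⟨η / (2 * (C + 1)), by positivity, ?_, ?_⟩
    · rw [div_lt_iff₀ (by positivity)]; nlinarith
    · rw [mul_div_assoc', div_lt_iff₀ (by positivity)]; nlinarith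
  obtain ⟨ρ, h, c, ψ, ψ', ψ'', φ, φ', φ'', hρ, hρε, hh, hc, hψ, hφ, h0, h1, t1, ht1, θ1, hq⟩ := H ε hε
  obtain ⟨Ψ, Ψt, Ψθ, n1, n2, n3, b0, b1, dΨ⟩ := hL ε hε _ _ _ _ _ _ hψ hφ
  have hTm := hT.out
  have m0 : (0 : ℝ) ∈ Icc 0 T := left_mem_Icc.2 hTm.le
  have mT : T ∈ Icc 0 T := right_mem_Icc.2 hTm.le
  rw [Prod.dist_eq, max_le_iff] at hc
  have res := @hη' ((ρ, h, c.1, c.2), (0, 0), (Ψ, Ψt, Ψθ)) (by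
    simp only [Frame.base, Prod.dist_eq, dist_self, dist_zero_right, sup_lt_iff, hη, true_and]
    rw [Real.norm_of_nonneg hρ.le, Real.dist_eq]
    exact ⟨⟨by linarith, by linarith, by linarith [hc.1], by linarith [hc.2]⟩, by linarith,
      by linarith, by linarith⟩) hρ rfl dΨ
  refine res (fun θ => ?_) (fun θ => ?_) ⟨t1, ht1, θ1, ?_⟩
  · rw [cf_x1 _ _ _ _ _ _ _ _ m0, cf_x2 _ _ _ _ _ _ _ _ m0, cf_V _ _ _ _ _ _ _ _ m0, b0,
      ← hb, ← hd, ← ha, exp_zero, mul_one, one_mul]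
    exact h0 θ
  · rw [cf_x1 _ _ _ _ _ _ _ _ mT, cf_x2 _ _ _ _ _ _ _ _ mT, cf_V _ _ _ _ _ _ _ _ mT, b1,
      ← hb, ← hd, ← ha]
    exact h1 θ
  · rw [cf_x1 _ _ _ _ _ _ _ _ (Ioo_subset_Icc_self ht1),
      cf_x2 _ _ _ _ _ _ _ _ (Ioo_subset_Icc_self ht1), ← hb, ← hd, ← ha]
    exact Prod.ext_iff.1 hq

end ellipse

end

noncomputable section

section polar

open Filter Topology MeasureTheory
open scoped ENNReal

theorem ellipse_smul (a b d k : ℝ) (c : ℝ × ℝ) (ρ θ : ℝ) :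
    ellipse (k * a) (k * b) (k * d) c ρ θ = ellipse a b d c (k * ρ) θ := by
  unfold ellipse; ext <;> simp <;> ring

theorem continuous_ellipse (a b d : ℝ) (c : ℝ × ℝ) :
    Continuous fun z : ℝ × ℝ => ellipse a b d c z.1 z.2 := by
  unfold ellipse; fun_prop

theorem lintegral_comp_triangular {a b d : ℝ} (ha : 0 < a) (hd : 0 < d) (c : ℝ × ℝ)
    {g : ℝ × ℝ → ℝ≥0∞} (hg : Measurable g) :
    ∫⁻ x : ℝ × ℝ, ENNReal.ofReal (a * d) * g (c.1 + a * x.1, c.2 + (b * x.1 + d * x.2)) = ∫⁻ x, g x := by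
  obtain ⟨L, hL⟩ : ∃ L : ℝ × ℝ →ₗ[ℝ] ℝ × ℝ, L = Matrix.toLin (Module.Basis.finTwoProd ℝ)
    (Module.Basis.finTwoProd ℝ) !![a, 0; b, d] := ⟨_, rfl⟩
  have hdet : LinearMap.det L = a * d := by
    rw [hL, LinearMap.det_toLin, Matrix.det_fin_two_of, zero_mul, sub_zero]
  have hLx (x : ℝ × ℝ) : L x = (a * x.1, b * x.1 + d * x.2) := by
    rw [hL, Matrix.toLin_finTwoProd_apply, zero_mul, add_zero]
  have hpos : 0 < a * d := mul_pos ha hd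
  have hmap := Measure.map_linearMap_addHaar_eq_smul_addHaar (μ := (volume : Measure (ℝ × ℝ)))
    (f := L) (by rw [hdet]; exact hpos.ne')
  rw [hdet, abs_of_pos (inv_pos.2 hpos)] at hmap
  have hgm : Measurable fun x => g (c + x) := hg.comp (measurable_const_add c)
  have hLm : Measurable L := L.continuous_of_finiteDimensional.measurable
  have h1 : ∫⁻ x, g (c + L x) = ENNReal.ofReal (a * d)⁻¹ * ∫⁻ x, g x := by
    rw [← lintegral_map (f := fun x => g (c + x)) hgm hLm, hmap, lintegral_smul_measure,
      lintegral_add_left_eq_self, smul_eq_mul]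
  rw [lintegral_const_mul']
  · have h2 : ∫⁻ x : ℝ × ℝ, g (c.1 + a * x.1, c.2 + (b * x.1 + d * x.2)) = ∫⁻ x, g (c + L x) := by
      refine lintegral_congr fun x => ?_
      rw [hLx]; rfl
    rw [h2, h1, ← mul_assoc, ← ENNReal.ofReal_mul hpos.le, mul_inv_cancel₀ hpos.ne',
      ENNReal.ofReal_one, one_mul]
  · exact ENNReal.ofReal_ne_top

theorem lintegral_ellipse {a b d : ℝ} (ha : 0 < a) (hd : 0 < d) (c : ℝ × ℝ)
    {g : ℝ × ℝ → ℝ≥0∞} (hg : Measurable g) :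
    ∫⁻ z, ENNReal.ofReal (z.1 * (a * d)) * g (ellipse a b d c z.1 z.2)
      ∂((volume.restrict (Ioi (0 : ℝ))).prod (volume.restrict (Ioo (-π) π))) = ∫⁻ x, g x := by
  rw [← lintegral_comp_triangular (b := b) ha hd c hg, ← lintegral_comp_polarCoord_symm,
    Measure.prod_restrict, ← Measure.volume_eq_prod]
  refine setLIntegral_congr_fun (measurableSet_Ioi.prod measurableSet_Ioo) fun z hz => ?_
  have hz1 : 0 ≤ z.1 := le_of_lt hz.1
  simp only [polarCoord_symm_apply, smul_eq_mul]
  rw [ENNReal.ofReal_mul hz1, mul_assoc]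
  congr 3
  unfold ellipse
  ext <;> simp <;> ring

theorem measurable_ellipse_integrand (a b d w : ℝ) (c : ℝ × ℝ) {g : ℝ × ℝ → ℝ≥0∞}
    (hg : Measurable g) :
    Measurable fun z : ℝ × ℝ => ENNReal.ofReal (z.1 * w) * g (ellipse a b d c z.1 z.2) := by
  have := hg.comp (continuous_ellipse a b d c).measurable
  have h2 : Measurable fun z : ℝ × ℝ => ENNReal.ofReal (z.1 * w) := by fun_prop
  exact h2.mul this

/-- Some ray carries at most its share of the integral. -/
theorem exists_good_angle {g : ℝ × ℝ → ℝ≥0∞} (hg : Measurable g) {e ρ : ℝ} (hρ : 0 < ρ)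
    (he : ∫⁻ x, g x ≤ ENNReal.ofReal e) (c : ℝ × ℝ) : ∃ θ ∈ Ioo (-π) π,
    ∫⁻ R in Ioi 0, ENNReal.ofReal (R * ρ ^ 2) * g (ellipse 1 0 1 c (ρ * R) θ) ≤
      ENNReal.ofReal e := by
  have h := lintegral_ellipse (b := ρ * 0) (mul_pos hρ one_pos) (mul_pos hρ one_pos) c hg
  rw [lintegral_prod_symm' _ (measurable_ellipse_integrand _ _ _ _ c hg)] at h
  obtain ⟨θ, hθ, hle⟩ := exists_le_setLAverage (μ := volume) (s := Ioo (-π) π)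
    (f := fun θ => ∫⁻ R in Ioi 0, ENNReal.ofReal (R * (ρ * 1 * (ρ * 1))) *
      g (ellipse (ρ * 1) (ρ * 0) (ρ * 1) c R θ))
    (by rw [Real.volume_Ioo, ne_eq, ENNReal.ofReal_eq_zero]; linarith [pi_pos])
    (by rw [Real.volume_Ioo]; exact ENNReal.ofReal_ne_top)
    (measurable_ellipse_integrand _ _ _ _ c hg).lintegral_prod_left'.aemeasurable
  refine ⟨θ, hθ, ?_⟩
  rw [setLAverage_eq, h, Real.volume_Ioo] at hle
  have h1 : (1 : ℝ≥0∞) ≤ ENNReal.ofReal (π - -π) := by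
    rw [ENNReal.one_le_ofReal]; linarith [pi_gt_three]
  calc _ = _ := by
        refine lintegral_congr fun R => ?_
        rw [← ellipse_smul]
        congr 2
        ring
    _ ≤ _ := hle
    _ ≤ ∫⁻ x, g x := ENNReal.div_le_of_le_mul (le_mul_of_one_le_right' h1)
    _ ≤ _ := he

/-- Some pair of homothetic ellipses carries at most its share of the integral. -/
theorem exists_good_radius {g : ℝ × ℝ → ℝ≥0∞} (hg : Measurable g) {e ρ k a b d : ℝ} (hρ : 0 < ρ)
    (hk : 0 < k) (ha : 0 < a) (hd : 0 < d) (he : ∫⁻ x, g x ≤ ENNReal.ofReal e) (c : ℝ × ℝ) :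
    ∃ R ∈ Icc (2 : ℝ) 4,
    ∫⁻ θ in Ioo (-π) π, ENNReal.ofReal (R * (ρ ^ 2 * (a * d))) * g (ellipse a b d c (ρ * R) θ) ≤
      ENNReal.ofReal e ∧
    ∫⁻ θ in Ioo (-π) π, ENNReal.ofReal (R * ((k * ρ) ^ 2 * (a * d))) *
      g (ellipse a b d c (k * ρ * R) θ) ≤ ENNReal.ofReal e := by
  have slice {k : ℝ} (hk : 0 < k) : Measurable (fun R => ∫⁻ θ in Ioo (-π) π,
        ENNReal.ofReal (R * (k ^ 2 * (a * d))) * g (ellipse a b d c (k * R) θ)) ∧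
      ∫⁻ R in Ioi 0, ∫⁻ θ in Ioo (-π) π, ENNReal.ofReal (R * (k ^ 2 * (a * d))) *
        g (ellipse a b d c (k * R) θ) ≤ ENNReal.ofReal e := by
    have h := lintegral_ellipse (b := k * b) (mul_pos hk ha) (mul_pos hk hd) c hg
    have hm := measurable_ellipse_integrand (k * a) (k * b) (k * d) (k * a * (k * d)) c hg
    rw [lintegral_prod _ hm.aemeasurable] at h
    have hm' := hm.lintegral_prod_right' (ν := volume.restrict (Ioo (-π) π))
    simp only [ellipse_smul, show k * a * (k * d) = k ^ 2 * (a * d) by ring] at h hm'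
    exact ⟨hm', h.le.trans he⟩
  obtain ⟨m1, i1⟩ := slice hρ
  obtain ⟨m2, i2⟩ := slice (mul_pos hk hρ)
  obtain ⟨R, hR, hle⟩ := exists_le_setLAverage (μ := volume) (s := Icc (2 : ℝ) 4)
    (by rw [Real.volume_Icc, ne_eq, ENNReal.ofReal_eq_zero]; norm_num)
    (by rw [Real.volume_Icc]; exact ENNReal.ofReal_ne_top) (m1.add m2).aemeasurable
  have hsub : Icc (2 : ℝ) 4 ⊆ Ioi 0 := fun x hx => lt_of_lt_of_le two_pos hx.1
  have hsum : ∫⁻ R in Icc (2 : ℝ) 4, ((∫⁻ θ in Ioo (-π) π, ENNReal.ofReal (R * (ρ ^ 2 * (a * d))) *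
        g (ellipse a b d c (ρ * R) θ)) + ∫⁻ θ in Ioo (-π) π,
        ENNReal.ofReal (R * ((k * ρ) ^ 2 * (a * d))) * g (ellipse a b d c (k * ρ * R) θ)) ≤
      ENNReal.ofReal e + ENNReal.ofReal e := by
    rw [lintegral_add_left m1]
    exact add_le_add ((lintegral_mono_set hsub).trans i1) ((lintegral_mono_set hsub).trans i2)
  have hfin : (∫⁻ θ in Ioo (-π) π, ENNReal.ofReal (R * (ρ ^ 2 * (a * d))) *
        g (ellipse a b d c (ρ * R) θ)) + ∫⁻ θ in Ioo (-π) π,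
        ENNReal.ofReal (R * ((k * ρ) ^ 2 * (a * d))) * g (ellipse a b d c (k * ρ * R) θ) ≤
      ENNReal.ofReal e := by
    refine hle.trans ?_
    rw [setLAverage_eq, Real.volume_Icc, show (4 : ℝ) - 2 = 2 by norm_num]
    refine ENNReal.div_le_of_le_mul (hsum.trans_eq ?_)
    rw [ENNReal.ofReal_ofNat, mul_two]
  exact ⟨R, hR, (self_le_add_right _ _).trans hfin, (self_le_add_left _ _).trans hfin⟩

end polar

end

noncomputable section

section loop

open Filter Topology MeasureTheory intervalIntegral
open scoped ENNReal

local notation "dfst" => ContinuousLinearMap.fst ℝ ℝ ℝ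
local notation "dsnd" => ContinuousLinearMap.snd ℝ ℝ ℝ

theorem abs_sub_le_of_integral_sq {G G' : ℝ → ℝ} {a b ε : ℝ} (hε : 0 < ε)
    (hd : ∀ x ∈ Icc a b, HasDerivAt G (G' x) x) (hc : ContinuousOn G' (Icc a b))
    (hi : ∫ x in a..b, G' x ^ 2 ≤ ε ^ 2) {x y : ℝ} (hx : x ∈ Icc a b) (hy : y ∈ Icc a b) :
    |G x - G y| ≤ ε * (1 + (b - a)) := by
  wlog hxy : y ≤ x generalizing x y
  · rw [abs_sub_comm]; exact this hy hx (le_of_not_ge hxy)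
  have hab : a ≤ b := hx.1.trans hx.2
  have hsub : Icc y x ⊆ Icc a b := Icc_subset_Icc hy.1 hx.2
  have hG : ∫ z in y..x, G' z = G x - G y := by
    refine integral_eq_sub_of_hasDerivAt (fun z hz => hd z ?_) ?_
    · rw [uIcc_of_le hxy] at hz; exact hsub hz
    · refine (hc.mono ?_).intervalIntegrable
      rwa [uIcc_of_le hxy]
  have hB : ContinuousOn (fun z => (ε⁻¹ * G' z ^ 2 + ε) / 2) (Icc a b) := by fun_prop
  have hBi : IntervalIntegrable (fun z => (ε⁻¹ * G' z ^ 2 + ε) / 2) volume a b :=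
    ContinuousOn.intervalIntegrable (by rwa [uIcc_of_le hab])
  have h2i : IntervalIntegrable (fun z => G' z ^ 2) volume a b :=
    ContinuousOn.intervalIntegrable (by rw [uIcc_of_le hab]; fun_prop)
  have hpt (z : ℝ) : |G' z| ≤ (ε⁻¹ * G' z ^ 2 + ε) / 2 := by
    rw [le_div_iff₀ two_pos, ← sub_nonneg]
    have : ε⁻¹ * G' z ^ 2 + ε - |G' z| * 2 = ε⁻¹ * (|G' z| - ε) ^ 2 := by
      field_simp; rw [← sq_abs (G' z)]; ring
    rw [this]; positivity
  calc |G x - G y| = |∫ z in y..x, G' z| := by rw [hG]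
    _ ≤ ∫ z in y..x, (ε⁻¹ * G' z ^ 2 + ε) / 2 := by
        rw [← Real.norm_eq_abs]
        refine norm_integral_le_of_norm_le hxy (.of_forall fun z _ => hpt z) ?_
        exact ContinuousOn.intervalIntegrable (by rw [uIcc_of_le hxy]; exact hB.mono hsub)
    _ ≤ ∫ z in a..b, (ε⁻¹ * G' z ^ 2 + ε) / 2 :=
        integral_mono_interval hy.1 hxy hx.2 (.of_forall fun z => by simp only [Pi.zero_apply]; positivity) hBi
    _ = (ε⁻¹ * (∫ z in a..b, G' z ^ 2) + (b - a) * ε) / 2 := by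
        rw [intervalIntegral.integral_div, integral_add (h2i.const_mul _) intervalIntegrable_const,
          intervalIntegral.integral_const_mul, intervalIntegral.integral_const, smul_eq_mul]
    _ ≤ (ε⁻¹ * ε ^ 2 + (b - a) * ε) / 2 := by gcongr
    _ ≤ ε * (1 + (b - a)) := by
        rw [show ε⁻¹ * ε ^ 2 = ε by field_simp]
        nlinarith [mul_nonneg hε.le (sub_nonneg.2 hab)]

theorem integral_le_of_lintegral_le {F : ℝ → ℝ} {a b e : ℝ} (hab : a ≤ b) (he : 0 ≤ e)
    (hF : ContinuousOn F (Icc a b)) (h0 : ∀ x, 0 ≤ F x)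
    (h : ∫⁻ x in Ioo a b, ENNReal.ofReal (F x) ≤ ENNReal.ofReal e) : ∫ x in a..b, F x ≤ e := by
  rw [intervalIntegral.integral_of_le hab, integral_Ioc_eq_integral_Ioo,
    ← ENNReal.ofReal_le_ofReal_iff he, ofReal_integral_eq_lintegral_ofReal]
  · exact h
  · exact (hF.integrableOn_Icc).mono_set Ioo_subset_Icc_self
  · exact .of_forall h0

theorem Function.Periodic.abs_sub_le {G G' : ℝ → ℝ} {ε : ℝ} (hε : 0 < ε)
    (hper : Function.Periodic G (2 * π))
    (hd : ∀ x, HasDerivAt G (G' x) x) (hc : Continuous G')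
    (hi : ∫ x in (-π)..π, G' x ^ 2 ≤ ε ^ 2) (x y : ℝ) : |G x - G y| ≤ 8 * ε := by
  obtain ⟨x', hx', ex⟩ := hper.exists_mem_Ioc two_pi_pos x (-π)
  obtain ⟨y', hy', ey⟩ := hper.exists_mem_Ioc two_pi_pos y (-π)
  rw [show -π + 2 * π = π by ring] at hx' hy'
  rw [ex, ey]
  refine (abs_sub_le_of_integral_sq hε (fun z _ => hd z) hc.continuousOn hi
    (Ioc_subset_Icc_self hx') (Ioc_subset_Icc_self hy')).trans ?_
  nlinarith [pi_lt_d2]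

theorem SmallLoop.const_mul {ε k : ℝ} {ψ ψ' ψ'' : ℝ → ℝ} (h : SmallLoop ε ψ ψ' ψ'') (hk : 0 ≤ k) :
    SmallLoop (k * ε) (fun x => k * ψ x) (fun x => k * ψ' x) (fun x => k * ψ'' x) where
  d1 x := (h.d1 x).const_mul k
  d2 x := (h.d2 x).const_mul k
  c2 := h.c2.const_mul k
  per x := by simp only [h.per x]
  le x := by
    rw [abs_mul, abs_of_nonneg hk]; exact mul_le_mul_of_nonneg_left (h.le x) hk
  int_le := by
    simp only [mul_pow, intervalIntegral.integral_const_mul]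
    exact mul_le_mul_of_nonneg_left h.int_le (sq_nonneg k)

theorem SmallLoop.mono {ε ε' : ℝ} {ψ ψ' ψ'' : ℝ → ℝ} (h : SmallLoop ε ψ ψ' ψ'') (hε : ε ≤ ε') :
    SmallLoop ε' ψ ψ' ψ'' where
  d1 := h.d1
  d2 := h.d2
  c2 := h.c2
  per := h.per
  le x := (h.le x).trans hε
  int_le := h.int_le.trans (pow_le_pow_left₀ ((abs_nonneg _).trans (h.le 0)) hε 2)

variable {α δ K R m a b d ϱ ε M P₁ P₂ h θ₁ : ℝ} {q0 c : ℝ × ℝ} {f p q r s t : ℝ × ℝ → ℝ}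

theorem hasDerivAt_ellipse (a b d : ℝ) (c : ℝ × ℝ) (ρ θ : ℝ) :
    HasDerivAt (ellipse a b d c ρ) (ρ * (-(a * sin θ)), ρ * (-(b * sin θ) + d * cos θ)) θ := by
  have hc := hasDerivAt_cos θ
  have hs := hasDerivAt_sin θ
  refine HasDerivAt.prodMk ?_ ?_
  · refine ((((hc.const_mul a)).const_mul ρ).const_add c.1).congr_deriv ?_
    ring
  · refine ((((hc.const_mul b).fun_add (hs.const_mul d)).const_mul ρ).const_add c.2).congr_deriv ?_
    ring

theorem periodic_ellipse (a b d : ℝ) (c : ℝ × ℝ) (ρ : ℝ) :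
    Function.Periodic (ellipse a b d c ρ) (2 * π) := by
  intro θ; simp [ellipse]

set_option maxHeartbeats 1000000 in
/-- Small Hessian energy on an ellipse makes the deviation of `f` from an affine function there
a small loop. -/
theorem PuncturedSol.exists_smallLoop (hf : PuncturedSol α q0 δ K R m f p q r s t)
    (hϱ : 0 < ϱ) (hε : 0 < ε) (hM : 1 ≤ M) (haM : |a| ≤ M) (hbM : |b| ≤ M) (hdM : |d| ≤ M)
    (hX : ∀ θ, ellipse a b d c ϱ θ ∈ Metric.ball q0 δ ∧ ellipse a b d c ϱ θ ≠ q0)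
    (hE : ∫ θ in (-π)..π, ϱ ^ 2 * (r (ellipse a b d c ϱ θ) ^ 2 + s (ellipse a b d c ϱ θ) ^ 2 +
      t (ellipse a b d c ϱ θ) ^ 2) ≤ ε ^ 2)
    (hp₁ : |p (ellipse a b d c ϱ θ₁) - P₁| ≤ ε) (hq₁ : |q (ellipse a b d c ϱ θ₁) - P₂| ≤ ε)
    (hf₁ : |f (ellipse a b d c ϱ θ₁) - h - ϱ * (P₁ * (a * cos θ₁) +
      P₂ * (b * cos θ₁ + d * sin θ₁))| ≤ 3 * M * ε * ϱ) :
    ∃ ψ ψ' ψ'' : ℝ → ℝ, SmallLoop (1000 * M ^ 2 * ε) ψ ψ' ψ'' ∧ ∀ θ, f (ellipse a b d c ϱ θ) =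
      h + ϱ * (P₁ * (a * cos θ) + P₂ * (b * cos θ + d * sin θ) + ψ θ) := by
  obtain ⟨X, hXe⟩ : ∃ X, X = ellipse a b d c ϱ := ⟨_, rfl⟩
  rw [← hXe] at hX hE hp₁ hq₁ hf₁ ⊢
  have hXd (θ : ℝ) : HasDerivAt X (ϱ * (-(a * sin θ)), ϱ * (-(b * sin θ) + d * cos θ)) θ := by
    rw [hXe]; exact hasDerivAt_ellipse a b d c ϱ θ
  have hXp : Function.Periodic X (2 * π) := by rw [hXe]; exact periodic_ellipse a b d c ϱ
  have hXc : Continuous X := continuous_iff_continuousAt.2 fun θ => (hXd θ).continuousAt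
  have hXm (θ : ℝ) : X θ ∈ Metric.ball q0 δ \ {q0} := ⟨(hX θ).1, (hX θ).2⟩
  have hrc : Continuous fun θ => r (X θ) := hf.cr.comp_continuous hXc hXm
  have hsc : Continuous fun θ => s (X θ) := hf.cs.comp_continuous hXc hXm
  have htc : Continuous fun θ => t (X θ) := hf.ct.comp_continuous hXc hXm
  obtain ⟨E, hEe⟩ : ∃ E : ℝ → ℝ, ∀ θ, E θ = ϱ ^ 2 * (r (X θ) ^ 2 + s (X θ) ^ 2 + t (X θ) ^ 2) :=
    ⟨_, fun _ => rfl⟩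
  simp only [← hEe] at hE
  have hEc : Continuous E := by
    rw [show E = _ from funext hEe]
    exact continuous_const.mul (((hrc.pow 2).add (hsc.pow 2)).add (htc.pow 2))
  have hEp : Function.Periodic E (2 * π) := fun θ => by simp only [hEe, hXp θ]
  have hM0 : 0 < M := one_pos.trans_le hM
  have hcs (k l u v : ℝ) : (k * u + l * v) ^ 2 ≤ (k ^ 2 + l ^ 2) * (u ^ 2 + v ^ 2) := by
    nlinarith [sq_nonneg (k * v - l * u)]
  have he2 {k : ℝ} (hk : |k| ≤ M) : k ^ 2 ≤ M ^ 2 := sq_le_sq' (abs_le.1 hk).1 (abs_le.1 hk).2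
  have hnorm (u v : ℝ) (huv : u ^ 2 + v ^ 2 = 1) :
      (a * u) ^ 2 + (b * u + d * v) ^ 2 ≤ 3 * M ^ 2 := by
    have h1 := hcs b d u v
    rw [huv, mul_one] at h1
    have h2 : (a * u) ^ 2 ≤ M ^ 2 := by
      rw [mul_pow]; nlinarith [he2 haM, sq_nonneg v, sq_nonneg a, sq_nonneg u]
    linarith [he2 hbM, he2 hdM]
  have hn1 (θ : ℝ) := hnorm (-sin θ) (cos θ) (by rw [neg_sq, sin_sq_add_cos_sq])
  have hn2 (θ : ℝ) := hnorm (cos θ) (sin θ) (cos_sq_add_sin_sq θ)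
  have key {g g1 g2 : ℝ × ℝ → ℝ} (hg : ∀ θ, HasFDerivAt g (g1 (X θ) • dfst + g2 (X θ) • dsnd) (X θ))
      (h1c : Continuous fun θ => g1 (X θ)) (h2c : Continuous fun θ => g2 (X θ))
      (hgE : ∀ θ, ϱ ^ 2 * (g1 (X θ) ^ 2 + g2 (X θ) ^ 2) ≤ E θ) :
      ∃ G' : ℝ → ℝ, (∀ θ, HasDerivAt (fun θ => g (X θ)) (G' θ) θ) ∧ Continuous G' ∧
        (∀ θ, G' θ ^ 2 ≤ 3 * M ^ 2 * E θ) ∧ ∀ x y, |g (X x) - g (X y)| ≤ 24 * M * ε := by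
    obtain ⟨G', hG'⟩ : ∃ G' : ℝ → ℝ, ∀ θ, G' θ = g1 (X θ) * (ϱ * (-(a * sin θ))) +
      g2 (X θ) * (ϱ * (-(b * sin θ) + d * cos θ)) := ⟨_, fun _ => rfl⟩
    have c1 : Continuous G' := by
      rw [show G' = _ from funext hG']
      refine (h1c.mul ?_).add (h2c.mul ?_) <;> fun_prop
    have d1 (θ : ℝ) : HasDerivAt (fun θ => g (X θ)) (G' θ) θ := by
      refine ((hg θ).comp_hasDerivAt θ (hXd θ)).congr_deriv ?_
      simp [hG']
    have b1 (θ : ℝ) : G' θ ^ 2 ≤ 3 * M ^ 2 * E θ := by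
      have e1 : G' θ = ϱ * (g1 (X θ) * (a * -sin θ) + g2 (X θ) * (b * -sin θ + d * cos θ)) := by
        rw [hG']; ring
      rw [e1, mul_pow]
      calc _ ≤ ϱ ^ 2 * ((g1 (X θ) ^ 2 + g2 (X θ) ^ 2) * (3 * M ^ 2)) := by
            refine mul_le_mul_of_nonneg_left ((hcs _ _ _ _).trans ?_) (sq_nonneg ϱ)
            exact mul_le_mul_of_nonneg_left (hn1 θ) (by positivity)
        _ = 3 * M ^ 2 * (ϱ ^ 2 * (g1 (X θ) ^ 2 + g2 (X θ) ^ 2)) := by ring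
        _ ≤ _ := mul_le_mul_of_nonneg_left (hgE θ) (by positivity)
    refine ⟨G', d1, c1, b1, fun x y => ?_⟩
    have hper : Function.Periodic (fun θ => g (X θ)) (2 * π) := fun θ => by simp only [hXp θ]
    refine (hper.abs_sub_le (ε := 3 * M * ε) (by positivity) d1 c1 ?_ x y).trans_eq (by ring)
    calc ∫ x in (-π)..π, G' x ^ 2 ≤ ∫ x in (-π)..π, 3 * M ^ 2 * E x :=
          integral_mono_on (by linarith [pi_pos]) ((c1.pow 2).intervalIntegrable _ _)
            ((continuous_const.mul hEc).intervalIntegrable _ _) fun x _ => b1 x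
      _ = 3 * M ^ 2 * ∫ x in (-π)..π, E x := intervalIntegral.integral_const_mul _ _
      _ ≤ 3 * M ^ 2 * ε ^ 2 := mul_le_mul_of_nonneg_left hE (by positivity)
      _ ≤ (3 * M * ε) ^ 2 := by nlinarith [mul_pos (pow_pos hM0 2) (pow_pos hε 2)]
  have hXne (θ : ℝ) : X θ ≠ q0 := (hX θ).2
  obtain ⟨A', dA, cA, bA, oA⟩ := key (fun θ => hf.dp _ (hX θ).1 (hXne θ)) hrc hsc fun θ => by
    rw [hEe]; exact mul_le_mul_of_nonneg_left (by nlinarith [sq_nonneg (t (X θ))]) (sq_nonneg ϱ)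
  obtain ⟨B', dB, cB, bB, oB⟩ := key (fun θ => hf.dq _ (hX θ).1 (hXne θ)) hsc htc fun θ => by
    rw [hEe]; exact mul_le_mul_of_nonneg_left (by nlinarith [sq_nonneg (r (X θ))]) (sq_nonneg ϱ)
  obtain ⟨A, hA⟩ : ∃ A : ℝ → ℝ, ∀ θ, A θ = p (X θ) - P₁ := ⟨_, fun _ => rfl⟩
  obtain ⟨B, hB⟩ : ∃ B : ℝ → ℝ, ∀ θ, B θ = q (X θ) - P₂ := ⟨_, fun _ => rfl⟩
  replace dA (θ : ℝ) : HasDerivAt A (A' θ) θ := by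
    rw [show A = _ from funext hA]; exact (dA θ).sub_const P₁
  replace dB (θ : ℝ) : HasDerivAt B (B' θ) θ := by
    rw [show B = _ from funext hB]; exact (dB θ).sub_const P₂
  have lA (θ : ℝ) : |A θ| ≤ 25 * M * ε := by
    rw [hA, show p (X θ) - P₁ = p (X θ) - p (X θ₁) + (p (X θ₁) - P₁) by ring]
    refine (abs_add_le _ _).trans ?_
    nlinarith [oA θ θ₁]
  have lB (θ : ℝ) : |B θ| ≤ 25 * M * ε := by
    rw [hB, show q (X θ) - P₂ = q (X θ) - q (X θ₁) + (q (X θ₁) - P₂) by ring]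
    refine (abs_add_le _ _).trans ?_
    nlinarith [oB θ θ₁]
  have lAB (θ u v : ℝ) (h1 : u ^ 2 + v ^ 2 ≤ 3 * M ^ 2) : |A θ * u + B θ * v| ≤ 75 * M ^ 2 * ε := by
    refine _root_.abs_le_of_sq_le_sq ?_ (by positivity)
    refine (hcs _ _ _ _).trans ?_
    have e1 : A θ ^ 2 ≤ (25 * M * ε) ^ 2 := sq_le_sq' (abs_le.1 (lA θ)).1 (abs_le.1 (lA θ)).2
    have e2 : B θ ^ 2 ≤ (25 * M * ε) ^ 2 := sq_le_sq' (abs_le.1 (lB θ)).1 (abs_le.1 (lB θ)).2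
    calc _ ≤ ((25 * M * ε) ^ 2 + (25 * M * ε) ^ 2) * (3 * M ^ 2) := by gcongr
      _ ≤ _ := by nlinarith [pow_pos (mul_pos (pow_pos hM0 2) hε) 2]
  obtain ⟨ψ, hψ⟩ : ∃ ψ : ℝ → ℝ, ∀ θ, ψ θ = (f (X θ) - h) / ϱ - (P₁ * (a * cos θ) +
    P₂ * (b * cos θ + d * sin θ)) := ⟨_, fun _ => rfl⟩
  obtain ⟨ψ', hψ'⟩ : ∃ ψ' : ℝ → ℝ, ∀ θ, ψ' θ = A θ * (a * -sin θ) +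
    B θ * (b * -sin θ + d * cos θ) := ⟨_, fun _ => rfl⟩
  obtain ⟨U, hU⟩ : ∃ U : ℝ → ℝ, ∀ θ, U θ = A θ * (a * cos θ) + B θ * (b * cos θ + d * sin θ) :=
    ⟨_, fun _ => rfl⟩
  obtain ⟨V, hV⟩ : ∃ V : ℝ → ℝ, ∀ θ, V θ = A' θ * (a * -sin θ) +
    B' θ * (b * -sin θ + d * cos θ) := ⟨_, fun _ => rfl⟩
  have cAA : Continuous A := continuous_iff_continuousAt.2 fun θ => (dA θ).continuousAt
  have cBB : Continuous B := continuous_iff_continuousAt.2 fun θ => (dB θ).continuousAt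
  have cU : Continuous U := by rw [show U = _ from funext hU]; fun_prop
  have cV : Continuous V := by rw [show V = _ from funext hV]; fun_prop
  have dψ (θ : ℝ) : HasDerivAt ψ (ψ' θ) θ := by
    rw [show ψ = _ from funext hψ]
    have e1 := (((hf.df _ (hX θ).1 (hXne θ)).comp_hasDerivAt θ (hXd θ)).sub_const h).div_const ϱ
    have e2 := (((hasDerivAt_cos θ).const_mul a).const_mul P₁).fun_add
      ((((hasDerivAt_cos θ).const_mul b).fun_add ((hasDerivAt_sin θ).const_mul d)).const_mul P₂)
    refine (e1.fun_sub e2).congr_deriv ?_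
    simp [hψ', hA, hB]
    field_simp
    ring
  have dψ' (θ : ℝ) : HasDerivAt ψ' (V θ - U θ) θ := by
    rw [show ψ' = _ from funext hψ']
    have e1 := (dA θ).fun_mul (((hasDerivAt_sin θ).fun_neg).const_mul a)
    have e2 := (dB θ).fun_mul ((((hasDerivAt_sin θ).fun_neg).const_mul b).fun_add
      ((hasDerivAt_cos θ).const_mul d))
    refine (e1.fun_add e2).congr_deriv ?_
    rw [hV, hU]; ring
  have pψ : Function.Periodic ψ (2 * π) := fun θ => by simp [hψ, hXp θ]
  have lψ' (θ : ℝ) : |ψ' θ| ≤ 75 * M ^ 2 * ε := by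
    rw [hψ']; exact lAB θ _ _ (hn1 θ)
  have lU (θ : ℝ) : |U θ| ≤ 75 * M ^ 2 * ε := by
    rw [hU]; exact lAB θ _ _ (hn2 θ)
  have lψ₁ : |ψ θ₁| ≤ 3 * M * ε := by
    have : ψ θ₁ = (f (X θ₁) - h - ϱ * (P₁ * (a * cos θ₁) + P₂ * (b * cos θ₁ + d * sin θ₁))) / ϱ := by
      rw [hψ]; field_simp
    rw [this, abs_div, abs_of_pos hϱ, div_le_iff₀ hϱ]
    exact hf₁
  have hMM : M ≤ M ^ 2 := by nlinarith
  have hMε : M * ε ≤ M ^ 2 * ε := mul_le_mul_of_nonneg_right hMM hε.le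
  have lψ (θ : ℝ) : |ψ θ| ≤ 1000 * M ^ 2 * ε := by
    obtain ⟨y, hy, e⟩ := pψ.exists_mem_Ioc two_pi_pos θ θ₁
    rw [e]
    have h1 := Convex.norm_image_sub_le_of_norm_hasDerivWithin_le (f := ψ) (f' := ψ') (s := univ)
      (x := θ₁) (y := y) (C := 75 * M ^ 2 * ε) (fun x _ => (dψ x).hasDerivWithinAt)
      (fun x _ => lψ' x) convex_univ (mem_univ _) (mem_univ _)
    rw [Real.norm_eq_abs, Real.norm_eq_abs, abs_of_pos (sub_pos.2 hy.1)] at h1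
    have h2 : 75 * M ^ 2 * ε * (y - θ₁) ≤ 75 * M ^ 2 * ε * 7 :=
      mul_le_mul_of_nonneg_left (by linarith [hy.2, pi_lt_d2]) (by positivity)
    rw [show ψ y = ψ y - ψ θ₁ + ψ θ₁ by ring]
    refine (abs_add_le _ _).trans ?_
    nlinarith [mul_pos hM0 hε]
  refine ⟨ψ, ψ', fun θ => V θ - U θ, ⟨dψ, dψ', cV.sub cU, pψ, lψ, ?_⟩, fun θ => ?_⟩
  · have hpt (θ : ℝ) : (V θ - U θ) ^ 2 ≤ 36 * M ^ 4 * E θ + 2 * (75 * M ^ 2 * ε) ^ 2 := by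
      have e1 : V θ ^ 2 ≤ (6 * M ^ 2 * E θ) * (3 * M ^ 2) := by
        rw [hV]
        refine (hcs _ _ _ _).trans ?_
        exact mul_le_mul (by linarith [bA θ, bB θ]) (hn1 θ) (by positivity)
          (by linarith [bA θ, bB θ, sq_nonneg (A' θ), sq_nonneg (B' θ)])
      have e2 : U θ ^ 2 ≤ (75 * M ^ 2 * ε) ^ 2 := sq_le_sq' (abs_le.1 (lU θ)).1 (abs_le.1 (lU θ)).2
      nlinarith [sq_nonneg (V θ + U θ)]
    have hE2 : ∫ x in (0 : ℝ)..2 * π, E x ≤ ε ^ 2 := by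
      have := hEp.intervalIntegral_add_eq 0 (-π)
      rw [zero_add, show -π + 2 * π = π by ring] at this
      rw [this]; exact hE
    calc ∫ x in (0 : ℝ)..2 * π, (V x - U x) ^ 2
        ≤ ∫ x in (0 : ℝ)..2 * π, (36 * M ^ 4 * E x + 2 * (75 * M ^ 2 * ε) ^ 2) :=
          integral_mono_on two_pi_pos.le (((cV.sub cU).pow 2).intervalIntegrable _ _)
            (((continuous_const.mul hEc).add continuous_const).intervalIntegrable _ _)
            fun x _ => hpt x
      _ = 36 * M ^ 4 * (∫ x in (0 : ℝ)..2 * π, E x) + 2 * π * (2 * (75 * M ^ 2 * ε) ^ 2) := by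
          have i1 : IntervalIntegrable (fun x => 36 * M ^ 4 * E x) volume 0 (2 * π) :=
            (continuous_const.mul hEc).intervalIntegrable _ _
          rw [integral_add i1 intervalIntegrable_const, intervalIntegral.integral_const_mul,
            intervalIntegral.integral_const, smul_eq_mul, sub_zero]
      _ ≤ 36 * M ^ 4 * ε ^ 2 + 7 * (2 * (75 * M ^ 2 * ε) ^ 2) := by
          gcongr
          linarith [pi_lt_d2]
      _ ≤ (1000 * M ^ 2 * ε) ^ 2 := by nlinarith [pow_pos (mul_pos (pow_pos hM0 2) hε) 2]
  · rw [hψ]; field_simp; ring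

end loop

end

noncomputable section

section ray

open Filter Topology MeasureTheory
open scoped ENNReal

local notation "dfst" => ContinuousLinearMap.fst ℝ ℝ ℝ
local notation "dsnd" => ContinuousLinearMap.snd ℝ ℝ ℝ

variable {α δ K R m : ℝ} {q0 : ℝ × ℝ} {f p q r s t : ℝ × ℝ → ℝ}

theorem PuncturedSol.exists_small_energy (hf : PuncturedSol α q0 δ K R m f p q r s t)
    (hδ : 0 < δ) (hm : 0 < m) {e : ℝ} (he : 0 < e) : ∃ η : ℝ, 0 < η ∧ η ≤ δ / 4 ∧
    ∃ g : ℝ × ℝ → ℝ≥0∞, Measurable g ∧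
      (∀ x ∈ Metric.ball q0 η, x ≠ q0 → g x = ENNReal.ofReal (r x ^ 2 + s x ^ 2 + t x ^ 2)) ∧
      ∫⁻ x, g x ≤ ENNReal.ofReal e := by
  have hfin := hf.lintegral_hessian_lt_top hδ hm
  have hS : MeasurableSet (Metric.ball q0 (δ / 4) \ {q0}) :=
    measurableSet_ball.diff (measurableSet_singleton q0)
  have hsub : Metric.ball q0 (δ / 4) \ {q0} ⊆ Metric.ball q0 δ \ {q0} :=
    Set.sdiff_subset_sdiff_left (Metric.ball_subset_ball (by linarith))
  rw [← lintegral_indicator hS] at hfin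
  obtain ⟨g, hg⟩ : ∃ g, g = (Metric.ball q0 (δ / 4) \ {q0}).indicator
    fun x => ENNReal.ofReal (r x ^ 2 + s x ^ 2 + t x ^ 2) := ⟨_, rfl⟩
  rw [← hg] at hfin
  have hgm : Measurable g := by
    classical
    rw [hg, ← Set.piecewise_eq_indicator]
    refine ContinuousOn.measurable_piecewise ?_ continuousOn_const hS
    refine ENNReal.continuous_ofReal.comp_continuousOn ?_
    exact (((hf.cr.mono hsub).pow 2).add ((hf.cs.mono hsub).pow 2)).add ((hf.ct.mono hsub).pow 2)
  obtain ⟨κ, hκ, H⟩ := exists_pos_setLIntegral_lt_of_measure_lt hfin.ne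
    (ENNReal.ofReal_pos.2 he).ne'
  have hlim : Tendsto (fun η : ℝ => ENNReal.ofReal (2 * η) * ENNReal.ofReal (2 * η)) (𝓝[>] 0)
      (𝓝 0) := by
    have h1 : Tendsto (fun η : ℝ => ENNReal.ofReal (2 * η)) (𝓝[>] 0) (𝓝 0) := by
      have : Continuous fun η : ℝ => ENNReal.ofReal (2 * η) :=
        ENNReal.continuous_ofReal.comp (continuous_const.mul continuous_id)
      simpa using (this.tendsto 0).mono_left nhdsWithin_le_nhds
    simpa using ENNReal.Tendsto.mul h1 (by simp) h1 (by simp)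
  obtain ⟨η, ⟨hη1, hη2⟩, hη0⟩ := ((hlim.eventually_lt_const hκ).and
    (Ioo_mem_nhdsGT (show (0 : ℝ) < δ / 4 by linarith))).and self_mem_nhdsWithin |>.exists
  refine ⟨η, hη0, hη2.2.le, (Metric.ball q0 η).indicator g, hgm.indicator measurableSet_ball,
    fun x hx hne => ?_, ?_⟩
  · rw [indicator_of_mem hx, hg, indicator_of_mem]
    exact ⟨Metric.ball_subset_ball hη2.2.le hx, hne⟩
  · rw [lintegral_indicator measurableSet_ball]
    refine (H _ ?_).le
    rw [← Prod.mk.eta (p := q0), ← ball_prod_same, Measure.volume_eq_prod, Measure.prod_prod,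
      Real.volume_ball, Real.volume_ball]
    exact hη1

theorem dist_ellipse_le {a b d M ρ ϱ θ : ℝ} (q0 : ℝ × ℝ) (hρ : 0 ≤ ρ) (hϱ : 0 ≤ ϱ)
    (h : (a * cos θ) ^ 2 + (b * cos θ + d * sin θ) ^ 2 ≤ M ^ 2) (hM : 0 ≤ M) :
    dist (ellipse a b d (q0.1 + ρ, q0.2) ϱ θ) q0 ≤ ρ + ϱ * M := by
  have h1 : |a * cos θ| ≤ M :=
    _root_.abs_le_of_sq_le_sq (by nlinarith [sq_nonneg (b * cos θ + d * sin θ)]) hM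
  have h2 : |b * cos θ + d * sin θ| ≤ M :=
    _root_.abs_le_of_sq_le_sq (by nlinarith [sq_nonneg (a * cos θ)]) hM
  rw [Prod.dist_eq, Real.dist_eq, Real.dist_eq]
  unfold ellipse
  refine max_le ?_ ?_
  · rw [show q0.1 + ρ + ϱ * (a * cos θ) - q0.1 = ρ + ϱ * (a * cos θ) by ring]
    refine (abs_add_le _ _).trans ?_
    rw [abs_of_nonneg hρ, abs_mul, abs_of_nonneg hϱ]
    gcongr
  · rw [show q0.2 + ϱ * (b * cos θ + d * sin θ) - q0.2 = ϱ * (b * cos θ + d * sin θ) by ring,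
      abs_mul, abs_of_nonneg hϱ]
    nlinarith [mul_le_mul_of_nonneg_left h2 hϱ]

theorem ray_ne {ρ ϱ θ : ℝ} (q0 : ℝ × ℝ) (hρ : 0 < ρ) (hϱ : 0 < ϱ) (hθ : θ ∈ Ioo (-π) π) :
    ellipse 1 0 1 (q0.1 + ρ, q0.2) ϱ θ ≠ q0 := by
  intro h
  have h1 := congrArg Prod.fst h
  have h2 := congrArg Prod.snd h
  simp only [ellipse, one_mul, zero_mul, zero_add, add_eq_left, mul_eq_zero, hϱ.ne', false_or]
    at h1 h2
  rw [sin_eq_zero_iff_of_lt_of_lt hθ.1 hθ.2] at h2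
  rw [h2, cos_zero] at h1
  linarith

theorem PuncturedSol.exists_ray (hf : PuncturedSol α q0 δ K R m f p q r s t)
    (hδ : 0 < δ) (hm : 0 < m) {A B : ℝ} (hA : 0 < A) (hAB : A ≤ B) {ε : ℝ} (hε : 0 < ε) :
    ∃ ρ₀ > 0, ∀ ρ ∈ Ioo 0 ρ₀, ∃ θ ∈ Ioo (-π) π, (∀ σ ∈ Icc A B,
      ellipse 1 0 1 (q0.1 + ρ, q0.2) (ρ * σ) θ ∈ Metric.ball q0 δ ∧
      ellipse 1 0 1 (q0.1 + ρ, q0.2) (ρ * σ) θ ≠ q0) ∧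
      ∀ σ ∈ Icc A B, ∀ τ ∈ Icc A B,
      |p (ellipse 1 0 1 (q0.1 + ρ, q0.2) (ρ * σ) θ) -
        p (ellipse 1 0 1 (q0.1 + ρ, q0.2) (ρ * τ) θ)| ≤ ε ∧
      |q (ellipse 1 0 1 (q0.1 + ρ, q0.2) (ρ * σ) θ) -
        q (ellipse 1 0 1 (q0.1 + ρ, q0.2) (ρ * τ) θ)| ≤ ε := by
  have hBA : 0 < 1 + (B - A) := by linarith
  obtain ⟨ε', hε'e⟩ : ∃ ε', ε' = ε / (1 + (B - A)) := ⟨_, rfl⟩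
  have hε' : 0 < ε' := hε'e ▸ div_pos hε hBA
  obtain ⟨η, hη, hηδ, g, hgm, hg, hge⟩ := hf.exists_small_energy hδ hm
    (show 0 < A * ε' ^ 2 by positivity)
  have hB1 : 0 < 1 + B := by linarith
  refine ⟨η / (1 + B), div_pos hη hB1, fun ρ hρ => ?_⟩
  obtain ⟨θ, hθ, hle⟩ := exists_good_angle hgm hρ.1 hge (q0.1 + ρ, q0.2)
  obtain ⟨X, hX⟩ : ∃ X : ℝ → ℝ × ℝ, ∀ σ, X σ = ellipse 1 0 1 (q0.1 + ρ, q0.2) (ρ * σ) θ :=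
    ⟨_, fun _ => rfl⟩
  simp only [← hX] at hle
  have hσ0 {σ : ℝ} (hσ : σ ∈ Icc A B) : 0 < σ := hA.trans_le hσ.1
  have hne {σ : ℝ} (hσ : σ ∈ Icc A B) : X σ ≠ q0 := by
    rw [hX]; exact ray_ne q0 hρ.1 (mul_pos hρ.1 (hσ0 hσ)) hθ
  have hball {σ : ℝ} (hσ : σ ∈ Icc A B) : X σ ∈ Metric.ball q0 η := by
    rw [hX, Metric.mem_ball]
    refine (dist_ellipse_le q0 hρ.1.le (mul_pos hρ.1 (hσ0 hσ)).le (M := 1) (by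
      nlinarith [sin_sq_add_cos_sq θ]) zero_le_one).trans_lt ?_
    have := (lt_div_iff₀ hB1).1 hρ.2
    nlinarith [hσ.2, hρ.1]
  have hballδ {σ : ℝ} (hσ : σ ∈ Icc A B) : X σ ∈ Metric.ball q0 δ :=
    Metric.ball_subset_ball (by linarith) (hball hσ)
  have hXd (σ : ℝ) : HasDerivAt X (ρ * cos θ, ρ * sin θ) σ := by
    rw [show X = _ from funext hX]
    unfold ellipse
    refine HasDerivAt.prodMk ?_ ?_
    · refine ((((hasDerivAt_id σ).const_mul ρ).mul_const _).const_add _).congr_deriv (by ring)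
    · refine ((((hasDerivAt_id σ).const_mul ρ).mul_const _).const_add _).congr_deriv (by ring)
  have hXc : Continuous X := continuous_iff_continuousAt.2 fun θ => (hXd θ).continuousAt
  have key {G g1 g2 : ℝ × ℝ → ℝ} (hG : ∀ x ∈ Metric.ball q0 δ, x ≠ q0 →
        HasFDerivAt G (g1 x • dfst + g2 x • dsnd) x)
      (h1c : ContinuousOn g1 (Metric.ball q0 δ \ {q0}))
      (h2c : ContinuousOn g2 (Metric.ball q0 δ \ {q0}))
      (hGE : ∀ x, g1 x ^ 2 + g2 x ^ 2 ≤ r x ^ 2 + s x ^ 2 + t x ^ 2) :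
      ∀ σ ∈ Icc A B, ∀ τ ∈ Icc A B, |G (X σ) - G (X τ)| ≤ ε := by
    obtain ⟨G', hG'⟩ : ∃ G' : ℝ → ℝ, ∀ σ, G' σ = ρ * (g1 (X σ) * cos θ + g2 (X σ) * sin θ) :=
      ⟨_, fun _ => rfl⟩
    have hmaps : MapsTo X (Icc A B) (Metric.ball q0 δ \ {q0}) := fun σ hσ => ⟨hballδ hσ, hne hσ⟩
    have c1 : ContinuousOn G' (Icc A B) := by
      rw [show G' = _ from funext hG']
      exact continuousOn_const.mul (((h1c.comp hXc.continuousOn hmaps).mul continuousOn_const).add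
        ((h2c.comp hXc.continuousOn hmaps).mul continuousOn_const))
    have d1 (σ : ℝ) (hσ : σ ∈ Icc A B) : HasDerivAt (fun σ => G (X σ)) (G' σ) σ := by
      refine ((hG _ (hballδ hσ) (hne hσ)).comp_hasDerivAt σ (hXd σ)).congr_deriv ?_
      simp [hG']; ring
    have hig : ∫ σ in A..B, G' σ ^ 2 ≤ ε' ^ 2 := by
      refine integral_le_of_lintegral_le hAB (sq_nonneg _) (c1.pow 2) (fun x => sq_nonneg _) ?_
      calc ∫⁻ σ in Ioo A B, ENNReal.ofReal (G' σ ^ 2)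
          ≤ ∫⁻ σ in Ioo A B, ENNReal.ofReal A⁻¹ * (ENNReal.ofReal (σ * ρ ^ 2) * g (X σ)) := by
            refine setLIntegral_mono' measurableSet_Ioo fun σ hσ' => ?_
            have hσ := Ioo_subset_Icc_self hσ'
            have hs0 := hσ0 hσ
            rw [hg _ (hball hσ) (hne hσ), ← ENNReal.ofReal_mul (mul_nonneg hs0.le (sq_nonneg ρ)),
              ← ENNReal.ofReal_mul (inv_nonneg.2 hA.le)]
            refine ENNReal.ofReal_le_ofReal ?_
            have h1 : G' σ ^ 2 ≤ ρ ^ 2 * (g1 (X σ) ^ 2 + g2 (X σ) ^ 2) := by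
              rw [hG', mul_pow]
              refine mul_le_mul_of_nonneg_left ?_ (sq_nonneg ρ)
              nlinarith [sq_nonneg (g1 (X σ) * sin θ - g2 (X σ) * cos θ), sin_sq_add_cos_sq θ]
            have h2 : 1 ≤ A⁻¹ * σ := by
              rw [inv_mul_eq_div, one_le_div hA]; exact hσ.1
            calc G' σ ^ 2 ≤ 1 * (ρ ^ 2 * (r (X σ) ^ 2 + s (X σ) ^ 2 + t (X σ) ^ 2)) := by
                  rw [one_mul]
                  exact h1.trans (mul_le_mul_of_nonneg_left (hGE _) (sq_nonneg ρ))
              _ ≤ A⁻¹ * σ * (ρ ^ 2 * (r (X σ) ^ 2 + s (X σ) ^ 2 + t (X σ) ^ 2)) :=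
                  mul_le_mul_of_nonneg_right h2 (by positivity)
              _ = _ := by ring
        _ = ENNReal.ofReal A⁻¹ * ∫⁻ σ in Ioo A B, ENNReal.ofReal (σ * ρ ^ 2) * g (X σ) :=
            lintegral_const_mul' _ _ ENNReal.ofReal_ne_top
        _ ≤ ENNReal.ofReal A⁻¹ * ENNReal.ofReal (A * ε' ^ 2) := by
            gcongr
            exact (lintegral_mono_set fun σ hσ => hA.trans hσ.1).trans hle
        _ = ENNReal.ofReal (ε' ^ 2) := by
            rw [← ENNReal.ofReal_mul (inv_nonneg.2 hA.le)]
            congr 1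
            field_simp
    intro σ hσ τ hτ
    refine (abs_sub_le_of_integral_sq hε' d1 c1 hig hσ hτ).trans_eq ?_
    rw [hε'e]; field_simp
  refine ⟨θ, hθ, ?_⟩
  simp only [← hX]
  refine ⟨fun σ hσ => ⟨hballδ hσ, hne hσ⟩, fun σ hσ τ hτ => ⟨?_, ?_⟩⟩
  · exact key hf.dp hf.cr hf.cs (fun x => by nlinarith [sq_nonneg (t x)]) σ hσ τ hτ
  · exact key hf.dq hf.cs hf.ct (fun x => by nlinarith [sq_nonneg (r x)]) σ hσ τ hτ

/-- Along suitable rays issued from points close to `q0` the gradient is almost a fixed vector. -/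
theorem PuncturedSol.exists_limit_gradient (hf : PuncturedSol α q0 δ K R m f p q r s t)
    (hδ : 0 < δ) (hm : 0 < m) {A B : ℝ} (hA : 0 < A) (hAB : A ≤ B) :
    ∃ P₁ P₂ : ℝ, |P₁| ≤ K ∧ |P₂| ≤ K ∧ ∀ ε > 0, ∀ ρ₁ > 0, ∃ ρ ∈ Ioo 0 ρ₁, ∃ θ ∈ Ioo (-π) π,
      ∀ σ ∈ Icc A B, |p (ellipse 1 0 1 (q0.1 + ρ, q0.2) (ρ * σ) θ) - P₁| ≤ ε ∧
        |q (ellipse 1 0 1 (q0.1 + ρ, q0.2) (ρ * σ) θ) - P₂| ≤ ε := by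
  have hn (n : ℕ) : (0 : ℝ) < 1 / ((n : ℝ) + 1) := Nat.one_div_pos_of_nat
  choose ρ₀ hρ₀ H using fun n : ℕ => hf.exists_ray hδ hm hA hAB (hn n)
  have hmin (n : ℕ) : 0 < min (ρ₀ n) (1 / ((n : ℝ) + 1)) := lt_min (hρ₀ n) (hn n)
  obtain ⟨ρ, hρ⟩ : ∃ ρ : ℕ → ℝ, ∀ n, ρ n = min (ρ₀ n) (1 / ((n : ℝ) + 1)) / 2 := ⟨_, fun _ => rfl⟩
  have hρ1 (n : ℕ) : ρ n ∈ Ioo 0 (ρ₀ n) := by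
    rw [hρ]; exact ⟨half_pos (hmin n), (half_lt_self (hmin n)).trans_le (min_le_left _ _)⟩
  have hρ2 (n : ℕ) : ρ n < 1 / ((n : ℝ) + 1) := by
    rw [hρ]; exact (half_lt_self (hmin n)).trans_le (min_le_right _ _)
  choose θ hθ hin hosc using fun n : ℕ => H n (ρ n) (hρ1 n)
  obtain ⟨x, hx⟩ : ∃ x : ℕ → ℝ × ℝ, ∀ n, x n =
    ellipse 1 0 1 (q0.1 + ρ n, q0.2) (ρ n * A) (θ n) := ⟨_, fun _ => rfl⟩
  have hAm : A ∈ Icc A B := left_mem_Icc.2 hAB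
  have hmem (n : ℕ) : ((p (x n), q (x n)) : ℝ × ℝ) ∈ Icc (-K) K ×ˢ Icc (-K) K := by
    have := hin n A hAm
    rw [← hx] at this
    exact ⟨abs_le.1 (hf.bp _ this.1 this.2), abs_le.1 (hf.bq _ this.1 this.2)⟩
  obtain ⟨P, hP, φ, hφ, hlim⟩ := (isCompact_Icc.prod isCompact_Icc).tendsto_subseq hmem
  refine ⟨P.1, P.2, abs_le.2 hP.1, abs_le.2 hP.2, fun ε hε ρ₁ hρ₁ => ?_⟩
  have h1 := (Metric.tendsto_nhds.1 hlim (ε / 2) (half_pos hε))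
  have h2 : ∀ᶠ n in atTop, 1 / ((φ n : ℝ) + 1) < min (ε / 2) ρ₁ :=
    (tendsto_one_div_add_atTop_nhds_zero_nat.comp hφ.tendsto_atTop).eventually_lt_const
      (lt_min (half_pos hε) hρ₁)
  obtain ⟨n, hn1, hn2⟩ := (h1.and h2).exists
  have hn3 := hn2.trans_le (min_le_left _ _)
  have hn4 := hn2.trans_le (min_le_right _ _)
  refine ⟨ρ (φ n), ⟨(hρ1 _).1, (hρ2 _).trans hn4⟩, θ (φ n), hθ _, fun σ hσ => ?_⟩
  have ho := hosc (φ n) σ hσ A hAm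
  rw [← hx (φ n)] at ho
  rw [Prod.dist_eq, max_lt_iff, Real.dist_eq, Real.dist_eq] at hn1
  constructor
  · have := abs_sub_le (p (ellipse 1 0 1 (q0.1 + ρ (φ n), q0.2) (ρ (φ n) * σ) (θ (φ n))))
      (p (x (φ n))) P.1
    have h3 : |p (x (φ n)) - P.1| < ε / 2 := hn1.1
    linarith [ho.1]
  · have := abs_sub_le (q (ellipse 1 0 1 (q0.1 + ρ (φ n), q0.2) (ρ (φ n) * σ) (θ (φ n))))
      (q (x (φ n))) P.2
    have h3 : |q (x (φ n)) - P.2| < ε / 2 := hn1.2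
    linarith [ho.2]

end ray

end

noncomputable section

section frame

open Filter Topology MeasureTheory
open scoped ENNReal

local notation "dfst" => ContinuousLinearMap.fst ℝ ℝ ℝ
local notation "dsnd" => ContinuousLinearMap.snd ℝ ℝ ℝ

theorem exists_polar {x y : ℝ} (h : x ^ 2 + y ^ 2 ≠ 0) :
    ∃ ρ > 0, ∃ θ : ℝ, x = ρ * cos θ ∧ y = ρ * sin θ := by
  have hz : (⟨x, y⟩ : ℂ) ≠ 0 := by
    intro h0
    rw [Complex.ext_iff] at h0
    have h1 : x = 0 := h0.1
    have h2 : y = 0 := h0.2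
    exact h (by rw [h1, h2]; ring)
  exact ⟨‖(⟨x, y⟩ : ℂ)‖, norm_pos_iff.2 hz, Complex.arg ⟨x, y⟩,
    (Complex.norm_mul_cos_arg ⟨x, y⟩).symm, (Complex.norm_mul_sin_arg ⟨x, y⟩).symm⟩

/-- `(x, y) ↦ (a x, b x + d y)` is a linear isomorphism onto Euclidean coordinates of the plane
with slope `(p, q)`. -/
theorem frame_bounds {p q a b d : ℝ} (ha : a = √(1 + q ^ 2)) (hb : b = -(p * q) / √(1 + q ^ 2))
    (hd : d = area p q / √(1 + q ^ 2)) : 0 < a ∧ 0 < d ∧ a * d = area p q ∧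
    ∀ x y : ℝ, x ^ 2 + y ^ 2 ≤ (a * x) ^ 2 + (b * x + d * y) ^ 2 ∧
      (a * x) ^ 2 + (b * x + d * y) ^ 2 ≤ area p q ^ 2 * (x ^ 2 + y ^ 2) := by
  have h1 : 0 < 1 + q ^ 2 := by positivity
  have ha0 : 0 < a := ha ▸ Real.sqrt_pos.2 h1
  rw [← ha] at hb hd
  have ha2 : a ^ 2 = 1 + q ^ 2 := by rw [ha, Real.sq_sqrt h1.le]
  have hW := area_sq p q
  have hWp := area_pos p q
  generalize area p q = W at hd hW hWp ⊢
  have had : a * d = W := by rw [hd]; field_simp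
  have hd2 : a ^ 2 * d ^ 2 = 1 + p ^ 2 + q ^ 2 := by rw [← mul_pow, had, hW]
  have hab : a * b = -(p * q) := by rw [hb]; field_simp
  have key (x y : ℝ) : (a * x) ^ 2 + (b * x + d * y) ^ 2 =
      x ^ 2 + y ^ 2 + (q * d * x - p / a * y) ^ 2 := by
    have e1 : d ^ 2 = 1 + (p / a) ^ 2 := by
      rw [div_pow]; field_simp; rw [ha2] at hd2 ⊢; linarith
    have e2 : b = -(q * (p / a)) := by rw [hb]; ring
    have e3 : a ^ 2 * (p / a) ^ 2 = p ^ 2 := by field_simp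
    have e4 : a ^ 2 = 1 + q ^ 2 := ha2
    rw [e2]
    linear_combination (x ^ 2) * e4 + (y ^ 2 - q ^ 2 * x ^ 2) * e1
  refine ⟨ha0, hd ▸ div_pos hWp ha0, had, fun x y => ⟨?_, ?_⟩⟩
  · rw [key]; nlinarith [sq_nonneg (q * d * x - p / a * y)]
  · rw [key]
    have e5 : (q * d) ^ 2 + (p / a) ^ 2 = W ^ 2 - 1 := by
      have e1 : d ^ 2 = 1 + (p / a) ^ 2 := by
        rw [div_pow]; field_simp; rw [ha2] at hd2 ⊢; linarith
      rw [← had, mul_pow a d, ha2, mul_pow]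
      linarith
    have e6 : (q * d * x - p / a * y) ^ 2 ≤ ((q * d) ^ 2 + (p / a) ^ 2) * (x ^ 2 + y ^ 2) := by
      nlinarith [sq_nonneg (q * d * y + p / a * x)]
    rw [e5] at e6
    linarith

variable {α δ K R m a b d M ρ : ℝ} {q0 : ℝ × ℝ} {f p q r s t : ℝ × ℝ → ℝ}

theorem ellipse_ne {ϱ θ : ℝ} (h : ϱ ^ 2 * ((a * cos θ) ^ 2 + (b * cos θ + d * sin θ) ^ 2) ≠ ρ ^ 2) :
    ellipse a b d (q0.1 + ρ, q0.2) ϱ θ ≠ q0 := by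
  intro h0
  have h1 := congrArg Prod.fst h0
  have h2 := congrArg Prod.snd h0
  simp only [ellipse] at h1 h2
  refine h ?_
  have e1 : ϱ * (a * cos θ) = -ρ := by linarith
  have e2 : ϱ * (b * cos θ + d * sin θ) = 0 := by linarith
  calc _ = (ϱ * (a * cos θ)) ^ 2 + (ϱ * (b * cos θ + d * sin θ)) ^ 2 := by ring
    _ = ρ ^ 2 := by rw [e1, e2]; ring

theorem PuncturedSol.mono (hf : PuncturedSol α q0 δ K R m f p q r s t) {K' R' m' : ℝ}
    (hK : K ≤ K') (hR : R ≤ R') (hm : m' ≤ m) : PuncturedSol α q0 δ K' R' m' f p q r s t :=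
  { hf with
    bp := fun x hx hne => (hf.bp x hx hne).trans hK
    bq := fun x hx hne => (hf.bq x hx hne).trans hK
    bx := fun x hx => ⟨(hf.bx x hx).1.trans hR, (hf.bx x hx).2.1.trans hR,
      (hf.bx x hx).2.2.1.trans hR, hm.trans (hf.bx x hx).2.2.2⟩ }

theorem PuncturedSol.integral_ellipse_le (hf : PuncturedSol α q0 δ K R m f p q r s t) {η ε κ S : ℝ}
    {c : ℝ × ℝ} {g : ℝ × ℝ → ℝ≥0∞}
    (hg : ∀ x ∈ Metric.ball q0 η, x ≠ q0 → g x = ENNReal.ofReal (r x ^ 2 + s x ^ 2 + t x ^ 2))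
    (hη : η ≤ δ) (hX : ∀ θ, ellipse a b d c (κ * S) θ ∈ Metric.ball q0 η ∧
      ellipse a b d c (κ * S) θ ≠ q0) (hS : S ∈ Icc (2 : ℝ) 4) (had : 1 ≤ a * d)
    (h : ∫⁻ θ in Ioo (-π) π, ENNReal.ofReal (S * (κ ^ 2 * (a * d))) * g (ellipse a b d c (κ * S) θ) ≤
      ENNReal.ofReal (ε ^ 2 / 4)) :
    ∫ θ in (-π)..π, (κ * S) ^ 2 * (r (ellipse a b d c (κ * S) θ) ^ 2 +
      s (ellipse a b d c (κ * S) θ) ^ 2 + t (ellipse a b d c (κ * S) θ) ^ 2) ≤ ε ^ 2 := by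
  obtain ⟨X, hXe⟩ : ∃ X, X = ellipse a b d c (κ * S) := ⟨_, rfl⟩
  rw [← hXe] at hX h ⊢
  have hXc : Continuous X := by
    rw [hXe]; exact continuous_iff_continuousAt.2 fun θ => (hasDerivAt_ellipse a b d c _ θ).continuousAt
  have hXm (θ : ℝ) : X θ ∈ Metric.ball q0 δ \ {q0} :=
    ⟨Metric.ball_subset_ball hη (hX θ).1, (hX θ).2⟩
  have hrc : Continuous fun θ => r (X θ) := hf.cr.comp_continuous hXc hXm
  have hsc : Continuous fun θ => s (X θ) := hf.cs.comp_continuous hXc hXm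
  have htc : Continuous fun θ => t (X θ) := hf.ct.comp_continuous hXc hXm
  refine integral_le_of_lintegral_le (by linarith [pi_pos]) (sq_nonneg _)
    (continuous_const.mul (((hrc.pow 2).add (hsc.pow 2)).add (htc.pow 2))).continuousOn
    (fun θ => by positivity) ?_
  calc _ ≤ ∫⁻ θ in Ioo (-π) π, ENNReal.ofReal 4 * (ENNReal.ofReal (S * (κ ^ 2 * (a * d))) * g (X θ)) := by
        refine setLIntegral_mono' measurableSet_Ioo fun θ _ => ?_
        have hS0 : 0 ≤ S := by linarith [hS.1]
        rw [hg _ (hX θ).1 (hX θ).2, ← ENNReal.ofReal_mul (by positivity),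
          ← ENNReal.ofReal_mul (by norm_num)]
        refine ENNReal.ofReal_le_ofReal ?_
        have h1 : S * 1 ≤ 4 * (a * d) := mul_le_mul hS.2 had zero_le_one (by norm_num)
        calc _ = (S * 1) * (S * κ ^ 2 * (r (X θ) ^ 2 + s (X θ) ^ 2 + t (X θ) ^ 2)) := by ring
          _ ≤ (4 * (a * d)) * (S * κ ^ 2 * (r (X θ) ^ 2 + s (X θ) ^ 2 + t (X θ) ^ 2)) :=
              mul_le_mul_of_nonneg_right h1 (by positivity)
          _ = _ := by ring
    _ = ENNReal.ofReal 4 * ∫⁻ θ in Ioo (-π) π, ENNReal.ofReal (S * (κ ^ 2 * (a * d))) * g (X θ) :=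
        lintegral_const_mul' _ _ ENNReal.ofReal_ne_top
    _ ≤ ENNReal.ofReal 4 * ENNReal.ofReal (ε ^ 2 / 4) := by gcongr
    _ = ENNReal.ofReal (ε ^ 2) := by
        rw [← ENNReal.ofReal_mul (by norm_num)]; congr 1; ring

/-- If the gradient is almost `(P₁, P₂)` along a segment then `f` is almost affine there. -/
theorem PuncturedSol.abs_sub_le_of_ray (hf : PuncturedSol α q0 δ K R m f p q r s t)
    {P₁ P₂ ε ϱ ϱ' θ : ℝ} {c : ℝ × ℝ} (hε : 0 ≤ ε) (hϱ : 0 ≤ ϱ) (hle : ϱ ≤ ϱ') (hM : 0 ≤ M)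
    (h1 : |a * cos θ| ≤ M) (h2 : |b * cos θ + d * sin θ| ≤ M)
    (hY : ∀ σ ∈ Icc ϱ ϱ', ellipse a b d c σ θ ∈ Metric.ball q0 δ ∧ ellipse a b d c σ θ ≠ q0 ∧
      |p (ellipse a b d c σ θ) - P₁| ≤ ε ∧ |q (ellipse a b d c σ θ) - P₂| ≤ ε) :
    |f (ellipse a b d c ϱ' θ) -
      (f (ellipse a b d c ϱ θ) - ϱ * (P₁ * (a * cos θ) + P₂ * (b * cos θ + d * sin θ))) -
      ϱ' * (P₁ * (a * cos θ) + P₂ * (b * cos θ + d * sin θ))| ≤ 3 * M * ε * ϱ' := by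
  obtain ⟨Y, hYe⟩ : ∃ Y : ℝ → ℝ × ℝ, ∀ σ, Y σ = ellipse a b d c σ θ := ⟨_, fun _ => rfl⟩
  simp only [← hYe] at hY ⊢
  obtain ⟨Λ, hΛ⟩ : ∃ Λ, Λ = P₁ * (a * cos θ) + P₂ * (b * cos θ + d * sin θ) := ⟨_, rfl⟩
  rw [← hΛ]
  have hYd (σ : ℝ) : HasDerivAt Y (a * cos θ, b * cos θ + d * sin θ) σ := by
    rw [show Y = _ from funext hYe]
    unfold ellipse
    refine HasDerivAt.prodMk ?_ ?_
    · exact (((hasDerivAt_id σ).mul_const _).const_add _).congr_deriv (by ring)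
    · exact (((hasDerivAt_id σ).mul_const _).const_add _).congr_deriv (by ring)
  have hd (σ : ℝ) (hσ : σ ∈ Icc ϱ ϱ') : HasDerivWithinAt (fun σ => f (Y σ) - σ * Λ)
      ((p (Y σ) - P₁) * (a * cos θ) + (q (Y σ) - P₂) * (b * cos θ + d * sin θ)) (Icc ϱ ϱ') σ := by
    have := ((hf.df _ (hY σ hσ).1 (hY σ hσ).2.1).comp_hasDerivAt σ (hYd σ)).fun_sub
      ((hasDerivAt_id σ).mul_const Λ)
    refine (this.congr_deriv ?_).hasDerivWithinAt
    simp [hΛ]; ring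
  have hb (σ : ℝ) (hσ : σ ∈ Icc ϱ ϱ') :
      ‖(p (Y σ) - P₁) * (a * cos θ) + (q (Y σ) - P₂) * (b * cos θ + d * sin θ)‖ ≤ 2 * M * ε := by
    rw [Real.norm_eq_abs]
    refine (abs_add_le _ _).trans ?_
    rw [abs_mul (p (Y σ) - P₁), abs_mul (q (Y σ) - P₂)]
    have e1 := mul_le_mul (hY σ hσ).2.2.1 h1 (abs_nonneg _) hε
    have e2 := mul_le_mul (hY σ hσ).2.2.2 h2 (abs_nonneg _) hε
    linarith
  have := Convex.norm_image_sub_le_of_norm_hasDerivWithin_le hd hb (convex_Icc ϱ ϱ')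
    (left_mem_Icc.2 hle) (right_mem_Icc.2 hle)
  rw [Real.norm_eq_abs, Real.norm_eq_abs, abs_of_nonneg (sub_nonneg.2 hle)] at this
  rw [show f (Y ϱ') - (f (Y ϱ) - ϱ * Λ) - ϱ' * Λ = f (Y ϱ') - ϱ' * Λ - (f (Y ϱ) - ϱ * Λ) by ring]
  refine this.trans ?_
  have h3 : 0 ≤ M * ε := mul_nonneg hM hε
  nlinarith [mul_nonneg h3 hϱ, mul_nonneg h3 (hϱ.trans hle)]

end frame

end

noncomputable section

section select

open Filter Topology MeasureTheory
open scoped ENNReal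

variable {α δ K R m : ℝ} {q0 : ℝ × ℝ} {f p q r s t : ℝ × ℝ → ℝ}

/-- A linear isomorphism bounded from below by one stretches some direction to a given one. -/
theorem exists_angle {a b d W : ℝ} (ha : 0 < a) (hd : 0 < d) (hW : 0 ≤ W)
    (hL : ∀ x y : ℝ, x ^ 2 + y ^ 2 ≤ (a * x) ^ 2 + (b * x + d * y) ^ 2 ∧
      (a * x) ^ 2 + (b * x + d * y) ^ 2 ≤ W ^ 2 * (x ^ 2 + y ^ 2)) (θ₀ : ℝ) :
    ∃ θ₁ l : ℝ, 1 ≤ l ∧ l ≤ W ∧ a * cos θ₁ = l * cos θ₀ ∧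
      b * cos θ₁ + d * sin θ₁ = l * sin θ₀ := by
  obtain ⟨x, hx⟩ : ∃ x, x = cos θ₀ / a := ⟨_, rfl⟩
  obtain ⟨y, hy⟩ : ∃ y, y = (sin θ₀ - b * x) / d := ⟨_, rfl⟩
  have hax : a * x = cos θ₀ := by rw [hx]; field_simp
  have hdy : b * x + d * y = sin θ₀ := by rw [hy]; field_simp; ring
  have hxy : x ^ 2 + y ^ 2 ≠ 0 := by
    intro h0
    have := (hL x y).2
    rw [hax, hdy, cos_sq_add_sin_sq, h0] at this
    linarith
  obtain ⟨μ, hμ, θ₁, hx1, hy1⟩ := exists_polar hxy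
  have hμl : μ⁻¹ * μ = 1 := inv_mul_cancel₀ hμ.ne'
  have hl0 : 0 < μ⁻¹ := inv_pos.2 hμ
  have hl1 : a * cos θ₁ = μ⁻¹ * cos θ₀ := by
    rw [← hax, hx1]; linear_combination (-a * cos θ₁) * hμl
  have hl2 : b * cos θ₁ + d * sin θ₁ = μ⁻¹ * sin θ₀ := by
    rw [← hdy, hx1, hy1]; linear_combination (-(b * cos θ₁ + d * sin θ₁)) * hμl
  have hlsq : (a * cos θ₁) ^ 2 + (b * cos θ₁ + d * sin θ₁) ^ 2 = μ⁻¹ ^ 2 := by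
    rw [hl1, hl2]; linear_combination μ⁻¹ ^ 2 * cos_sq_add_sin_sq θ₀
  have h := hL (cos θ₁) (sin θ₁)
  rw [hlsq, cos_sq_add_sin_sq, mul_one] at h
  exact ⟨θ₁, μ⁻¹, (one_le_sq_iff₀ hl0.le).1 h.1,
    (pow_le_pow_iff_left₀ hl0.le hW two_ne_zero).1 h.2, hl1, hl2⟩

theorem exists_ellipse_eq {a b d W τ T ρ : ℝ} (q0 : ℝ × ℝ) (ha : 0 < a) (hd : 0 < d)
    (hL : ∀ x y : ℝ, x ^ 2 + y ^ 2 ≤ (a * x) ^ 2 + (b * x + d * y) ^ 2 ∧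
      (a * x) ^ 2 + (b * x + d * y) ^ 2 ≤ W ^ 2 * (x ^ 2 + y ^ 2)) (hW : 0 ≤ W) (hτ : 0 < τ)
    (hτW : τ * W < 1) (hτT : 1 / τ < exp T) :
    ∃ t ∈ Ioo 0 T, ∃ θ, ellipse a b d (q0.1 + ρ, q0.2) (τ * ρ * exp t) θ = q0 := by
  obtain ⟨x, hx⟩ : ∃ x, x = -1 / (τ * a) := ⟨_, rfl⟩
  obtain ⟨y, hy⟩ : ∃ y, y = -(b * x) / d := ⟨_, rfl⟩
  have hax : a * x = -1 / τ := by rw [hx]; field_simp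
  have hdy : b * x + d * y = 0 := by rw [hy]; field_simp; ring
  have hLxy := hL x y
  rw [hax, hdy] at hLxy
  have hinv : (-1 / τ) ^ 2 + 0 ^ 2 = (1 / τ) ^ 2 := by field_simp; ring
  rw [hinv] at hLxy
  have hpos : 0 < (1 / τ) ^ 2 := by positivity
  have hxy : x ^ 2 + y ^ 2 ≠ 0 := by
    intro h0
    rw [h0] at hLxy
    linarith [hLxy.2]
  obtain ⟨μ, hμ, θ, hx1, hy1⟩ := exists_polar hxy
  have hμ2 : x ^ 2 + y ^ 2 = μ ^ 2 := by
    rw [hx1, hy1]; linear_combination μ ^ 2 * cos_sq_add_sin_sq θ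
  rw [hμ2, ← mul_pow] at hLxy
  have h1 : μ ≤ 1 / τ := (pow_le_pow_iff_left₀ hμ.le (by positivity) two_ne_zero).1 hLxy.1
  have h2 : 1 / τ ≤ W * μ :=
    (pow_le_pow_iff_left₀ (by positivity) (by positivity) two_ne_zero).1 hLxy.2
  have hμ1 : 1 < μ := by
    rw [div_le_iff₀ hτ] at h2
    by_contra! hcon
    have h3 : τ * W * μ ≤ τ * W * 1 := mul_le_mul_of_nonneg_left hcon (by positivity)
    linarith
  refine ⟨log μ, ⟨log_pos hμ1, (log_lt_iff_lt_exp hμ).2 (h1.trans_lt hτT)⟩, θ, ?_⟩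
  rw [exp_log hμ]
  have e1 : τ * ρ * μ * (a * cos θ) = -ρ := by
    calc _ = τ * ρ * (a * x) := by rw [hx1]; ring
      _ = -ρ := by rw [hax]; field_simp
  have e2 : τ * ρ * μ * (b * cos θ + d * sin θ) = 0 := by
    calc _ = τ * ρ * (b * x + d * y) := by rw [hx1, hy1]; ring
      _ = 0 := by rw [hdy, mul_zero]
  simp [ellipse, e1, e2]

set_option maxHeartbeats 1000000 in
/-- Near `q0` there are two homothetic ellipses, whose ratio is prescribed, which separate `q0`
from infinity in the conformal chart and on which the graph is almost planar. -/
theorem PuncturedSol.exists_ellipses (hf : PuncturedSol α q0 δ K R m f p q r s t)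
    (hδ : 0 < δ) (hm : 0 < m) (hK : 0 ≤ K) {T M : ℝ} (hM : M = 1 + 2 * K) (hT : exp T = 16 * M) :
    ∃ P₁ P₂ : ℝ, |P₁| ≤ K ∧ |P₂| ≤ K ∧ ∀ a b d : ℝ, a = √(1 + P₂ ^ 2) →
      b = -(P₁ * P₂) / √(1 + P₂ ^ 2) → d = area P₁ P₂ / √(1 + P₂ ^ 2) →
      ∀ ε > 0, ∃ (ρ h : ℝ) (c : ℝ × ℝ) (ψ ψ' ψ'' φ φ' φ'' : ℝ → ℝ),
        0 < ρ ∧ ρ ≤ ε ∧ |h - f q0| ≤ ε ∧ dist c q0 ≤ ε ∧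
        SmallLoop ε ψ ψ' ψ'' ∧ SmallLoop ε φ φ' φ'' ∧
        (∀ θ, f (ellipse a b d c ρ θ) =
          h + ρ * (P₁ * (a * cos θ) + P₂ * (b * cos θ + d * sin θ) + ψ θ)) ∧
        (∀ θ, f (ellipse a b d c (ρ * exp T) θ) =
          h + ρ * (exp T * (P₁ * (a * cos θ) + P₂ * (b * cos θ + d * sin θ)) + φ θ)) ∧
        ∃ t ∈ Ioo 0 T, ∃ θ, ellipse a b d c (ρ * exp t) θ = q0 := by
  have hM1 : 1 ≤ M := by linarith
  have hM0 : 0 < M := by linarith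
  have hKM : K ≤ M := by linarith
  have hA : 0 < 1 / (8 * M) := by positivity
  have hAB : 1 / (8 * M) ≤ 4 * M := by
    rw [div_le_iff₀ (by positivity)]; nlinarith
  obtain ⟨P₁, P₂, hP₁, hP₂, H⟩ := hf.exists_limit_gradient hδ hm hA hAB
  refine ⟨P₁, P₂, hP₁, hP₂, fun a b d ha hb hd ε hε => ?_⟩
  obtain ⟨ha0, hd0, had, hL⟩ := frame_bounds ha hb hd
  have hW1 := one_le_area P₁ P₂
  have hWM : area P₁ P₂ ≤ M := hM ▸ area_le_of_abs_le hP₁ hP₂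
  generalize area P₁ P₂ = W at had hL hW1 hWM
  have hW2 : W ^ 2 ≤ M ^ 2 := pow_le_pow_left₀ (by linarith) hWM 2
  have hLM (x y : ℝ) : (a * x) ^ 2 + (b * x + d * y) ^ 2 ≤ M ^ 2 * (x ^ 2 + y ^ 2) :=
    (hL x y).2.trans (mul_le_mul_of_nonneg_right hW2 (by positivity))
  have hLθ (θ : ℝ) : 1 ≤ (a * cos θ) ^ 2 + (b * cos θ + d * sin θ) ^ 2 ∧
      (a * cos θ) ^ 2 + (b * cos θ + d * sin θ) ^ 2 ≤ M ^ 2 := by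
    have h1 := (hL (cos θ) (sin θ)).1
    have h2 := hLM (cos θ) (sin θ)
    rw [cos_sq_add_sin_sq] at h1 h2
    exact ⟨h1, by linarith⟩
  have haM : |a| ≤ M := _root_.abs_le_of_sq_le_sq (by nlinarith [hLM 1 0, sq_nonneg b]) hM0.le
  have hbM : |b| ≤ M := _root_.abs_le_of_sq_le_sq (by nlinarith [hLM 1 0, sq_nonneg a]) hM0.le
  have hdM : |d| ≤ M := _root_.abs_le_of_sq_le_sq (by nlinarith [hLM 0 1]) hM0.le
  have hc1 (θ : ℝ) : |a * cos θ| ≤ M :=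
    _root_.abs_le_of_sq_le_sq (by nlinarith [hLθ θ, sq_nonneg (b * cos θ + d * sin θ)]) hM0.le
  have hc2 (θ : ℝ) : |b * cos θ + d * sin θ| ≤ M :=
    _root_.abs_le_of_sq_le_sq (by nlinarith [hLθ θ, sq_nonneg (a * cos θ)]) hM0.le
  obtain ⟨ε₁, hε₁e⟩ : ∃ ε₁, ε₁ = ε / (16 * M * (1000 * M ^ 2)) := ⟨_, rfl⟩
  have hε₁ : 0 < ε₁ := by rw [hε₁e]; positivity
  have hε₁ε : 16 * M * (1000 * M ^ 2 * ε₁) = ε := by rw [hε₁e]; field_simp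
  obtain ⟨η, hη, hηδ, g, hgm, hg, hge⟩ := hf.exists_small_energy hδ hm
    (show 0 < ε₁ ^ 2 / 4 by positivity)
  have hfc : ContinuousAt f q0 := hf.cont.continuousAt (Metric.ball_mem_nhds q0 hδ)
  obtain ⟨η₂, hη₂, hfη⟩ := Metric.continuousAt_iff.1 hfc (ε / 2) (half_pos hε)
  have h4M : 0 < (1 + 4 * M) ^ 2 := by positivity
  obtain ⟨ρ, hρ, θ₀, hθ₀, hray⟩ := H ε₁ hε₁ (min (min η η₂) ε / (1 + 4 * M) ^ 2)
    (div_pos (lt_min (lt_min hη hη₂) hε) h4M)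
  have hρ0 : 0 < ρ := hρ.1
  have hρmin : ρ * (1 + 4 * M) ^ 2 < min (min η η₂) ε := (lt_div_iff₀ h4M).1 hρ.2
  have hρη : ρ * (1 + 4 * M) ^ 2 < η := hρmin.trans_le ((min_le_left _ _).trans (min_le_left _ _))
  have hρη₂ : ρ * (1 + 4 * M) ^ 2 < η₂ := hρmin.trans_le ((min_le_left _ _).trans (min_le_right _ _))
  have hρε : ρ * (1 + 4 * M) ^ 2 < ε := hρmin.trans_le (min_le_right _ _)
  have hsq1 : ρ * (1 + 4 * M) ≤ ρ * (1 + 4 * M) ^ 2 :=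
    mul_le_mul_of_nonneg_left (le_self_pow₀ (by linarith) two_ne_zero) hρ0.le
  obtain ⟨c, hc⟩ : ∃ c : ℝ × ℝ, c = (q0.1 + ρ, q0.2) := ⟨_, rfl⟩
  obtain ⟨k, hk⟩ : ∃ k, k = (16 * M)⁻¹ := ⟨_, rfl⟩
  have hk0 : 0 < k := by rw [hk]; positivity
  have hkM : k * (16 * M) = 1 := by rw [hk]; field_simp
  have hk1 : k ≤ 1 / 16 := by
    rw [hk, one_div]; exact inv_anti₀ (by norm_num) (by linarith)
  obtain ⟨S, hS, hS1, hS2⟩ := exists_good_radius hgm hρ0 hk0 ha0 hd0 (b := b) hge c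
  have hS0 : 0 < S := by linarith [hS.1]
  have hkS : k * S * W ≤ 1 / 4 := by
    calc k * S * W ≤ k * 4 * M := by
          refine mul_le_mul (mul_le_mul_of_nonneg_left hS.2 hk0.le) hWM (by linarith) (by positivity)
      _ = 1 / 4 := by linarith
  have hdist {ϱ θ : ℝ} (h0 : 0 ≤ ϱ) (h4 : ϱ ≤ 4 * ρ) :
      dist (ellipse a b d c ϱ θ) q0 ≤ ρ * (1 + 4 * M) := by
    rw [hc]
    refine (dist_ellipse_le q0 hρ0.le h0 (hLθ θ).2 hM0.le).trans ?_
    linarith [mul_le_mul_of_nonneg_right h4 hM0.le]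
  have hball {ϱ θ : ℝ} (h0 : 0 ≤ ϱ) (h4 : ϱ ≤ 4 * ρ) :
      ellipse a b d c ϱ θ ∈ Metric.ball q0 η :=
    (hdist h0 h4).trans_lt (hsq1.trans_lt hρη)
  have hout4 : ρ * S ≤ 4 * ρ := by
    rw [mul_comm]; exact mul_le_mul_of_nonneg_right hS.2 hρ0.le
  have hin_out : k * ρ * S ≤ ρ * S := by
    have := mul_pos hρ0 hS0
    calc k * ρ * S = k * (ρ * S) := by ring
      _ ≤ 1 * (ρ * S) := mul_le_mul_of_nonneg_right (by linarith) this.le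
      _ = ρ * S := one_mul _
  have hin0 : 0 < k * ρ * S := by positivity
  have hXout (θ : ℝ) : ellipse a b d c (ρ * S) θ ∈ Metric.ball q0 η ∧
      ellipse a b d c (ρ * S) θ ≠ q0 := by
    refine ⟨hball (by positivity) hout4, ?_⟩
    rw [hc]
    refine ellipse_ne (ne_of_gt ?_)
    have h1 : 2 ^ 2 ≤ S ^ 2 := pow_le_pow_left₀ two_pos.le hS.1 2
    calc ρ ^ 2 < ρ ^ 2 * 2 ^ 2 := lt_mul_of_one_lt_right (pow_pos hρ0 2) (by norm_num)
      _ ≤ ρ ^ 2 * S ^ 2 := mul_le_mul_of_nonneg_left h1 (sq_nonneg _)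
      _ = (ρ * S) ^ 2 := (mul_pow _ _ _).symm
      _ ≤ _ := le_mul_of_one_le_right (sq_nonneg _) (hLθ θ).1
  have hXin (θ : ℝ) : ellipse a b d c (k * ρ * S) θ ∈ Metric.ball q0 η ∧
      ellipse a b d c (k * ρ * S) θ ≠ q0 := by
    refine ⟨hball hin0.le (hin_out.trans hout4), ?_⟩
    rw [hc]
    refine ellipse_ne (ne_of_lt ?_)
    have h1 := (hL (cos θ) (sin θ)).2
    rw [cos_sq_add_sin_sq, mul_one] at h1
    have h2 : (k * S * W) ^ 2 ≤ (1 / 4) ^ 2 := pow_le_pow_left₀ (by positivity) hkS 2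
    calc (k * ρ * S) ^ 2 * ((a * cos θ) ^ 2 + (b * cos θ + d * sin θ) ^ 2)
        ≤ (k * ρ * S) ^ 2 * W ^ 2 := mul_le_mul_of_nonneg_left h1 (sq_nonneg _)
      _ = ρ ^ 2 * (k * S * W) ^ 2 := by ring
      _ ≤ ρ ^ 2 * (1 / 4) ^ 2 := mul_le_mul_of_nonneg_left h2 (sq_nonneg _)
      _ < ρ ^ 2 := by linarith [pow_pos hρ0 2]
  have hηδ' : η ≤ δ := by linarith
  have hEout := hf.integral_ellipse_le (κ := ρ) hg hηδ' hXout hS (had ▸ hW1) hS1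
  have hEin := hf.integral_ellipse_le (κ := k * ρ) hg hηδ' hXin hS (had ▸ hW1) hS2
  obtain ⟨θ₁, l, hl1', hlW, hl1, hl2⟩ := exists_angle ha0 hd0 (by linarith) hL θ₀
  have hl0 : 0 < l := by linarith
  have hlM : l ≤ M := hlW.trans hWM
  have hY (σ : ℝ) : ellipse a b d c σ θ₁ = ellipse 1 0 1 c (ρ * (σ * l / ρ)) θ₀ := by
    unfold ellipse
    rw [hl1, hl2, mul_div_cancel₀ _ hρ0.ne']
    ext <;> ring
  have hYm {σ : ℝ} (hσ : σ ∈ Icc (k * ρ * S) (ρ * S)) : σ * l / ρ ∈ Icc (1 / (8 * M)) (4 * M) := by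
    have hσ0 : 0 < σ := hin0.trans_le hσ.1
    constructor
    · rw [le_div_iff₀ hρ0]
      have h1 : 1 / (8 * M) = k * 2 := by rw [hk]; field_simp; norm_num
      rw [h1]
      calc k * 2 * ρ ≤ k * S * ρ := by gcongr; exact hS.1
        _ = k * ρ * S := by ring
        _ ≤ σ := hσ.1
        _ ≤ σ * l := le_mul_of_one_le_right hσ0.le hl1'
    · rw [div_le_iff₀ hρ0]
      calc σ * l ≤ (4 * ρ) * M := mul_le_mul (hσ.2.trans hout4) hlM hl0.le (by positivity)
        _ = 4 * M * ρ := by ring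
  have hYall (σ : ℝ) (hσ : σ ∈ Icc (k * ρ * S) (ρ * S)) :
      ellipse a b d c σ θ₁ ∈ Metric.ball q0 δ ∧ ellipse a b d c σ θ₁ ≠ q0 ∧
      |p (ellipse a b d c σ θ₁) - P₁| ≤ ε₁ ∧ |q (ellipse a b d c σ θ₁) - P₂| ≤ ε₁ := by
    have hσ0 : 0 < σ := hin0.trans_le hσ.1
    have hr := hray _ (hYm hσ)
    rw [← hc, ← hY] at hr
    refine ⟨Metric.ball_subset_ball hηδ' (hball hσ0.le (hσ.2.trans hout4)), ?_, hr⟩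
    rw [hY, hc]
    exact ray_ne q0 hρ0 (by positivity) hθ₀
  have hinm : k * ρ * S ∈ Icc (k * ρ * S) (ρ * S) := left_mem_Icc.2 hin_out
  have houtm : ρ * S ∈ Icc (k * ρ * S) (ρ * S) := right_mem_Icc.2 hin_out
  have hmv := hf.abs_sub_le_of_ray hε₁.le hin0.le hin_out hM0.le (hc1 θ₁) (hc2 θ₁) hYall
  obtain ⟨h, hh⟩ : ∃ h, h = f (ellipse a b d c (k * ρ * S) θ₁) -
    k * ρ * S * (P₁ * (a * cos θ₁) + P₂ * (b * cos θ₁ + d * sin θ₁)) := ⟨_, rfl⟩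
  rw [← hh] at hmv
  obtain ⟨φ, φ', φ'', hφ, hfφ⟩ := hf.exists_smallLoop (ϱ := ρ * S) (h := h) (P₁ := P₁) (P₂ := P₂)
    (by positivity) hε₁ hM1 haM hbM hdM
    (fun θ => ⟨Metric.ball_subset_ball hηδ' (hXout θ).1, (hXout θ).2⟩) hEout
    (hYall _ houtm).2.2.1 (hYall _ houtm).2.2.2 hmv
  obtain ⟨ψ, ψ', ψ'', hψ, hfψ⟩ := hf.exists_smallLoop (ϱ := k * ρ * S) (h := h) (P₁ := P₁) (P₂ := P₂)
    (θ₁ := θ₁) hin0 hε₁ hM1 haM hbM hdM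
    (fun θ => ⟨Metric.ball_subset_ball hηδ' (hXin θ).1, (hXin θ).2⟩) hEin
    (hYall _ hinm).2.2.1 (hYall _ hinm).2.2.2 (by
      rw [hh, sub_sub_cancel, sub_self, abs_zero]; positivity)
  have hTe : k * ρ * S * exp T = ρ * S := by rw [hT]; linear_combination ρ * S * hkM
  have hε₂ : 1000 * M ^ 2 * ε₁ ≤ ε := by
    rw [← hε₁ε]
    exact le_mul_of_one_le_left (by positivity) (by linarith)
  have hinρ : k * ρ * S ≤ ρ / 4 := by
    have h1 : k * S ≤ 1 / 16 * 4 := mul_le_mul hk1 hS.2 hS0.le (by norm_num)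
    linarith [mul_le_mul_of_nonneg_right h1 hρ0.le]
  have hρ1M : ρ * 1 ≤ ρ * (1 + 4 * M) ^ 2 :=
    mul_le_mul_of_nonneg_left (one_le_pow₀ (by linarith)) hρ0.le
  refine ⟨k * ρ * S, h, c, ψ, ψ', ψ'', fun θ => exp T * φ θ, fun θ => exp T * φ' θ,
    fun θ => exp T * φ'' θ, hin0, by linarith, ?_, ?_, hψ.mono hε₂,
    (hφ.const_mul (exp_pos T).le).mono ?_, hfψ, fun θ => ?_, ?_⟩
  · have h1 : dist (ellipse a b d c (k * ρ * S) θ₁) q0 < η₂ :=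
      (hdist hin0.le (hin_out.trans hout4)).trans_lt (hsq1.trans_lt hρη₂)
    have h2 := hfη h1
    rw [Real.dist_eq] at h2
    have h3 : |P₁ * (a * cos θ₁) + P₂ * (b * cos θ₁ + d * sin θ₁)| ≤ 2 * (M * M) := by
      refine (abs_add_le _ _).trans ?_
      rw [abs_mul P₁, abs_mul P₂]
      have e1 := mul_le_mul (hP₁.trans hKM) (hc1 θ₁) (abs_nonneg _) hM0.le
      have e2 := mul_le_mul (hP₂.trans hKM) (hc2 θ₁) (abs_nonneg _) hM0.le
      linarith
    have h4 : |k * ρ * S * (P₁ * (a * cos θ₁) + P₂ * (b * cos θ₁ + d * sin θ₁))| ≤ ε / 2 := by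
      rw [abs_mul, abs_of_pos hin0]
      calc _ ≤ ρ / 4 * (2 * (M * M)) := mul_le_mul hinρ h3 (abs_nonneg _) (by positivity)
        _ ≤ ε / 2 := by linarith [mul_pos hρ0 hM0, mul_pos hρ0 (mul_pos hM0 hM0)]
    rw [hh, sub_right_comm]
    refine (abs_sub _ _).trans ?_
    linarith
  · rw [hc, Prod.dist_eq, Real.dist_eq, Real.dist_eq, add_sub_cancel_left, sub_self, abs_zero,
      abs_of_pos hρ0]
    exact max_le (by linarith) hε.le
  · rw [hT, hε₁ε]
  · rw [hTe, hfφ, ← hTe]; ring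
  · rw [hc, show k * ρ * S = k * S * ρ by ring]
    refine exists_ellipse_eq q0 ha0 hd0 hL (by linarith) (mul_pos hk0 hS0) (by linarith) ?_
    rw [hT, div_lt_iff₀ (mul_pos hk0 hS0)]
    calc (1 : ℝ) < S := by linarith [hS.1]
      _ = 16 * M * (k * S) := by linear_combination -S * hkM

/-- Isolated singularities of the equation with bounded gradient are removable. -/
theorem PuncturedSol.analyticAt (hf : PuncturedSol α q0 δ K R m f p q r s t)
    (hδ : 0 < δ) (hm : 0 < m) (hK : 0 ≤ K) (hN : 0 < q0.1 ^ 2 + q0.2 ^ 2 + f q0 ^ 2) :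
    AnalyticAt ℝ f q0 := by
  have h16 : 1 < 16 * (1 + 2 * K) := by linarith
  have hT : exp (log (16 * (1 + 2 * K))) = 16 * (1 + 2 * K) := exp_log (by linarith)
  have : Fact (0 < log (16 * (1 + 2 * K))) := ⟨log_pos h16⟩
  obtain ⟨P₁, P₂, hP₁, hP₂, H⟩ := hf.exists_ellipses hδ hm hK rfl hT
  refine analyticAt_of_ellipses (log (16 * (1 + 2 * K))) (K := K + 1)
    (R := max R (q0.1 ^ 2 + q0.2 ^ 2 + f q0 ^ 2 + 1))
    (m := min m ((q0.1 ^ 2 + q0.2 ^ 2 + f q0 ^ 2) / 2))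
    (hf.mono (by linarith) (le_max_left _ _) (min_le_left _ _)) hδ hN (by linarith) (by linarith)
    (le_max_right _ _) (lt_min hm (half_pos hN)) (min_le_right _ _) rfl rfl rfl
    (H _ _ _ rfl rfl rfl)

end select

end

noncomputable section

section plane

open Filter Topology

local notation "E2" => EuclideanSpace ℝ (Fin 2)
local notation "dfst" => ContinuousLinearMap.fst ℝ ℝ ℝ
local notation "dsnd" => ContinuousLinearMap.snd ℝ ℝ ℝ

/-- Cartesian coordinates on the Euclidean plane. -/
def planeEquiv : (ℝ × ℝ) ≃L[ℝ] E2 :=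
  (ContinuousLinearEquiv.finTwoArrow ℝ ℝ).symm.trans (EuclideanSpace.equiv (Fin 2) ℝ).symm

theorem planeEquiv_apply_zero (z : ℝ × ℝ) : planeEquiv z 0 = z.1 := rfl

theorem planeEquiv_apply_one (z : ℝ × ℝ) : planeEquiv z 1 = z.2 := rfl

theorem norm_planeEquiv_sq (z : ℝ × ℝ) : ‖planeEquiv z‖ ^ 2 = z.1 ^ 2 + z.2 ^ 2 := by
  simp [EuclideanSpace.norm_sq_eq, Fin.sum_univ_two, planeEquiv_apply_zero, planeEquiv_apply_one]

theorem inner_planeEquiv (z w : ℝ × ℝ) :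
    ⟪planeEquiv z, planeEquiv w⟫ = z.1 * w.1 + z.2 * w.2 := by
  rw [PiLp.inner_apply, Fin.sum_univ_two]
  simp only [planeEquiv_apply_zero, planeEquiv_apply_one, RCLike.inner_apply, conj_trivial]
  ring

theorem planeEquiv_one_zero : planeEquiv (1, 0) = EuclideanSpace.single 0 1 := by
  ext i; fin_cases i <;> simp [planeEquiv_apply_zero, planeEquiv_apply_one]

theorem planeEquiv_zero_one : planeEquiv (0, 1) = EuclideanSpace.single 1 1 := by
  ext i; fin_cases i <;> simp [planeEquiv_apply_zero, planeEquiv_apply_one]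

theorem gradient_planeEquiv (u : E2 → ℝ) (z : ℝ × ℝ) :
    gradient u (planeEquiv z) = planeEquiv (fderiv ℝ (u ∘ planeEquiv) z (1, 0),
      fderiv ℝ (u ∘ planeEquiv) z (0, 1)) := by
  have h (w : ℝ × ℝ) : fderiv ℝ (u ∘ planeEquiv) z w =
      ⟪gradient u (planeEquiv z), planeEquiv w⟫ := by
    rw [inner_gradient_left, planeEquiv.comp_right_fderiv]; rfl
  rw [h, h, planeEquiv_one_zero, planeEquiv_zero_one, EuclideanSpace.inner_single_right,
    EuclideanSpace.inner_single_right]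
  ext i; fin_cases i <;> simp [planeEquiv_apply_zero, planeEquiv_apply_one]

theorem sqrt_gradient_planeEquiv (u : E2 → ℝ) (z : ℝ × ℝ) :
    √(1 + ‖gradient u (planeEquiv z)‖ ^ 2) = area (fderiv ℝ (u ∘ planeEquiv) z (1, 0))
      (fderiv ℝ (u ∘ planeEquiv) z (0, 1)) := by
  rw [gradient_planeEquiv, norm_planeEquiv_sq, area, add_assoc]

theorem hasFDerivAt_of_differentiableAt {g : ℝ × ℝ → ℝ} {z : ℝ × ℝ} (h : DifferentiableAt ℝ g z) :
    HasFDerivAt g (fderiv ℝ g z (1, 0) • dfst + fderiv ℝ g z (0, 1) • dsnd) z := by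
  refine h.hasFDerivAt.congr_fderiv ?_
  ext <;> simp

theorem mcDiv_planeEquiv {u : E2 → ℝ} {P Q : ℝ × ℝ → ℝ} {r s t : ℝ} {z : ℝ × ℝ}
    (hP : ∀ z, P z = fderiv ℝ (u ∘ planeEquiv) z (1, 0))
    (hQ : ∀ z, Q z = fderiv ℝ (u ∘ planeEquiv) z (0, 1))
    (hp : HasFDerivAt P (r • dfst + s • dsnd) z) (hq : HasFDerivAt Q (s • dfst + t • dsnd) z) :
    mcDiv u (planeEquiv z) * area (P z) (Q z) ^ 3 =
      (1 + Q z ^ 2) * r - 2 * P z * Q z * s + (1 + P z ^ 2) * t := by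
  have hA := area_pos (P z) (Q z)
  have h1 := hasFDerivAt_flux hp hq
  have h2 := hasFDerivAt_flux hq hp
  have hF : (fun x => (√(1 + ‖gradient u x‖ ^ 2))⁻¹ • gradient u x) =
      planeEquiv ∘ (fun z => (P z / area (P z) (Q z), Q z / area (Q z) (P z))) ∘
        planeEquiv.symm := by
    funext x
    obtain ⟨y, rfl⟩ := planeEquiv.surjective x
    rw [sqrt_gradient_planeEquiv, gradient_planeEquiv, ← map_smul, ← hP, ← hQ]
    simp [div_eq_inv_mul, area_comm (Q y)]
  have hD := planeEquiv.hasFDerivAt.comp (planeEquiv z) (HasFDerivAt.comp (planeEquiv z)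
    (f := planeEquiv.symm) (by rw [planeEquiv.symm_apply_apply]; exact h1.prodMk h2)
    planeEquiv.symm.hasFDerivAt)
  rw [mcDiv, Fin.sum_univ_two, hF, hD.fderiv, ← planeEquiv_one_zero,
    ← planeEquiv_zero_one]
  simp [planeEquiv_apply_zero, planeEquiv_apply_one, area_comm (Q z)]
  field_simp
  ring

theorem analyticAt_comp_planeEquiv {α ρ : ℝ} {u : E2 → ℝ} {K : NNReal} {z : ℝ × ℝ}
    (hLip : LipschitzOnWith K u (Metric.ball 0 ρ))
    (hC2 : ContDiffOn ℝ 2 u (Metric.ball 0 ρ \ {0}))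
    (heq : ∀ q ∈ Metric.ball (0 : E2) ρ \ {0},
      mcDiv u q = α * (u q - ⟪q, gradient u q⟫) /
        ((‖q‖ ^ 2 + u q ^ 2) * √(1 + ‖gradient u q‖ ^ 2)))
    (hz : planeEquiv z ∈ Metric.ball 0 ρ) (hN : 0 < z.1 ^ 2 + z.2 ^ 2 + u (planeEquiv z) ^ 2) :
    AnalyticAt ℝ (u ∘ planeEquiv) z := by
  obtain ⟨f, hf⟩ : ∃ f, f = u ∘ planeEquiv := ⟨_, rfl⟩
  obtain ⟨P, hP⟩ : ∃ P : ℝ × ℝ → ℝ, ∀ z, P z = fderiv ℝ f z (1, 0) := ⟨_, fun _ => rfl⟩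
  obtain ⟨Q, hQ⟩ : ∃ Q : ℝ × ℝ → ℝ, ∀ z, Q z = fderiv ℝ f z (0, 1) := ⟨_, fun _ => rfl⟩
  have hfc : ∀ x, planeEquiv x ∈ Metric.ball 0 ρ → ContinuousAt f x := fun x hx => by
    rw [hf]
    exact (hLip.continuousOn.continuousAt (Metric.isOpen_ball.mem_nhds hx)).comp
      planeEquiv.continuous.continuousAt
  have hsm : ∀ x, planeEquiv x ∈ Metric.ball 0 ρ \ {0} → ContDiffAt ℝ 2 f x := fun x hx => by
    rw [hf]
    exact (hC2.contDiffAt ((Metric.isOpen_ball.sdiff isClosed_singleton).mem_nhds hx)).comp x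
      planeEquiv.contDiff.contDiffAt
  have hPs : ∀ x, planeEquiv x ∈ Metric.ball 0 ρ \ {0} → ContDiffAt ℝ 1 P x := fun x hx => by
    rw [funext hP]
    exact ((hsm x hx).fderiv_right (by norm_num)).clm_apply contDiffAt_const
  have hQs : ∀ x, planeEquiv x ∈ Metric.ball 0 ρ \ {0} → ContDiffAt ℝ 1 Q x := fun x hx => by
    rw [funext hQ]
    exact ((hsm x hx).fderiv_right (by norm_num)).clm_apply contDiffAt_const
  have hc : ∀ {g : ℝ × ℝ → ℝ} {x} (v : ℝ × ℝ), ContDiffAt ℝ 1 g x →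
      ContinuousAt (fun x => fderiv ℝ g x v) x := fun v h =>
    ((h.fderiv_right (m := 0) (by norm_num)).clm_apply contDiffAt_const).continuousAt
  have hsymm : ∀ x, planeEquiv x ∈ Metric.ball 0 ρ \ {0} →
      fderiv ℝ Q x (1, 0) = fderiv ℝ P x (0, 1) := fun x hx => by
    have hd := ((hsm x hx).fderiv_right (m := 1) (by norm_num)).differentiableAt one_ne_zero
    rw [funext hP, funext hQ, fderiv_clm_apply hd (differentiableAt_const _),
      fderiv_clm_apply hd (differentiableAt_const _)]
    simpa using ((hsm x hx).isSymmSndFDerivAt (by simp)).eq (1, 0) (0, 1)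
  have hev : ∀ᶠ x in 𝓝 z, planeEquiv x ∈ Metric.ball 0 ρ ∧
      (x ≠ z → planeEquiv x ∈ Metric.ball 0 ρ \ {0}) ∧
      |x.1| ≤ |z.1| + |z.2| + |f z| + 1 ∧ |x.2| ≤ |z.1| + |z.2| + |f z| + 1 ∧
      |f x| ≤ |z.1| + |z.2| + |f z| + 1 ∧
      (z.1 ^ 2 + z.2 ^ 2 + f z ^ 2) / 2 ≤ x.1 ^ 2 + x.2 ^ 2 + f x ^ 2 := by
    have hf0 := hfc z hz
    have hb : ∀ᶠ x in 𝓝 z, planeEquiv x ∈ Metric.ball 0 ρ :=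
      planeEquiv.continuous.continuousAt (Metric.isOpen_ball.mem_nhds hz)
    have hne : ∀ᶠ x in 𝓝 z, x ≠ z → planeEquiv x ≠ 0 := by
      rcases eq_or_ne z 0 with rfl | h0
      · exact Eventually.of_forall fun x hx => planeEquiv.map_eq_zero_iff.not.2 hx
      · filter_upwards [isOpen_ne.mem_nhds h0] with x hx _ using planeEquiv.map_eq_zero_iff.not.2 hx
    have h0 := abs_nonneg z.1
    have h0' := abs_nonneg z.2
    have h0'' := abs_nonneg (f z)
    have h1 := (continuous_fst.abs.tendsto z).eventually_le_const
      (show |z.1| < |z.1| + |z.2| + |f z| + 1 by linarith)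
    have h2 := (continuous_snd.abs.tendsto z).eventually_le_const
      (show |z.2| < |z.1| + |z.2| + |f z| + 1 by linarith)
    have h3 := hf0.abs.eventually_le_const (show |f z| < |z.1| + |z.2| + |f z| + 1 by linarith)
    have h4 : ContinuousAt (fun x : ℝ × ℝ => x.1 ^ 2 + x.2 ^ 2 + f x ^ 2) z :=
      ((continuousAt_fst.pow 2).add (continuousAt_snd.pow 2)).add (hf0.pow 2)
    have h5 := h4.eventually_const_le (half_lt_self (by rw [hf]; exact hN))
    filter_upwards [hb, hne, h1, h2, h3, h5] with x hb hne h1 h2 h3 h5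
    exact ⟨hb, fun h => ⟨hb, hne h⟩, h1, h2, h3, h5⟩
  obtain ⟨δ, hδ, H⟩ := Metric.eventually_nhds_iff_ball.1 hev
  have hbd : ∀ x ∈ Metric.ball z δ, ‖fderiv ℝ f x‖ ≤ K * ‖(planeEquiv : ℝ × ℝ →L[ℝ] E2)‖ :=
    fun x hx => by
      rw [hf, planeEquiv.comp_right_fderiv]
      exact (ContinuousLinearMap.opNorm_comp_le _ _).trans (mul_le_mul_of_nonneg_right
        (norm_fderiv_le_of_lipschitzOn ℝ (Metric.isOpen_ball.mem_nhds (H x hx).1) hLip)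
        (norm_nonneg _))
  have hbv : ∀ x ∈ Metric.ball z δ, ∀ v : ℝ × ℝ, ‖v‖ = 1 →
      |fderiv ℝ f x v| ≤ K * ‖(planeEquiv : ℝ × ℝ →L[ℝ] E2)‖ := fun x hx v hv => by
    simpa [hv] using (fderiv ℝ f x).le_of_opNorm_le (hbd x hx) v
  rw [← hf]
  refine PuncturedSol.analyticAt (α := α) (p := P) (q := Q) (r := fun x => fderiv ℝ P x (1, 0))
    (s := fun x => fderiv ℝ P x (0, 1)) (t := fun x => fderiv ℝ Q x (0, 1)) (δ := δ)
    (m := (z.1 ^ 2 + z.2 ^ 2 + f z ^ 2) / 2) (R := |z.1| + |z.2| + |f z| + 1)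
    (K := K * ‖(planeEquiv : ℝ × ℝ →L[ℝ] E2)‖) ?_ hδ (half_pos (by rw [hf]; exact hN))
    (by positivity) (by rw [hf]; exact hN)
  have hdP : ∀ x ∈ Metric.ball z δ, x ≠ z →
      HasFDerivAt P (fderiv ℝ P x (1, 0) • dfst + fderiv ℝ P x (0, 1) • dsnd) x :=
    fun x hx h => hasFDerivAt_of_differentiableAt
      ((hPs x ((H x hx).2.1 h)).differentiableAt one_ne_zero)
  have hdQ : ∀ x ∈ Metric.ball z δ, x ≠ z →
      HasFDerivAt Q (fderiv ℝ P x (0, 1) • dfst + fderiv ℝ Q x (0, 1) • dsnd) x :=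
    fun x hx h => by
      rw [← hsymm x ((H x hx).2.1 h)]
      exact hasFDerivAt_of_differentiableAt
        ((hQs x ((H x hx).2.1 h)).differentiableAt one_ne_zero)
  exact
    { cont := fun x hx => (hfc x (H x hx).1).continuousWithinAt
      df := fun x hx h => by
        rw [hP, hQ]
        exact hasFDerivAt_of_differentiableAt
          ((hsm x ((H x hx).2.1 h)).differentiableAt two_ne_zero)
      dp := hdP
      dq := hdQ
      cr := fun x hx => (hc _ (hPs x ((H x hx.1).2.1 hx.2))).continuousWithinAt
      cs := fun x hx => (hc _ (hPs x ((H x hx.1).2.1 hx.2))).continuousWithinAt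
      ct := fun x hx => (hc _ (hQs x ((H x hx.1).2.1 hx.2))).continuousWithinAt
      bp := fun x hx _ => by rw [hP]; exact hbv x hx _ (by simp [Prod.norm_def])
      bq := fun x hx _ => by rw [hQ]; exact hbv x hx _ (by simp [Prod.norm_def])
      bx := fun x hx => (H x hx).2.2
      eq := fun x hx h => by
        subst hf
        rw [← mcDiv_planeEquiv hP hQ (hdP x hx h) (hdQ x hx h), heq _ ((H x hx).2.1 h),
          sqrt_gradient_planeEquiv, norm_planeEquiv_sq, gradient_planeEquiv, inner_planeEquiv,
          ← hP, ← hQ, rhs, ← sub_sub]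
        rfl }

end plane

end

/-- Thm. 4.2, removable singularity: a Lipschitz solution of (eq-div) on the
punctured disk which is `C²` off the origin is real-analytic on the whole disk. -/
theorem removable_singularity (α : ℝ) (r : ℝ) (hr : 0 < r)
    (u : EuclideanSpace ℝ (Fin 2) → ℝ) (K : NNReal)
    (hLip : LipschitzOnWith K u (Metric.ball 0 r))
    (hC2 : ContDiffOn ℝ 2 u (Metric.ball 0 r \ {0}))
    (hpos : ∀ q ∈ Metric.ball (0 : EuclideanSpace ℝ (Fin 2)) r, 0 < ‖q‖ ^ 2 + u q ^ 2)
    (heq : ∀ q ∈ Metric.ball (0 : EuclideanSpace ℝ (Fin 2)) r \ {0},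
      mcDiv u q = α * (u q - ⟪q, gradient u q⟫) /
        ((‖q‖ ^ 2 + u q ^ 2) * Real.sqrt (1 + ‖gradient u q‖ ^ 2))) :
    AnalyticOnNhd ℝ u (Metric.ball 0 r) := by
  intro x hx
  obtain ⟨z, rfl⟩ := planeEquiv.surjective x
  have h := analyticAt_comp_planeEquiv hLip hC2 heq hx (by
    rw [← norm_planeEquiv_sq]; exact hpos _ hx)
  refine (h.comp_of_eq (planeEquiv.symm.analyticAt _)
    (planeEquiv.symm_apply_apply z)).congr (.of_forall fun y => ?_)
  exact congrArg u (planeEquiv.apply_symm_apply y)
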